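/- Let n ≥ 2 and 1 < p < ∞. There exists a constant C > 0, depending only on n, such that the following holds for every β < 0 and every bounded, open, convex set Ω ⊂ ℝⁿ. Let Ω* be the ball centered at the origin with P(Ω*) = P(Ω), let v be a first eigenfunction of λ_{p,β}(Ω*) and v_m its minimum on the closure of Ω*, and let Ω♯ be a ball with |Ω♯| = |Ω| minimizing |Ω △ B| among all balls B with |B| = |Ω|; assume |Ω △ Ω♯| < |Ω|/2. Then λ_{p,β}(Ω*) − λ_{p,β}(Ω) ≥ |λ_{p,β}(Ω)| · C · (v_m^p · |Ω*| / ‖v‖_{L^p(Ω*)}^p) · d_H(Ω, Ω♯)^{2n} / (diam(Ω) + diam(Ω♯))^{2n}, where d_H is the Hausdorff distance and diam denotes the diameter. -/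

import Mathlib

open MeasureTheory Metric Set Bornology
open scoped NNReal ENNReal Pointwise symmDiff

noncomputable section

/-- The perimeter of a (convex) set: the `(n-1)`-dimensional Hausdorff measure of its
topological boundary. -/
def perim (n : ℕ) (Ω : Set (EuclideanSpace ℝ (Fin n))) : ℝ :=
  (μH[(n : ℝ) - 1] (frontier Ω)).toReal

/-- The Rayleigh quotient of `u` on `Ω` with boundary parameter `β`. -/
def rayleigh (n : ℕ) (p β : ℝ) (Ω : Set (EuclideanSpace ℝ (Fin n)))
    (u : EuclideanSpace ℝ (Fin n) → ℝ) : ℝ :=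
  ((∫ x in Ω, ‖fderiv ℝ u x‖ ^ p) +
      β * ∫ x in frontier Ω, |u x| ^ p ∂(μH[(n : ℝ) - 1])) /
    ∫ x in Ω, |u x| ^ p

/-- The first Robin eigenvalue of the `p`-Laplacian on `Ω` with boundary parameter `β`. -/
def robinEig (n : ℕ) (p β : ℝ) (Ω : Set (EuclideanSpace ℝ (Fin n))) : ℝ :=
  sInf { r : ℝ | ∃ u : EuclideanSpace ℝ (Fin n) → ℝ,
    (∃ K : ℝ≥0, LipschitzOnWith K u (closure Ω)) ∧
    (0 < ∫ x in Ω, |u x| ^ p) ∧ r = rayleigh n p β Ω u }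

/-- `v` is a first eigenfunction for the Robin `p`-Laplacian on `Ω`: a positive radial
Lipschitz function on the closure of `Ω` whose Rayleigh quotient equals `λ_{p,β}(Ω)`. -/
def IsFirstEigenfunction (n : ℕ) (p β : ℝ) (Ω : Set (EuclideanSpace ℝ (Fin n)))
    (v : EuclideanSpace ℝ (Fin n) → ℝ) : Prop :=
  (∃ K : ℝ≥0, LipschitzOnWith K v (closure Ω)) ∧
  (∀ x ∈ closure Ω, 0 < v x) ∧
  (∃ h : ℝ → ℝ, ∀ x ∈ closure Ω, v x = h ‖x‖) ∧
  (0 < ∫ x in Ω, |v x| ^ p) ∧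
  rayleigh n p β Ω v = robinEig n p β Ω

/-- `ω_n`, the Lebesgue measure of the unit ball of `ℝⁿ`. -/
def unitBallVol (n : ℕ) : ℝ :=
  (volume (ball (0 : EuclideanSpace ℝ (Fin n)) 1)).toReal

namespace RobinStab

theorem volume_add_le_of_isCompact {K L C : Set ℝ} (hK : IsCompact K) (hL : IsCompact L)
    (hKn : K.Nonempty) (hLn : L.Nonempty) (hC : K + L ⊆ C) :
    volume K + volume L ≤ volume C := by
  obtain ⟨k, hk, hkm⟩ := hK.exists_isGreatest hKn
  obtain ⟨l, hl, hlm⟩ := hL.exists_isLeast hLn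
  have h1 : volume ((fun x => x + l) '' K) = volume K := by
    simp [image_add_right]
  have h2 : volume ((fun x => k + x) '' L) = volume L := by
    simp [image_add_left]
  have hdis : AEDisjoint volume ((fun x => x + l) '' K) ((fun x => k + x) '' L) := by
    refine measure_mono_null (t := {k + l}) ?_ (by simp)
    rintro z ⟨⟨x, hx, rfl⟩, ⟨y, hy, hxy⟩⟩
    have := hkm hx
    have := hlm hy
    simp only [mem_singleton_iff] at *
    linarith
  rw [← h1, ← h2, ← measure_union₀ (hL.image (by fun_prop)).measurableSet.nullMeasurableSet hdis]
  refine measure_mono ?_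
  rintro z (⟨x, hx, rfl⟩ | ⟨y, hy, rfl⟩)
  · exact hC (add_mem_add hx hl)
  · exact hC (add_mem_add hk hy)

theorem volume_add_le_real {A B C : Set ℝ} (hA : MeasurableSet A) (hB : MeasurableSet B)
    (hAn : A.Nonempty) (hBn : B.Nonempty) (hC : A + B ⊆ C) :
    volume A + volume B ≤ volume C := by
  obtain ⟨a, ha⟩ := hAn
  obtain ⟨b, hb⟩ := hBn
  rw [hA.measure_eq_iSup_isCompact, hB.measure_eq_iSup_isCompact]
  have key : ∀ K ⊆ A, IsCompact K → ∀ L ⊆ B, IsCompact L → volume K + volume L ≤ volume C := by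
    intro K hKA hK L hLB hL
    calc volume K + volume L ≤ volume (insert a K) + volume (insert b L) := by
          gcongr <;> exact subset_insert _ _
      _ ≤ volume C := volume_add_le_of_isCompact (hK.insert a) (hL.insert b) ⟨a, by simp⟩
          ⟨b, by simp⟩ ((add_subset_add (insert_subset ha hKA) (insert_subset hb hLB)).trans hC)
  simp only [iSup_and']
  exact ENNReal.biSup_add_biSup_le' ⟨∅, by simp⟩ ⟨∅, by simp⟩
    (fun K hK L hL => key K hK.1 hK.2 L hL.1 hL.2)

theorem geom_mean_le_arith_mean_ennreal {a b : ℝ} (ha : 0 < a) (hb : 0 < b) (hab : a + b = 1)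
    (x y : ℝ≥0∞) : x ^ a * y ^ b ≤ ENNReal.ofReal a * x + ENNReal.ofReal b * y := by
  rcases eq_or_ne x ⊤ with rfl | hx
  · rw [ENNReal.mul_top (by simpa using ha)]; simp
  rcases eq_or_ne y ⊤ with rfl | hy
  · rw [ENNReal.mul_top (by simpa using hb)]; simp
  lift x to ℝ≥0 using hx
  lift y to ℝ≥0 using hy
  rw [← ENNReal.coe_rpow_of_nonneg _ ha.le, ← ENNReal.coe_rpow_of_nonneg _ hb.le,
    ENNReal.ofReal, ENNReal.ofReal]
  norm_cast
  have := NNReal.geom_mean_le_arith_mean2_weighted a.toNNReal b.toNNReal x y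
    (by rw [← Real.toNNReal_add ha.le hb.le, hab]; simp)
  simpa [ha.le, hb.le] using this

theorem lintegral_eq_of_le_one {α : Type*} [MeasurableSpace α] {μ : Measure α} {f : α → ℝ≥0∞}
    (hf : Measurable f) (h1 : ∀ x, f x ≤ 1) :
    ∫⁻ x, f x ∂μ = ∫⁻ t in Ioo (0 : ℝ) 1, μ {x | ENNReal.ofReal t < f x} := by
  have h2 : ∀ x, f x = ENNReal.ofReal (f x).toReal := fun x =>
    (ENNReal.ofReal_toReal ((h1 x).trans_lt ENNReal.one_lt_top).ne).symm
  calc ∫⁻ x, f x ∂μ = ∫⁻ x, ENNReal.ofReal (f x).toReal ∂μ := by simp_rw [← h2]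
    _ = ∫⁻ t in Ioi (0 : ℝ), μ {x | t < (f x).toReal} :=
        lintegral_eq_lintegral_meas_lt μ (Filter.Eventually.of_forall fun x => ENNReal.toReal_nonneg)
          hf.ennreal_toReal.aemeasurable
    _ = ∫⁻ t in Ioi (0 : ℝ), μ {x | ENNReal.ofReal t < f x} := by
        refine setLIntegral_congr_fun measurableSet_Ioi fun t ht => ?_
        congr 1; ext x
        exact (ENNReal.ofReal_lt_iff_lt_toReal (le_of_lt ht)
          ((h1 x).trans_lt ENNReal.one_lt_top).ne).symm
    _ = ∫⁻ t in Ioo (0 : ℝ) 1, μ {x | ENNReal.ofReal t < f x} := by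
        have hu : Ioi (0 : ℝ) = Ioo 0 1 ∪ Ici 1 := by
          ext t; simp only [mem_Ioi, mem_union, mem_Ioo, mem_Ici]; grind
        rw [hu, lintegral_union measurableSet_Ici
          (by rw [Set.disjoint_left]; intro t ht ht'; exact absurd ht.2 (not_lt.2 ht'))]
        suffices h0 : ∫⁻ t in Ici (1 : ℝ), μ {x | ENNReal.ofReal t < f x} = 0 by
          rw [h0, add_zero]
        rw [setLIntegral_congr_fun (g := 0) measurableSet_Ici fun t ht => ?_]
        · simp
        have he : {x | ENNReal.ofReal t < f x} = ∅ := by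
          ext x
          simp only [mem_ofPred_eq, mem_empty_iff_false, iff_false, not_lt]
          exact (h1 x).trans (by simpa using ht)
        simp [he]

/-- One-dimensional Prékopa–Leindler for functions with supremum one. -/
theorem prekopa_leindler_normalized {a b : ℝ} (ha : 0 < a) (hb : 0 < b) (hab : a + b = 1)
    {f g h : ℝ → ℝ≥0∞} (hf : Measurable f) (hg : Measurable g) (hh : Measurable h)
    (hf1 : ∀ x, f x ≤ 1) (hg1 : ∀ x, g x ≤ 1)
    (hfs : ∀ t < 1, ∃ x, t < f x) (hgs : ∀ t < 1, ∃ x, t < g x)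
    (hfgh : ∀ x y, f x ^ a * g y ^ b ≤ h (a * x + b * y)) :
    ENNReal.ofReal a * (∫⁻ x, f x) + ENNReal.ofReal b * (∫⁻ x, g x) ≤ ∫⁻ x, h x := by
  calc _ = ∫⁻ t in Ioo (0 : ℝ) 1, (ENNReal.ofReal a * volume {x | ENNReal.ofReal t < f x} +
        ENNReal.ofReal b * volume {x | ENNReal.ofReal t < g x}) := by
        have mono : ∀ f : ℝ → ℝ≥0∞,
            Measurable fun t : ℝ => volume {x | ENNReal.ofReal t < f x} := fun f =>
          (Antitone.measurable fun s t hst => measure_mono fun x hx =>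
            (ENNReal.ofReal_le_ofReal hst).trans_lt hx)
        rw [lintegral_add_left ((mono f).const_mul _), lintegral_const_mul _ (mono f),
          lintegral_const_mul _ (mono g), lintegral_eq_of_le_one hf hf1,
          lintegral_eq_of_le_one hg hg1]
    _ ≤ ∫⁻ t in Ioo (0 : ℝ) 1, volume {x | ENNReal.ofReal t < min (h x) 1} := by
        refine setLIntegral_mono_ae' measurableSet_Ioo (ae_of_all _ fun t ht => ?_)
        have ht1 : ENNReal.ofReal t < 1 := by simpa using ht.2
        obtain ⟨x0, hx0⟩ := hfs _ ht1
        obtain ⟨y0, hy0⟩ := hgs _ ht1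
        have e1 : ENNReal.ofReal a * volume {x | ENNReal.ofReal t < f x} =
            volume (a • {x | ENNReal.ofReal t < f x}) := by
          rw [Measure.addHaar_smul]; simp [abs_of_pos ha]
        have e2 : ENNReal.ofReal b * volume {x | ENNReal.ofReal t < g x} =
            volume (b • {x | ENNReal.ofReal t < g x}) := by
          rw [Measure.addHaar_smul]; simp [abs_of_pos hb]
        rw [e1, e2]
        refine volume_add_le_real ((measurableSet_lt measurable_const hf).const_smul_of_ne_zero ha.ne')
          ((measurableSet_lt measurable_const hg).const_smul_of_ne_zero hb.ne')
          ⟨a • x0, smul_mem_smul_set hx0⟩ ⟨b • y0, smul_mem_smul_set hy0⟩ ?_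
        rintro _ ⟨_, ⟨x, hx, rfl⟩, _, ⟨y, hy, rfl⟩, rfl⟩
        simp only [mem_ofPred_eq] at hx hy
        refine lt_min ?_ ht1
        have ht0 : ENNReal.ofReal t ≠ 0 := by simpa using ht.1
        calc ENNReal.ofReal t = ENNReal.ofReal t ^ a * ENNReal.ofReal t ^ b := by
              rw [← ENNReal.rpow_add _ _ ht0 ENNReal.ofReal_ne_top, hab, ENNReal.rpow_one]
          _ < f x ^ a * g y ^ b := by
              refine ENNReal.mul_lt_mul (ENNReal.rpow_lt_rpow hx ha) (ENNReal.rpow_lt_rpow hy hb)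
          _ ≤ _ := hfgh x y
    _ = ∫⁻ x, min (h x) 1 := (lintegral_eq_of_le_one (hh.min measurable_const)
          (fun x => min_le_right _ _)).symm
    _ ≤ ∫⁻ x, h x := lintegral_mono fun x => min_le_left _ _

theorem prekopa_leindler_bdd {a b : ℝ} (ha : 0 < a) (hb : 0 < b) (hab : a + b = 1)
    {f g h : ℝ → ℝ≥0∞} (hf : Measurable f) (hg : Measurable g) (hh : Measurable h)
    (hf1 : ⨆ x, f x ≠ ⊤) (hg1 : ⨆ x, g x ≠ ⊤)
    (hfgh : ∀ x y, f x ^ a * g y ^ b ≤ h (a * x + b * y)) :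
    (∫⁻ x, f x) ^ a * (∫⁻ x, g x) ^ b ≤ ∫⁻ x, h x := by
  set M := ⨆ x, f x with hM
  set N := ⨆ x, g x with hN
  rcases eq_or_ne M 0 with hM0 | hM0
  · have : ∀ x, f x = 0 := by simpa [hM] using hM0
    simp [this, ENNReal.zero_rpow_of_pos ha]
  rcases eq_or_ne N 0 with hN0 | hN0
  · have : ∀ x, g x = 0 := by simpa [hN] using hN0
    simp [this, ENNReal.zero_rpow_of_pos hb]
  have hMa : M ^ a ≠ 0 := by simp [hM0, hf1, ha.not_gt]
  have hMa' : M ^ a ≠ ⊤ := by simp [hM0, hf1, ha.not_gt]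
  have hNb : N ^ b ≠ 0 := by simp [hN0, hg1, hb.not_gt]
  have hNb' : N ^ b ≠ ⊤ := by simp [hN0, hg1, hb.not_gt]
  have sup : ∀ (f : ℝ → ℝ≥0∞) (hf0 : ⨆ x, f x ≠ 0) (hf1 : ⨆ x, f x ≠ ⊤) (t : ℝ≥0∞), t < 1 →
      ∃ x, t < (⨆ x, f x)⁻¹ * f x := by
    intro f hf0 hf1 t ht
    have : t * (⨆ x, f x) < ⨆ x, f x := by
      conv_rhs => rw [← one_mul (⨆ x, f x)]
      exact (ENNReal.mul_lt_mul_iff_left hf0 hf1).2 ht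
    obtain ⟨x, hx⟩ := lt_iSup_iff.1 this
    exact ⟨x, by rw [mul_comm, ← div_eq_mul_inv]; exact (ENNReal.lt_div_iff_mul_lt (Or.inl hf0) (Or.inl hf1)).2 hx⟩
  have le1 : ∀ (f : ℝ → ℝ≥0∞) (x : ℝ), (⨆ x, f x)⁻¹ * f x ≤ 1 := by
    intro f x
    rw [mul_comm, ← div_eq_mul_inv]
    exact ENNReal.div_le_of_le_mul (by simpa using le_iSup f x)
  have main := prekopa_leindler_normalized ha hb hab (f := fun x => M⁻¹ * f x)
    (g := fun x => N⁻¹ * g x) (h := fun x => (M ^ a * N ^ b)⁻¹ * h x)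
    (hf.const_mul _) (hg.const_mul _) (hh.const_mul _) (le1 f) (le1 g) (sup f hM0 hf1)
    (sup g hN0 hg1) (fun x y => by
      rw [ENNReal.mul_rpow_of_nonneg _ _ ha.le, ENNReal.mul_rpow_of_nonneg _ _ hb.le,
        ENNReal.inv_rpow, ENNReal.inv_rpow, ENNReal.mul_inv (Or.inl hMa) (Or.inl hMa')]
      calc _ = (M ^ a)⁻¹ * (N ^ b)⁻¹ * (f x ^ a * g y ^ b) := by ring
        _ ≤ _ := by gcongr; exact hfgh x y)
  rw [lintegral_const_mul _ hf, lintegral_const_mul _ hg, lintegral_const_mul _ hh] at main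
  have := (geom_mean_le_arith_mean_ennreal ha hb hab _ _).trans main
  rw [ENNReal.mul_rpow_of_nonneg _ _ ha.le, ENNReal.mul_rpow_of_nonneg _ _ hb.le,
        ENNReal.inv_rpow, ENNReal.inv_rpow, ENNReal.mul_inv (Or.inl hMa) (Or.inl hMa')] at this
  calc _ = (M ^ a * (M ^ a)⁻¹) * (N ^ b * (N ^ b)⁻¹) * ((∫⁻ x, f x) ^ a * (∫⁻ x, g x) ^ b) := by
        rw [ENNReal.mul_inv_cancel hMa hMa', ENNReal.mul_inv_cancel hNb hNb']; simp
    _ = (M ^ a * N ^ b) * ((M ^ a)⁻¹ * (∫⁻ x, f x) ^ a * ((N ^ b)⁻¹ * (∫⁻ x, g x) ^ b)) := by ring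
    _ ≤ (M ^ a * N ^ b) * ((M ^ a)⁻¹ * (N ^ b)⁻¹ * ∫⁻ x, h x) := by gcongr
    _ = (M ^ a * (M ^ a)⁻¹) * (N ^ b * (N ^ b)⁻¹) * ∫⁻ x, h x := by ring
    _ = _ := by
        rw [ENNReal.mul_inv_cancel hMa hMa', ENNReal.mul_inv_cancel hNb hNb']; simp

/-- One-dimensional Prékopa–Leindler inequality. -/
theorem prekopa_leindler_real {a b : ℝ} (ha : 0 < a) (hb : 0 < b) (hab : a + b = 1)
    {f g h : ℝ → ℝ≥0∞} (hf : Measurable f) (hg : Measurable g) (hh : Measurable h)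
    (hfgh : ∀ x y, f x ^ a * g y ^ b ≤ h (a * x + b * y)) :
    (∫⁻ x, f x) ^ a * (∫⁻ x, g x) ^ b ≤ ∫⁻ x, h x := by
  have trunc : ∀ f : ℝ → ℝ≥0∞, Measurable f →
      ∫⁻ x, f x = ⨆ N : ℕ, ∫⁻ x, min (f x) N := by
    intro f hf
    rw [← lintegral_iSup (fun N => hf.min measurable_const)
      (fun m n hmn x => min_le_min le_rfl (by exact_mod_cast hmn))]
    refine lintegral_congr fun x => ?_
    rw [← inf_iSup_eq, ENNReal.iSup_natCast, inf_top_eq]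
  have pow : ∀ (c : ℝ) (hc : 0 < c) (F : ℕ → ℝ≥0∞), (⨆ N, F N) ^ c = ⨆ N, F N ^ c := fun c hc F =>
    (ENNReal.orderIsoRpow c hc).map_iSup F
  rw [trunc f hf, trunc g hg, pow a ha, pow b hb]
  simp only [ENNReal.iSup_mul, ENNReal.mul_iSup]
  refine iSup_le fun m => iSup_le fun n => ?_
  have bdd : ∀ f : ℝ → ℝ≥0∞, ∀ N : ℕ, ⨆ x, min (f x) (N : ℝ≥0∞) ≠ ⊤ := fun f N =>
    ((iSup_le fun x => min_le_right _ _).trans_lt (ENNReal.natCast_lt_top N)).ne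
  refine prekopa_leindler_bdd ha hb hab (hf.min measurable_const)
    (hg.min measurable_const) hh (bdd f _) (bdd g _) fun x y => ?_
  refine le_trans ?_ (hfgh x y)
  gcongr <;> exact min_le_left _ _

/-- The Prékopa–Leindler property of a measure with respect to weights `a`, `b`. -/
def PL {X : Type*} [AddCommGroup X] [Module ℝ X] [MeasurableSpace X] (μ : Measure X)
    (a b : ℝ) : Prop :=
  ∀ f g h : X → ℝ≥0∞, Measurable f → Measurable g → Measurable h →
    (∀ x y, f x ^ a * g y ^ b ≤ h (a • x + b • y)) →
    (∫⁻ x, f x ∂μ) ^ a * (∫⁻ x, g x ∂μ) ^ b ≤ ∫⁻ x, h x ∂μ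

theorem PL.prod {X Y : Type*} [AddCommGroup X] [Module ℝ X] [MeasurableSpace X]
    [AddCommGroup Y] [Module ℝ Y] [MeasurableSpace Y] {μ : Measure X} {ν : Measure Y}
    [SFinite μ] [SFinite ν] {a b : ℝ} (hμ : PL μ a b) (hν : PL ν a b) : PL (μ.prod ν) a b := by
  intro f g h hf hg hh hfgh
  rw [lintegral_prod _ hf.aemeasurable, lintegral_prod _ hg.aemeasurable,
    lintegral_prod _ hh.aemeasurable]
  refine hμ _ _ _ hf.lintegral_prod_right' hg.lintegral_prod_right' hh.lintegral_prod_right'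
    fun x y => ?_
  exact hν _ _ _ (hf.comp measurable_prodMk_left) (hg.comp measurable_prodMk_left)
    (hh.comp measurable_prodMk_left) fun u v => hfgh (x, u) (y, v)

theorem PL.of_measurePreserving {X Y : Type*} [AddCommGroup X] [Module ℝ X] [MeasurableSpace X]
    [AddCommGroup Y] [Module ℝ Y] [MeasurableSpace Y] {μ : Measure X} {ν : Measure Y}
    {a b : ℝ} (hμ : PL μ a b) (T : X → Y) (hT : MeasurePreserving T μ ν)
    (hlin : ∀ x y, T (a • x + b • y) = a • T x + b • T y) : PL ν a b := by
  intro f g h hf hg hh hfgh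
  rw [← hT.lintegral_comp hf, ← hT.lintegral_comp hg, ← hT.lintegral_comp hh]
  refine hμ _ _ _ (hf.comp hT.measurable) (hg.comp hT.measurable) (hh.comp hT.measurable)
    fun x y => ?_
  rw [hlin]; exact hfgh _ _

theorem PL_pi {a b : ℝ} (ha : 0 < a) (hb : 0 < b) (hab : a + b = 1) (n : ℕ) :
    PL (volume : Measure (Fin n → ℝ)) a b := by
  induction n with
  | zero =>
    intro f g h hf hg hh hfgh
    have := hfgh 0 0
    rw [Measure.volume_pi_eq_dirac 0]
    simpa [lintegral_dirac' _ hf, lintegral_dirac' _ hg, lintegral_dirac' _ hh] using this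
  | succ n ih =>
    have h1 : PL (volume : Measure ℝ) a b := fun f g h hf hg hh hfgh =>
      prekopa_leindler_real ha hb hab hf hg hh hfgh
    refine (h1.prod ih).of_measurePreserving (MeasurableEquiv.piFinSuccAbove (fun _ => ℝ) 0).symm
      (volume_preserving_piFinSuccAbove (fun _ => ℝ) 0).symm ?_
    intro x y
    ext i
    refine Fin.cases ?_ (fun i => ?_) i <;> simp [MeasurableEquiv.piFinSuccAbove]

theorem PL_euclidean {a b : ℝ} (ha : 0 < a) (hb : 0 < b) (hab : a + b = 1) (n : ℕ) :
    PL (volume : Measure (EuclideanSpace ℝ (Fin n))) a b :=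
  (PL_pi ha hb hab n).of_measurePreserving _ (PiLp.volume_preserving_toLp (Fin n))
    fun _ _ => rfl

/-- Multiplicative Brunn–Minkowski inequality. -/
theorem brunn_minkowski_mul {n : ℕ} {a b : ℝ} (ha : 0 < a) (hb : 0 < b) (hab : a + b = 1)
    {A B C : Set (EuclideanSpace ℝ (Fin n))} (hA : MeasurableSet A) (hB : MeasurableSet B)
    (hC : MeasurableSet C) (h : ∀ x ∈ A, ∀ y ∈ B, a • x + b • y ∈ C) :
    volume A ^ a * volume B ^ b ≤ volume C := by
  have := PL_euclidean ha hb hab n (A.indicator 1) (B.indicator 1) (C.indicator 1)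
    (measurable_one.indicator hA) (measurable_one.indicator hB) (measurable_one.indicator hC)
    (fun x y => by
      by_cases hx : x ∈ A
      · by_cases hy : y ∈ B
        · simp [hx, hy, h x hx y hy]
        · simp [hy, ENNReal.zero_rpow_of_pos hb]
      · simp [hx, ENNReal.zero_rpow_of_pos ha])
  simpa [lintegral_indicator_one, hA, hB, hC] using this

/-- Brunn–Minkowski for sets of positive finite volume. -/
theorem brunn_minkowski {n : ℕ}
    {A B C : Set (EuclideanSpace ℝ (Fin n))} (hA : MeasurableSet A) (hB : MeasurableSet B)
    (hC : MeasurableSet C) (h : A + B ⊆ C) {x y : ℝ} (hx : 0 < x) (hy : 0 < y)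
    (hAx : ENNReal.ofReal (x ^ n) ≤ volume A) (hBy : ENNReal.ofReal (y ^ n) ≤ volume B) :
    ENNReal.ofReal ((x + y) ^ n) ≤ volume C := by
  have hxy : 0 < x + y := by positivity
  have ha : 0 < x / (x + y) := by positivity
  have hb : 0 < y / (x + y) := by positivity
  have key := brunn_minkowski_mul (n := n) ha hb (by field_simp)
    (A := x⁻¹ • A) (B := y⁻¹ • B) (C := (x + y)⁻¹ • C)
    (hA.const_smul_of_ne_zero (by positivity)) (hB.const_smul_of_ne_zero (by positivity))
    (hC.const_smul_of_ne_zero (by positivity)) (by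
      rintro _ ⟨u, hu, rfl⟩ _ ⟨v, hv, rfl⟩
      refine ⟨u + v, h (add_mem_add hu hv), ?_⟩
      simp only [smul_smul, smul_add]
      congr 2 <;> field_simp)
  have one_le : ∀ (z : ℝ) (Z : Set (EuclideanSpace ℝ (Fin n))), 0 < z →
      ENNReal.ofReal (z ^ n) ≤ volume Z → 1 ≤ volume (z⁻¹ • Z) := by
    intro z Z hz hZ
    rw [Measure.addHaar_smul]
    calc (1 : ℝ≥0∞) = ENNReal.ofReal (z⁻¹ ^ n) * ENNReal.ofReal (z ^ n) := by
          rw [← ENNReal.ofReal_mul (by positivity), ← mul_pow, inv_mul_cancel₀ hz.ne']; simp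
      _ ≤ _ := by
          gcongr
          simp [abs_of_pos hz]
  have h1 : 1 ≤ volume ((x + y)⁻¹ • C) := by
    refine le_trans ?_ key
    calc (1 : ℝ≥0∞) = 1 ^ (x / (x + y)) * 1 ^ (y / (x + y)) := by simp
      _ ≤ _ := by
        gcongr
        · exact one_le x A hx hAx
        · exact one_le y B hy hBy
  rw [Measure.addHaar_smul] at h1
  have h2 : volume C = ENNReal.ofReal ((x + y) ^ n) *
      (ENNReal.ofReal |(x + y)⁻¹ ^ Module.finrank ℝ (EuclideanSpace ℝ (Fin n))| * volume C) := by
    rw [← mul_assoc, ← ENNReal.ofReal_mul (by positivity), finrank_euclideanSpace_fin,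
      abs_of_pos (by positivity), ← mul_pow, mul_inv_cancel₀ hxy.ne']; simp
  rw [h2]
  exact le_mul_of_one_le_right (by simp) h1

theorem sum_sq_sub_quadForm {m : Type*} [Fintype m] (H : m → m → ℝ)
    (hsymm : ∀ i j, H i j = H j i) (a d : m → ℝ) (ha : ∀ i, 0 < a i)
    (hrow : ∀ i, ∑ j, H i j * a j = d i * a i) (x : m → ℝ) :
    ∑ i, d i * x i ^ 2 - ∑ i, ∑ j, H i j * x i * x j =
      (1 / 2) * ∑ i, ∑ j, H i j * a i * a j * (x i / a i - x j / a j) ^ 2 := by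
  have e1 : ∑ i, d i * x i ^ 2 = ∑ i, ∑ j, H i j * a i * a j * (x i / a i) ^ 2 := by
    refine Finset.sum_congr rfl fun i _ => ?_
    calc d i * x i ^ 2 = (d i * a i) * (a i * (x i / a i) ^ 2) := by
          have := (ha i).ne'; field_simp
      _ = ∑ j, H i j * a i * a j * (x i / a i) ^ 2 := by
          rw [← hrow, Finset.sum_mul]; exact Finset.sum_congr rfl fun j _ => by ring
  have e2 : ∑ i, d i * x i ^ 2 = ∑ i, ∑ j, H i j * a i * a j * (x j / a j) ^ 2 := by
    rw [e1, Finset.sum_comm]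
    refine Finset.sum_congr rfl fun i _ => Finset.sum_congr rfl fun j _ => ?_
    rw [hsymm]; ring
  have e3 : ∑ i, ∑ j, H i j * x i * x j =
      ∑ i, ∑ j, H i j * a i * a j * (x i / a i * (x j / a j)) := by
    refine Finset.sum_congr rfl fun i _ => Finset.sum_congr rfl fun j _ => ?_
    have := (ha i).ne'; have := (ha j).ne'
    field_simp
  have e4 : ∑ i, ∑ j, H i j * a i * a j * (x i / a i - x j / a j) ^ 2 =
      ∑ i, ∑ j, H i j * a i * a j * (x i / a i) ^ 2 +
      ∑ i, ∑ j, H i j * a i * a j * (x j / a j) ^ 2 -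
      2 * ∑ i, ∑ j, H i j * a i * a j * (x i / a i * (x j / a j)) := by
    simp only [Finset.mul_sum, ← Finset.sum_add_distrib, ← Finset.sum_sub_distrib]
    refine Finset.sum_congr rfl fun i _ => Finset.sum_congr rfl fun j _ => ?_
    ring
  rw [e4, ← e1, ← e2, e3]; ring

/-- The key spectral step of the Bochner method. -/
theorem quadForm_nonpos_of_sq {m : Type*} [Fintype m] [DecidableEq m] (H : m → m → ℝ)
    (hsymm : ∀ i j, H i j = H j i) (a d : m → ℝ) (ha : ∀ i, 0 < a i) (hd : ∀ i, 0 < d i)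
    (hrow : ∀ i, ∑ j, H i j * a j = d i * a i) (hoff : ∀ i j, i ≠ j → 0 ≤ H i j)
    (hconn : ∀ S : Set m, S.Nonempty → Sᶜ.Nonempty → ∃ i ∈ S, ∃ j ∈ Sᶜ, 0 < H i j)
    (hsq : ∀ x : m → ℝ, ∑ i, ∑ j, H i j * x i * x j ≤ ∑ i, (∑ j, H i j * x j) ^ 2 / d i)
    (z : m → ℝ) (hz : ∑ i, d i * a i * z i = 0) : ∑ i, ∑ j, H i j * z i * z j ≤ 0 := by
  set A : Matrix m m ℝ := Matrix.of fun i j => H i j / (√(d i) * √(d j)) with hAdef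
  have hA : A.IsHermitian := by
    ext i j
    simp [hAdef, hsymm i j, mul_comm]
  have hs : ∀ i, 0 < √(d i) := fun i => Real.sqrt_pos.2 (hd i)
  have hss : ∀ i, √(d i) * √(d i) = d i := fun i => Real.mul_self_sqrt (hd i).le
  have hmul : ∀ (y : m → ℝ) i, ∑ j, H i j * (y j / √(d j)) = √(d i) * (A.mulVec y) i := by
    intro y i
    simp only [Matrix.mulVec, dotProduct, hAdef, Matrix.of_apply, Finset.mul_sum]
    refine Finset.sum_congr rfl fun j _ => ?_
    have := (hs i).ne'; have := (hs j).ne'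
    field_simp
  have hform : ∀ x : m → ℝ, ∑ i, ∑ j, H i j * x i * x j = ∑ i, x i * ∑ j, H i j * x j := by
    intro x
    refine Finset.sum_congr rfl fun i _ => ?_
    rw [Finset.mul_sum]
    exact Finset.sum_congr rfl fun j _ => by ring
  set b := hA.eigenvectorBasis
  set ev := hA.eigenvalues
  have hb : ∀ k, A.mulVec (b k).ofLp = ev k • (b k).ofLp := fun k => hA.mulVec_eigenvectorBasis k
  have hnorm : ∀ k, ∑ i, (b k) i ^ 2 = 1 := by
    intro k
    have := b.orthonormal.1 k
    rw [EuclideanSpace.norm_eq, Real.sqrt_eq_one] at this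
    simpa using this
  have hx1 : ∀ k, ∑ i, ∑ j, H i j * ((b k) i / √(d i)) * ((b k) j / √(d j)) = ev k := by
    intro k
    rw [hform]
    calc _ = ∑ i, ev k * (b k) i ^ 2 := by
          refine Finset.sum_congr rfl fun i _ => ?_
          rw [hmul (b k).ofLp i, hb]
          have := (hs i).ne'
          simp only [Pi.smul_apply, smul_eq_mul]
          field_simp
      _ = ev k := by rw [← Finset.mul_sum, hnorm, mul_one]
  have hx2 : ∀ k, ev k ≤ ev k ^ 2 := by
    intro k
    calc ev k ≤ _ := (hx1 k).symm.le.trans (hsq _)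
      _ = ∑ i, ev k ^ 2 * (b k) i ^ 2 := by
          refine Finset.sum_congr rfl fun i _ => ?_
          rw [hmul (b k).ofLp i, hb, div_eq_iff (hd i).ne', mul_pow, Real.sq_sqrt (hd i).le]
          simp only [Pi.smul_apply, smul_eq_mul]
          ring
      _ = ev k ^ 2 := by rw [← Finset.mul_sum, hnorm, mul_one]
  have hx3 : ∀ k, 1 - ev k = (1 / 2) * ∑ i, ∑ j, H i j * a i * a j *
      ((b k) i / √(d i) / a i - (b k) j / √(d j) / a j) ^ 2 := by
    intro k
    rw [← sum_sq_sub_quadForm H hsymm a d ha hrow, hx1, ← hnorm k]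
    congr 1
    refine Finset.sum_congr rfl fun i _ => ?_
    rw [div_pow, Real.sq_sqrt (hd i).le, mul_div_cancel₀ _ (hd i).ne']
  have hterm : ∀ k i j, 0 ≤ H i j * a i * a j *
      ((b k) i / √(d i) / a i - (b k) j / √(d j) / a j) ^ 2 := by
    intro k i j
    rcases eq_or_ne i j with rfl | hij
    · simp
    · have := hoff i j hij; have := ha i; have := ha j; positivity
  have hle1 : ∀ k, ev k ≤ 1 := by
    intro k
    have : 0 ≤ 1 - ev k := by
      rw [hx3]
      exact mul_nonneg (by norm_num)
        (Finset.sum_nonneg fun i _ => Finset.sum_nonneg fun j _ => hterm k i j)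
    linarith
  set w : EuclideanSpace ℝ m := WithLp.toLp 2 fun i => √(d i) * z i with hw
  have horth : ∀ k, ev k = 1 → inner ℝ (b k) w = 0 := by
    intro k hk
    have h0 := hx3 k
    rw [hk, sub_self, eq_comm, mul_eq_zero, or_iff_right (by norm_num),
      Finset.sum_eq_zero_iff_of_nonneg
        fun i _ => Finset.sum_nonneg fun j _ => hterm k i j] at h0
    have h1 : ∀ i j, H i j * a i * a j *
      ((b k) i / √(d i) / a i - (b k) j / √(d j) / a j) ^ 2 = 0 := fun i j =>
        (Finset.sum_eq_zero_iff_of_nonneg fun j _ => hterm k i j).1 (h0 i (Finset.mem_univ i)) j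
          (Finset.mem_univ j)
    rcases isEmpty_or_nonempty m with hm | ⟨⟨i0⟩⟩
    · simp [PiLp.inner_apply]
    set c := (b k) i0 / √(d i0) / a i0 with hc
    have hall : ∀ i, (b k) i / √(d i) / a i = c := by
      by_contra hne
      push Not at hne
      obtain ⟨i1, hi1⟩ := hne
      obtain ⟨i, hi, j, hj, hij⟩ := hconn {i | (b k) i / √(d i) / a i = c} ⟨i0, rfl⟩ ⟨i1, hi1⟩
      have := h1 i j
      have hp : H i j * a i * a j ≠ 0 := by
        have := ha i; have := ha j; positivity
      rw [mul_eq_zero, or_iff_right hp, sq_eq_zero_iff, sub_eq_zero] at this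
      exact hj (this.symm.trans hi)
    have : ∀ i, (b k) i = c * a i * √(d i) := by
      intro i
      rw [← hall i]
      have := (hs i).ne'; have := (ha i).ne'
      field_simp
    simp only [PiLp.inner_apply, hw, this, RCLike.inner_apply, conj_trivial]
    calc _ = ∑ i, c * (d i * a i * z i) := by
          refine Finset.sum_congr rfl fun i _ => ?_
          linear_combination (c * a i * z i) * hss i
      _ = 0 := by rw [← Finset.mul_sum, hz, mul_zero]
  have hw1 : w.ofLp = ∑ k, inner ℝ (b k) w • (b k).ofLp := by
    conv_lhs => rw [← b.sum_repr' w]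
    simp
  have hAw : A.mulVec w.ofLp = ∑ k, (inner ℝ (b k) w * ev k) • (b k).ofLp := by
    conv_lhs => rw [hw1]
    rw [Matrix.mulVec_sum]
    refine Finset.sum_congr rfl fun k _ => ?_
    rw [Matrix.mulVec_smul, hb, smul_smul]
  have hfin : ∑ i, ∑ j, H i j * z i * z j = ∑ k, ev k * inner ℝ (b k) w ^ 2 := by
    have hzw : ∀ i, z i = w i / √(d i) := fun i => by
      have := (hs i).ne'
      simp only [hw]; field_simp
    rw [hform]
    calc _ = ∑ i, w i * (A.mulVec w.ofLp) i := by
          refine Finset.sum_congr rfl fun i _ => ?_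
          have := hmul w.ofLp i
          simp only [hzw] at *
          rw [this]
          have := (hs i).ne'
          field_simp
      _ = ∑ k, ev k * inner ℝ (b k) w ^ 2 := by
          rw [hAw]
          simp only [Finset.sum_apply, Pi.smul_apply, smul_eq_mul, Finset.mul_sum]
          rw [Finset.sum_comm]
          refine Finset.sum_congr rfl fun k _ => ?_
          have : inner ℝ (b k) w = ∑ i, w i * (b k) i := by
            simp [PiLp.inner_apply]
          calc _ = inner ℝ (b k) w * ev k * ∑ i, w i * (b k) i := by
                rw [Finset.mul_sum]; exact Finset.sum_congr rfl fun i _ => by ring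
            _ = _ := by rw [← this]; ring
  rw [hfin]
  refine Finset.sum_nonpos fun k _ => ?_
  rcases eq_or_ne (ev k) 1 with h1 | h1
  · rw [horth k h1]; simp
  · have h2 : ev k < 1 := lt_of_le_of_ne (hle1 k) h1
    have h3 : ev k ≤ 0 := by
      by_contra h
      have := hx2 k
      nlinarith
    exact mul_nonpos_of_nonpos_of_nonneg h3 (sq_nonneg _)

open MvPolynomial

section DirDeriv
variable {ι : Type*} [Fintype ι]

/-- Directional derivative of a polynomial. -/
def dd (x : ι → ℝ) : MvPolynomial ι ℝ →ₗ[ℝ] MvPolynomial ι ℝ :=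
  ∑ i, x i • (pderiv i).toLinearMap

/-- Iterated partial derivative along a list of variables. -/
def pd (l : List ι) (p : MvPolynomial ι ℝ) : MvPolynomial ι ℝ :=
  l.foldr (fun i q => pderiv i q) p

theorem pd_cons (i : ι) (l : List ι) (p : MvPolynomial ι ℝ) :
    pd (i :: l) p = pderiv i (pd l p) := rfl

theorem dd_apply (x : ι → ℝ) (p : MvPolynomial ι ℝ) : dd x p = ∑ i, x i • pderiv i p := by
  simp [dd]

theorem eval_dd (h x : ι → ℝ) (p : MvPolynomial ι ℝ) :
    eval h (dd x p) = ∑ i, x i * eval h (pderiv i p) := by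
  simp [dd_apply, smul_eval]

theorem pderiv_pderiv_comm {σ : Type*} (i j : σ) (p : MvPolynomial σ ℝ) :
    pderiv i (pderiv j p) = pderiv j (pderiv i p) := by
  classical
  ext m
  simp only [coeff_pderiv]
  rcases eq_or_ne i j with rfl | hij
  · rfl
  · rw [add_right_comm]
    simp [Finsupp.single_eq_of_ne hij, Finsupp.single_eq_of_ne hij.symm]
    ring

theorem dd_pderiv (x : ι → ℝ) (i : ι) (p : MvPolynomial ι ℝ) :
    dd x (pderiv i p) = pderiv i (dd x p) := by
  simp [dd_apply, pderiv_pderiv_comm _ i]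

theorem dd_comm (x y : ι → ℝ) (p : MvPolynomial ι ℝ) : dd x (dd y p) = dd y (dd x p) := by
  rw [dd_apply y p, map_sum, dd_apply y (dd x p)]
  simp [dd_pderiv]

theorem dd_pd (x : ι → ℝ) (l : List ι) (p : MvPolynomial ι ℝ) : dd x (pd l p) = pd l (dd x p) := by
  induction l with
  | nil => rfl
  | cons i l ih => rw [pd_cons, pd_cons, dd_pderiv, ih]

theorem pd_zero (l : List ι) : pd l (0 : MvPolynomial ι ℝ) = 0 := by
  induction l with
  | nil => rfl
  | cons i l ih => rw [pd_cons, ih, map_zero]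

theorem dd_add (x y : ι → ℝ) (p : MvPolynomial ι ℝ) : dd (x + y) p = dd x p + dd y p := by
  simp [dd_apply, add_smul, Finset.sum_add_distrib]

theorem dd_smul (c : ℝ) (x : ι → ℝ) (p : MvPolynomial ι ℝ) : dd (c • x) p = c • dd x p := by
  simp [dd_apply, Finset.smul_sum, smul_smul]

theorem isHomogeneous_dd {n : ℕ} {p : MvPolynomial ι ℝ} (hp : p.IsHomogeneous n) (x : ι → ℝ) :
    (dd x p).IsHomogeneous (n - 1) := by
  rw [dd_apply]
  refine IsHomogeneous.sum _ _ _ fun i _ => ?_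
  rw [smul_eq_C_mul]
  simpa using (isHomogeneous_C ι (x i)).mul hp.pderiv

theorem isHomogeneous_pd {n : ℕ} {p : MvPolynomial ι ℝ} (hp : p.IsHomogeneous n) (l : List ι) :
    (pd l p).IsHomogeneous (n - l.length) := by
  induction l with
  | nil => exact hp
  | cons i l ih => rw [pd_cons, List.length_cons, ← Nat.sub_sub]; exact ih.pderiv

theorem eval_dd_self {n : ℕ} {p : MvPolynomial ι ℝ} (hp : p.IsHomogeneous n) (h : ι → ℝ) :
    eval h (dd h p) = n * eval h p := by
  have := congrArg (eval h) hp.sum_X_mul_pderiv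
  simpa [eval_dd] using this

theorem hasDerivAt_eval (h x : ι → ℝ) (p : MvPolynomial ι ℝ) (t : ℝ) :
    HasDerivAt (fun t : ℝ => eval (h + t • x) p) (eval (h + t • x) (dd x p)) t := by
  induction p using MvPolynomial.induction_on with
  | C a => simpa [dd_apply] using hasDerivAt_const t a
  | add p q hp hq => simpa using! hp.add hq
  | mul_X p i hp =>
    classical
    have h1 : HasDerivAt (fun t : ℝ => (h + t • x) i) (x i) t := by
      simpa using ((hasDerivAt_id t).mul_const (x i)).const_add (h i)
    have h2 : dd x (p * X i) = dd x p * X i + x i • p := by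
      rw [dd_apply, dd_apply]
      simp only [pderiv_mul, pderiv_X, smul_add, Finset.sum_add_distrib, Finset.sum_mul,
        smul_mul_assoc]
      congr 1
      rw [Finset.sum_eq_single i] <;> simp +contextual [eq_comm]
    rw [h2]
    have := hp.mul h1
    simp only [map_mul, eval_X, map_add, smul_eval]
    refine this.congr_deriv ?_
    ring

theorem eval_add_of_dd_eq_zero {x : ι → ℝ} {p : MvPolynomial ι ℝ} (hp : dd x p = 0) (h : ι → ℝ) :
    eval (h + x) p = eval h p := by
  have hd : ∀ t : ℝ, HasDerivAt (fun t : ℝ => eval (h + t • x) p) 0 t := fun t => by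
    have := hasDerivAt_eval h x p t
    rwa [hp, map_zero] at this
  have := is_const_of_deriv_eq_zero (fun t => (hd t).differentiableAt) (fun t => (hd t).deriv) 1 0
  simpa using this

theorem eval_eq_of_isHomogeneous_zero {p : MvPolynomial ι ℝ} (hp : p.IsHomogeneous 0)
    (h h' : ι → ℝ) : eval h p = eval h' p := by
  have := (totalDegree_zero_iff_isHomogeneous (p := p)).2 hp
  rw [totalDegree_eq_zero_iff_eq_C] at this
  rw [this]; simp

end DirDeriv

theorem sum_subtype_eq_of_zero {ι : Type*} [Fintype ι] (P : ι → Prop) [DecidablePred P]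
    (g : ι → ℝ) (hg : ∀ i, ¬ P i → g i = 0) : ∑ i : {i // P i}, g i = ∑ i, g i := by
  rw [← Finset.sum_filter_of_ne (p := P) fun i _ hi => by by_contra h; exact hi (hg i h)]
  exact (Finset.sum_subtype _ (by simp) g).symm

/-- Reverse Cauchy–Schwarz for a symmetric form that is positive somewhere and nonpositive on the
orthogonal complement. -/
theorem reverse_cauchySchwarz {V : Type*} [AddCommGroup V] [Module ℝ V] (Q : V →ₗ[ℝ] V →ₗ[ℝ] ℝ)
    (hQ : ∀ x y, Q x y = Q y x) (a : V) (hc : ∀ x, Q x a = 0 → Q x x ≤ 0)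
    (x y : V) (hy : 0 < Q y y) : Q x x * Q y y ≤ Q x y ^ 2 := by
  have hya : Q y a ≠ 0 := fun h => absurd (hc y h) (not_le.2 hy)
  have h1 := hc (x - (Q x a / Q y a) • y) (by simp [hya])
  set s := Q x a / Q y a
  simp only [map_sub, map_smul, LinearMap.sub_apply, LinearMap.smul_apply, smul_eq_mul] at h1
  rw [hQ y x] at h1
  nlinarith [sq_nonneg (s * Q y y - Q x y)]

/-- The combinatorial and analytic data of the volume polynomial of a type cone of simple
polytopes, in the form needed for the Bochner method. -/
structure ChamberData (n : ℕ) (ι E : Type*) [Fintype ι] [DecidableEq ι] [AddCommGroup E]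
    [Module ℝ E] where
  p : MvPolynomial ι ℝ
  cone : Set (ι → ℝ)
  T : E →ₗ[ℝ] (ι → ℝ)
  F : Finset ι → Prop
  homog : p.IsHomogeneous n
  pos : ∀ l : List ι, l.Nodup → F l.toFinset → l.length + 1 ≤ n → ∀ h ∈ cone, ∀ c ∈ cone,
    0 < eval h (dd c (pd l p))
  zero : ∀ l : List ι, l.Nodup → ¬ F l.toFinset → pd l p = 0
  transl : ∀ y, dd (T y) p = 0
  lift : ∀ l : List ι, F l.toFinset → ∀ x : ι → ℝ, ∃ y, ∀ j ∈ l, T y j = x j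
  relint : ∀ l : List ι, F l.toFinset → ∀ h ∈ cone, ∃ y, (∀ j ∈ l, h j = T y j) ∧
    ∀ j ∉ l, T y j < h j
  logc : ∀ l : List ι, l.Nodup → F l.toFinset → l.length + 3 ≤ n → ∀ h ∈ cone, ∀ x y,
    0 < eval h (dd y (dd y (pd l p))) →
    eval h (dd x (dd x (pd l p))) * eval h (dd y (dd y (pd l p))) ≤
      eval h (dd x (dd y (pd l p))) ^ 2

/-- The Hessian of a polynomial as a bilinear form. -/
def hess {ι : Type*} [Fintype ι] (h : ι → ℝ) (f : MvPolynomial ι ℝ) :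
    (ι → ℝ) →ₗ[ℝ] (ι → ℝ) →ₗ[ℝ] ℝ :=
  LinearMap.mk₂ ℝ (fun x y => eval h (dd x (dd y f)))
    (fun x x' y => by simp [dd_add]) (fun c x y => by simp [dd_smul, smul_eval])
    (fun x y y' => by simp [dd_add]) (fun c x y => by simp [dd_smul, smul_eval])

theorem hess_apply {ι : Type*} [Fintype ι] (h : ι → ℝ) (f : MvPolynomial ι ℝ) (x y : ι → ℝ) :
    hess h f x y = eval h (dd x (dd y f)) := rfl

theorem hess_comm {ι : Type*} [Fintype ι] (h : ι → ℝ) (f : MvPolynomial ι ℝ) (x y : ι → ℝ) :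
    hess h f x y = hess h f y x := by simp [hess_apply, dd_comm x y]

theorem hess_eq_sum {ι : Type*} [Fintype ι] (h : ι → ℝ) (f : MvPolynomial ι ℝ) (x y : ι → ℝ) :
    hess h f x y = ∑ i, ∑ j, eval h (pderiv i (pderiv j f)) * x i * y j := by
  simp only [hess_apply, eval_dd, ← dd_pderiv, Finset.mul_sum]
  refine Finset.sum_congr rfl fun i _ => Finset.sum_congr rfl fun j _ => ?_
  rw [pderiv_pderiv_comm]; ring

/-- The inductive step of the Bochner method. -/
theorem hess_nonpos_of_link {ι : Type*} [Fintype ι] (f : MvPolynomial ι ℝ) {d : ℕ}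
    (hd : 3 ≤ d) (hf : f.IsHomogeneous d) (S : ι → Prop) [DecidablePred S] (h : ι → ℝ)
    (hS : ∀ i, S i → 0 < h i) (hSf : ∀ i, S i → 0 < eval h (pderiv i f))
    (h0 : ∀ i, ¬ S i → h i = 0 ∨ pderiv i f = 0)
    (hoff : ∀ i j, i ≠ j → S i → S j → 0 ≤ eval h (pderiv i (pderiv j f)))
    (hconn : ∀ A : Set {i // S i}, A.Nonempty → Aᶜ.Nonempty →
      ∃ i ∈ A, ∃ j ∈ Aᶜ, 0 < eval h (pderiv i.1 (pderiv j.1 f)))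
    (hlor : ∀ i, S i → ∀ x y, 0 < hess h (pderiv i f) y y →
      hess h (pderiv i f) x x * hess h (pderiv i f) y y ≤ hess h (pderiv i f) x y ^ 2)
    (x : ι → ℝ) (hx : ∀ i, ¬ S i → x i = 0 ∨ pderiv i f = 0) (hxh : hess h f x h = 0) :
    hess h f x x ≤ 0 := by
  classical
  have hd2 : (2 : ℝ) < d := by exact_mod_cast hd
  have c1 : ((d - 1 : ℕ) : ℝ) = d - 1 := by rw [Nat.cast_sub (by omega)]; simp
  have c2 : ((d - 1 - 1 : ℕ) : ℝ) = d - 2 := by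
    rw [Nat.sub_sub, Nat.cast_sub (by omega)]; norm_num
  -- sums against vectors satisfying the vanishing condition
  have red : ∀ (u w : ι → ℝ), (∀ i, ¬ S i → w i = 0 ∨ pderiv i f = 0) →
      hess h f w u = ∑ i : {i // S i}, w i * eval h (dd u (pderiv i.1 f)) := by
    intro u w hw
    rw [hess_apply, eval_dd, ← sum_subtype_eq_of_zero S]
    · refine Finset.sum_congr rfl fun i _ => ?_
      rw [dd_pderiv]
    · intro i hi
      rcases hw i hi with h | h
      · simp [h]
      · rw [← dd_pderiv, h]; simp
  have red1 : ∀ (w : ι → ℝ) (j : ι), (∀ i, ¬ S i → w i = 0 ∨ pderiv i f = 0) →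
      eval h (dd w (pderiv j f)) = ∑ i : {i // S i}, eval h (pderiv j (pderiv i.1 f)) * w i := by
    intro w j hw
    rw [eval_dd, ← sum_subtype_eq_of_zero S]
    · refine Finset.sum_congr rfl fun i _ => ?_
      rw [pderiv_pderiv_comm, mul_comm]
    · intro i hi
      rcases hw i hi with h | h
      · simp [h]
      · rw [pderiv_pderiv_comm, h]; simp
  have euler : ∀ i, eval h (dd h (pderiv i f)) = (d - 1) * eval h (pderiv i f) := fun i => by
    rw [eval_dd_self hf.pderiv, c1]
  set D : {i // S i} → ℝ := fun i => (d - 1) * eval h (pderiv i.1 f) / h i with hD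
  have key := quadForm_nonpos_of_sq (m := {i // S i})
    (fun i j => eval h (pderiv i.1 (pderiv j.1 f))) (fun i j => by rw [pderiv_pderiv_comm])
    (fun i => h i) D (fun i => hS i i.2)
    (fun i => div_pos (mul_pos (by linarith) (hSf i i.2)) (hS i i.2))
    (fun i => by
      rw [← red1 h i h0, euler, hD]
      have := (hS i i.2).ne'
      field_simp)
    (fun i j hij => hoff i j (fun h => hij (Subtype.ext h)) i.2 j.2) hconn ?_ (fun i => x i) ?_
  · rw [red x x hx]
    refine le_of_eq_of_le (Finset.sum_congr rfl fun i _ => ?_) key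
    rw [red1 x i hx, Finset.mul_sum]
    exact Finset.sum_congr rfl fun j _ => by ring
  · intro w
    set W : ι → ℝ := fun i => if hi : S i then w ⟨i, hi⟩ else 0 with hWdef
    have hW : ∀ i, ¬ S i → W i = 0 ∨ pderiv i f = 0 := fun i hi => Or.inl (by simp [hWdef, hi])
    have hWw : ∀ i : {i // S i}, W i = w i := fun i => by simp [hWdef, i.2]
    have e1 : ∑ i : {i // S i}, ∑ j : {i // S i},
        eval h (pderiv i.1 (pderiv j.1 f)) * w i * w j = hess h f W W := by
      rw [red W W hW]
      refine Finset.sum_congr rfl fun i _ => ?_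
      rw [red1 W i hW, Finset.mul_sum, hWw]
      exact Finset.sum_congr rfl fun j _ => by rw [hWw]; ring
    have e2 : ∀ i : {i // S i}, ∑ j : {i // S i}, eval h (pderiv i.1 (pderiv j.1 f)) * w j =
        eval h (dd W (pderiv i.1 f)) := fun i => by
      rw [red1 W i hW]
      exact Finset.sum_congr rfl fun j _ => by rw [hWw]
    have e3 : (d - 2) * hess h f W W = ∑ i : {i // S i}, h i * hess h (pderiv i.1 f) W W := by
      have := eval_dd_self (isHomogeneous_dd (isHomogeneous_dd hf W) W) h
      rw [c2] at this
      rw [hess_apply, ← this, eval_dd, ← sum_subtype_eq_of_zero S]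
      · simp only [hess_apply, dd_pderiv]
      · intro i hi
        rcases h0 i hi with h | h
        · simp [h]
        · rw [← dd_pderiv, ← dd_pderiv, h]; simp
    have e4 : ∀ i : {i // S i}, h i * hess h (pderiv i.1 f) W W ≤
        (d - 2) * (eval h (dd W (pderiv i.1 f)) ^ 2 / D i) := by
      intro i
      have hi := hS i i.2
      have hfi := hSf i i.2
      have a1 : hess h (pderiv i.1 f) h h = (d - 1) * (d - 2) * eval h (pderiv i.1 f) := by
        rw [hess_apply, eval_dd_self (isHomogeneous_dd hf.pderiv h), euler, c2]; ring
      have a2 : hess h (pderiv i.1 f) W h = (d - 2) * eval h (dd W (pderiv i.1 f)) := by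
        rw [hess_comm, hess_apply, eval_dd_self (isHomogeneous_dd hf.pderiv W), c2]
      have a3 := hlor i i.2 W h (by
        rw [a1]; exact mul_pos (mul_pos (by linarith) (by linarith)) hfi)
      rw [a1, a2] at a3
      have a4 : (d - 1) * eval h (pderiv i.1 f) * hess h (pderiv i.1 f) W W ≤
          (d - 2) * eval h (dd W (pderiv i.1 f)) ^ 2 := by
        have : 0 < (d : ℝ) - 2 := by linarith
        refine le_of_mul_le_mul_left ?_ this
        linarith
      have a5 : 0 < (d - 1) * eval h (pderiv i.1 f) := mul_pos (by linarith) hfi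
      have a6 : (d - 2) * (eval h (dd W (pderiv i.1 f)) ^ 2 / D i) =
          h i * ((d - 2) * eval h (dd W (pderiv i.1 f)) ^ 2 / ((d - 1) * eval h (pderiv i.1 f))) := by
        rw [hD]; field_simp
      rw [a6]
      refine mul_le_mul_of_nonneg_left ?_ hi.le
      rw [le_div_iff₀ a5]
      linarith
    rw [e1]
    have : (d - 2) * hess h f W W ≤
        (d - 2) * ∑ i : {i // S i}, eval h (dd W (pderiv i.1 f)) ^ 2 / D i := by
      rw [e3, Finset.mul_sum]
      exact Finset.sum_le_sum fun i _ => e4 i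
    have := le_of_mul_le_mul_left this (by linarith)
    simpa only [e2] using this
  · rw [red h x hx] at hxh
    rw [← hxh]
    refine Finset.sum_congr rfl fun i _ => ?_
    rw [euler, hD]
    have := (hS i i.2).ne'
    field_simp

theorem hess_translate {ι : Type*} [Fintype ι] {f : MvPolynomial ι ℝ} {w : ι → ℝ}
    (hw : dd w f = 0) (h : ι → ℝ) : hess (h + w) f = hess h f := by
  ext x y
  simp only [hess_apply]
  exact eval_add_of_dd_eq_zero (by rw [dd_comm w, dd_comm w, hw]; simp) h

theorem hess_sub_left {ι : Type*} [Fintype ι] {f : MvPolynomial ι ℝ} {w : ι → ℝ}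
    (hw : dd w f = 0) (h x y : ι → ℝ) : hess h f (x - w) y = hess h f x y := by
  rw [map_sub, LinearMap.sub_apply, hess_apply h f w, dd_comm, hw]; simp

namespace ChamberData
variable {n : ℕ} {ι E : Type*} [Fintype ι] [DecidableEq ι] [AddCommGroup E] [Module ℝ E]
  (D : ChamberData n ι E)

theorem dd_T_pd (l : List ι) (y : E) : dd (D.T y) (pd l D.p) = 0 := by
  rw [dd_pd, D.transl, pd_zero]

theorem eval_pd_pos {l : List ι} (hl : l.Nodup) (hF : D.F l.toFinset) (hn : l.length + 1 ≤ n)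
    {h : ι → ℝ} (hh : h ∈ D.cone) : 0 < eval h (pd l D.p) := by
  have h1 := D.pos l hl hF hn h hh h hh
  rw [eval_dd_self (isHomogeneous_pd D.homog l)] at h1
  exact pos_of_mul_pos_right h1 (Nat.cast_nonneg _)

theorem exists_adj {l : List ι} (hl : l.Nodup) (hF : D.F l.toFinset) (hn : l.length + 4 ≤ n)
    {h h' : ι → ℝ} (hh : h ∈ D.cone) {y : E} (hy : h' + D.T y = h) (h0 : ∀ j ∈ l, h' j = 0)
    (hpos : ∀ j ∉ l, 0 < h' j)
    (A : Set {i // i ∉ l ∧ D.F (insert i l.toFinset)}) (hA : A.Nonempty) (hA' : Aᶜ.Nonempty) :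
    ∃ i ∈ A, ∃ j ∈ Aᶜ, D.F (i :: j :: l : List ι).toFinset := by
  classical
  by_contra! hcon
  set g := pd l D.p with hg
  have hgh : g.IsHomogeneous (n - l.length) := isHomogeneous_pd D.homog l
  have hgT : dd (D.T y) g = 0 := D.dd_T_pd l y
  have hhg : hess h g = hess h' g := by rw [← hy, hess_translate hgT]
  have hd : (0 : ℝ) < ((n - l.length - 1 : ℕ) : ℝ) := by
    rw [Nat.cast_pos]; omega
  -- the part of `h'` supported on a set of indices
  let r : Set {i // i ∉ l ∧ D.F (insert i l.toFinset)} → ι → ℝ := fun B i =>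
    if hi : i ∉ l ∧ D.F (insert i l.toFinset) then (if ⟨i, hi⟩ ∈ B then h' i else 0) else 0
  have rmem : ∀ B i, r B i ≠ 0 → ∃ hi : i ∉ l ∧ D.F (insert i l.toFinset),
      (⟨i, hi⟩ : {i // i ∉ l ∧ D.F (insert i l.toFinset)}) ∈ B ∧ r B i = h' i := by
    intro B i hi
    by_cases h1 : i ∉ l ∧ D.F (insert i l.toFinset)
    · refine ⟨h1, ?_⟩
      by_cases h2 : (⟨i, h1⟩ : {i // i ∉ l ∧ D.F (insert i l.toFinset)}) ∈ B
      · exact ⟨h2, by simp only [r]; rw [dif_pos h1, if_pos h2]⟩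
      · exact absurd (by simp only [r]; rw [dif_pos h1, if_neg h2]) hi
    · exact absurd (by simp only [r]; rw [dif_neg h1]) hi
  have cross : ∀ i ∈ A, ∀ j ∈ Aᶜ, eval h' (pderiv i.1 (pderiv j.1 g)) = 0 := by
    intro i hi j hj
    have hij : i.1 ≠ j.1 := fun e => hj (by rwa [← Subtype.ext e])
    have hnd : (i.1 :: j.1 :: l).Nodup := by
      simp [hl, hij, i.2.1, j.2.1]
    have := D.zero _ hnd (hcon i hi j hj)
    rw [pd_cons, pd_cons] at this
    rw [this, map_zero]
  have hab : hess h' g (r A) (r Aᶜ) = 0 := by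
    rw [hess_eq_sum]
    refine Finset.sum_eq_zero fun i _ => Finset.sum_eq_zero fun j _ => ?_
    by_cases hi : r A i = 0
    · simp [hi]
    by_cases hj : r Aᶜ j = 0
    · simp [hj]
    obtain ⟨hi1, hi2, -⟩ := rmem _ _ hi
    obtain ⟨hj1, hj2, -⟩ := rmem _ _ hj
    rw [cross _ hi2 _ hj2]; simp
  have hsum : ∀ j, r A j + r Aᶜ j = h' j ∨ pderiv j g = 0 := by
    intro j
    by_cases h1 : j ∈ l
    · left; rw [h0 j h1]; simp [r, h1]
    · by_cases h2 : D.F (insert j l.toFinset)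
      · left
        have h3 : j ∉ l ∧ D.F (insert j l.toFinset) := ⟨h1, h2⟩
        by_cases h4 : (⟨j, h3⟩ : {i // i ∉ l ∧ D.F (insert i l.toFinset)}) ∈ A
        · have : (⟨j, h3⟩ : {i // i ∉ l ∧ D.F (insert i l.toFinset)}) ∉ Aᶜ := fun h => h h4
          simp only [r]; rw [dif_pos h3, if_pos h4, dif_pos h3, if_neg this, add_zero]
        · have : (⟨j, h3⟩ : {i // i ∉ l ∧ D.F (insert i l.toFinset)}) ∈ Aᶜ := h4
          simp only [r]; rw [dif_pos h3, if_neg h4, dif_pos h3, if_pos this, zero_add]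
      · right
        exact D.zero (j :: l) (by simp [hl, h1]) (by simpa using h2)
  have hrow : ∀ B : Set {i // i ∉ l ∧ D.F (insert i l.toFinset)}, B.Nonempty →
      0 < hess h' g (r B) h' := by
    intro B hB
    have e : hess h' g (r B) h' =
        ∑ i, r B i * (((n - l.length - 1 : ℕ) : ℝ) * eval h' (pderiv i g)) := by
      rw [hess_apply, eval_dd]
      refine Finset.sum_congr rfl fun i _ => ?_
      rw [← dd_pderiv, eval_dd_self hgh.pderiv]
    have hpd : ∀ i, i ∉ l ∧ D.F (insert i l.toFinset) → 0 < eval h' (pderiv i g) := by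
      intro i hi
      have h1 := D.eval_pd_pos (l := i :: l) (by simp [hl, hi.1]) (by simpa using hi.2)
        (by simp; omega) hh
      rw [pd_cons, ← hy, eval_add_of_dd_eq_zero] at h1
      · exact h1
      · rw [dd_pderiv, hgT, map_zero]
    rw [e]
    obtain ⟨i0, hi0⟩ := hB
    have hr0 : r B i0.1 = h' i0.1 := by
      simp only [r]; rw [dif_pos i0.2, if_pos hi0]
    refine Finset.sum_pos' (fun i _ => ?_) ⟨i0.1, Finset.mem_univ _, ?_⟩
    · by_cases hi : r B i = 0
      · simp [hi]
      · obtain ⟨hi1, -, hi3⟩ := rmem _ _ hi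
        rw [hi3]
        exact (mul_pos (hpos i hi1.1) (mul_pos hd (hpd i hi1))).le
    · rw [hr0]
      exact mul_pos (hpos _ i0.2.1) (mul_pos hd (hpd _ i0.2))
  have hsplit : ∀ z, hess h' g z h' = hess h' g z (r A) + hess h' g z (r Aᶜ) := by
    intro z
    rw [← map_add, hess_eq_sum, hess_eq_sum]
    refine Finset.sum_congr rfl fun i _ => Finset.sum_congr rfl fun j _ => ?_
    rcases hsum j with h | h
    · rw [Pi.add_apply, h]
    · rw [h]; simp
  have haa := hrow A hA
  have hbb := hrow Aᶜ hA'
  rw [hsplit, hab, add_zero] at haa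
  rw [hsplit, hess_comm _ _ (r Aᶜ) (r A), hab, zero_add] at hbb
  have := D.logc l hl hF (by omega) h hh (r A) (r Aᶜ)
  simp only [← hess_apply, ← hg, hhg] at this
  have := this hbb
  rw [hab] at this
  nlinarith [mul_pos haa hbb]

theorem hess_lorentzian (k : ℕ) : ∀ l : List ι, l.Nodup → D.F l.toFinset →
    l.length + k + 3 = n → ∀ h ∈ D.cone, ∀ c ∈ D.cone, ∀ x y,
    0 < hess h (dd c (pd l D.p)) y y →
    hess h (dd c (pd l D.p)) x x * hess h (dd c (pd l D.p)) y y ≤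
      hess h (dd c (pd l D.p)) x y ^ 2 := by
  classical
  induction k with
  | zero =>
    intro l hl hF hn h hh c hc x y hy
    have h3 : (pd l D.p).IsHomogeneous 3 := by
      have := isHomogeneous_pd D.homog l
      rwa [show n - l.length = 3 by omega] at this
    have key : ∀ u w, hess h (dd c (pd l D.p)) u w = eval c (dd u (dd w (pd l D.p))) := by
      intro u w
      have h1 : (dd u (dd w (pd l D.p))).IsHomogeneous 1 :=
        isHomogeneous_dd (isHomogeneous_dd h3 w) u
      rw [hess_apply, dd_comm w c, dd_comm u c,
        eval_eq_of_isHomogeneous_zero (isHomogeneous_dd h1 c) h c, eval_dd_self h1]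
      simp
    simp only [key] at hy ⊢
    exact D.logc l hl hF (by omega) c hc x y hy
  | succ k ih =>
    intro l hl hF hn h hh c hc x y hy
    set f := dd c (pd l D.p) with hf
    obtain ⟨y0, hy0, hy0'⟩ := D.relint l hF h hh
    set h' := h - D.T y0 with hh'
    have hadd : h' + D.T y0 = h := by simp [hh']
    have hT : ∀ z, dd (D.T z) f = 0 := fun z => by rw [hf, dd_comm, D.dd_T_pd, map_zero]
    have hhess : hess h f = hess h' f := by rw [← hadd, hess_translate (hT y0)]
    have h0 : ∀ j ∈ l, h' j = 0 := fun j hj => by simp [hh', hy0 j hj]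
    have hpos : ∀ j ∉ l, 0 < h' j := fun j hj => by simpa [hh'] using hy0' j hj
    have hev : ∀ l' : List ι, eval h' (dd c (pd l' D.p)) = eval h (dd c (pd l' D.p)) := fun l' => by
      rw [← hadd, eval_add_of_dd_eq_zero]
      rw [dd_comm, D.dd_T_pd, map_zero]
    have hpf : ∀ i, pderiv i f = dd c (pd (i :: l) D.p) := fun i => by rw [hf, ← dd_pderiv]; rfl
    have hppf : ∀ i j, pderiv i (pderiv j f) = dd c (pd (i :: j :: l) D.p) := fun i j => by
      rw [hpf, ← dd_pderiv]; rfl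
    have hfd : f.IsHomogeneous (k + 3) := by
      have := isHomogeneous_dd (isHomogeneous_pd D.homog l) c
      rwa [show n - l.length - 1 = k + 3 by omega] at this
    have h0' : ∀ i, ¬ (i ∉ l ∧ D.F (insert i l.toFinset)) → i ∈ l ∨ pderiv i f = 0 := by
      intro i hi
      by_cases h1 : i ∈ l
      · exact Or.inl h1
      · right
        rw [hpf, D.zero (i :: l) (by simp [hl, h1]), map_zero]
        intro h2
        exact hi ⟨h1, by simpa using h2⟩
    have hoff : ∀ i j, i ≠ j → i ∉ l → j ∉ l →
        D.F (i :: j :: l).toFinset → 0 < eval h' (pderiv i (pderiv j f)) := by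
      intro i j hij hi hj hFij
      rw [hppf, hev]
      exact D.pos _ (by simp [hl, hij, hi, hj]) hFij (by simp; omega) h hh c hc
    refine reverse_cauchySchwarz (hess h f) (hess_comm h f) h' (fun w hw => ?_) x y hy
    obtain ⟨z, hz⟩ := D.lift l hF w
    rw [hhess] at hw ⊢
    have e1 : hess h' f w w = hess h' f (w - D.T z) (w - D.T z) := by
      rw [hess_sub_left (hT z), hess_comm h' f w (w - D.T z), hess_sub_left (hT z)]
    rw [e1]
    refine hess_nonpos_of_link f (by omega : 3 ≤ k + 3) hfd
      (fun i => i ∉ l ∧ D.F (insert i l.toFinset)) h' (fun i hi => hpos i hi.1) ?_ ?_ ?_ ?_ ?_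
      (w - D.T z) ?_ ?_
    · intro i hi
      rw [hpf, hev]
      exact D.pos _ (by simp [hl, hi.1]) (by simpa using hi.2) (by simp; omega) h hh c hc
    · intro i hi
      exact (h0' i hi).imp_left (h0 i)
    · intro i j hij hi hj
      by_cases hFij : D.F (i :: j :: l).toFinset
      · exact (hoff i j hij hi.1 hj.1 hFij).le
      · rw [hppf, D.zero _ (by simp [hl, hij, hi.1, hj.1]) hFij]; simp
    · intro A hA hA'
      obtain ⟨i, hi, j, hj, hij⟩ := D.exists_adj hl hF (by omega) hh hadd h0 hpos A hA hA'
      exact ⟨i, hi, j, hj, hoff _ _ (fun e => hj (by rwa [← Subtype.ext e])) i.2.1 j.2.1 hij⟩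
    · intro i hi u v hv
      rw [hpf] at hv ⊢
      have e : hess h' (dd c (pd (i :: l) D.p)) = hess h (dd c (pd (i :: l) D.p)) := by
        rw [← hadd, hess_translate]
        rw [dd_comm, D.dd_T_pd, map_zero]
      rw [e] at hv ⊢
      exact ih (i :: l) (by simp [hl, hi.1]) (by simpa using hi.2) (by simp; omega) h hh c hc u v hv
    · intro i hi
      refine (h0' i hi).imp_left fun h1 => ?_
      simp [hz i h1]
    · rw [hess_sub_left (hT z)]; exact hw

end ChamberData

theorem eval_smul_of_isHomogeneous {ι : Type*} [Fintype ι] {m : ℕ} {q : MvPolynomial ι ℝ}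
    (hq : q.IsHomogeneous m) (t : ℝ) (h : ι → ℝ) : eval (t • h) q = t ^ m * eval h q := by
  rw [eval_eq, eval_eq, Finset.mul_sum]
  refine Finset.sum_congr rfl fun d hd => ?_
  have hdeg : ∑ i ∈ d.support, d i = m := by
    have := hq (mem_support_iff.1 hd)
    simpa [Finsupp.weight_apply, Finsupp.sum] using this
  simp only [Pi.smul_apply, smul_eq_mul, mul_pow, Finset.prod_mul_distrib]
  rw [Finset.prod_pow_eq_pow_sum, hdeg]; ring

namespace ChamberData
variable {n : ℕ} {ι E : Type*} [Fintype ι] [DecidableEq ι] [AddCommGroup E] [Module ℝ E]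
  (D : ChamberData n ι E)

theorem second_deriv_le (hn : 2 ≤ n) (hF : D.F ∅) {h c : ι → ℝ} (hh : h ∈ D.cone)
    (hc : c ∈ D.cone) (x : ι → ℝ) :
    eval h (dd c D.p) * eval h (dd x (dd x (dd c D.p))) ≤
      (1 - 1 / ((n : ℝ) - 1)) * eval h (dd x (dd c D.p)) ^ 2 := by
  set f := dd c D.p with hf
  have hf1 : f.IsHomogeneous (n - 1) := isHomogeneous_dd D.homog c
  have hfpos : 0 < eval h f := D.pos [] (by simp) (by simpa using hF) (by simp; omega) h hh c hc
  rcases hn.eq_or_lt with rfl | hn3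
  · have h0 : (dd x (dd x f)) = 0 := by
      have h1 : (dd x f).IsHomogeneous 0 := isHomogeneous_dd hf1 x
      rw [(totalDegree_eq_zero_iff_eq_C).1 ((totalDegree_zero_iff_isHomogeneous _).2 h1)]
      simp [dd_apply]
    rw [h0]; norm_num
  · have c1 : ((n - 1 : ℕ) : ℝ) = n - 1 := by rw [Nat.cast_sub (by omega)]; simp
    have c2 : ((n - 1 - 1 : ℕ) : ℝ) = n - 2 := by
      rw [Nat.sub_sub, Nat.cast_sub (by omega)]; norm_num
    have hn' : (2 : ℝ) < n := by exact_mod_cast hn3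
    have hhh : eval h (dd h (dd h f)) = (n - 1) * (n - 2) * eval h f := by
      rw [eval_dd_self (isHomogeneous_dd hf1 h), eval_dd_self hf1, c1, c2]; ring
    have hxh : eval h (dd x (dd h f)) = (n - 2) * eval h (dd x f) := by
      rw [dd_comm, eval_dd_self (isHomogeneous_dd hf1 x), c2]
    have key := D.hess_lorentzian (n - 3) [] (by simp) (by simpa using hF) (by simp; omega) h hh
      c hc x h
    change 0 < eval h (dd h (dd h f)) → eval h (dd x (dd x f)) * eval h (dd h (dd h f)) ≤
      eval h (dd x (dd h f)) ^ 2 at key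
    rw [hhh, hxh] at key
    have key := key (mul_pos (mul_pos (by linarith) (by linarith)) hfpos)
    have h2 : (0 : ℝ) < n - 2 := by linarith
    have h1 : (0 : ℝ) < n - 1 := by linarith
    have e : (1 - 1 / ((n : ℝ) - 1)) * eval h (dd x f) ^ 2 =
        ((n - 2) * eval h (dd x f) ^ 2) / (n - 1) := by field_simp; ring
    rw [e, le_div_iff₀ h1]
    refine le_of_mul_le_mul_left ?_ h2
    linarith

theorem rpow_add_le (hn : 2 ≤ n) (hF : D.F ∅) (hconv : Convex ℝ D.cone) {c h h' : ι → ℝ}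
    (hc : c ∈ D.cone) (hh : h ∈ D.cone) (hh' : h' ∈ D.cone) :
    eval h (dd c D.p) ^ (1 / ((n : ℝ) - 1)) + eval h' (dd c D.p) ^ (1 / ((n : ℝ) - 1)) ≤
      eval (h + h') (dd c D.p) ^ (1 / ((n : ℝ) - 1)) := by
  set f := dd c D.p with hf
  have hn' : (2 : ℝ) ≤ n := by exact_mod_cast hn
  set a : ℝ := 1 / ((n : ℝ) - 1) with ha
  have hf1 : f.IsHomogeneous (n - 1) := isHomogeneous_dd D.homog c
  have hfpos : ∀ h ∈ D.cone, 0 < eval h f := fun h hh =>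
    D.pos [] (by simp) (by simpa using hF) (by simp; omega) h hh c hc
  set x := h' - h
  have hmem : ∀ s ∈ Icc (0 : ℝ) 1, h + s • x ∈ D.cone := fun s hs =>
    hconv.add_smul_sub_mem hh hh' hs
  have hd1 : ∀ s ∈ Icc (0 : ℝ) 1, HasDerivAt (fun s : ℝ => eval (h + s • x) f ^ a)
      (eval (h + s • x) (dd x f) * a * eval (h + s • x) f ^ (a - 1)) s := fun s hs =>
    (hasDerivAt_eval h x f s).rpow_const (Or.inl (hfpos _ (hmem s hs)).ne')
  have hd2 : ∀ s ∈ Icc (0 : ℝ) 1, HasDerivAt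
      (fun s : ℝ => eval (h + s • x) (dd x f) * a * eval (h + s • x) f ^ (a - 1))
      (eval (h + s • x) (dd x (dd x f)) * a * eval (h + s • x) f ^ (a - 1) +
        eval (h + s • x) (dd x f) * a *
          (eval (h + s • x) (dd x f) * (a - 1) * eval (h + s • x) f ^ (a - 1 - 1))) s :=
    fun s hs => ((hasDerivAt_eval h x (dd x f) s).mul_const a).mul
      ((hasDerivAt_eval h x f s).rpow_const (Or.inl (hfpos _ (hmem s hs)).ne'))
  have hsub : interior (Icc (0 : ℝ) 1) ⊆ Icc (0 : ℝ) 1 := interior_subset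
  have hconc := concaveOn_of_hasDerivWithinAt2_nonpos (convex_Icc (0 : ℝ) 1)
    (fun s hs => (hd1 s hs).continuousAt.continuousWithinAt)
    (fun s hs => (hd1 s (hsub hs)).hasDerivWithinAt)
    (fun s hs => (hd2 s (hsub hs)).hasDerivWithinAt) (fun s hs => ?_)
  · have h2 := hconc.2 (left_mem_Icc.2 zero_le_one) (right_mem_Icc.2 zero_le_one)
      (by norm_num : (0 : ℝ) ≤ 1 / 2) (by norm_num : (0 : ℝ) ≤ 1 / 2) (by norm_num)
    have e1 : h + (1 : ℝ) • x = h' := by simp [x]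
    have e2 : h + (1 / 2 : ℝ) • x = (1 / 2 : ℝ) • (h + h') := by
      simp only [x, smul_sub, smul_add]
      ext i; simp; ring
    simp only [zero_smul, add_zero, smul_eq_mul, mul_zero, mul_one, zero_add] at h2
    rw [e1, e2, eval_smul_of_isHomogeneous hf1, Real.mul_rpow (by positivity), ← Real.rpow_natCast,
      ← Real.rpow_mul (by norm_num), Nat.cast_sub (by omega : 1 ≤ n), Nat.cast_one, ha,
      mul_one_div_cancel (by linarith), Real.rpow_one] at h2
    · linarith
    · have := hfpos _ (hmem (1 / 2) (by constructor <;> norm_num))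
      rw [e2, eval_smul_of_isHomogeneous hf1] at this
      exact (pos_of_mul_pos_right this (by positivity)).le
  · have hs' := hmem s (hsub hs)
    have hp := hfpos _ hs'
    have key := D.second_deriv_le hn hF hs' hc x
    rw [← hf, ← ha] at key
    set g := eval (h + s • x) f
    have e : g ^ (a - 1) = g ^ (a - 1 - 1) * g := by
      rw [← Real.rpow_add_one hp.ne']; congr 1; ring
    rw [e]
    have ha0 : 0 < a := by rw [ha]; exact one_div_pos.2 (by linarith)
    have hg2 : 0 < g ^ (a - 1 - 1) := Real.rpow_pos_of_pos hp _
    have : a * g ^ (a - 1 - 1) * (g * eval (h + s • x) (dd x (dd x f)) -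
        (1 - a) * eval (h + s • x) (dd x f) ^ 2) ≤ 0 :=
      mul_nonpos_of_nonneg_of_nonpos (by positivity) (by linarith)
    linarith

end ChamberData

section Vertices
variable {n : ℕ} {ι : Type*} (ν : ι → EuclideanSpace ℝ (Fin n))

local notation "⟪" left "," right "⟫" => inner ℝ left right

theorem exists_dual {e : Fin n → ι} (he : LinearIndependent ℝ (ν ∘ e)) :
    ∃ y : Fin n → EuclideanSpace ℝ (Fin n), ∀ k l, ⟪ν (e l), y k⟫ = if l = k then 1 else 0 := by
  let A : EuclideanSpace ℝ (Fin n) →ₗ[ℝ] (Fin n → ℝ) :=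
    LinearMap.pi fun k => (innerₛₗ ℝ (ν (e k)))
  have hspan : Submodule.span ℝ (range (ν ∘ e)) = ⊤ :=
    he.span_eq_top_of_card_eq_finrank' (by simp)
  have hA : Function.Injective A := by
    rw [← LinearMap.ker_eq_bot, LinearMap.ker_eq_bot']
    intro x hx
    have h1 : ∀ z ∈ Submodule.span ℝ (range (ν ∘ e)), ⟪z, x⟫ = 0 := by
      intro z hz
      induction hz using Submodule.span_induction with
      | mem z hz => obtain ⟨k, rfl⟩ := hz; exact congrFun hx k
      | zero => simp
      | add a b _ _ ha hb => rw [inner_add_left, ha, hb, add_zero]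
      | smul c a _ ha => rw [inner_smul_left, ha, mul_zero]
    exact inner_self_eq_zero.1 (h1 x (by rw [hspan]; trivial))
  have hs : Function.Surjective A :=
    (LinearMap.injective_iff_surjective_of_finrank_eq_finrank (by simp)).1 hA
  choose y hy using fun k => hs (Pi.single k 1)
  refine ⟨y, fun k l => ?_⟩
  have := congrFun (hy k) l
  simpa [A, Pi.single_apply] using this

open Classical in
/-- The basis dual to `ν ∘ e`. -/
def dualVec (e : Fin n → ι) : Fin n → EuclideanSpace ℝ (Fin n) :=
  if he : LinearIndependent ℝ (ν ∘ e) then (exists_dual ν he).choose else 0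

/-- The solution of the equations `⟪ν (e k), x⟫ = h (e k)`. -/
def vert (e : Fin n → ι) : (ι → ℝ) →ₗ[ℝ] EuclideanSpace ℝ (Fin n) :=
  ∑ k, (LinearMap.proj (e k)).smulRight (dualVec ν e k)

variable {ν} {e : Fin n → ι}

theorem inner_dualVec (he : LinearIndependent ℝ (ν ∘ e))
    (k l : Fin n) : ⟪ν (e l), dualVec ν e k⟫ = if l = k then 1 else 0 := by
  rw [dualVec, dif_pos he]; exact (exists_dual ν he).choose_spec k l

theorem inner_vert (he : LinearIndependent ℝ (ν ∘ e))
    (h : ι → ℝ) (k : Fin n) : ⟪ν (e k), vert ν e h⟫ = h (e k) := by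
  simp [vert, inner_sum, inner_smul_right, inner_dualVec he]

theorem eq_of_inner_eq (he : LinearIndependent ℝ (ν ∘ e))
    {x y : EuclideanSpace ℝ (Fin n)}
    (h : ∀ k, ⟪ν (e k), x⟫ = ⟪ν (e k), y⟫) : x = y := by
  have hspan : Submodule.span ℝ (range (ν ∘ e)) = ⊤ :=
    he.span_eq_top_of_card_eq_finrank' (by simp)
  have h1 : ∀ z ∈ Submodule.span ℝ (range (ν ∘ e)), ⟪z, x - y⟫ = 0 := by
    intro z hz
    induction hz using Submodule.span_induction with
    | mem z hz => obtain ⟨k, rfl⟩ := hz; simp [inner_sub_right, h k]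
    | zero => simp
    | add a b _ _ ha hb => rw [inner_add_left, ha, hb, add_zero]
    | smul c a _ ha => rw [inner_smul_left, ha, mul_zero]
  exact sub_eq_zero.1 (inner_self_eq_zero.1 (h1 (x - y) (by rw [hspan]; trivial)))

theorem eq_vert (he : LinearIndependent ℝ (ν ∘ e))
    {h : ι → ℝ} {x : EuclideanSpace ℝ (Fin n)} (hx : ∀ k, ⟪ν (e k), x⟫ = h (e k)) :
    x = vert ν e h := eq_of_inner_eq he fun k => by rw [hx, inner_vert he]

theorem eq_sum_dualVec (he : LinearIndependent ℝ (ν ∘ e))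
    (u : EuclideanSpace ℝ (Fin n)) : u = ∑ k, ⟪u, dualVec ν e k⟫ • ν (e k) := by
  have hspan : Submodule.span ℝ (range (ν ∘ e)) = ⊤ :=
    he.span_eq_top_of_card_eq_finrank' (by simp)
  have hu : u ∈ Submodule.span ℝ (range (ν ∘ e)) := by rw [hspan]; trivial
  obtain ⟨c, hc⟩ := (Submodule.mem_span_range_iff_exists_fun ℝ).1 hu
  have : ∀ k, ⟪u, dualVec ν e k⟫ = c k := fun k => by
    rw [← hc, sum_inner]
    simp [inner_smul_left, inner_dualVec he]
  simp only [this]; exact hc.symm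

end Vertices

section Chamber
variable {n : ℕ} {ι : Type*} (ν : ι → EuclideanSpace ℝ (Fin n)) (h₀ : ι → ℝ)

local notation "⟪" left "," right "⟫" => inner ℝ left right

/-- The polyhedron with outer normals `ν i` at heights `h i`. -/
def poly (h : ι → ℝ) : Set (EuclideanSpace ℝ (Fin n)) := {x | ∀ i, ⟪ν i, x⟫ ≤ h i}

/-- Index sets of the vertices of a simple polytope. -/
def vertexSet : Set (Fin n → ι) :=
  {e | LinearIndependent ℝ (ν ∘ e) ∧ ∀ j ∉ range e, ⟪ν j, vert ν e h₀⟫ < h₀ j}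

/-- The type cone of a simple polytope. -/
def chamber : Set (ι → ℝ) :=
  {h | ∀ e ∈ vertexSet ν h₀, ∀ j ∉ range e, ⟪ν j, vert ν e h⟫ < h j}

/-- The index sets of the nonempty faces of a simple polytope. -/
def IsFace (J : Finset ι) : Prop := ∃ e ∈ vertexSet ν h₀, (J : Set ι) ⊆ range e

/-- The normals and heights of a simple polytope. -/
structure IsSimple : Prop where
  bdd : ∀ h, IsBounded (poly ν h)
  nonempty : (poly ν h₀).Nonempty
  generic : ∀ e : Fin n → ι, LinearIndependent ℝ (ν ∘ e) → ∀ j ∉ range e, ⟪ν j, vert ν e h₀⟫ ≠ h₀ j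

/-- Restrictions of linear functionals to the normals. -/
def evalMap : EuclideanSpace ℝ (Fin n) →ₗ[ℝ] (ι → ℝ) := LinearMap.pi fun i => innerₛₗ ℝ (ν i)

theorem evalMap_apply (y : EuclideanSpace ℝ (Fin n)) (i : ι) : evalMap ν y i = ⟪ν i, y⟫ := rfl

theorem isClosed_poly (h : ι → ℝ) : IsClosed (poly ν h) := by
  simp only [poly, ofPred_forall]
  exact isClosed_iInter fun i => isClosed_le (by fun_prop) continuous_const

theorem convex_poly (h : ι → ℝ) : Convex ℝ (poly ν h) := by
  intro x hx y hy a b ha hb hab i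
  rw [inner_add_right, inner_smul_right, inner_smul_right]
  have := add_le_add (mul_le_mul_of_nonneg_left (hx i) ha) (mul_le_mul_of_nonneg_left (hy i) hb)
  rwa [← add_mul, hab, one_mul] at this

variable {ν h₀}

theorem self_mem_chamber : h₀ ∈ chamber ν h₀ := fun _ he j hj => he.2 j hj

theorem vert_mem_poly {e : Fin n → ι} (he : e ∈ vertexSet ν h₀) {h : ι → ℝ}
    (hh : h ∈ chamber ν h₀) : vert ν e h ∈ poly ν h := by
  intro i
  by_cases hi : i ∈ range e
  · obtain ⟨k, rfl⟩ := hi; exact (inner_vert he.1 h k).le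
  · exact (hh e he i hi).le

theorem chamber_add {h h' : ι → ℝ} (hh : h ∈ chamber ν h₀) (hh' : h' ∈ chamber ν h₀) :
    h + h' ∈ chamber ν h₀ := by
  intro e he j hj
  rw [map_add, inner_add_right]
  exact add_lt_add (hh e he j hj) (hh' e he j hj)

theorem chamber_smul {h : ι → ℝ} (hh : h ∈ chamber ν h₀) {t : ℝ} (ht : 0 < t) :
    t • h ∈ chamber ν h₀ := by
  intro e he j hj
  rw [map_smul, inner_smul_right]
  exact mul_lt_mul_of_pos_left (hh e he j hj) ht

theorem convex_chamber : Convex ℝ (chamber ν h₀) := by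
  intro x hx y hy a b ha hb hab
  rcases ha.eq_or_lt with rfl | ha
  · rw [zero_add] at hab; simpa [hab] using hy
  rcases hb.eq_or_lt with rfl | hb
  · rw [add_zero] at hab; simpa [hab] using hx
  exact chamber_add (chamber_smul hx ha) (chamber_smul hy hb)

theorem vert_evalMap {e : Fin n → ι} (he : LinearIndependent ℝ (ν ∘ e))
    (y : EuclideanSpace ℝ (Fin n)) : vert ν e (evalMap ν y) = y :=
  (eq_vert he fun _ => rfl).symm

theorem chamber_add_evalMap {h : ι → ℝ} (hh : h ∈ chamber ν h₀) (y : EuclideanSpace ℝ (Fin n)) :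
    h + evalMap ν y ∈ chamber ν h₀ := by
  intro e he j hj
  rw [map_add, inner_add_right, vert_evalMap he.1]
  exact add_lt_add_left (hh e he j hj) _

theorem isOpen_chamber [Finite ι] : IsOpen (chamber ν h₀) := by
  have : Fintype ι := Fintype.ofFinite ι
  have : chamber ν h₀ = ⋂ e : Fin n → ι, ⋂ j : ι,
      {h | e ∈ vertexSet ν h₀ → j ∉ range e → ⟪ν j, vert ν e h⟫ < h j} := by
    ext h; simp only [chamber, mem_iInter, mem_ofPred_eq]; tauto
  rw [this]
  refine isOpen_iInter_of_finite fun e => isOpen_iInter_of_finite fun j => ?_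
  by_cases h1 : e ∈ vertexSet ν h₀
  · by_cases h2 : j ∈ range e
    · simp [h2]
    · simp only [h1, h2, not_false_eq_true, true_imp_iff]
      have hv : Continuous (vert ν e) := LinearMap.continuous_of_finiteDimensional _
      exact isOpen_lt (by fun_prop) (continuous_apply j)
  · simp [h1]

/-- The normal cones of the vertices cover the space. -/
theorem IsSimple.exists_cone [Finite ι] (hs : IsSimple ν h₀) (u : EuclideanSpace ℝ (Fin n)) :
    ∃ e ∈ vertexSet ν h₀, ∀ k, 0 ≤ ⟪u, dualVec ν e k⟫ := by
  have : Fintype ι := Fintype.ofFinite ι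
  have hcpt : IsCompact (poly ν h₀) :=
    isCompact_of_isClosed_isBounded (isClosed_poly ν h₀) (hs.bdd h₀)
  obtain ⟨x₀, hx₀, hmax⟩ := hcpt.exists_isMaxOn hs.nonempty
    (f := fun x => ⟪u, x⟫) (by fun_prop)
  set G := {x ∈ poly ν h₀ | ⟪u, x⟫ = ⟪u, x₀⟫} with hG
  have hGc : IsCompact G := hcpt.inter_right (isClosed_eq (by fun_prop) continuous_const)
  obtain ⟨z, hz⟩ := hGc.extremePoints_nonempty ⟨x₀, hx₀, rfl⟩
  have hzP : z ∈ poly ν h₀ := hz.1.1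
  have hzu : ⟪u, z⟫ = ⟪u, x₀⟫ := hz.1.2
  -- small perturbations tangent to the active constraints stay in the polytope
  have hpert : ∀ w : EuclideanSpace ℝ (Fin n), (∀ i, ⟪ν i, z⟫ = h₀ i → ⟪ν i, w⟫ ≤ 0) →
      ∃ t : ℝ, 0 < t ∧ z + t • w ∈ poly ν h₀ := by
    intro w hw
    have h1 : ∀ i, ∀ᶠ t in nhdsWithin (0 : ℝ) (Ioi 0), ⟪ν i, z + t • w⟫ ≤ h₀ i := by
      intro i
      rcases (hzP i).eq_or_lt with h | h
      · filter_upwards [self_mem_nhdsWithin] with t ht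
        rw [inner_add_right, inner_smul_right, h]
        have := mul_nonpos_of_nonneg_of_nonpos (le_of_lt ht) (hw i h)
        linarith
      · have hc : ContinuousAt (fun t : ℝ => ⟪ν i, z + t • w⟫) 0 := by fun_prop
        have := hc.tendsto.eventually_lt_const (by simpa using h)
        exact (this.filter_mono nhdsWithin_le_nhds).mono fun t ht => ht.le
    have h2 := (Filter.eventually_all.2 h1).and self_mem_nhdsWithin
    obtain ⟨t, ht, ht0⟩ := h2.exists
    exact ⟨t, ht0, ht⟩
  set A : Set (EuclideanSpace ℝ (Fin n)) := ν '' {i | ⟪ν i, z⟫ = h₀ i} with hA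
  have hspan : Submodule.span ℝ A = ⊤ := by
    by_contra hne
    obtain ⟨w, hw0, hw⟩ : ∃ w : EuclideanSpace ℝ (Fin n), w ≠ 0 ∧ ∀ a ∈ Submodule.span ℝ A, ⟪a, w⟫ = 0 := by
      have : (Submodule.span ℝ A)ᗮ ≠ ⊥ := fun h => hne (Submodule.orthogonal_eq_bot_iff.1 h)
      obtain ⟨w, hw, hw0⟩ := Submodule.exists_mem_ne_zero_of_ne_bot this
      exact ⟨w, hw0, fun a ha => hw a ha⟩
    have hwi : ∀ i, ⟪ν i, z⟫ = h₀ i → ⟪ν i, w⟫ = 0 := fun i hi =>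
      hw _ (Submodule.subset_span ⟨i, hi, rfl⟩)
    obtain ⟨t, ht, hzt⟩ := hpert w fun i hi => (hwi i hi).le
    obtain ⟨s, hs', hzs⟩ := hpert (-w) fun i hi => by simp [hwi i hi]
    have hm1 : ⟪u, z + t • w⟫ ≤ ⟪u, x₀⟫ := hmax hzt
    have hm2 : ⟪u, z + s • (-w)⟫ ≤ ⟪u, x₀⟫ := hmax hzs
    rw [inner_add_right, inner_smul_right, hzu] at hm1
    rw [inner_add_right, inner_smul_right, hzu, inner_neg_right] at hm2
    have huw : ⟪u, w⟫ = 0 := by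
      apply le_antisymm
      · by_contra! h; nlinarith
      · by_contra! h; nlinarith
    have g1 : z + t • w ∈ G := ⟨hzt, by rw [inner_add_right, inner_smul_right, huw, hzu]; ring⟩
    have g2 : z + s • (-w) ∈ G := ⟨hzs, by
      rw [inner_add_right, inner_smul_right, inner_neg_right, huw, hzu]; ring⟩
    have hseg : z ∈ openSegment ℝ (z + t • w) (z + s • (-w)) := by
      refine ⟨s / (s + t), t / (s + t), by positivity, by positivity, by field_simp, ?_⟩
      have hst : s + t ≠ 0 := by positivity
      have e1 : s / (s + t) + t / (s + t) = 1 := by field_simp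
      have e2 : s / (s + t) * t - t / (s + t) * s = 0 := by field_simp; ring
      calc (s / (s + t)) • (z + t • w) + (t / (s + t)) • (z + s • (-w))
          = (s / (s + t) + t / (s + t)) • z + (s / (s + t) * t - t / (s + t) * s) • w := by module
        _ = z := by rw [e1, e2]; simp
    have h3 := hz.2 g1 g2 hseg
    have : t • w = 0 := by simpa using h3
    exact hw0 ((smul_eq_zero.1 this).resolve_left ht.ne')
  obtain ⟨f, hfA, -, hfi⟩ := Submodule.exists_fun_fin_finrank_span_eq ℝ A
  have hfr : Module.finrank ℝ (Submodule.span ℝ A) = n := by rw [hspan]; simp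
  choose g hg hgf using hfA
  obtain ⟨e, he, hact⟩ : ∃ e : Fin n → ι, LinearIndependent ℝ (ν ∘ e) ∧
      ∀ k, ⟪ν (e k), z⟫ = h₀ (e k) := by
    refine ⟨g ∘ Fin.cast hfr.symm, ?_, fun k => hg _⟩
    have : ν ∘ (g ∘ Fin.cast hfr.symm) = f ∘ Fin.cast hfr.symm := by
      ext1 k; exact hgf _
    rw [this]
    exact hfi.comp _ (Fin.cast_injective _)
  have hzv : z = vert ν e h₀ := eq_vert he hact
  have hev : e ∈ vertexSet ν h₀ := ⟨he, fun j hj =>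
    lt_of_le_of_ne (by rw [← hzv]; exact hzP j) (hs.generic e he j hj)⟩
  refine ⟨e, hev, fun k => ?_⟩
  obtain ⟨t, ht, hzt⟩ := hpert (-dualVec ν e k) fun i hi => by
    by_cases hi' : i ∈ range e
    · obtain ⟨l, rfl⟩ := hi'
      rw [inner_neg_right, inner_dualVec he]
      split_ifs <;> norm_num
    · exact absurd (hzv ▸ hi) (hev.2 i hi').ne
  have hm : ⟪u, z + t • (-dualVec ν e k)⟫ ≤ ⟪u, x₀⟫ := hmax hzt
  rw [inner_add_right, inner_smul_right, hzu, inner_neg_right] at hm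
  by_contra! h
  nlinarith

/-- The index set of active constraints at a point of a polytope of the type cone is a face. -/
theorem IsSimple.isFace_of_active [Finite ι] (hs : IsSimple ν h₀) {h : ι → ℝ}
    (hh : h ∈ chamber ν h₀) {x : EuclideanSpace ℝ (Fin n)} (hx : x ∈ poly ν h) {J : Finset ι}
    (hJ : ∀ j ∈ J, ⟪ν j, x⟫ = h j) : IsFace ν h₀ J := by
  obtain ⟨e, he, hk⟩ := hs.exists_cone (∑ j ∈ J, ν j)
  refine ⟨e, he, ?_⟩
  by_contra hsub
  obtain ⟨j, hj, hje⟩ := Set.not_subset.1 hsub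
  have h1 : ∑ j ∈ J, h j = ∑ k, ⟪∑ j ∈ J, ν j, dualVec ν e k⟫ * ⟪ν (e k), x⟫ := by
    rw [← Finset.sum_congr rfl hJ, ← sum_inner]
    conv_lhs => rw [eq_sum_dualVec he.1 (∑ j ∈ J, ν j)]
    rw [sum_inner]; simp [inner_smul_left]
  have h2 : ∑ j ∈ J, ⟪ν j, vert ν e h⟫ = ∑ k, ⟪∑ j ∈ J, ν j, dualVec ν e k⟫ * h (e k) := by
    rw [← sum_inner]
    conv_lhs => rw [eq_sum_dualVec he.1 (∑ j ∈ J, ν j)]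
    rw [sum_inner]; simp [inner_smul_left, inner_vert he.1]
  have h3 : ∑ j ∈ J, ⟪ν j, vert ν e h⟫ < ∑ j ∈ J, h j :=
    Finset.sum_lt_sum (fun i _ => vert_mem_poly he hh i) ⟨j, hj, hh e he j hje⟩
  rw [h1, h2] at h3
  exact absurd h3 (not_lt.2 (Finset.sum_le_sum fun k _ =>
    mul_le_mul_of_nonneg_left (hx _) (hk k)))

theorem IsFace.mono {J J' : Finset ι} (h : IsFace ν h₀ J) (hJ : J' ⊆ J) : IsFace ν h₀ J' := by
  obtain ⟨e, he, hJe⟩ := h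
  exact ⟨e, he, (Finset.coe_subset.2 hJ).trans hJe⟩

/-- A point in the relative interior of a face. -/
theorem IsFace.exists_relint [Finite ι] {J : Finset ι} (hJ : IsFace ν h₀ J) {h : ι → ℝ}
    (hh : h ∈ chamber ν h₀) :
    ∃ y, (∀ j ∈ J, ⟪ν j, y⟫ = h j) ∧ ∀ j ∉ J, ⟪ν j, y⟫ < h j := by
  classical
  obtain ⟨e, he, hJe⟩ := hJ
  have hinj : Function.Injective e := fun a b hab => he.1.injective (by simp [hab])
  set w := ∑ k, (if e k ∈ J then (0 : ℝ) else 1) • dualVec ν e k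
  have hw : ∀ k, ⟪ν (e k), w⟫ = if e k ∈ J then 0 else 1 := fun k => by
    simp only [w, inner_sum, inner_smul_right, inner_dualVec he.1, mul_ite, mul_one, mul_zero]
    simp
  have h1 : ∀ i, ∀ᶠ t in nhdsWithin (0 : ℝ) (Ioi 0), i ∉ range e →
      ⟪ν i, vert ν e h - t • w⟫ < h i := by
    intro i
    by_cases hi : i ∈ range e
    · simp [hi]
    · have hc : ContinuousAt (fun t : ℝ => ⟪ν i, vert ν e h - t • w⟫) 0 := by fun_prop
      have := hc.tendsto.eventually_lt_const (by simpa using hh e he i hi)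
      exact (this.filter_mono nhdsWithin_le_nhds).mono fun t ht _ => ht
  obtain ⟨t, ht, ht0⟩ := ((Filter.eventually_all.2 h1).and self_mem_nhdsWithin).exists
  have ht0 : 0 < t := ht0
  refine ⟨vert ν e h - t • w, fun j hj => ?_, fun j hj => ?_⟩
  · obtain ⟨k, rfl⟩ := hJe hj
    rw [inner_sub_right, inner_smul_right, hw, inner_vert he.1, if_pos (by simpa using hj)]; ring
  · by_cases hje : j ∈ range e
    · obtain ⟨k, rfl⟩ := hje
      rw [inner_sub_right, inner_smul_right, hw, inner_vert he.1, if_neg hj]; linarith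
    · exact ht j hje

end Chamber

set_option maxHeartbeats 1000000 in
theorem hasDerivAt_sub_of_partial {ι : Type*} [Fintype ι] [DecidableEq ι] {U : Set (ι → ℝ)}
    (hU : IsOpen U) (f : (ι → ℝ) → ℝ) (g : (ι → ℝ) → ℝ) (i : ι) (hg : ContinuousOn g U)
    (hf : ∀ h ∈ U, HasDerivAt (fun s => f (Function.update h i s)) (g h) (h i))
    {h : ι → ℝ} (hh : h ∈ U) (y : ι → ℝ) (a : ℝ) :
    HasDerivAt (fun t : ℝ => f (h + t • y + Pi.single i (t * a)) - f (h + t • y))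
      (a * g h) 0 := by
  rw [hasDerivAt_iff_isLittleO]
  simp only [zero_smul, add_zero, zero_mul, Pi.single_zero, sub_self, sub_zero, smul_eq_mul]
  rw [Asymptotics.isLittleO_iff]
  intro ε hε
  obtain ⟨η, hη, hηε⟩ : ∃ η > 0, η * |a| ≤ ε :=
    ⟨ε / (|a| + 1), by positivity, by
      rw [div_mul_eq_mul_div, div_le_iff₀ (by positivity)]; nlinarith [abs_nonneg a]⟩
  have hc := hg.continuousAt (hU.mem_nhds hh)
  have hUn : ∀ᶠ z in nhds h, z ∈ U := hU.mem_nhds hh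
  obtain ⟨δ, hδ, hball⟩ := Metric.eventually_nhds_iff_ball.1
    (hUn.and (hc.eventually (ball_mem_nhds _ hη)))
  have hsmall : ∀ᶠ t in nhds (0 : ℝ), ‖t • y‖ + |t * a| < δ := by
    have : Continuous fun t : ℝ => ‖t • y‖ + |t * a| := by fun_prop
    exact this.continuousAt.eventually_lt_const (by simpa using hδ)
  filter_upwards [hsmall] with t ht
  set A := h + t • y with hA
  have hmem : ∀ s ∈ uIcc 0 (t * a), A + Pi.single i s ∈ ball h δ := by
    intro s hs
    rw [mem_ball_iff_norm, hA, add_assoc, add_sub_cancel_left]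
    have h1 : |s| ≤ |t * a| := by
      have := abs_sub_left_of_mem_uIcc hs; simpa using this
    have h2 : ‖(Pi.single i s : ι → ℝ)‖ = |s| := by
      rw [Pi.norm_single (ι := ι) (G := fun _ => ℝ) s]; rfl
    have h3 := norm_add_le (t • y) (Pi.single i s : ι → ℝ)
    linarith
  have hd : ∀ s ∈ uIcc 0 (t * a), HasDerivWithinAt
      (fun s => f (A + (Pi.single i s : ι → ℝ)) - s * g h) (g (A + Pi.single i s) - g h)
      (uIcc 0 (t * a)) s := by
    intro s hs
    have h1 := hf _ (hball _ (hmem s hs)).1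
    have h2 : HasDerivAt (fun s => f (A + Pi.single i s)) (g (A + Pi.single i s)) s := by
      have h3 : (fun s => f (A + Pi.single i s)) =
          (fun r => f (Function.update (A + Pi.single i s) i r)) ∘ (fun s => A i + s) := by
        ext r; simp only [Function.comp]; congr 1; ext j
        by_cases hj : j = i
        · subst hj; simp
        · simp [hj]
      rw [h3]
      have h4 : HasDerivAt (fun s : ℝ => A i + s) 1 s := (hasDerivAt_id s).const_add _
      have h5 : (A + Pi.single i s : ι → ℝ) i = A i + s := by simp
      rw [h5] at h1
      simpa using h1.comp s h4
    have h6 : HasDerivAt (fun s : ℝ => s * g h) (g h) s := by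
      simpa using (hasDerivAt_id s).mul_const (g h)
    exact (h2.sub h6).hasDerivWithinAt
  have hmv := (convex_uIcc (0 : ℝ) (t * a)).norm_image_sub_le_of_norm_hasDerivWithin_le
    (C := η) hd (fun s hs => (mem_ball_iff_norm.1 (hball _ (hmem s hs)).2).le)
    left_mem_uIcc right_mem_uIcc
  simp only [Pi.single_zero, add_zero, zero_mul, sub_zero] at hmv
  calc ‖f (A + Pi.single i (t * a)) - f A - t * (a * g h)‖
      = ‖f (A + Pi.single i (t * a)) - t * a * g h - f A‖ := by congr 1; ring
    _ ≤ η * ‖t * a‖ := hmv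
    _ = η * |a| * ‖t‖ := by rw [norm_mul, Real.norm_eq_abs a]; ring
    _ ≤ ε * ‖t‖ := by gcongr

theorem hasDerivAt_of_partial {ι : Type*} [Fintype ι] [DecidableEq ι] {U : Set (ι → ℝ)}
    (hU : IsOpen U) (f : (ι → ℝ) → ℝ) (g : ι → (ι → ℝ) → ℝ) (S : Finset ι)
    (hg : ∀ i ∈ S, ContinuousOn (g i) U)
    (hf : ∀ i ∈ S, ∀ h ∈ U, HasDerivAt (fun s => f (Function.update h i s)) (g i h) (h i))
    {h : ι → ℝ} (hh : h ∈ U) (x : ι → ℝ) :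
    HasDerivAt (fun t : ℝ => f (h + t • (fun i => if i ∈ S then x i else 0)))
      (∑ i ∈ S, x i * g i h) 0 := by
  induction S using Finset.induction_on with
  | empty =>
    have : (fun t : ℝ => f (h + t • (fun i => if i ∈ (∅ : Finset ι) then x i else 0))) =
        fun _ => f h := by
      ext t; congr 1; ext j; simp
    rw [this]; simpa using hasDerivAt_const (0 : ℝ) (f h)
  | insert i S hi ih =>
    specialize ih (fun j hj => hg j (Finset.mem_insert_of_mem hj))
      (fun j hj => hf j (Finset.mem_insert_of_mem hj))
    rw [Finset.sum_insert hi, add_comm]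
    set y : ι → ℝ := fun i => if i ∈ S then x i else 0 with hy
    have hins : ∀ t : ℝ, h + t • (fun j => if j ∈ insert i S then x j else 0) =
        h + t • y + Pi.single i (t * x i) := by
      intro t; ext j
      by_cases hj : j = i
      · subst hj; simp [hy, hi]
      · simp [hy, hj]
    simp only [hins]
    have hr := hasDerivAt_sub_of_partial hU f (g i) i (hg i (Finset.mem_insert_self i S))
      (hf i (Finset.mem_insert_self i S)) hh y (x i)
    exact (ih.add hr).congr_of_eventuallyEq (by filter_upwards with t; simp)

section Face
variable {n : ℕ} {ι : Type*} (ν : ι → EuclideanSpace ℝ (Fin n))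

local notation "⟪" left "," right "⟫" => inner ℝ left right

/-- A linear parametrization of the affine subspaces `⟪ν j, x⟫ = h j`, `j ∈ l`. -/
structure FaceData (l : List ι) (m : ℕ) where
  φ : EuclideanSpace ℝ (Fin m) →ₗ[ℝ] EuclideanSpace ℝ (Fin n)
  Z : (ι → ℝ) →ₗ[ℝ] EuclideanSpace ℝ (Fin n)
  inj : Function.Injective φ
  mem_range : ∀ y, (∀ j ∈ l, ⟪ν j, y⟫ = 0) ↔ ∃ t, φ t = y
  inner_Z : ∀ h, ∀ j ∈ l, ⟪ν j, Z h⟫ = h j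
  Z_congr : ∀ h h', (∀ j ∈ l, h j = h' j) → Z h = Z h'

variable {ν}
namespace FaceData

/-- The trivial parametrization of the whole space. -/
def nil : FaceData ν [] n where
  φ := LinearMap.id
  Z := 0
  inj := Function.injective_id
  mem_range := by simp
  inner_Z := by simp
  Z_congr := by simp

variable {l : List ι} {m : ℕ} (D : FaceData ν l m)

/-- The face in the parametrization. -/
def slice (h : ι → ℝ) : Set (EuclideanSpace ℝ (Fin m)) := {t | D.Z h + D.φ t ∈ poly ν h}

/-- The volume of the face in the parametrization. -/
def vol (h : ι → ℝ) : ℝ := volume.real (D.slice h)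

theorem inner_φ (t : EuclideanSpace ℝ (Fin m)) {j : ι} (hj : j ∈ l) : ⟪ν j, D.φ t⟫ = 0 :=
  (D.mem_range _).2 ⟨t, rfl⟩ j hj

theorem isClosed_slice (h : ι → ℝ) : IsClosed (D.slice h) := by
  have : Continuous D.φ := LinearMap.continuous_of_finiteDimensional _
  exact (isClosed_poly ν h).preimage (by fun_prop)

theorem isBounded_slice {h : ι → ℝ} (hb : IsBounded (poly ν h)) : IsBounded (D.slice h) := by
  obtain ⟨K, hK, hKa⟩ := D.φ.injective_iff_antilipschitz.1 D.inj
  have h1 : AntilipschitzWith K fun t => D.Z h + D.φ t := by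
    intro x y; simpa [edist_add_left] using hKa x y
  exact h1.isBounded_preimage hb

theorem volume_slice_ne_top {h : ι → ℝ} (hb : IsBounded (poly ν h)) :
    volume (D.slice h) ≠ ∞ := (D.isBounded_slice hb).measure_lt_top.ne

theorem slice_smul (h : ι → ℝ) {s : ℝ} (hs : 0 < s) : D.slice (s • h) = s • D.slice h := by
  ext t
  rw [Set.mem_smul_set_iff_inv_smul_mem₀ hs.ne']
  simp only [slice, mem_ofPred_eq, poly]
  refine forall_congr' fun i => ?_
  have : D.Z h + D.φ (s⁻¹ • t) = s⁻¹ • (D.Z (s • h) + D.φ t) := by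
    rw [map_smul, map_smul, smul_add, smul_smul, inv_mul_cancel₀ hs.ne', one_smul]
  rw [this, inner_smul_right, Pi.smul_apply, smul_eq_mul, inv_mul_le_iff₀ hs]

theorem vol_smul (h : ι → ℝ) {s : ℝ} (hs : 0 < s) : D.vol (s • h) = s ^ m * D.vol h := by
  rw [vol, slice_smul D h hs, Measure.real, Measure.addHaar_smul, ENNReal.toReal_mul,
    ENNReal.toReal_ofReal (abs_nonneg _), abs_of_pos (by positivity)]
  simp [vol, Measure.real]

theorem vol_add_evalMap (h : ι → ℝ) (y : EuclideanSpace ℝ (Fin n)) :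
    D.vol (h + evalMap ν y) = D.vol h := by
  obtain ⟨t₀, ht₀⟩ := (D.mem_range (D.Z (evalMap ν y) - y)).1 fun j hj => by
    rw [inner_sub_right, D.inner_Z _ j hj, evalMap_apply, sub_self]
  have : D.slice (h + evalMap ν y) = (fun t => t₀ + t) ⁻¹' D.slice h := by
    ext t
    simp only [slice, poly, mem_ofPred_eq, mem_preimage]
    refine forall_congr' fun i => ?_
    have : D.Z (h + evalMap ν y) + D.φ t = D.Z h + D.φ (t₀ + t) + y := by
      rw [map_add, map_add, ht₀]; abel
    rw [this, inner_add_right, Pi.add_apply, evalMap_apply, add_le_add_iff_right]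
  rw [vol, this, vol, Measure.real, measure_preimage_add, Measure.real]

end FaceData
end Face

section Face
variable {n : ℕ} {ι : Type*} {ν : ι → EuclideanSpace ℝ (Fin n)}

local notation "⟪" left "," right "⟫" => inner ℝ left right

theorem exists_volume_eq_prod {m : ℕ} (a : EuclideanSpace ℝ (Fin (m + 1)) →ₗ[ℝ] ℝ)
    {w : EuclideanSpace ℝ (Fin (m + 1))} (hw : a w = 1) :
    ∃ ψ : EuclideanSpace ℝ (Fin m) →ₗ[ℝ] EuclideanSpace ℝ (Fin (m + 1)),
      Isometry ψ ∧ (∀ x, a x = 0 ↔ ∃ t, ψ t = x) ∧ ∃ c : ℝ, 0 < c ∧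
      ∀ S : Set (EuclideanSpace ℝ (Fin (m + 1))), MeasurableSet S →
        volume S = ENNReal.ofReal c * ∫⁻ s : ℝ, volume {t | s • w + ψ t ∈ S} := by
  have hsurj : Function.Surjective a := fun r => ⟨r • w, by simp [hw]⟩
  have hfr : Module.finrank ℝ (LinearMap.ker a) = m := by
    have h1 := LinearMap.finrank_range_add_finrank_ker a
    rw [LinearMap.range_eq_top.2 hsurj] at h1
    simp at h1; omega
  let ψ₀ : EuclideanSpace ℝ (Fin m) ≃ₗᵢ[ℝ] LinearMap.ker a :=
    ((stdOrthonormalBasis ℝ (LinearMap.ker a)).reindex (finCongr hfr)).repr.symm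
  let ψ : EuclideanSpace ℝ (Fin m) →ₗ[ℝ] EuclideanSpace ℝ (Fin (m + 1)) :=
    (LinearMap.ker a).subtype ∘ₗ ψ₀.toLinearEquiv.toLinearMap
  have hψ : ∀ t, a (ψ t) = 0 := fun t => (ψ₀ t).2
  have hinj : Function.Injective ψ := (Submodule.subtype_injective _).comp ψ₀.injective
  have hiso : Isometry ψ := isometry_subtype_coe.comp ψ₀.isometry
  refine ⟨ψ, hiso, fun x => ⟨fun hx => ⟨ψ₀.symm ⟨x, hx⟩, by simp [ψ]⟩, ?_⟩, ?_⟩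
  · rintro ⟨t, rfl⟩; exact hψ t
  let L₀ : ℝ × EuclideanSpace ℝ (Fin m) →ₗ[ℝ] EuclideanSpace ℝ (Fin (m + 1)) :=
    LinearMap.coprod (LinearMap.toSpanSingleton ℝ _ w) ψ
  have hL₀ : ∀ x, L₀ x = x.1 • w + ψ x.2 := fun x => by simp [L₀]
  have hLi : Function.Injective L₀ := by
    rw [← LinearMap.ker_eq_bot, LinearMap.ker_eq_bot']
    rintro ⟨s, t⟩ h
    rw [hL₀] at h
    have h1 : s = 0 := by have := congrArg a h; simpa [hw, hψ] using this
    have h2 : ψ t = 0 := by simpa [h1] using h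
    rw [h1, hinj (h2.trans (map_zero ψ).symm)]; rfl
  let L := (LinearEquiv.ofInjectiveOfFinrankEq L₀ hLi (by simp [add_comm])).toContinuousLinearEquiv
  have hL : ∀ x, L x = x.1 • w + ψ x.2 := hL₀
  let P : Measure (ℝ × EuclideanSpace ℝ (Fin m)) := volume.prod volume
  have hP : (P.map L).IsAddHaarMeasure := L.isAddHaarMeasure_map P
  set c := Measure.addHaarScalarFactor (volume : Measure (EuclideanSpace ℝ (Fin (m + 1)))) (P.map L)
  have hvol : (volume : Measure (EuclideanSpace ℝ (Fin (m + 1)))) = c • P.map L :=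
    Measure.isAddLeftInvariant_eq_smul _ _
  have hc : 0 < c := Measure.addHaarScalarFactor_pos_of_isAddHaarMeasure _ _
  refine ⟨c, by exact_mod_cast hc, fun S hS => ?_⟩
  rw [hvol, Measure.smul_apply, Measure.map_apply L.continuous.measurable hS,
    Measure.prod_apply (L.continuous.measurable hS)]
  simp only [ENNReal.ofReal_coe_nnreal]
  rfl

namespace FaceData
variable {l : List ι} {m : ℕ}

theorem exists_cons [DecidableEq ι] (D : FaceData ν l (m + 1)) {i : ι}
    {y : EuclideanSpace ℝ (Fin n)} (hy : ∀ j ∈ l, ⟪ν j, y⟫ = 0) (hyi : ⟪ν i, y⟫ = 1) :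
    ∃ (D' : FaceData ν (i :: l) m) (c : ℝ), 0 < c ∧ ∀ h,
      volume (D.slice h) =
        ENNReal.ofReal c * ∫⁻ s in Iic (h i), volume (D'.slice (Function.update h i s)) := by
  obtain ⟨w, rfl⟩ := (D.mem_range y).1 hy
  have hil : i ∉ l := fun h => by rw [hy i h] at hyi; exact zero_ne_one hyi
  let a : EuclideanSpace ℝ (Fin (m + 1)) →ₗ[ℝ] ℝ := innerₛₗ ℝ (ν i) ∘ₗ D.φ
  have ha : ∀ t, a t = ⟪ν i, D.φ t⟫ := fun t => rfl
  obtain ⟨ψ, hψiso, hψ, c, hc, hvol⟩ := exists_volume_eq_prod a (w := w) hyi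
  have hψi := hψiso.injective
  have hψ0 : ∀ t, ⟪ν i, D.φ (ψ t)⟫ = 0 := fun t => (hψ _).2 ⟨t, rfl⟩
  let Z' : (ι → ℝ) →ₗ[ℝ] EuclideanSpace ℝ (Fin n) :=
    D.Z + (LinearMap.proj i - innerₛₗ ℝ (ν i) ∘ₗ D.Z).smulRight (D.φ w)
  have hZ' : ∀ h, Z' h = D.Z h + (h i - ⟪ν i, D.Z h⟫) • D.φ w := fun h => by simp [Z']
  let D' : FaceData ν (i :: l) m :=
    { φ := D.φ ∘ₗ ψ
      Z := Z'
      inj := D.inj.comp hψi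
      mem_range := fun z => by
        rw [List.forall_mem_cons, D.mem_range]
        constructor
        · rintro ⟨h1, t, rfl⟩
          obtain ⟨r, rfl⟩ := (hψ t).1 h1
          exact ⟨r, rfl⟩
        · rintro ⟨r, rfl⟩
          exact ⟨hψ0 r, ψ r, rfl⟩
      inner_Z := fun h j hj => by
        rw [hZ', inner_add_right, inner_smul_right]
        rcases List.mem_cons.1 hj with rfl | hj
        · rw [hyi]; ring
        · rw [hy j hj, D.inner_Z h j hj]; ring
      Z_congr := fun h h' hh => by
        rw [hZ', hZ', D.Z_congr h h' fun j hj => hh j (List.mem_cons_of_mem _ hj),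
          hh i List.mem_cons_self] }
  refine ⟨D', c, hc, fun h => ?_⟩
  rw [hvol _ (D.isClosed_slice h).measurableSet]
  congr 1
  set b := ⟪ν i, D.Z h⟫ with hb
  rw [← lintegral_indicator measurableSet_Iic,
    ← lintegral_add_right_eq_self
      ((Iic (h i)).indicator fun s => volume (D'.slice (Function.update h i s))) b]
  refine lintegral_congr fun s => ?_
  have hZu : D.Z (Function.update h i (s + b)) = D.Z h := D.Z_congr _ _ fun j hj => by
    rw [Function.update_of_ne]; rintro rfl; exact hil hj
  have hpt : ∀ t, D'.Z (Function.update h i (s + b)) + D'.φ t = D.Z h + D.φ (s • w + ψ t) := by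
    intro t
    change Z' _ + D.φ (ψ t) = _
    rw [hZ', hZu, ← hb, Function.update_self, map_add, map_smul]
    module
  have hi : ∀ t, ⟪ν i, D.Z h + D.φ (s • w + ψ t)⟫ = s + b := by
    intro t
    rw [map_add, map_smul, inner_add_right, inner_add_right, inner_smul_right, hyi, hψ0, ← hb]
    ring
  by_cases hs : s + b ∈ Iic (h i)
  · rw [indicator_of_mem hs]
    congr 1; ext t
    simp only [slice, poly, mem_ofPred_eq, hpt]
    refine forall_congr' fun j => ?_
    by_cases hj : j = i
    · subst hj; rw [hi, Function.update_self]; simpa using hs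
    · rw [Function.update_of_ne hj]
  · rw [indicator_of_notMem hs]
    convert measure_empty (μ := (volume : Measure (EuclideanSpace ℝ (Fin m))))
    ext t
    simp only [mem_ofPred_eq, mem_empty_iff_false, iff_false]
    intro ht
    have := ht i
    rw [hi] at this
    exact hs this

/-- The derivative of a volume in one of the heights. -/
theorem hasDerivAt_vol [Fintype ι] [DecidableEq ι] (D : FaceData ν l (m + 1)) {i : ι}
    (D' : FaceData ν (i :: l) m) {c : ℝ} (hc : 0 < c)
    (hD : ∀ h, volume (D.slice h) =
      ENNReal.ofReal c * ∫⁻ s in Iic (h i), volume (D'.slice (Function.update h i s)))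
    (hb : ∀ h, IsBounded (poly ν h)) {U : Set (ι → ℝ)} (hU : IsOpen U) {q : MvPolynomial ι ℝ}
    (hq : ∀ h ∈ U, D'.vol h = eval h q) {h : ι → ℝ} (hh : h ∈ U) :
    HasDerivAt (fun s => D.vol (Function.update h i s)) (c * eval h q) (h i) := by
  have hcu : Continuous fun s : ℝ => Function.update h i s := continuous_const.update i continuous_id
  have hUn : ∀ᶠ s in nhds (h i), Function.update h i s ∈ U :=
    hcu.continuousAt.preimage_mem_nhds (by simpa using hU.mem_nhds hh)
  obtain ⟨δ, hδ, hball⟩ := Metric.eventually_nhds_iff_ball.1 hUn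
  set a := h i - δ / 2 with ha
  set f : ℝ → ℝ := fun s => eval (Function.update h i s) q with hf
  have hfc : Continuous f := (MvPolynomial.continuous_eval q).comp hcu
  have hmem : ∀ s, a ≤ s → s < h i + δ → Function.update h i s ∈ U := fun s h1 h2 =>
    hball s (by rw [mem_ball, Real.dist_eq, abs_lt]; constructor <;> linarith)
  have key : ∀ b, a ≤ b → b < h i + δ → D.vol (Function.update h i b) =
      D.vol (Function.update h i a) + c * ∫ s in a..b, f s := by
    intro b hab hbδ
    have hsplit : volume (D.slice (Function.update h i b)) =
        volume (D.slice (Function.update h i a)) +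
          ENNReal.ofReal (c * ∫ s in a..b, f s) := by
      rw [hD, hD, ENNReal.ofReal_mul hc.le, ← mul_add]
      simp only [Function.update_self, Function.update_idem]
      congr 1
      rw [← Iic_union_Ioc_eq_Iic hab, lintegral_union measurableSet_Ioc
        (Iic_disjoint_Ioc le_rfl)]
      congr 1
      rw [intervalIntegral.integral_of_le hab, ofReal_integral_eq_lintegral_ofReal]
      · refine setLIntegral_congr_fun measurableSet_Ioc fun s hs => ?_
        change _ = ENNReal.ofReal (eval _ q)
        rw [← hq _ (hmem s hs.1.le (hs.2.trans_lt hbδ)), vol,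
          ofReal_measureReal (D'.volume_slice_ne_top (hb _))]
      · exact (hfc.integrableOn_Icc).mono_set Ioc_subset_Icc_self
      · filter_upwards [ae_restrict_mem measurableSet_Ioc] with s hs
        change 0 ≤ eval _ q
        rw [← hq _ (hmem s hs.1.le (hs.2.trans_lt hbδ))]
        exact measureReal_nonneg
    have hnn : 0 ≤ c * ∫ s in a..b, f s := mul_nonneg hc.le <|
      intervalIntegral.integral_nonneg hab fun s hs => by
        change 0 ≤ eval _ q
        rw [← hq _ (hmem s hs.1 (hs.2.trans_lt hbδ))]
        exact measureReal_nonneg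
    rw [vol, Measure.real, hsplit, ENNReal.toReal_add (D.volume_slice_ne_top (hb _))
      ENNReal.ofReal_ne_top, ENNReal.toReal_ofReal hnn]
    rfl
  have hder : HasDerivAt (fun b => D.vol (Function.update h i a) + c * ∫ s in a..b, f s)
      (c * eval h q) (h i) := by
    have := (hfc.integral_hasStrictDerivAt a (h i)).hasDerivAt
    have h1 : f (h i) = eval h q := by simp [f]
    rw [h1] at this
    exact (this.const_mul c).const_add _
  refine hder.congr_of_eventuallyEq ?_
  filter_upwards [Ioo_mem_nhds (show a < h i by linarith) (show h i < h i + δ by linarith)]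
    with b hb
  exact key b hb.1.le hb.2

end FaceData
end Face

/-- The linear polynomial of a linear functional. -/
def linPoly {ι : Type*} [Fintype ι] (f : (ι → ℝ) →ₗ[ℝ] ℝ) : MvPolynomial ι ℝ :=
  open Classical in ∑ i, C (f (Pi.single i 1)) * X i

theorem eval_linPoly {ι : Type*} [Fintype ι] (f : (ι → ℝ) →ₗ[ℝ] ℝ) (h : ι → ℝ) :
    eval h (linPoly f) = f h := by
  classical
  rw [linPoly, LinearMap.pi_apply_eq_sum_univ f h]
  simp only [map_sum, map_mul, eval_C, eval_X, smul_eq_mul]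
  refine Finset.sum_congr rfl fun i _ => ?_
  rw [mul_comm]
  congr 2
  ext j; simp [Pi.single_apply, eq_comm]

theorem isHomogeneous_linPoly {ι : Type*} [Fintype ι] (f : (ι → ℝ) →ₗ[ℝ] ℝ) :
    (linPoly f).IsHomogeneous 1 := by
  classical
  exact IsHomogeneous.sum _ _ _ fun i _ => by
    simpa using (isHomogeneous_C ι _).mul (isHomogeneous_X ℝ i)

theorem eq_zero_of_eval_eq_zero {ι : Type*} [Fintype ι] {U : Set (ι → ℝ)} (hU : IsOpen U)
    (hne : U.Nonempty) {q : MvPolynomial ι ℝ} (hq : ∀ h ∈ U, eval h q = 0) : q = 0 := by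
  obtain ⟨h, hh⟩ := hne
  obtain ⟨δ, hδ, hball⟩ := Metric.isOpen_iff.1 hU h hh
  refine funext_set (fun i => ball (h i) δ) (fun i => ?_) fun x hx => ?_
  · rw [Real.ball_eq_Ioo]; exact Set.Ioo_infinite (by linarith)
  · rw [map_zero]
    refine hq x (hball ?_)
    rw [mem_ball, dist_pi_lt_iff hδ]
    exact fun i => hx i trivial

section Face
variable {n : ℕ} {ι : Type*} {ν : ι → EuclideanSpace ℝ (Fin n)} {h₀ : ι → ℝ}

local notation "⟪" left "," right "⟫" => inner ℝ left right

theorem IsFace.exists_inner_eq_one [DecidableEq ι] {i : ι} {l : List ι}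
    (hF : IsFace ν h₀ (i :: l).toFinset) (hil : i ∉ l) :
    ∃ y, (∀ j ∈ l, ⟪ν j, y⟫ = 0) ∧ ⟪ν i, y⟫ = 1 := by
  obtain ⟨e, he, hJ⟩ := hF
  refine ⟨vert ν e (Pi.single i 1), fun j hj => ?_, ?_⟩
  · obtain ⟨k, rfl⟩ := hJ (show j ∈ _ by simp [hj])
    rw [inner_vert he.1, Pi.single_eq_of_ne]
    rintro rfl; exact hil hj
  · obtain ⟨k, rfl⟩ := hJ (show i ∈ _ by simp)
    rw [inner_vert he.1, Pi.single_eq_same]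

namespace FaceData
variable {l : List ι} {m : ℕ}

theorem hasDerivAt_vol_of_not_isFace [Fintype ι] [DecidableEq ι] (hs : IsSimple ν h₀)
    (D : FaceData ν l m) {i : ι} (hil : i ∉ l) (hF : ¬ IsFace ν h₀ (i :: l).toFinset)
    {h : ι → ℝ} (hh : h ∈ chamber ν h₀) :
    HasDerivAt (fun s => D.vol (Function.update h i s)) 0 (h i) := by
  have hcu : Continuous fun s : ℝ => Function.update h i s := continuous_const.update i continuous_id
  have hUn : ∀ᶠ s in nhds (h i), Function.update h i s ∈ chamber ν h₀ :=
    hcu.continuousAt.preimage_mem_nhds (by simpa using isOpen_chamber.mem_nhds hh)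
  obtain ⟨δ, hδ, hball⟩ := Metric.eventually_nhds_iff_ball.1 hUn
  rw [Real.ball_eq_Ioo] at hball
  have hZ : ∀ s, D.Z (Function.update h i s) = D.Z h := fun s => D.Z_congr _ _ fun j hj => by
    rw [Function.update_of_ne]; rintro rfl; exact hil hj
  have hsub : ∀ s₁ ∈ Ioo (h i - δ) (h i + δ), ∀ s₂ ∈ Ioo (h i - δ) (h i + δ),
      D.slice (Function.update h i s₁) ⊆ D.slice (Function.update h i s₂) := by
    intro s₁ hs₁ s₂ hs₂ t ht
    simp only [slice, poly, mem_ofPred_eq, hZ] at ht ⊢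
    have hne : ∀ j, j ≠ i → ⟪ν j, D.Z h + D.φ t⟫ ≤ h j := fun j hj => by
      simpa [hj] using ht j
    have hi := ht i
    rw [Function.update_self] at hi
    intro j
    by_cases hj : j = i
    swap; · simpa [hj] using hne j hj
    subst hj
    rw [Function.update_self]
    by_contra! hlt
    set x := D.Z h + D.φ t
    set σ := ⟪ν j, x⟫
    refine hF (hs.isFace_of_active (hball σ ⟨hs₂.1.trans hlt, hi.trans_lt hs₁.2⟩) (x := x) ?_ ?_)
    · intro k
      by_cases hk : k = j
      · subst hk; simp [σ]
      · simpa [hk] using hne k hk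
    · intro k hk
      rcases List.mem_cons.1 (List.mem_toFinset.1 hk) with rfl | hk'
      · simp [σ]
      · rw [inner_add_right, D.inner_φ t hk', D.inner_Z h k hk', add_zero, Function.update_of_ne]
        rintro rfl; exact hil hk'
  refine (hasDerivAt_const (h i) (D.vol h)).congr_of_eventuallyEq ?_
  filter_upwards [Ioo_mem_nhds (show h i - δ < h i by linarith) (show h i < h i + δ by linarith)]
    with s hs'
  have h0 : h i ∈ Ioo (h i - δ) (h i + δ) := ⟨by linarith, by linarith⟩
  have : D.slice (Function.update h i s) = D.slice h := by
    conv_rhs => rw [← Function.update_eq_self i h]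
    exact (hsub s hs' _ h0).antisymm (hsub _ h0 s hs')
  simp only [vol, this]

/-- The volumes of the faces are polynomials on the type cone. -/
theorem exists_poly [Fintype ι] [DecidableEq ι] (hs : IsSimple ν h₀) (m : ℕ) :
    ∀ l : List ι, l.Nodup → IsFace ν h₀ l.toFinset → ∀ D : FaceData ν l m,
      ∃ q : MvPolynomial ι ℝ, q.IsHomogeneous m ∧ ∀ h ∈ chamber ν h₀, D.vol h = eval h q := by
  induction m with
  | zero =>
    intro l hl hF D
    refine ⟨C (volume.real (univ : Set (EuclideanSpace ℝ (Fin 0)))), isHomogeneous_C _ _,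
      fun h hh => ?_⟩
    obtain ⟨y, hy, hy'⟩ := hF.exists_relint hh
    obtain ⟨t, ht⟩ := (D.mem_range (y - D.Z h)).1 fun j hj => by
      rw [inner_sub_right, D.inner_Z h j hj, hy j (by simpa using hj), sub_self]
    have : D.slice h = univ := by
      refine eq_univ_of_forall fun t' => ?_
      rw [Subsingleton.elim t' t]
      intro j
      rw [ht, add_sub_cancel]
      by_cases hj : j ∈ l.toFinset
      · exact (hy j hj).le
      · exact (hy' j hj).le
    rw [vol, this, eval_C]
  | succ m ih =>
    intro l hl hF D
    have hr : ∀ i, i ∉ l → ∃ r : MvPolynomial ι ℝ, r.IsHomogeneous m ∧ ∀ h ∈ chamber ν h₀,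
        HasDerivAt (fun s => D.vol (Function.update h i s)) (eval h r) (h i) := by
      intro i hil
      by_cases hFi : IsFace ν h₀ (i :: l).toFinset
      · obtain ⟨y, hy, hyi⟩ := hFi.exists_inner_eq_one hil
        obtain ⟨D', c, hc, hD⟩ := D.exists_cons hy hyi
        obtain ⟨q, hqm, hq⟩ := ih (i :: l) (List.nodup_cons.2 ⟨hil, hl⟩) hFi D'
        refine ⟨C c * q, by simpa using (isHomogeneous_C ι c).mul hqm, fun h hh => ?_⟩
        rw [map_mul, eval_C]
        exact D.hasDerivAt_vol D' hc hD hs.bdd isOpen_chamber hq hh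
      · exact ⟨0, isHomogeneous_zero _ _ _, fun h hh => by
          rw [map_zero]; exact D.hasDerivAt_vol_of_not_isFace hs hil hFi hh⟩
    choose! r hrm hr using hr
    let P : (ι → ℝ) →ₗ[ℝ] (ι → ℝ) := LinearMap.id - evalMap ν ∘ₗ D.Z
    have hP : ∀ h, P h = h + evalMap ν (-D.Z h) := fun h => by simp [P, sub_eq_add_neg]
    set S : Finset ι := Finset.univ.filter (· ∉ l)
    refine ⟨C (1 / ((m : ℝ) + 1)) * bind₁ (fun k => linPoly (LinearMap.proj k ∘ₗ P))
      (∑ i ∈ S, X i * r i), ?_, fun h hh => ?_⟩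
    · rw [← aeval_eq_bind₁]
      have h1 : (∑ i ∈ S, X i * r i).IsHomogeneous (m + 1) :=
        IsHomogeneous.sum _ _ _ fun i hi => by
          simpa [add_comm] using (isHomogeneous_X ℝ i).mul (hrm i (by simpa [S] using hi))
      simpa using (isHomogeneous_C ι (1 / ((m : ℝ) + 1))).mul
        (h1.aeval (fun k => linPoly (LinearMap.proj k ∘ₗ P)) fun _ => isHomogeneous_linPoly _)
    · have hPh : P h ∈ chamber ν h₀ := by rw [hP]; exact chamber_add_evalMap hh _
      have hev : ∀ p : MvPolynomial ι ℝ,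
          eval h (bind₁ (fun k => linPoly (LinearMap.proj k ∘ₗ P)) p) = eval (P h) p := by
        intro p
        have := eval₂Hom_bind₁ (RingHom.id ℝ) h (fun k => linPoly (LinearMap.proj k ∘ₗ P)) p
        have h2 : (fun i => eval₂Hom (RingHom.id ℝ) h (linPoly (LinearMap.proj i ∘ₗ P))) = P h := by
          ext i; exact eval_linPoly _ _
        rw [h2] at this
        exact this
      have hPl : ∀ j ∈ l, P h j = 0 := fun j hj => by
        simp [P, evalMap_apply, D.inner_Z h j hj]
      have hvol : D.vol h = D.vol (P h) := by rw [hP, vol_add_evalMap]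
      have hd := hasDerivAt_of_partial isOpen_chamber D.vol (fun i h => eval h (r i)) S
        (fun i _ => (MvPolynomial.continuous_eval (r i)).continuousOn)
        (fun i hi h hh => hr i (by simpa [S] using hi) h hh) hPh (P h)
      have hPS : (fun i => if i ∈ S then P h i else 0) = P h := by
        ext j; by_cases hj : j ∈ l
        · simp [S, hj, hPl j hj]
        · simp [S, hj]
      rw [hPS] at hd
      have hd' : HasDerivAt (fun t : ℝ => D.vol (P h + t • P h))
          (((m : ℝ) + 1) * D.vol (P h)) 0 := by
        have h1 : HasDerivAt (fun t : ℝ => (1 + t) ^ (m + 1) * D.vol (P h))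
            (((m : ℝ) + 1) * D.vol (P h)) 0 := by
          have h2 : HasDerivAt (fun t : ℝ => 1 + t) 1 0 := (hasDerivAt_id (0 : ℝ)).const_add 1
          simpa using (h2.pow (m + 1)).mul_const (D.vol (P h))
        refine h1.congr_of_eventuallyEq ?_
        filter_upwards [Ioi_mem_nhds (show (-1 : ℝ) < 0 by norm_num)] with t ht
        have ht : (-1 : ℝ) < t := ht
        rw [← D.vol_smul _ (by linarith : 0 < 1 + t), add_smul, one_smul]
      have := hd'.unique hd
      rw [map_mul, eval_C, hev, map_sum, hvol]
      simp only [map_mul, eval_X]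
      rw [← this]
      field_simp

end FaceData
end Face

theorem hasDerivAt_eval_update {ι : Type*} [Fintype ι] [DecidableEq ι] (h : ι → ℝ) (i : ι)
    (q : MvPolynomial ι ℝ) :
    HasDerivAt (fun s => eval (Function.update h i s) q) (eval h (pderiv i q)) (h i) := by
  have h1 : (fun s => eval (Function.update h i s) q) =
      (fun t : ℝ => eval (h + t • Pi.single i 1) q) ∘ fun s => s - h i := by
    ext s; simp only [Function.comp]; congr 2; ext j
    by_cases hj : j = i
    · subst hj; simp
    · simp [hj]
  have h2 := hasDerivAt_eval h (Pi.single i 1) q 0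
  have h3 : HasDerivAt (fun s : ℝ => s - h i) 1 (h i) := (hasDerivAt_id _).sub_const _
  rw [h1]
  have h4 : dd (Pi.single i (1 : ℝ)) q = pderiv i q := by
    rw [dd_apply, Finset.sum_eq_single i] <;> simp +contextual
  rw [h4, zero_smul, add_zero] at h2
  have h5 : HasDerivAt (fun t : ℝ => eval (h + t • Pi.single i 1) q) (eval h (pderiv i q))
      (h i - h i) := by rwa [sub_self]
  have h6 := HasDerivAt.comp (h₂ := fun t : ℝ => eval (h + t • Pi.single i 1) q)
    (h := fun s : ℝ => s - h i) (h i) h5 h3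
  rwa [mul_one] at h6

theorem le_of_hasDerivAt_of_le {g : ℝ → ℝ} {g' a : ℝ} (hg : HasDerivAt g g' 0)
    (h : ∀ᶠ s in nhdsWithin (0 : ℝ) (Ioi 0), g 0 + s * a ≤ g s) : a ≤ g' := by
  refine ge_of_tendsto hg.tendsto_slope_zero_right ?_
  filter_upwards [h, self_mem_nhdsWithin] with s hs hs0
  have hs0 : 0 < s := hs0
  rw [zero_add, smul_eq_mul, inv_mul_eq_div, le_div_iff₀ hs0]
  linarith

/-- Second-order consequence of midpoint log-concavity. -/
theorem eval_dd_dd_nonpos {ι : Type*} [Fintype ι] {q : MvPolynomial ι ℝ} {h x : ι → ℝ}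
    (hpos : 0 < eval h q) (hx : eval h (dd x q) = 0)
    (hlog : ∀ᶠ t in nhds (0 : ℝ), eval (h + t • x) q * eval (h + t • (-x)) q ≤ eval h q ^ 2) :
    eval h (dd x (dd x q)) ≤ 0 := by
  by_contra! hneg
  set φ : ℝ → ℝ := fun t => eval (h + t • x) q * eval (h + t • (-x)) q with hφ
  have hdn : ∀ r : MvPolynomial ι ℝ, dd (-x) r = -dd x r := fun r => by
    simp [dd_apply]
  have h1 : ∀ t, HasDerivAt φ (eval (h + t • x) (dd x q) * eval (h + t • (-x)) q +
      eval (h + t • x) q * eval (h + t • (-x)) (dd (-x) q)) t := fun t =>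
    (hasDerivAt_eval h x q t).mul (hasDerivAt_eval h (-x) q t)
  have h2 : HasDerivAt (fun t : ℝ => eval (h + t • x) (dd x q) * eval (h + t • (-x)) q +
      eval (h + t • x) q * eval (h + t • (-x)) (dd (-x) q))
      (2 * (eval h q * eval h (dd x (dd x q)))) 0 := by
    have := ((hasDerivAt_eval h x (dd x q) 0).mul (hasDerivAt_eval h (-x) q 0)).add
      ((hasDerivAt_eval h x q 0).mul (hasDerivAt_eval h (-x) (dd (-x) q) 0))
    refine this.congr_deriv ?_
    simp only [zero_smul, add_zero, hdn, map_neg, hx]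
    ring
  have hder : deriv φ = fun t : ℝ => eval (h + t • x) (dd x q) * eval (h + t • (-x)) q +
      eval (h + t • x) q * eval (h + t • (-x)) (dd (-x) q) := funext fun t => (h1 t).deriv
  have hmin : IsLocalMin φ 0 := by
    refine isLocalMin_of_deriv_deriv_pos ?_ ?_ (h1 0).continuousAt
    · rw [hder, h2.deriv]; positivity
    · rw [hder]; simp [hdn, hx]
  have hφ0 : φ 0 = eval h q ^ 2 := by simp [hφ, sq]
  have hconst : φ =ᶠ[nhds 0] fun _ => eval h q ^ 2 := by
    filter_upwards [hlog, hmin] with t ht ht'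
    exact le_antisymm ht (hφ0 ▸ ht')
  have h3 : deriv (deriv φ) 0 = 0 := by
    rw [hconst.deriv.deriv_eq]; simp
  rw [hder, h2.deriv] at h3
  have : 0 < 2 * (eval h q * eval h (dd x (dd x q))) := by positivity
  linarith

section Face
variable {n : ℕ} {ι : Type*} {ν : ι → EuclideanSpace ℝ (Fin n)} {h₀ : ι → ℝ}

local notation "⟪" left "," right "⟫" => inner ℝ left right

theorem IsSimple.isFace_empty [Finite ι] (hs : IsSimple ν h₀) : IsFace ν h₀ ∅ := by
  obtain ⟨e, he, -⟩ := hs.exists_cone 0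
  exact ⟨e, he, by simp⟩

theorem chamber_sub_smul [Finite ι] {h c : ι → ℝ} (hc : c ∈ chamber ν h₀) :
    ∃ δ > 0, c - (δ : ℝ) • h ∈ chamber ν h₀ := by
  have h1 : ContinuousAt (fun δ : ℝ => c - δ • h) 0 := by fun_prop
  have h2 : ∀ᶠ δ : ℝ in nhds 0, c - δ • h ∈ chamber ν h₀ :=
    h1.preimage_mem_nhds (by simpa using isOpen_chamber.mem_nhds hc)
  obtain ⟨δ, h3, h4⟩ := ((h2.filter_mono nhdsWithin_le_nhds).and
    (self_mem_nhdsWithin (s := Ioi (0 : ℝ)))).exists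
  exact ⟨δ, h4, h3⟩

namespace FaceData
variable {l : List ι} {m : ℕ}

theorem exists_mem_slice [Finite ι] (D : FaceData ν l m) {J : Finset ι} (hJ : ∀ j, j ∈ J ↔ j ∈ l)
    (hF : IsFace ν h₀ J) {h : ι → ℝ} (hh : h ∈ chamber ν h₀) :
    ∃ t ∈ D.slice h, ∀ j ∉ l, ⟪ν j, D.Z h + D.φ t⟫ < h j := by
  obtain ⟨y, hy, hy'⟩ := hF.exists_relint hh
  obtain ⟨t, ht⟩ := (D.mem_range (y - D.Z h)).1 fun j hj => by
    rw [inner_sub_right, D.inner_Z h j hj, hy j ((hJ j).2 hj), sub_self]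
  have hp : D.Z h + D.φ t = y := by rw [ht, add_sub_cancel]
  refine ⟨t, fun j => ?_, fun j hj => by rw [hp]; exact hy' j (by rwa [hJ])⟩
  rw [hp]
  by_cases hj : j ∈ J
  · exact (hy j hj).le
  · exact (hy' j hj).le

theorem vol_pos [Finite ι] (hs : IsSimple ν h₀) (D : FaceData ν l m) {J : Finset ι}
    (hJ : ∀ j, j ∈ J ↔ j ∈ l)
    (hF : IsFace ν h₀ J) {h : ι → ℝ} (hh : h ∈ chamber ν h₀) : 0 < D.vol h := by
  have : Fintype ι := Fintype.ofFinite ι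
  obtain ⟨t, -, ht⟩ := D.exists_mem_slice hJ hF hh
  have hφ : Continuous D.φ := LinearMap.continuous_of_finiteDimensional _
  let O : Set (EuclideanSpace ℝ (Fin m)) := ⋂ j : ι, {t | j ∉ l → ⟪ν j, D.Z h + D.φ t⟫ < h j}
  have hO : IsOpen O := isOpen_iInter_of_finite fun j => by
    by_cases hj : j ∈ l
    · simp [hj]
    · simp only [hj, not_false_eq_true, true_imp_iff]
      exact isOpen_lt (by fun_prop) continuous_const
  have hOs : O ⊆ D.slice h := fun s hs j => by
    by_cases hj : j ∈ l
    · rw [inner_add_right, D.inner_Z h j hj, D.inner_φ s hj, add_zero]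
    · exact (mem_iInter.1 hs j hj).le
  have h1 : 0 < volume O := hO.measure_pos _ ⟨t, mem_iInter.2 fun j hj => ht j hj⟩
  exact ENNReal.toReal_pos (h1.trans_le (measure_mono hOs)).ne' (D.volume_slice_ne_top (hs.bdd h))

theorem vol_le_vol_add [Finite ι] (hs : IsSimple ν h₀) (D : FaceData ν l m) {J : Finset ι}
    (hJ : ∀ j, j ∈ J ↔ j ∈ l) (hF : IsFace ν h₀ J) (h : ι → ℝ) {c : ι → ℝ}
    (hc : c ∈ chamber ν h₀) : D.vol h ≤ D.vol (h + c) := by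
  obtain ⟨t, ht, -⟩ := D.exists_mem_slice hJ hF hc
  have h1 : D.slice h ⊆ (fun s => t + s) ⁻¹' D.slice (h + c) := fun s hs j => by
    have : D.Z (h + c) + D.φ (t + s) = (D.Z h + D.φ s) + (D.Z c + D.φ t) := by
      rw [map_add, map_add]; abel
    rw [this, inner_add_right, Pi.add_apply]
    exact add_le_add (hs j) (ht j)
  refine ENNReal.toReal_mono (D.volume_slice_ne_top (hs.bdd _)) ?_
  calc volume (D.slice h) ≤ _ := measure_mono h1
    _ = _ := measure_preimage_add _ _ _

theorem vol_mul_vol_le (D : FaceData ν l m) (hb : ∀ h, IsBounded (poly ν h)) (h h' : ι → ℝ) :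
    D.vol h * D.vol h' ≤ D.vol ((1 / 2 : ℝ) • (h + h')) ^ 2 := by
  have key := brunn_minkowski_mul (a := 1 / 2) (b := 1 / 2) (by norm_num) (by norm_num) (by norm_num)
    (D.isClosed_slice h).measurableSet (D.isClosed_slice h').measurableSet
    (D.isClosed_slice ((1 / 2 : ℝ) • (h + h'))).measurableSet (fun x hx y hy i => by
      have : D.Z ((1 / 2 : ℝ) • (h + h')) + D.φ ((1 / 2 : ℝ) • x + (1 / 2 : ℝ) • y) =
          (1 / 2 : ℝ) • ((D.Z h + D.φ x) + (D.Z h' + D.φ y)) := by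
        simp only [map_add, map_smul]; module
      rw [this, inner_smul_right, inner_add_right, Pi.smul_apply, Pi.add_apply, smul_eq_mul]
      have := add_le_add (hx i) (hy i)
      linarith)
  have h2 := ENNReal.toReal_mono (D.volume_slice_ne_top (hb _)) key
  rw [ENNReal.toReal_mul, ← ENNReal.toReal_rpow, ← ENNReal.toReal_rpow] at h2
  have e : ∀ x : ℝ, 0 ≤ x → (x ^ (1 / 2 : ℝ)) ^ 2 = x := fun x hx => by
    rw [← Real.sqrt_eq_rpow, Real.sq_sqrt hx]
  have h3 : (0 : ℝ) ≤ D.vol h := measureReal_nonneg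
  have h4 : (0 : ℝ) ≤ D.vol h' := measureReal_nonneg
  calc D.vol h * D.vol h' = (D.vol h ^ (1 / 2 : ℝ) * D.vol h' ^ (1 / 2 : ℝ)) ^ 2 := by
        rw [mul_pow, e _ h3, e _ h4]
    _ ≤ _ := pow_le_pow_left₀ (by positivity) h2 2

theorem exists_eval_pd [Fintype ι] [DecidableEq ι] (hs : IsSimple ν h₀) {p : MvPolynomial ι ℝ}
    (hp : ∀ h ∈ chamber ν h₀, (nil (ν := ν)).vol h = eval h p) (l : List ι) (hl : l.Nodup) :
    (IsFace ν h₀ l.toFinset → ∃ (m : ℕ) (D : FaceData ν l m) (c : ℝ), l.length + m = n ∧ 0 < c ∧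
      ∀ h ∈ chamber ν h₀, eval h (pd l p) = c * D.vol h) ∧
    (¬ IsFace ν h₀ l.toFinset → pd l p = 0) := by
  induction l with
  | nil =>
    refine ⟨fun _ => ⟨n, nil, 1, by simp, one_pos, fun h hh => by rw [hp h hh]; simp [pd]⟩,
      fun hF => absurd hs.isFace_empty (by simpa using hF)⟩
  | cons i l ih =>
    obtain ⟨hil, hl'⟩ := List.nodup_cons.1 hl
    obtain ⟨ih1, ih2⟩ := ih hl'
    have hder : ∀ (m : ℕ) (D : FaceData ν l m) (c d : ℝ), ∀ h ∈ chamber ν h₀,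
        (∀ h ∈ chamber ν h₀, eval h (pd l p) = c * D.vol h) →
        HasDerivAt (fun s => D.vol (Function.update h i s)) d (h i) →
        eval h (pd (i :: l) p) = c * d := by
      intro m D c d h hh hD hd
      refine (hasDerivAt_eval_update h i (pd l p)).unique ((hd.const_mul c).congr_of_eventuallyEq ?_)
      have hcu : Continuous fun s : ℝ => Function.update h i s :=
        continuous_const.update i continuous_id
      have hUn : ∀ᶠ s in nhds (h i), Function.update h i s ∈ chamber ν h₀ :=
        hcu.continuousAt.preimage_mem_nhds (by simpa using isOpen_chamber.mem_nhds hh)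
      filter_upwards [hUn] with s hs
      exact hD _ hs
    refine ⟨fun hF => ?_, fun hF => ?_⟩
    · obtain ⟨m, D, c, hlm, hc, hD⟩ := ih1 (hF.mono (by intro j; simp +contextual))
      obtain ⟨y, hy, hyi⟩ := hF.exists_inner_eq_one hil
      obtain _ | m := m
      · obtain ⟨t, rfl⟩ := (D.mem_range y).1 hy
        rw [Subsingleton.elim t 0] at hyi
        simp at hyi
      obtain ⟨D', c', hc', hD'⟩ := D.exists_cons hy hyi
      obtain ⟨q, -, hq⟩ := exists_poly hs m (i :: l) hl hF D'
      refine ⟨m, D', c * c', by simp; omega, by positivity, fun h hh => ?_⟩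
      rw [hder _ D c _ h hh hD (D.hasDerivAt_vol D' hc' hD' hs.bdd isOpen_chamber hq hh), hq h hh]
      ring
    · by_cases hFl : IsFace ν h₀ l.toFinset
      · obtain ⟨m, D, c, hlm, hc, hD⟩ := ih1 hFl
        refine eq_zero_of_eval_eq_zero (U := chamber ν h₀) isOpen_chamber ⟨h₀, self_mem_chamber⟩ fun h hh => ?_
        rw [hder _ D c _ h hh hD (D.hasDerivAt_vol_of_not_isFace hs hil hF hh), mul_zero]
      · rw [pd_cons, ih2 hFl, map_zero]

end FaceData

/-- The volume polynomial of a simple polytope satisfies the hypotheses of the Bochner method. -/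
theorem IsSimple.exists_chamberData [Fintype ι] [DecidableEq ι] (hs : IsSimple ν h₀) :
    ∃ D : ChamberData n ι (EuclideanSpace ℝ (Fin n)), D.cone = chamber ν h₀ ∧ D.F ∅ ∧
      ∀ h ∈ chamber ν h₀, volume.real (poly ν h) = eval h D.p := by
  obtain ⟨p, hpn, hp⟩ := FaceData.exists_poly hs n [] List.nodup_nil
    (by simpa using hs.isFace_empty) FaceData.nil
  have hpd := FaceData.exists_eval_pd hs hp
  have hJ : ∀ l : List ι, ∀ j, j ∈ l.toFinset ↔ j ∈ l := fun l j => List.mem_toFinset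
  refine ⟨{ p := p, cone := chamber ν h₀, T := evalMap ν, F := IsFace ν h₀, homog := hpn,
            pos := ?_, zero := fun l hl => (hpd l hl).2, transl := ?_, lift := ?_, relint := ?_,
            logc := ?_ }, rfl, hs.isFace_empty, ?_⟩
  · intro l hl hF hln h hh c hc
    obtain ⟨m, D, k, hlm, hk, hD⟩ := (hpd l hl).1 hF
    obtain ⟨δ, hδ, hcδ⟩ := chamber_sub_smul (h := h) hc
    have hv := D.vol_pos hs (hJ l) hF hh
    have hd := hasDerivAt_eval h c (pd l p) 0
    rw [zero_smul, add_zero] at hd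
    refine lt_of_lt_of_le (show 0 < δ * (k * D.vol h) by positivity)
      (le_of_hasDerivAt_of_le hd ?_)
    filter_upwards [self_mem_nhdsWithin] with s hs0
    have hs0 : 0 < s := hs0
    have e : h + s • c = (1 + s * δ) • h + s • (c - δ • h) := by module
    rw [zero_smul, add_zero, hD h hh, hD _ (chamber_add hh (chamber_smul hc hs0)), e]
    have h1 := D.vol_le_vol_add hs (hJ l) hF ((1 + s * δ) • h) (chamber_smul hcδ hs0)
    rw [D.vol_smul h (by positivity)] at h1
    have h2 : 1 + s * δ ≤ (1 + s * δ) ^ m := le_self_pow₀ (by nlinarith) (by omega)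
    nlinarith [mul_le_mul_of_nonneg_right h2 hv.le]
  · intro y
    refine eq_zero_of_eval_eq_zero (U := chamber ν h₀) isOpen_chamber ⟨h₀, self_mem_chamber⟩ fun h hh => ?_
    have hd := hasDerivAt_eval h (evalMap ν y) p 0
    rw [zero_smul, add_zero] at hd
    refine hd.unique ((hasDerivAt_const 0 (eval h p)).congr_of_eventuallyEq ?_)
    filter_upwards with t
    rw [← map_smul, ← hp _ hh, ← hp _ (chamber_add_evalMap hh _), FaceData.vol_add_evalMap]
  · rintro l ⟨e, he, hJe⟩ x
    refine ⟨vert ν e x, fun j hj => ?_⟩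
    obtain ⟨k, rfl⟩ := hJe (show j ∈ _ by simpa using hj)
    rw [evalMap_apply, inner_vert he.1]
  · intro l hF h hh
    obtain ⟨y, hy, hy'⟩ := hF.exists_relint hh
    exact ⟨y, fun j hj => (hy j (by simpa using hj)).symm, fun j hj => hy' j (by simpa using hj)⟩
  · intro l hl hF hln h hh x y hy
    obtain ⟨m, D, k, hlm, hk, hD⟩ := (hpd l hl).1 hF
    have hm : 3 ≤ m := by omega
    have hq : (pd l p).IsHomogeneous m := by
      have := isHomogeneous_pd hpn l
      rwa [show n - l.length = m by omega] at this
    refine reverse_cauchySchwarz (hess h (pd l p)) (hess_comm h _) h (fun x hx => ?_) x y hy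
    have hx0 : eval h (dd x (pd l p)) = 0 := by
      have h1 := eval_dd_self (isHomogeneous_dd hq x) h
      rw [hess_comm, hess_apply, h1] at hx
      refine (mul_eq_zero.1 hx).resolve_left ?_
      exact_mod_cast (by omega : m - 1 ≠ 0)
    have hpos : 0 < eval h (pd l p) := by
      rw [hD h hh]; exact mul_pos hk (D.vol_pos hs (hJ l) hF hh)
    refine eval_dd_dd_nonpos hpos hx0 ?_
    have hmem : ∀ z : ι → ℝ, ∀ᶠ t in nhds (0 : ℝ), h + t • z ∈ chamber ν h₀ := fun z => by
      have h1 : ContinuousAt (fun t : ℝ => h + t • z) 0 := by fun_prop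
      exact h1.preimage_mem_nhds (by simpa using isOpen_chamber.mem_nhds hh)
    filter_upwards [hmem x, hmem (-x)] with t h1 h2
    have h3 := D.vol_mul_vol_le hs.bdd (h + t • x) (h + t • (-x))
    have e : (1 / 2 : ℝ) • (h + t • x + (h + t • (-x))) = h := by module
    rw [e] at h3
    rw [hD _ h1, hD _ h2, hD _ hh]
    nlinarith [mul_le_mul_of_nonneg_left h3 (sq_nonneg k)]
  · intro h hh
    rw [← hp h hh]
    congr 1
    ext t
    simp [FaceData.slice, FaceData.nil]

end Face

section Support
variable {n : ℕ}

local notation "𝔼" => EuclideanSpace ℝ (Fin n)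
local notation "⟪" left "," right "⟫" => inner ℝ left right

theorem exists_inner_lt_of_notMem {K : Set 𝔼} (hK : Convex ℝ K) (hc : IsClosed K) {x : 𝔼}
    (hx : x ∉ K) : ∃ (y : 𝔼) (c : ℝ), (∀ z ∈ K, ⟪y, z⟫ < c) ∧ c < ⟪y, x⟫ := by
  obtain ⟨f, u, h1, h2⟩ := geometric_hahn_banach_closed_point hK hc hx
  refine ⟨(InnerProductSpace.toDual ℝ 𝔼).symm f, u, fun z hz => ?_, ?_⟩
  · simpa using h1 z hz
  · simpa using h2

/-- The support function of a set. -/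
def supp (K : Set 𝔼) (u : 𝔼) : ℝ := sSup ((fun x => ⟪u, x⟫) '' K)

theorem bddAbove_inner_image {K : Set 𝔼} (hK : IsBounded K) (u : 𝔼) :
    BddAbove ((fun x => ⟪u, x⟫) '' K) := by
  obtain ⟨M, hM⟩ := hK.exists_norm_le
  refine ⟨‖u‖ * M, ?_⟩
  rintro _ ⟨x, hx, rfl⟩
  exact (real_inner_le_norm u x).trans (mul_le_mul_of_nonneg_left (hM x hx) (norm_nonneg _))

theorem inner_le_supp {K : Set 𝔼} (hK : IsBounded K) (u : 𝔼) {x : 𝔼} (hx : x ∈ K) :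
    ⟪u, x⟫ ≤ supp K u := le_csSup (bddAbove_inner_image hK u) (mem_image_of_mem _ hx)

theorem supp_le {K : Set 𝔼} (hne : K.Nonempty) {u : 𝔼} {c : ℝ} (h : ∀ x ∈ K, ⟪u, x⟫ ≤ c) :
    supp K u ≤ c := csSup_le (hne.image _) (by rintro _ ⟨x, hx, rfl⟩; exact h x hx)

theorem supp_add {K Q : Set 𝔼} (hK : IsBounded K) (hQ : IsBounded Q) (hKn : K.Nonempty)
    (hQn : Q.Nonempty) (u : 𝔼) : supp (K + Q) u = supp K u + supp Q u := by
  refine le_antisymm (supp_le (hKn.add hQn) ?_) ?_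
  · rintro _ ⟨x, hx, y, hy, rfl⟩
    rw [inner_add_right]
    exact add_le_add (inner_le_supp hK u hx) (inner_le_supp hQ u hy)
  · rw [← le_sub_iff_add_le]
    refine supp_le hKn fun x hx => ?_
    rw [le_sub_comm]
    refine supp_le hQn fun y hy => ?_
    rw [le_sub_iff_add_le', ← inner_add_right]
    exact inner_le_supp (hK.add hQ) u (add_mem_add hx hy)

theorem supp_pos {K : Set 𝔼} (hK : IsBounded K) (h0 : (0 : 𝔼) ∈ interior K) {u : 𝔼} (hu : u ≠ 0) :
    0 < supp K u := by
  obtain ⟨ρ, hρ, hb⟩ := Metric.isOpen_iff.1 isOpen_interior 0 h0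
  have hun : 0 < ‖u‖ := norm_pos_iff.2 hu
  have h1 : (ρ / 2 / ‖u‖) • u ∈ K := interior_subset (hb (by
    rw [mem_ball_zero_iff, norm_smul, Real.norm_of_nonneg (by positivity), div_mul_cancel₀ _ hun.ne']
    linarith))
  refine lt_of_lt_of_le ?_ (inner_le_supp hK u h1)
  rw [inner_smul_right, real_inner_self_eq_norm_sq]; positivity

/-- Cancellation law for Minkowski sums. -/
theorem subset_of_add_subset_add {X Y C : Set 𝔼} (hY : Convex ℝ Y) (hYc : IsClosed Y)
    (hYb : IsBounded Y) (hC : IsBounded C) (hCn : C.Nonempty) (h : X + C ⊆ Y + C) : X ⊆ Y := by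
  intro x hx
  by_contra hxY
  obtain ⟨y, c, h1, h2⟩ := exists_inner_lt_of_notMem hY hYc hxY
  have hYn : Y.Nonempty := by
    obtain ⟨q, hq⟩ := hCn
    obtain ⟨z, hz, -⟩ := h (add_mem_add hx hq); exact ⟨z, hz⟩
  have h3 : supp C y ≤ supp (Y + C) y - ⟪y, x⟫ := supp_le hCn fun q hq => by
    rw [le_sub_iff_add_le', ← inner_add_right]
    exact inner_le_supp (hYb.add hC) y (h (add_mem_add hx hq))
  rw [supp_add hYb hC hYn hCn] at h3
  have h4 : supp Y y ≤ c := supp_le hYn fun z hz => (h1 z hz).le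
  linarith

/-- The convex hull of finitely many points is an intersection of finitely many half-spaces. -/
theorem exists_facet_normals {V : Set 𝔼} (hV : V.Finite) (h0 : (0 : 𝔼) ∈ interior (convexHull ℝ V)) :
    ∃ N : Finset 𝔼, (∀ u ∈ N, ‖u‖ = 1) ∧
      ∀ x, (∀ u ∈ N, ⟪u, x⟫ ≤ supp (convexHull ℝ V) u) → x ∈ convexHull ℝ V := by
  classical
  set K := convexHull ℝ V with hK
  have hKc : IsCompact K := hV.isCompact_convexHull ℝ
  set S : Set 𝔼 := {y | ∀ v ∈ V, ⟪v, y⟫ ≤ 1} with hS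
  have hSK : ∀ y ∈ S, ∀ x ∈ K, ⟪x, y⟫ ≤ 1 := fun y hy x hx => by
    have : K ⊆ {x | ⟪x, y⟫ ≤ 1} := convexHull_min (fun v hv => hy v hv)
      (convex_halfSpace_le ⟨fun a b => inner_add_left a b y, fun c a => by simp [inner_smul_left]⟩ 1)
    exact this hx
  obtain ⟨ρ, hρ, hb⟩ := Metric.isOpen_iff.1 isOpen_interior 0 h0
  have hSc : IsClosed S := by
    have : S = ⋂ v ∈ V, {y | ⟪v, y⟫ ≤ 1} := by ext; simp [hS]
    rw [this]
    exact isClosed_biInter fun v _ => isClosed_le (by fun_prop) continuous_const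
  have hSconv : Convex ℝ S := by
    intro x hx y hy a b ha hb hab v hv
    rw [inner_add_right, inner_smul_right, inner_smul_right]
    nlinarith [mul_le_mul_of_nonneg_left (hx v hv) ha, mul_le_mul_of_nonneg_left (hy v hv) hb]
  have hSb : IsBounded S := by
    refine (isBounded_closedBall (x := (0 : 𝔼)) (r := 2 / ρ)).subset fun y hy => ?_
    rw [mem_closedBall_zero_iff]
    rcases eq_or_ne y 0 with rfl | hy0
    · simp; positivity
    have hyn : 0 < ‖y‖ := norm_pos_iff.2 hy0
    have h1 : (ρ / 2 / ‖y‖) • y ∈ K := interior_subset (hb (by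
      rw [mem_ball_zero_iff, norm_smul, Real.norm_of_nonneg (by positivity),
        div_mul_cancel₀ _ hyn.ne']
      linarith))
    have h2 := hSK y hy _ h1
    rw [real_inner_smul_left, real_inner_self_eq_norm_sq] at h2
    rw [le_div_iff₀ hρ]
    have : ρ / 2 / ‖y‖ * ‖y‖ ^ 2 = ρ / 2 * ‖y‖ := by field_simp
    linarith
  have hScpt : IsCompact S := isCompact_of_isClosed_isBounded hSc hSb
  have hext : (S.extremePoints ℝ).Finite := by
    have hinj : InjOn (fun y => {v ∈ V | ⟪v, y⟫ = 1}) (S.extremePoints ℝ) := by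
      intro y hy y' hy' heq
      by_contra hne
      have hyS := hy.1
      have h1 : ∀ᶠ t : ℝ in nhds 0, ∀ v ∈ V, ⟪v, y⟫ < 1 → ⟪v, y + t • (y' - y)⟫ < 1 ∧
          ⟪v, y - t • (y' - y)⟫ < 1 := by
        rw [Filter.eventually_all_finite hV]
        intro v hv
        by_cases hlt : ⟪v, y⟫ < 1
        · simp only [hlt, true_imp_iff]
          have c1 : ContinuousAt (fun t : ℝ => ⟪v, y + t • (y' - y)⟫) 0 := by fun_prop
          have c2 : ContinuousAt (fun t : ℝ => ⟪v, y - t • (y' - y)⟫) 0 := by fun_prop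
          exact (c1.eventually_lt_const (by simpa using hlt)).and
            (c2.eventually_lt_const (by simpa using hlt))
        · simp [hlt]
      obtain ⟨t, ht, ht0⟩ := ((h1.filter_mono nhdsWithin_le_nhds).and
        (self_mem_nhdsWithin (s := Ioi (0 : ℝ)))).exists
      have ht0 : 0 < t := ht0
      have hact : ∀ v ∈ V, ¬ ⟪v, y⟫ < 1 → ⟪v, y' - y⟫ = 0 := fun v hv hlt => by
        have e1 : ⟪v, y⟫ = 1 := le_antisymm (hyS v hv) (not_lt.1 hlt)
        have e2 : v ∈ {v ∈ V | ⟪v, y'⟫ = 1} := by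
          have : v ∈ {v ∈ V | ⟪v, y⟫ = 1} := ⟨hv, e1⟩
          exact (Set.ext_iff.1 heq v).1 this
        rw [inner_sub_right, e1, e2.2, sub_self]
      have hmem1 : y + t • (y' - y) ∈ S := fun v hv => by
        by_cases hlt : ⟪v, y⟫ < 1
        · exact (ht v hv hlt).1.le
        · rw [inner_add_right, inner_smul_right, hact v hv hlt]; simpa using hyS v hv
      have hmem2 : y - t • (y' - y) ∈ S := fun v hv => by
        by_cases hlt : ⟪v, y⟫ < 1
        · exact (ht v hv hlt).2.le
        · rw [inner_sub_right, inner_smul_right, hact v hv hlt]; simpa using hyS v hv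
      have h3 := (mem_extremePoints.1 hy).2 _ hmem1 _ hmem2
        ⟨1 / 2, 1 / 2, by norm_num, by norm_num, by norm_num, by module⟩
      have h4 : t • (y' - y) = 0 := by simpa using h3.1
      rcases smul_eq_zero.1 h4 with h5 | h5
      · exact ht0.ne' h5
      · exact hne (sub_eq_zero.1 h5).symm
    refine Set.Finite.of_finite_image (f := fun y => {v ∈ V | ⟪v, y⟫ = 1}) ?_ hinj
    exact hV.finite_subsets.subset (by rintro _ ⟨y, -, rfl⟩; exact sep_subset _ _)
  refine ⟨(hext.toFinset.filter (· ≠ 0)).image fun y => ‖y‖⁻¹ • y, fun u hu => ?_, fun x hx => ?_⟩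
  · obtain ⟨y, hy, rfl⟩ := Finset.mem_image.1 hu
    have : y ≠ 0 := (Finset.mem_filter.1 hy).2
    rw [norm_smul, norm_inv, norm_norm, inv_mul_cancel₀ (norm_ne_zero_iff.2 this)]
  · by_contra hxK
    obtain ⟨y, c, h1, h2⟩ := exists_inner_lt_of_notMem (convex_convexHull ℝ V) hKc.isClosed hxK
    have hc : 0 < c := by simpa using h1 0 (interior_subset h0)
    have hyS : c⁻¹ • y ∈ S := fun v hv => by
      have := h1 v (subset_convexHull ℝ V hv)
      rw [inner_smul_right, real_inner_comm, inv_mul_le_iff₀ hc]; linarith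
    have hxS : S ⊆ {y | ⟪y, x⟫ ≤ 1} := by
      rw [← closure_convexHull_extremePoints hScpt hSconv]
      refine closure_minimal (convexHull_min (fun z hz => ?_) ?_)
        (isClosed_le (by fun_prop) continuous_const)
      · rcases eq_or_ne z 0 with rfl | hz0
        · simp
        have hzn : 0 < ‖z‖ := norm_pos_iff.2 hz0
        have h3 := hx (‖z‖⁻¹ • z) (Finset.mem_image_of_mem _ (by simp [hz, hz0]))
        have h4 : supp K (‖z‖⁻¹ • z) ≤ ‖z‖⁻¹ := supp_le ⟨0, interior_subset h0⟩ fun w hw => by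
          rw [real_inner_smul_left, real_inner_comm]
          exact mul_le_of_le_one_right (by positivity) (hSK z hz.1 w hw)
        rw [real_inner_smul_left] at h3
        have := h3.trans h4
        exact le_of_mul_le_mul_left (by simpa using this) (inv_pos.2 hzn)
      · exact convex_halfSpace_le
          ⟨fun a b => inner_add_left a b x, fun c a => by simp [inner_smul_left]⟩ 1
    have := hxS hyS
    rw [mem_ofPred_eq, real_inner_smul_left, inv_mul_le_iff₀ hc] at this
    linarith

end Support

section Closure
variable {n : ℕ} {ι : Type*} {ν : ι → EuclideanSpace ℝ (Fin n)} {h₀ : ι → ℝ}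

local notation "𝔼" => EuclideanSpace ℝ (Fin n)
local notation "⟪" left "," right "⟫" => inner ℝ left right

theorem chamber_add_smul_self {h : ι → ℝ}
    (h1 : ∀ e ∈ vertexSet ν h₀, ∀ j ∉ range e, ⟪ν j, vert ν e h⟫ ≤ h j) {δ : ℝ} (hδ : 0 < δ) :
    h + δ • h₀ ∈ chamber ν h₀ := by
  intro e he j hj
  rw [map_add, map_smul, inner_add_right, inner_smul_right]
  exact add_lt_add_of_le_of_lt (h1 e he j hj) (mul_lt_mul_of_pos_left (he.2 j hj) hδ)

theorem mem_closure_chamber {h : ι → ℝ}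
    (h1 : ∀ e ∈ vertexSet ν h₀, ∀ j ∉ range e, ⟪ν j, vert ν e h⟫ ≤ h j) :
    h ∈ closure (chamber ν h₀) := by
  have hc : Continuous fun δ : ℝ => h + δ • h₀ := by fun_prop
  have ht : Filter.Tendsto (fun δ : ℝ => h + δ • h₀) (nhdsWithin 0 (Ioi 0)) (nhds h) :=
    tendsto_nhdsWithin_of_tendsto_nhds (by simpa using hc.tendsto 0)
  exact mem_closure_of_tendsto ht
    (Filter.eventually_of_mem self_mem_nhdsWithin fun δ hδ => chamber_add_smul_self h1 hδ)

theorem ChamberData.rpow_add_le_closure {E : Type*} [Fintype ι] [DecidableEq ι] [AddCommGroup E]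
    [Module ℝ E] (D : ChamberData n ι E) (hn : 2 ≤ n) (hF : D.F ∅) (hconv : Convex ℝ D.cone)
    {c h h' : ι → ℝ} (hc : c ∈ closure D.cone) (hh : h ∈ closure D.cone)
    (hh' : h' ∈ closure D.cone) :
    eval h (dd c D.p) ^ (1 / ((n : ℝ) - 1)) + eval h' (dd c D.p) ^ (1 / ((n : ℝ) - 1)) ≤
      eval (h + h') (dd c D.p) ^ (1 / ((n : ℝ) - 1)) := by
  have hn' : (2 : ℝ) ≤ n := by exact_mod_cast hn
  have ha : 0 ≤ 1 / ((n : ℝ) - 1) := one_div_nonneg.2 (by linarith)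
  have hcont : Continuous fun z : (ι → ℝ) × (ι → ℝ) => eval z.1 (dd z.2 D.p) := by
    simp only [eval_dd]
    refine continuous_finsetSum _ fun i _ => ?_
    have := (continuous_eval (pderiv i D.p)).comp (continuous_fst (X := ι → ℝ) (Y := ι → ℝ))
    exact ((continuous_apply i).comp continuous_snd).mul this
  obtain ⟨c', hc', hct⟩ := mem_closure_iff_seq_limit.1 hc
  obtain ⟨x, hx, hxt⟩ := mem_closure_iff_seq_limit.1 hh
  obtain ⟨y, hy, hyt⟩ := mem_closure_iff_seq_limit.1 hh'
  have key : ∀ {z : ℕ → ι → ℝ} {w : ι → ℝ}, Filter.Tendsto z Filter.atTop (nhds w) →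
      Filter.Tendsto (fun k => eval (z k) (dd (c' k) D.p) ^ (1 / ((n : ℝ) - 1))) Filter.atTop
        (nhds (eval w (dd c D.p) ^ (1 / ((n : ℝ) - 1)))) := fun hz =>
    (((hcont.tendsto (_, c)).comp (hz.prodMk_nhds hct))).rpow_const (Or.inr ha)
  exact le_of_tendsto_of_tendsto' ((key hxt).add (key hyt)) (key (hxt.add hyt))
    fun k => D.rpow_add_le hn hF hconv (hc' k) (hx k) (hy k)

theorem poly_mono {h h' : ι → ℝ} (hh : ∀ i, h i ≤ h' i) : poly ν h ⊆ poly ν h' :=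
  fun _ hx i => (hx i).trans (hh i)

theorem poly_smul {t : ℝ} (ht : 0 < t) (h : ι → ℝ) : poly ν (t • h) = t • poly ν h := by
  ext x
  rw [Set.mem_smul_set_iff_inv_smul_mem₀ ht.ne']
  simp only [poly, mem_ofPred_eq, inner_smul_right, inv_mul_le_iff₀ ht, Pi.smul_apply, smul_eq_mul]

theorem volume_real_smul {t : ℝ} (ht : 0 ≤ t) (K : Set 𝔼) :
    volume.real (t • K) = t ^ n * volume.real K := by
  rw [Measure.real, Measure.addHaar_smul, ENNReal.toReal_mul,
    ENNReal.toReal_ofReal (abs_nonneg _), abs_of_nonneg (by simpa using pow_nonneg ht n)]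
  simp [Measure.real]

/-- Boundedness of one polytope with positive heights gives boundedness for all heights. -/
theorem isBounded_poly [Finite ι] {h : ι → ℝ} (hpos : ∀ i, 0 < h i) (hb : IsBounded (poly ν h))
    (h' : ι → ℝ) : IsBounded (poly ν h') := by
  have : Fintype ι := Fintype.ofFinite ι
  have hM : ∀ i, h' i ≤ ((∑ j, |h' j| / h j + 1) • h) i := fun i => by
    have h1 : |h' i| / h i ≤ ∑ j, |h' j| / h j :=
      Finset.single_le_sum (f := fun j => |h' j| / h j)
        (fun j _ => div_nonneg (abs_nonneg _) (hpos j).le) (Finset.mem_univ i)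
    have h2 : |h' i| ≤ (∑ j, |h' j| / h j) * h i := (div_le_iff₀ (hpos i)).1 h1
    simp only [Pi.smul_apply, smul_eq_mul]
    nlinarith [le_abs_self (h' i), hpos i]
  refine IsBounded.subset ?_ (poly_mono hM)
  have : 0 ≤ ∑ j, |h' j| / h j := Finset.sum_nonneg fun j _ => div_nonneg (abs_nonneg _) (hpos j).le
  rw [poly_smul (by linarith)]
  exact hb.smul₀ _

/-- The volume polynomial computes volumes on the closed chamber. -/
theorem volume_poly_eq_eval [Finite ι] {p : MvPolynomial ι ℝ} (hb : ∀ h, IsBounded (poly ν h))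
    (hp : ∀ h ∈ chamber ν h₀, volume.real (poly ν h) = eval h p) (h₀pos : ∀ i, 0 < h₀ i)
    {h : ι → ℝ} (hpos : ∀ i, 0 < h i)
    (h1 : ∀ e ∈ vertexSet ν h₀, ∀ j ∉ range e, ⟪ν j, vert ν e h⟫ ≤ h j) :
    volume.real (poly ν h) = eval h p := by
  have : Fintype ι := Fintype.ofFinite ι
  set C := ∑ j, h₀ j / h j
  have hC : 0 ≤ C := Finset.sum_nonneg fun j _ => div_nonneg (h₀pos j).le (hpos j).le
  have hCle : ∀ i, h₀ i ≤ C * h i := fun i => (div_le_iff₀ (hpos i)).1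
    (Finset.single_le_sum (f := fun j => h₀ j / h j)
      (fun j _ => div_nonneg (h₀pos j).le (hpos j).le) (Finset.mem_univ i))
  have hfin : ∀ h, volume (poly ν h) ≠ ⊤ := fun h => (hb h).measure_lt_top.ne
  have hlow : ∀ δ : ℝ, 0 < δ → volume.real (poly ν h) ≤ eval (h + δ • h₀) p := fun δ hδ => by
    rw [← hp _ (chamber_add_smul_self h1 hδ)]
    refine measureReal_mono (poly_mono fun i => ?_) (hfin _)
    simp only [Pi.add_apply, Pi.smul_apply, smul_eq_mul]
    nlinarith [h₀pos i]
  have hup : ∀ δ : ℝ, 0 < δ → eval (h + δ • h₀) p ≤ (1 + δ * C) ^ n * volume.real (poly ν h) := fun δ hδ => by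
    rw [← hp _ (chamber_add_smul_self h1 hδ), ← volume_real_smul (by positivity),
      ← poly_smul (by positivity)]
    refine measureReal_mono (poly_mono fun i => ?_) (hfin _)
    simp only [Pi.add_apply, Pi.smul_apply, smul_eq_mul]
    nlinarith [hCle i, mul_le_mul_of_nonneg_left (hCle i) hδ.le]
  have hlim : Filter.Tendsto (fun δ : ℝ => eval (h + δ • h₀) p) (nhdsWithin 0 (Ioi 0))
      (nhds (eval h p)) := by
    have hc : Continuous fun δ : ℝ => eval (h + δ • h₀) p :=
      (continuous_eval p).comp (by fun_prop : Continuous fun δ : ℝ => h + δ • h₀)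
    exact tendsto_nhdsWithin_of_tendsto_nhds (by simpa using hc.tendsto 0)
  have hlim2 : Filter.Tendsto (fun δ : ℝ => (1 + δ * C) ^ n * volume.real (poly ν h))
      (nhdsWithin 0 (Ioi 0)) (nhds (volume.real (poly ν h))) := by
    have hc : Continuous fun δ : ℝ => (1 + δ * C) ^ n * volume.real (poly ν h) := by fun_prop
    exact tendsto_nhdsWithin_of_tendsto_nhds (by simpa using hc.tendsto 0)
  refine le_antisymm (ge_of_tendsto hlim ?_) (le_of_tendsto_of_tendsto hlim hlim2 ?_)
  · exact Filter.eventually_of_mem self_mem_nhdsWithin fun δ hδ => hlow δ hδ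
  · exact Filter.eventually_of_mem self_mem_nhdsWithin fun δ hδ => hup δ hδ

/-- Generic heights near given heights. -/
theorem exists_generic [Finite ι] (ν : ι → 𝔼) {U : Set (ι → ℝ)} (hU : IsOpen U)
    (hne : U.Nonempty) : ∃ h ∈ U, ∀ e : Fin n → ι, LinearIndependent ℝ (ν ∘ e) →
      ∀ j ∉ range e, ⟪ν j, vert ν e h⟫ ≠ h j := by
  classical
  have : Fintype ι := Fintype.ofFinite ι
  have hae : ∀ᵐ h : ι → ℝ, ∀ e : Fin n → ι, ∀ j, j ∉ range e → ⟪ν j, vert ν e h⟫ ≠ h j := by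
    rw [ae_all_iff]; intro e
    rw [ae_all_iff]; intro j
    by_cases hj : j ∈ range e
    · simp [hj]
    let L : (ι → ℝ) →ₗ[ℝ] ℝ := (innerₛₗ ℝ (ν j)).comp (vert ν e) - LinearMap.proj j
    have hL : L (Pi.single j 1) = -1 := by
      have : vert ν e (Pi.single j 1) = 0 := by
        simp only [vert, LinearMap.sum_apply, LinearMap.smulRight_apply, LinearMap.proj_apply]
        refine Finset.sum_eq_zero fun k _ => ?_
        rw [Pi.single_eq_of_ne (fun hk => hj ⟨k, hk⟩), zero_smul]
      simp [L, this]
    have h0 : volume (LinearMap.ker L : Set (ι → ℝ)) = 0 := by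
      refine Measure.addHaar_submodule _ _ fun htop => ?_
      have : Pi.single j (1 : ℝ) ∈ LinearMap.ker L := htop ▸ Submodule.mem_top
      rw [LinearMap.mem_ker, hL] at this
      norm_num at this
    filter_upwards [measure_eq_zero_iff_ae_notMem.1 h0] with h hh _ heq
    exact hh (by simp [L, heq])
  obtain ⟨h, hhU, hh⟩ := (Measure.dense_of_ae hae).exists_mem_open hU hne
  exact ⟨h, hh, fun e _ j hj => hhU e j hj⟩

end Closure

section PolytopeGBM
variable {n : ℕ}

local notation "𝔼" => EuclideanSpace ℝ (Fin n)
local notation "⟪" left "," right "⟫" => inner ℝ left right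

/-- The chamber of a generic perturbation of `hK + hQ` contains `hK` and `hQ` in its closure,
provided the polytope of `hK + hQ` is a Minkowski sum. -/
theorem exists_isSimple {ι : Type*} [Finite ι] {ν : ι → 𝔼} {hK hQ : ι → ℝ} {K Q : Set 𝔼}
    (hpos : ∀ i, 0 < (hK + hQ) i) (hb : ∀ h, IsBounded (poly ν h))
    (hK1 : K ⊆ poly ν hK) (hQ1 : Q ⊆ poly ν hQ) (hsum : poly ν (hK + hQ) ⊆ K + Q) :
    ∃ h₀, IsSimple ν h₀ ∧ (∀ i, 0 < h₀ i) ∧ ∀ e ∈ vertexSet ν h₀, ∀ j,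
      ⟪ν j, vert ν e hK⟫ ≤ hK j ∧ ⟪ν j, vert ν e hQ⟫ ≤ hQ j := by
  have : Fintype ι := Fintype.ofFinite ι
  set hR := hK + hQ with hR_def
  let U : Set (ι → ℝ) := (⋂ i, {h | 0 < h i}) ∩
    ⋂ e : Fin n → ι, ⋂ j, {h | hR j < ⟪ν j, vert ν e hR⟫ → h j < ⟪ν j, vert ν e h⟫}
  have hU : IsOpen U := by
    refine (isOpen_iInter_of_finite fun i => isOpen_lt continuous_const (continuous_apply i)).inter
      (isOpen_iInter_of_finite fun e => isOpen_iInter_of_finite fun j => ?_)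
    by_cases hlt : hR j < ⟪ν j, vert ν e hR⟫
    · simp only [hlt, true_imp_iff]
      have : Continuous (vert ν e) := LinearMap.continuous_of_finiteDimensional _
      exact isOpen_lt (continuous_apply j) (by fun_prop)
    · simp [hlt]
  obtain ⟨h₀, ⟨h1, h2⟩, hgen⟩ := exists_generic ν hU
    ⟨hR, mem_iInter.2 hpos, mem_iInter.2 fun e => mem_iInter.2 fun j h => h⟩
  have h1 : ∀ i, 0 < h₀ i := fun i => mem_iInter.1 h1 i
  refine ⟨h₀, ⟨hb, ⟨0, fun i => by simpa using (h1 i).le⟩, hgen⟩, h1, fun e he => ?_⟩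
  have hmem : vert ν e hR ∈ poly ν hR := fun i => by
    by_cases hi : i ∈ range e
    · obtain ⟨k, rfl⟩ := hi
      exact (inner_vert he.1 hR k).le
    · by_contra! hlt
      exact (he.2 i hi).not_gt ((mem_iInter.1 (mem_iInter.1 h2 e) i) hlt)
  obtain ⟨k, hk, q, hq, hkq⟩ := hsum hmem
  have hkq : k + q = vert ν e hR := hkq
  have hact : ∀ l, ⟪ν (e l), k⟫ = hK (e l) ∧ ⟪ν (e l), q⟫ = hQ (e l) := fun l => by
    have e1 := inner_vert he.1 hR l
    rw [← hkq, inner_add_right, hR_def, Pi.add_apply] at e1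
    have e2 := hK1 hk (e l)
    have e3 := hQ1 hq (e l)
    constructor <;> linarith
  have ek : k = vert ν e hK := eq_vert he.1 fun l => (hact l).1
  have eq : q = vert ν e hQ := eq_vert he.1 fun l => (hact l).2
  exact fun j => ⟨ek ▸ hK1 hk j, eq ▸ hQ1 hq j⟩

/-- The generalized Brunn-Minkowski inequality for the derivative of the volume of Minkowski sums
of two polytopes. -/
theorem exists_polytope_gbm (hn : 2 ≤ n) {V W : Set 𝔼} (hV : V.Finite) (hW : W.Finite)
    (h0V : (0 : 𝔼) ∈ interior (convexHull ℝ V)) (h0W : (0 : 𝔼) ∈ interior (convexHull ℝ W)) :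
    ∃ (N : Finset 𝔼) (f g : ℝ → ℝ), (∀ u ∈ N, ‖u‖ = 1) ∧
      (∀ s ∈ Icc (0 : ℝ) 1, poly (fun u : N => (u : 𝔼))
        (fun u => supp (convexHull ℝ V) u + s * supp (convexHull ℝ W) u) =
          convexHull ℝ V + s • convexHull ℝ W) ∧
      (∀ s ∈ Icc (0 : ℝ) 1, volume.real (convexHull ℝ V + s • convexHull ℝ W) = f s) ∧
      (∀ s, HasDerivAt f (g s) s) ∧
      (∀ s ∈ Icc (0 : ℝ) 1, 0 ≤ g s ∧ g s ^ (1 / ((n : ℝ) - 1)) +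
        (1 - s) * (n * volume.real (convexHull ℝ W)) ^ (1 / ((n : ℝ) - 1)) ≤
          g 1 ^ (1 / ((n : ℝ) - 1))) := by
  classical
  set K := convexHull ℝ V with hKdef
  set Q := convexHull ℝ W with hQdef
  have hKc : IsCompact K := hV.isCompact_convexHull ℝ
  have hQc : IsCompact Q := hW.isCompact_convexHull ℝ
  have hKb := hKc.isBounded
  have hQb := hQc.isBounded
  have hKn : K.Nonempty := ⟨0, interior_subset h0V⟩
  have hQn : Q.Nonempty := ⟨0, interior_subset h0W⟩
  have hsumc : convexHull ℝ (V + W) = K + Q := convexHull_add V W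
  have h0 : (0 : 𝔼) ∈ interior (convexHull ℝ (V + W)) := by
    rw [hsumc]
    have hsub : K ⊆ K + Q := fun x hx => ⟨x, hx, 0, interior_subset h0W, add_zero x⟩
    exact interior_mono hsub h0V
  obtain ⟨N, hN1, hN⟩ := exists_facet_normals (hV.add hW) h0
  rw [hsumc] at hN
  set ν : N → 𝔼 := fun u => (u : 𝔼) with hν
  set hK : N → ℝ := fun u => supp K u with hKd
  set hQ : N → ℝ := fun u => supp Q u with hQd
  have hne : ∀ u : N, (u : 𝔼) ≠ 0 := fun u => norm_ne_zero_iff.1 (by rw [hN1 u u.2]; norm_num)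
  have hKp : ∀ i, 0 < hK i := fun u => supp_pos hKb h0V (hne u)
  have hQp : ∀ i, 0 < hQ i := fun u => supp_pos hQb h0W (hne u)
  have hK1 : K ⊆ poly ν hK := fun x hx u => inner_le_supp hKb _ hx
  have hQ1 : Q ⊆ poly ν hQ := fun x hx u => inner_le_supp hQb _ hx
  have hsum : poly ν (hK + hQ) ⊆ K + Q := fun x hx => hN x fun u hu => by
    rw [supp_add hKb hQb hKn hQn]; exact hx ⟨u, hu⟩
  have hRp : ∀ i, 0 < (hK + hQ) i := fun i => add_pos (hKp i) (hQp i)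
  have hb : ∀ h, IsBounded (poly ν h) := isBounded_poly hRp ((hKb.add hQb).subset hsum)
  obtain ⟨h₀, hs, h₀p, hvert⟩ := exists_isSimple hRp hb hK1 hQ1 hsum
  obtain ⟨D, hDc, hDF, hDp⟩ := hs.exists_chamberData
  have hpath : ∀ s ∈ Icc (0 : ℝ) 1, poly ν (hK + s • hQ) = K + s • Q := by
    intro s hs
    refine Subset.antisymm (subset_of_add_subset_add (C := (1 - s) • Q) ?_ ?_ ?_ (hQb.smul₀ _)
      (hQn.image _) ?_) ?_
    · exact (convex_convexHull ℝ V).add ((convex_convexHull ℝ W).smul s)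
    · exact (hKc.add (hQc.smul s)).isClosed
    · exact hKb.add (hQb.smul₀ s)
    · rw [add_assoc, ← (convex_convexHull ℝ W).add_smul hs.1 (by linarith [hs.2]),
        add_sub_cancel, one_smul]
      refine Subset.trans ?_ hsum
      rintro _ ⟨x, hx, _, ⟨q, hq, rfl⟩, rfl⟩ i
      have e1 := hx i
      have e2 := mul_le_mul_of_nonneg_left (hQ1 hq i) (show 0 ≤ 1 - s by linarith [hs.2])
      simp only [Pi.add_apply, Pi.smul_apply, smul_eq_mul] at e1 ⊢
      rw [inner_add_right, inner_smul_right]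
      linarith
    · rintro _ ⟨x, hx, _, ⟨q, hq, rfl⟩, rfl⟩ i
      simp only [Pi.add_apply, Pi.smul_apply, smul_eq_mul]
      rw [inner_add_right, inner_smul_right]
      exact add_le_add (hK1 hx i) (mul_le_mul_of_nonneg_left (hQ1 hq i) hs.1)
  have hcl : ∀ a b : ℝ, 0 ≤ a → 0 ≤ b → ∀ e ∈ vertexSet ν h₀, ∀ j ∉ range e,
      ⟪ν j, vert ν e (a • hK + b • hQ)⟫ ≤ (a • hK + b • hQ) j := by
    intro a b ha hb e he j _
    rw [map_add, map_smul, map_smul, inner_add_right, inner_smul_right, inner_smul_right]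
    exact add_le_add (mul_le_mul_of_nonneg_left (hvert e he j).1 ha)
      (mul_le_mul_of_nonneg_left (hvert e he j).2 hb)
  have hmemcl : ∀ a b : ℝ, 0 ≤ a → 0 ≤ b → a • hK + b • hQ ∈ closure D.cone := fun a b ha hb =>
    hDc ▸ mem_closure_chamber (hcl a b ha hb)
  have hder : ∀ s : ℝ, HasDerivAt (fun t : ℝ => eval (hK + t • hQ) D.p)
      (eval (hK + s • hQ) (dd hQ D.p)) s := fun s => hasDerivAt_eval hK hQ D.p s
  have hvol : ∀ s ∈ Icc (0 : ℝ) 1, volume.real (K + s • Q) = eval (hK + s • hQ) D.p := fun s hs => by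
    rw [← hpath s hs]
    refine volume_poly_eq_eval hb hDp h₀p (fun i => ?_) ?_
    · exact add_pos_of_pos_of_nonneg (hKp i) (mul_nonneg hs.1 (hQp i).le)
    · simpa using hcl 1 s zero_le_one hs.1
  have hQvol : volume.real Q ≤ eval hQ D.p := by
    rw [← volume_poly_eq_eval hb hDp h₀p hQp (by simpa using hcl 0 1 le_rfl zero_le_one)]
    exact measureReal_mono hQ1 (hb _).measure_lt_top.ne
  have hn' : (2 : ℝ) ≤ n := by exact_mod_cast hn
  have hn1 : ((n - 1 : ℕ) : ℝ) = n - 1 := by rw [Nat.cast_sub (by omega)]; simp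
  have hgpos : ∀ s : ℝ, 0 ≤ s → 0 ≤ eval (hK + s • hQ) (dd hQ D.p) := by
    intro s hs
    have hcont : Continuous fun z : (N → ℝ) × (N → ℝ) => eval z.1 (dd z.2 D.p) := by
      simp only [eval_dd]
      refine continuous_finsetSum _ fun i _ => ?_
      have := (continuous_eval (pderiv i D.p)).comp (continuous_fst (X := N → ℝ) (Y := N → ℝ))
      exact ((continuous_apply i).comp continuous_snd).mul this
    obtain ⟨c, hc, hct⟩ := mem_closure_iff_seq_limit.1 (hmemcl 0 1 le_rfl zero_le_one)
    obtain ⟨x, hx, hxt⟩ := mem_closure_iff_seq_limit.1 (hmemcl 1 s zero_le_one hs)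
    rw [zero_smul, zero_add, one_smul] at hct
    rw [one_smul] at hxt
    exact ge_of_tendsto' ((hcont.tendsto (_, hQ)).comp (hxt.prodMk_nhds hct)) fun k =>
      (D.pos [] (by simp) (by simpa using hDF) (by simp; omega) _ (hx k) _ (hc k)).le
  refine ⟨N, _, _, hN1, hpath, hvol, hder, fun s hs => ⟨hgpos s hs.1, ?_⟩⟩
  have hs1 : 0 ≤ 1 - s := by linarith [hs.2]
  have key := D.rpow_add_le_closure hn hDF (hDc ▸ convex_chamber) (c := hQ) (h := hK + s • hQ)
    (h' := (1 - s) • hQ) (by simpa using hmemcl 0 1 le_rfl zero_le_one)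
    (by simpa using hmemcl 1 s zero_le_one hs.1) (by simpa using hmemcl 0 (1 - s) le_rfl hs1)
  have e1 : hK + s • hQ + (1 - s) • hQ = hK + (1 : ℝ) • hQ := by module
  rw [e1, eval_smul_of_isHomogeneous (isHomogeneous_dd D.homog hQ), eval_dd_self D.homog] at key
  refine le_trans (add_le_add le_rfl ?_) key
  have hQ0 : 0 ≤ volume.real Q := measureReal_nonneg
  have hexp : 0 ≤ 1 / ((n : ℝ) - 1) := one_div_nonneg.2 (by linarith)
  have e2 : (1 - s) = ((1 - s) ^ (n - 1)) ^ (1 / ((n : ℝ) - 1)) := by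
    rw [← Real.rpow_natCast, ← Real.rpow_mul hs1, hn1, mul_one_div_cancel (by linarith),
      Real.rpow_one]
  conv_lhs => rw [e2]
  rw [← Real.mul_rpow (by positivity) (by positivity)]
  exact Real.rpow_le_rpow (by positivity) (by gcongr) hexp

end PolytopeGBM

section Relation

theorem hausdorffMeasure_le_of_rel {X Y : Type*} [MetricSpace X] [MeasurableSpace X]
    [BorelSpace X] [MetricSpace Y] [MeasurableSpace Y] [BorelSpace Y] {d : ℝ} (hd : 0 ≤ d)
    {A : Set X} {B : Set Y} (R : X → Y → Prop) (h1 : ∀ a ∈ A, ∃ b ∈ B, R a b)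
    (h2 : ∀ a b a' b', R a b → R a' b' → dist a a' ≤ dist b b') : μH[d] A ≤ μH[d] B := by
  rcases A.eq_empty_or_nonempty with rfl | ⟨a₀, ha₀⟩
  · simp
  have : Nonempty X := ⟨a₀⟩
  obtain ⟨b₀, -, -⟩ := h1 a₀ ha₀
  have h1' : ∀ a, ∃ b, a ∈ A → b ∈ B ∧ R a b := fun a => by
    by_cases ha : a ∈ A
    · obtain ⟨b, hb, hr⟩ := h1 a ha; exact ⟨b, fun _ => ⟨hb, hr⟩⟩
    · exact ⟨b₀, fun h => absurd h ha⟩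
  choose f hf using h1'
  have hinj : InjOn f A := fun a ha a' ha' h => by
    have := h2 a _ a' _ (hf a ha).2 (hf a' ha').2
    rw [h, dist_self] at this
    exact dist_le_zero.1 this
  have hg : LipschitzOnWith 1 (Function.invFunOn f A) (f '' A) := by
    refine LipschitzOnWith.of_dist_le_mul ?_
    rintro _ ⟨a, ha, rfl⟩ _ ⟨a', ha', rfl⟩
    rw [hinj.leftInvOn_invFunOn ha, hinj.leftInvOn_invFunOn ha', NNReal.coe_one, one_mul]
    exact h2 _ _ _ _ (hf a ha).2 (hf a' ha').2
  calc μH[d] A = μH[d] (Function.invFunOn f A '' (f '' A)) := by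
        rw [hinj.leftInvOn_invFunOn.image_image]
    _ ≤ (1 : ℝ≥0) ^ d * μH[d] (f '' A) := hg.hausdorffMeasure_image_le hd
    _ ≤ μH[d] B := by
        rw [ENNReal.coe_one, ENNReal.one_rpow, one_mul]
        refine measure_mono ?_
        rintro _ ⟨a, ha, rfl⟩
        exact (hf a ha).1

end Relation

section Normals
variable {n : ℕ}

local notation "𝔼" => EuclideanSpace ℝ (Fin n)
local notation "⟪" left "," right "⟫" => inner ℝ left right

theorem volume_le_of_rel {A B : Set 𝔼} (R : 𝔼 → 𝔼 → Prop) (h1 : ∀ a ∈ A, ∃ b ∈ B, R a b)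
    (h2 : ∀ a b a' b', R a b → R a' b' → dist a a' ≤ dist b b') : volume A ≤ volume B := by
  have hH : (μH[(Module.finrank ℝ 𝔼 : ℝ)] : Measure 𝔼).IsAddHaarMeasure := inferInstance
  have h := hausdorffMeasure_le_of_rel (d := (Module.finrank ℝ 𝔼 : ℝ)) (by positivity) R h1 h2
  rw [Measure.isAddLeftInvariant_eq_smul (volume : Measure 𝔼)
    (μH[(Module.finrank ℝ 𝔼 : ℝ)] : Measure 𝔼)]
  simp only [Measure.smul_apply]
  gcongr

/-- `w` is an outer normal vector of `K` at `b ∈ K`. -/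
def IsNormal (K : Set 𝔼) (b w : 𝔼) : Prop := b ∈ K ∧ ∀ x ∈ K, ⟪w, x - b⟫ ≤ 0

theorem IsNormal.inner_nonneg {K : Set 𝔼} {b w b' w' : 𝔼} (h : IsNormal K b w)
    (h' : IsNormal K b' w') : 0 ≤ ⟪b - b', w - w'⟫ := by
  have h1 := h.2 b' h'.1
  have h2 := h'.2 b h.1
  rw [inner_sub_right] at h1 h2
  rw [inner_sub_right, real_inner_comm w, real_inner_comm w', inner_sub_right, inner_sub_right]
  linarith

theorem IsNormal.dist_le {K : Set 𝔼} {b w b' w' : 𝔼} (h : IsNormal K b w)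
    (h' : IsNormal K b' w') : dist b b' ≤ dist (b + w) (b' + w') := by
  have h1 := h.inner_nonneg h'
  rw [dist_eq_norm, dist_eq_norm, show b + w - (b' + w') = (b - b') + (w - w') by abel]
  refine le_of_sq_le_sq ?_ (norm_nonneg _)
  rw [norm_add_sq_real]
  nlinarith [sq_nonneg ‖w - w'‖]

theorem IsNormal.dist_sub_le {K : Set 𝔼} {b w b' w' : 𝔼} (h : IsNormal K b w)
    (h' : IsNormal K b' w') : dist (b - w) (b' - w') ≤ dist (b + w) (b' + w') := by
  have h1 := h.inner_nonneg h'
  rw [dist_eq_norm, dist_eq_norm, show b + w - (b' + w') = (b - b') + (w - w') by abel,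
    show b - w - (b' - w') = (b - b') - (w - w') by abel]
  refine le_of_sq_le_sq ?_ (norm_nonneg _)
  rw [norm_add_sq_real, norm_sub_sq_real]
  linarith

theorem exists_isNormal {K : Set 𝔼} (hK : Convex ℝ K)
    (hi : (interior K).Nonempty) {b : 𝔼} (hb : b ∉ interior K) :
    ∃ w, ‖w‖ = 1 ∧ ∀ x ∈ K, ⟪w, x - b⟫ ≤ 0 := by
  obtain ⟨f, hf⟩ := geometric_hahn_banach_open_point hK.interior isOpen_interior hb
  set y := (InnerProductSpace.toDual ℝ 𝔼).symm f with hy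
  have hfy : ∀ x, f x = ⟪y, x⟫ := fun x => by simp [hy]
  obtain ⟨z, hz⟩ := hi
  have hy0 : y ≠ 0 := by
    rintro h
    have := hf z hz
    simp [hfy, h] at this
  refine ⟨‖y‖⁻¹ • y, ?_, fun x hx => ?_⟩
  · rw [norm_smul, norm_inv, norm_norm, inv_mul_cancel₀ (norm_ne_zero_iff.2 hy0)]
  · rw [inner_smul_left, inner_sub_right]
    have h1 : x ∈ closure (interior K) := by
      rw [hK.closure_interior_eq_closure_of_nonempty_interior ⟨z, hz⟩]
      exact subset_closure hx
    have h2 : closure (interior K) ⊆ {x | f x ≤ f b} :=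
      closure_minimal (fun a ha => (hf a ha).le) (isClosed_le f.continuous continuous_const)
    have h3 : f x ≤ f b := h2 h1
    rw [hfy, hfy] at h3
    have : 0 ≤ ‖y‖⁻¹ := by positivity
    simp only [conj_trivial]
    nlinarith

theorem exists_mem_frontier_ray {L : Set 𝔼} (hL : IsBounded L) {b w : 𝔼} (hb : b ∈ closure L)
    (hw : w ≠ 0) : ∃ t : ℝ, 0 ≤ t ∧ b + t • w ∈ frontier L := by
  set T : Set ℝ := {t | 0 ≤ t ∧ b + t • w ∈ closure L} with hT
  have hTc : IsClosed T := (isClosed_Ici).inter (isClosed_closure.preimage (by fun_prop))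
  obtain ⟨M, hM⟩ := hL.closure.exists_norm_le
  have hTb : BddAbove T := by
    refine ⟨(M + ‖b‖) / ‖w‖, fun t ht => ?_⟩
    rw [le_div_iff₀ (norm_pos_iff.2 hw)]
    calc t * ‖w‖ = ‖(b + t • w) - b‖ := by
          rw [add_sub_cancel_left, norm_smul, Real.norm_of_nonneg ht.1]
      _ ≤ ‖b + t • w‖ + ‖b‖ := norm_sub_le _ _
      _ ≤ M + ‖b‖ := by gcongr; exact hM _ ht.2
  have hTn : T.Nonempty := ⟨0, le_rfl, by simpa using hb⟩
  have hmem := hTc.csSup_mem hTn hTb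
  refine ⟨sSup T, hmem.1, hmem.2, fun h_interior => ?_⟩
  have hcont : ContinuousAt (fun t : ℝ => b + t • w) (sSup T) := by fun_prop
  have hev : ∀ᶠ t in nhds (sSup T), b + t • w ∈ L :=
    hcont.eventually (mem_interior_iff_mem_nhds.1 h_interior)
  obtain ⟨ε, hε, hball⟩ := Metric.eventually_nhds_iff.1 hev
  have h1 := hball (y := sSup T + ε / 2) (by
    rw [Real.dist_eq, add_sub_cancel_left, abs_of_pos (half_pos hε)]; exact half_lt_self hε)
  have h2 := le_csSup hTb (show sSup T + ε / 2 ∈ T from ⟨by linarith [hmem.1], subset_closure h1⟩)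
  linarith

/-- Monotonicity of the surface measure for nested convex sets. -/
theorem hausdorffMeasure_frontier_mono {d : ℝ} (hd : 0 ≤ d) {K L : Set 𝔼} (hK : Convex ℝ K)
    (hc : IsClosed K) (hi : (interior K).Nonempty) (hL : IsBounded L) (hKL : K ⊆ closure L) :
    μH[d] (frontier K) ≤ μH[d] (frontier L) := by
  refine hausdorffMeasure_le_of_rel hd
    (fun b y => ∃ w, IsNormal K b w ∧ y = b + w) (fun b hb => ?_) ?_
  · obtain ⟨w, hw, hn⟩ := exists_isNormal hK hi hb.2
    have hbK : b ∈ K := hc.frontier_subset hb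
    obtain ⟨t, ht, h⟩ := exists_mem_frontier_ray hL (hKL hbK)
      (show w ≠ 0 by rintro rfl; simp at hw)
    refine ⟨_, h, t • w, ⟨hbK, fun x hx => ?_⟩, rfl⟩
    rw [real_inner_smul_left]
    exact mul_nonpos_of_nonneg_of_nonpos ht (hn x hx)
  · rintro a _ a' _ ⟨w, hw, rfl⟩ ⟨w', hw', rfl⟩
    exact hw.dist_le hw'

/-- The inner parallel set. -/
def innerPar (K : Set 𝔼) (t : ℝ) : Set 𝔼 := {x | closedBall x t ⊆ K}

theorem innerPar_subset (K : Set 𝔼) {t : ℝ} (ht : 0 ≤ t) : innerPar K t ⊆ K :=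
  fun _ hx => hx (mem_closedBall_self ht)

/-- The inner tube has at most the volume of the outer tube. -/
theorem volume_diff_innerPar_le {K : Set 𝔼} (hK : Convex ℝ K) (hc : IsClosed K)
    (hi : (interior K).Nonempty) {ε : ℝ} :
    volume (K \ innerPar K ε) ≤ volume ((K + closedBall 0 ε) \ K) := by
  have h0 : volume (frontier K) = 0 := hK.addHaar_frontier volume
  calc volume (K \ innerPar K ε) ≤ volume (interior K \ innerPar K ε) + volume (frontier K) := by
        refine (measure_mono fun x hx => ?_).trans (measure_union_le _ _)
        by_cases hxi : x ∈ interior K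
        · exact Or.inl ⟨hxi, hx.2⟩
        · exact Or.inr ⟨subset_closure hx.1, hxi⟩
    _ = volume (interior K \ innerPar K ε) := by rw [h0, add_zero]
    _ ≤ _ := ?_
  refine volume_le_of_rel
    (fun a y => ∃ b w, IsNormal K b w ∧ a = b - w ∧ y = b + w) (fun a ha => ?_) ?_
  · have hne : Kᶜ.Nonempty := by
      obtain ⟨z, hz, hzK⟩ := not_subset.1 ha.2
      exact ⟨z, hzK⟩
    obtain ⟨z, hz, hzK⟩ := not_subset.1 ha.2
    obtain ⟨b, hbm, hbd⟩ := (isClosed_closure (s := Kᶜ)).exists_infDist_eq_dist hne.closure a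
    have hbi : b ∉ interior K := by rwa [closure_compl] at hbm
    have hlt : ball a (dist a b) ⊆ interior K := fun x hx => by
      by_contra hxi
      have : x ∈ closure Kᶜ := by rwa [closure_compl]
      have h1 := infDist_le_dist_of_mem (x := a) this
      rw [hbd] at h1
      rw [mem_ball, dist_comm] at hx
      linarith
    have hab : a ≠ b := fun h => hbi (h ▸ ha.1)
    have hpos : 0 < dist a b := dist_pos.2 hab
    have hdle : dist a b ≤ ε := by
      rw [← hbd]
      refine (infDist_le_dist_of_mem (x := a) (subset_closure hzK)).trans ?_
      rw [dist_comm]; exact hz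
    have hbK : b ∈ K := by
      have : b ∈ closure (ball a (dist a b)) := by
        rw [closure_ball _ hpos.ne', mem_closedBall, dist_comm]
      exact hc.closure_subset_iff.2 (hlt.trans interior_subset) this
    obtain ⟨u, hu, hun⟩ := exists_isNormal hK hi hbi
    set δ := dist a b with hδ
    -- the whole ball lies in the half-space of the normal, hence `b = a + δ u`
    have h1 : a + δ • u ∈ K := by
      have : a + δ • u ∈ closure (ball a δ) := by
        rw [closure_ball _ hpos.ne', mem_closedBall, dist_eq_norm, add_sub_cancel_left, norm_smul,
          hu, Real.norm_of_nonneg hpos.le, mul_one]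
      exact hc.closure_subset_iff.2 (hlt.trans interior_subset) this
    have h2 := hun _ h1
    have h3 : δ ≤ ⟪u, b - a⟫ := by
      rw [show a + δ • u - b = δ • u - (b - a) by abel, inner_sub_right, inner_smul_right,
        real_inner_self_eq_norm_sq, hu] at h2
      linarith
    have h4 : b - a = δ • u := by
      have h5 : ‖b - a‖ = δ := by rw [hδ, dist_comm, dist_eq_norm]
      have h6 : ‖(b - a) - δ • u‖ ^ 2 ≤ 0 := by
        rw [norm_sub_sq_real, inner_smul_right, norm_smul, hu, h5, Real.norm_of_nonneg hpos.le,
          real_inner_comm]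
        nlinarith
      have h7 : ‖(b - a) - δ • u‖ = 0 := by
        have := norm_nonneg ((b - a) - δ • u); nlinarith
      exact sub_eq_zero.1 (norm_eq_zero.1 h7)
    refine ⟨b + δ • u, ⟨⟨b, hbK, δ • u, ?_, rfl⟩, fun hK' => ?_⟩, b, δ • u, ⟨hbK, fun x hx => ?_⟩,
      ?_, rfl⟩
    · rw [mem_closedBall_zero_iff, norm_smul, hu, Real.norm_of_nonneg hpos.le, mul_one]
      exact hdle
    · have := hun _ hK'
      rw [add_sub_cancel_left, inner_smul_right, real_inner_self_eq_norm_sq, hu] at this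
      linarith
    · rw [real_inner_smul_left]
      exact mul_nonpos_of_nonneg_of_nonpos hpos.le (hun x hx)
    · rw [← h4]; abel
  · rintro _ _ _ _ ⟨b, w, hw, rfl, rfl⟩ ⟨b', w', hw', rfl, rfl⟩
    exact hw.dist_sub_le hw'

end Normals

section Prism

/-- The right prism over the part `A` of the hyperplane `⟪ν, x⟫ = c` with heights in `I`. -/
def prism {n : ℕ} (ν : EuclideanSpace ℝ (Fin n)) (c : ℝ) (A : Set (EuclideanSpace ℝ (Fin n)))
    (I : Set ℝ) : Set (EuclideanSpace ℝ (Fin n)) :=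
  {x | x - (inner ℝ ν x - c) • ν ∈ A ∧ inner ℝ ν x - c ∈ I}

theorem measurableSet_prism {n : ℕ} (ν : EuclideanSpace ℝ (Fin n)) (c : ℝ)
    {A : Set (EuclideanSpace ℝ (Fin n))} {I : Set ℝ} (hA : MeasurableSet A)
    (hI : MeasurableSet I) : MeasurableSet (prism ν c A I) := by
  refine MeasurableSet.inter ?_ ?_
  · exact (show Continuous fun x : EuclideanSpace ℝ (Fin n) => x - (inner ℝ ν x - c) • ν by
      fun_prop).measurable hA
  · exact (show Continuous fun x : EuclideanSpace ℝ (Fin n) => inner ℝ ν x - c by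
      fun_prop).measurable hI

theorem exists_prism_const {n : ℕ} (hn : 1 ≤ n) :
    ∃ c₀ : ℝ, 0 < c₀ ∧ ∀ (ν : EuclideanSpace ℝ (Fin n)), ‖ν‖ = 1 → ∀ (c : ℝ)
      (A : Set (EuclideanSpace ℝ (Fin n))), MeasurableSet A → (∀ x ∈ A, inner ℝ ν x = c) →
      ∀ I : Set ℝ, MeasurableSet I →
        ENNReal.ofReal c₀ * volume (prism ν c A I) = volume I * μH[(n : ℝ) - 1] A := by
  obtain ⟨m, rfl⟩ : ∃ m, n = m + 1 := ⟨n - 1, by omega⟩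
  set e : EuclideanSpace ℝ (Fin (m + 1)) := EuclideanSpace.single 0 1 with he
  have hen : ‖e‖ = 1 := by simp [he]
  obtain ⟨ψ, hψ, hker, c₁, hc₁, hvol⟩ := exists_volume_eq_prod
    (innerₛₗ ℝ e : EuclideanSpace ℝ (Fin (m + 1)) →ₗ[ℝ] ℝ) (w := e) (by
      simp [hen])
  have hH : (μH[(Module.finrank ℝ (EuclideanSpace ℝ (Fin m)) : ℝ)] :
    Measure (EuclideanSpace ℝ (Fin m))).IsAddHaarMeasure := inferInstance
  rw [finrank_euclideanSpace_fin] at hH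
  set κ := Measure.addHaarScalarFactor (μH[(m : ℝ)] : Measure (EuclideanSpace ℝ (Fin m))) volume
  have hκ : (μH[(m : ℝ)] : Measure (EuclideanSpace ℝ (Fin m))) = κ • volume :=
    Measure.isAddLeftInvariant_eq_smul _ _
  have hκpos : 0 < κ := Measure.addHaarScalarFactor_pos_of_isAddHaarMeasure _ _
  refine ⟨κ / c₁, by positivity, fun ν hν c A hA hAc I hI => ?_⟩
  let ρ := (ℝ ∙ (ν - e))ᗮ.reflection
  have hρ : ρ ν = e := Submodule.reflection_sub (hν.trans hen.symm)
  have hρe : ρ.symm e = ν := by rw [← hρ, LinearIsometryEquiv.symm_apply_apply]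
  have hin : ∀ t, inner ℝ ν (ρ.symm (ψ t)) = 0 := fun t => by
    rw [← hρe, LinearIsometryEquiv.inner_map_map]
    exact (hker _).2 ⟨t, rfl⟩
  have hνν : inner ℝ ν ν = 1 := by rw [real_inner_self_eq_norm_sq, hν]; norm_num
  set T : Set (EuclideanSpace ℝ (Fin m)) := {t | ρ.symm (ψ t) + c • ν ∈ A} with hT
  have hS := measurableSet_prism ν c hA hI
  have h1 : volume (prism ν c A I) = ENNReal.ofReal c₁ * (volume T * volume I) := by
    rw [← ρ.symm.measurePreserving.measure_preimage hS.nullMeasurableSet,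
      hvol _ (ρ.symm.continuous.measurable hS)]
    congr 1
    have h2 : ∀ s : ℝ, volume {t | s • e + ψ t ∈ ρ.symm ⁻¹' prism ν c A I} =
        ((fun s => s - c) ⁻¹' I).indicator (fun _ => volume T) s := fun s => by
      have h3 : ∀ t, ρ.symm (s • e + ψ t) = s • ν + ρ.symm (ψ t) := fun t => by
        rw [map_add, map_smul, hρe]
      have h4 : ∀ t, inner ℝ ν (s • ν + ρ.symm (ψ t)) = s := fun t => by
        rw [inner_add_right, inner_smul_right, hνν, hin]; ring
      have h5 : ∀ t, s • ν + ρ.symm (ψ t) - (s - c) • ν = ρ.symm (ψ t) + c • ν := fun t => by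
        module
      simp only [mem_preimage, prism, mem_ofPred_eq, h3, h4, h5]
      by_cases hs : s - c ∈ I
      · rw [indicator_of_mem (by exact hs)]; simp [hs, hT]
      · rw [indicator_of_notMem (by exact hs)]; simp [hs]
    rw [lintegral_congr h2, lintegral_indicator_const ((show Measurable fun s : ℝ => s - c from measurable_id.sub_const c) hI)]
    congr 1
    simp_rw [sub_eq_add_neg]
    exact measure_preimage_add_right volume (-c) I
  have h6 : A = (fun t => ρ.symm (ψ t) + c • ν) '' T := by
    refine Subset.antisymm (fun x hx => ?_) (by rintro _ ⟨t, ht, rfl⟩; exact ht)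
    have : innerₛₗ ℝ e (ρ (x - c • ν)) = 0 := by
      change inner ℝ e (ρ (x - c • ν)) = 0
      rw [← hρ, LinearIsometryEquiv.inner_map_map, inner_sub_right, inner_smul_right, hνν, hAc x hx]
      ring
    obtain ⟨t, ht⟩ := (hker _).1 this
    have h7 : ρ.symm (ψ t) + c • ν = x := by rw [ht]; simp
    exact ⟨t, by rw [hT, mem_ofPred_eq, h7]; exact hx, h7⟩
  have h8 : μH[((m + 1 : ℕ) : ℝ) - 1] A = κ * volume T := by
    have hiso : Isometry (fun t => ρ.symm (ψ t) + c • ν) :=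
      (isometry_add_right (c • ν)).comp (ρ.symm.isometry.comp hψ)
    conv_lhs => rw [h6]
    rw [show ((m + 1 : ℕ) : ℝ) - 1 = m by push_cast; ring,
      hiso.hausdorffMeasure_image (Or.inl (by positivity)), hκ]
    rfl
  rw [h1, h8, ENNReal.ofReal_div_of_pos hc₁, ENNReal.ofReal_coe_nnreal]
  have hc1 : ENNReal.ofReal c₁ ≠ 0 := by simpa using hc₁
  rw [← mul_assoc, ENNReal.div_mul_cancel hc1 ENNReal.ofReal_ne_top]
  ring

end Prism

section Tube
variable {n : ℕ} {ι : Type*} {ν : ι → EuclideanSpace ℝ (Fin n)}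

local notation "𝔼" => EuclideanSpace ℝ (Fin n)
local notation "⟪" left "," right "⟫" => inner ℝ left right

/-- The normalising constant relating `μH[n - 1]` on hyperplanes to Lebesgue measure. -/
def IsPrismConst (n : ℕ) (c₀ : ℝ) : Prop :=
  0 < c₀ ∧ ∀ (ν : EuclideanSpace ℝ (Fin n)), ‖ν‖ = 1 → ∀ (c : ℝ)
      (A : Set (EuclideanSpace ℝ (Fin n))), MeasurableSet A → (∀ x ∈ A, inner ℝ ν x = c) →
      ∀ I : Set ℝ, MeasurableSet I →
        ENNReal.ofReal c₀ * volume (prism ν c A I) = volume I * μH[(n : ℝ) - 1] A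

theorem volume_hyperplane {w : 𝔼} (hw : w ≠ 0) (c : ℝ) : volume {x : 𝔼 | ⟪w, x⟫ = c} = 0 := by
  rcases ({x : 𝔼 | ⟪w, x⟫ = c}).eq_empty_or_nonempty with h | ⟨x₀, hx₀⟩
  · rw [h, measure_empty]
  have h1 : {x : 𝔼 | ⟪w, x⟫ = c} = (fun x => -x₀ + x) ⁻¹'
      ((LinearMap.ker (innerₛₗ ℝ w : 𝔼 →ₗ[ℝ] ℝ) : Submodule ℝ 𝔼) : Set 𝔼) := by
    ext x
    have hx₀' : ⟪w, x₀⟫ = c := hx₀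
    simp only [mem_ofPred_eq, mem_preimage, SetLike.mem_coe, LinearMap.mem_ker]
    change _ ↔ ⟪w, -x₀ + x⟫ = 0
    rw [inner_add_right, inner_neg_right, hx₀']
    constructor <;> intro h <;> linarith
  rw [h1, measure_preimage_add]
  refine Measure.addHaar_submodule _ _ fun h => hw ?_
  have : w ∈ LinearMap.ker (innerₛₗ ℝ w : 𝔼 →ₗ[ℝ] ℝ) := h ▸ Submodule.mem_top
  have h2 : ⟪w, w⟫ = 0 := this
  exact inner_self_eq_zero.1 h2

/-- The facet of a polytope with a given normal. -/
def facet (ν : ι → 𝔼) (h : ι → ℝ) (i : ι) : Set 𝔼 := poly ν h ∩ {x | ⟪ν i, x⟫ = h i}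

theorem isClosed_facet (h : ι → ℝ) (i : ι) : IsClosed (facet ν h i) :=
  (isClosed_poly ν h).inter (isClosed_eq (by fun_prop) continuous_const)

theorem facet_subset_frontier (hν : ∀ i, ‖ν i‖ = 1) (h : ι → ℝ) (i : ι) :
    facet ν h i ⊆ frontier (poly ν h) := by
  rintro x ⟨hx, hxi⟩
  refine ⟨subset_closure hx, fun h_interior => ?_⟩
  obtain ⟨ε, hε, hb⟩ := Metric.isOpen_iff.1 isOpen_interior x h_interior
  have h1 : x + (ε / 2) • ν i ∈ poly ν h := interior_subset (hb (by
    rw [mem_ball, dist_eq_norm, add_sub_cancel_left, norm_smul, hν, mul_one,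
      Real.norm_of_nonneg (by positivity)]
    linarith))
  have h2 := h1 i
  have hxi' : ⟪ν i, x⟫ = h i := hxi
  rw [inner_add_right, inner_smul_right, real_inner_self_eq_norm_sq, hν, hxi'] at h2
  linarith

theorem frontier_poly_subset [Finite ι] (h : ι → ℝ) :
    frontier (poly ν h) ⊆ ⋃ i, facet ν h i := by
  intro x hx
  have hxP : x ∈ poly ν h := (isClosed_poly ν h).frontier_subset hx
  by_contra hne
  simp only [mem_iUnion, not_exists] at hne
  refine hx.2 (mem_interior.2 ⟨{y | ∀ i, ⟪ν i, y⟫ < h i}, fun y hy i => (hy i).le, ?_, fun i => ?_⟩)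
  · rw [ofPred_forall]
    exact isOpen_iInter_of_finite fun i => isOpen_lt (by fun_prop) continuous_const
  · exact (hxP i).lt_of_ne fun h' => hne i ⟨hxP, h'⟩

theorem IsPrismConst.aedisjoint_facet {c₀ : ℝ} (hc : IsPrismConst n c₀) (hν : ∀ i, ‖ν i‖ = 1)
    (hinj : Function.Injective ν) {h : ι → ℝ} (hpos : ∀ i, 0 < h i) {i j : ι} (hij : i ≠ j) :
    μH[(n : ℝ) - 1] (facet ν h i ∩ facet ν h j) = 0 := by
  set A := facet ν h i ∩ facet ν h j with hA
  have hAm : MeasurableSet A :=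
    ((isClosed_facet h i).inter (isClosed_facet h j)).measurableSet
  have hAi : ∀ x ∈ A, ⟪ν i, x⟫ = h i := fun x hx => hx.1.2
  have hAj : ∀ x ∈ A, ⟪ν j, x⟫ = h j := fun x hx => hx.2.2
  have h1 := hc.2 (ν i) (hν i) (h i) A hAm hAi (Icc 0 1) measurableSet_Icc
  have hii : ⟪ν i, ν i⟫ = 1 := by rw [real_inner_self_eq_norm_sq, hν]; norm_num
  by_cases hw : ν j - ⟪ν i, ν j⟫ • ν i = 0
  · have hw' : ν j = ⟪ν i, ν j⟫ • ν i := sub_eq_zero.1 hw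
    have h2 : |⟪ν i, ν j⟫| = 1 := by
      have := congrArg norm hw'
      rw [norm_smul, hν, hν, mul_one] at this
      exact this.symm
    rcases (abs_eq zero_le_one).1 h2 with h3 | h3
    · rw [h3, one_smul] at hw'
      exact absurd (hinj hw').symm hij
    · rw [h3] at hw'
      have : A = ∅ := by
        by_contra hne
        obtain ⟨x, hx⟩ := nonempty_iff_ne_empty.2 hne
        have h4 := hAj x hx
        rw [hw', inner_smul_left, hAi x hx] at h4
        simp at h4
        linarith [hpos i, hpos j]
      rw [this, measure_empty]
  · have h2 : prism (ν i) (h i) A (Icc 0 1) ⊆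
        {x | ⟪ν j - ⟪ν i, ν j⟫ • ν i, x⟫ = h j - ⟪ν i, ν j⟫ * h i} := by
      rintro x ⟨hx, -⟩
      have h3 := hAj _ hx
      rw [inner_sub_right, inner_smul_right, real_inner_comm (ν i) (ν j)] at h3
      simp only [mem_ofPred_eq, inner_sub_left, real_inner_smul_left]
      linarith
    have h3 : volume (prism (ν i) (h i) A (Icc 0 1)) = 0 :=
      measure_mono_null h2 (volume_hyperplane hw _)
    rw [h3] at h1
    simpa using h1.symm

theorem IsPrismConst.sum_facet_le [Fintype ι] {c₀ : ℝ} (hc : IsPrismConst n c₀)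
    (hν : ∀ i, ‖ν i‖ = 1) (hinj : Function.Injective ν) {h : ι → ℝ} (hpos : ∀ i, 0 < h i) :
    ∑ i, μH[(n : ℝ) - 1] (facet ν h i) ≤ μH[(n : ℝ) - 1] (frontier (poly ν h)) := by
  rw [← tsum_fintype (L := .unconditional _), ← measure_iUnion₀ (fun i j hij => hc.aedisjoint_facet hν hinj hpos hij)
    fun i => (isClosed_facet h i).measurableSet.nullMeasurableSet]
  exact measure_mono (iUnion_subset fun i => facet_subset_frontier hν h i)

/-- The inner tube of a polytope. -/
theorem IsPrismConst.volume_diff_le [Finite ι] {c₀ : ℝ} (hc : IsPrismConst n c₀)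
    (hν : ∀ i, ‖ν i‖ = 1) (hinj : Function.Injective ν) {h : ι → ℝ} (hpos : ∀ i, 0 < h i)
    (t : ℝ) : ENNReal.ofReal c₀ * volume (poly ν h \ poly ν fun i => h i - t) ≤
      ENNReal.ofReal t * μH[(n : ℝ) - 1] (frontier (poly ν h)) := by
  have : Fintype ι := Fintype.ofFinite ι
  have h1 : poly ν h \ poly ν (fun i => h i - t) ⊆
      ⋃ i, prism (ν i) (h i) (facet ν h i) (Icc (-t) 0) := by
    rintro x ⟨hx, hxt⟩
    simp only [poly, mem_ofPred_eq, not_forall, not_le] at hxt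
    obtain ⟨k, hk⟩ := hxt
    have : Nonempty ι := ⟨k⟩
    obtain ⟨i, hi⟩ := Finite.exists_min fun i => h i - ⟪ν i, x⟫
    have hik := hi k
    simp only [mem_iUnion]
    refine ⟨i, ⟨fun j => ?_, ?_⟩, ?_, ?_⟩
    · have hij := hi j
      have hji : ⟪ν j, ν i⟫ ≤ 1 := by
        simpa [hν] using real_inner_le_norm (ν j) (ν i)
      rw [inner_sub_right, inner_smul_right]
      have := hx i
      nlinarith
    · rw [mem_ofPred_eq, inner_sub_right, inner_smul_right, real_inner_self_eq_norm_sq, hν]; ring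
    · linarith
    · have := hx i; linarith
  calc ENNReal.ofReal c₀ * volume (poly ν h \ poly ν fun i => h i - t)
      ≤ ENNReal.ofReal c₀ * ∑ i, volume (prism (ν i) (h i) (facet ν h i) (Icc (-t) 0)) := by
        gcongr
        exact (measure_mono h1).trans (measure_iUnion_fintype_le _ _)
    _ = ∑ i, ENNReal.ofReal t * μH[(n : ℝ) - 1] (facet ν h i) := by
        rw [Finset.mul_sum]
        refine Finset.sum_congr rfl fun i _ => ?_
        rw [hc.2 (ν i) (hν i) (h i) _ (isClosed_facet h i).measurableSet (fun x hx => hx.2) _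
          measurableSet_Icc, Real.volume_Icc, zero_sub, neg_neg]
    _ ≤ _ := by
        rw [← Finset.mul_sum]
        gcongr
        exact hc.sum_facet_le hν hinj hpos

theorem isNormal_facet {h : ι → ℝ} {i : ι} {y : 𝔼} (hy : y ∈ facet ν h i) {s : ℝ}
    (hs : 0 ≤ s) : IsNormal (poly ν h) y (s • ν i) := by
  refine ⟨hy.1, fun x hx => ?_⟩
  rw [real_inner_smul_left, inner_sub_right]
  have h1 : ⟪ν i, y⟫ = h i := hy.2
  have := hx i
  exact mul_nonpos_of_nonneg_of_nonpos hs (by linarith)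

/-- The outer tube of a polytope circumscribed to the unit ball. -/
theorem IsPrismConst.frontier_le [Finite ι] {c₀ : ℝ} (hc : IsPrismConst n c₀)
    (hν : ∀ i, ‖ν i‖ = 1) (hinj : Function.Injective ν) (hb : IsBounded (poly ν fun _ => 1)) :
    μH[(n : ℝ) - 1] (frontier (poly ν fun _ => 1)) ≤
      ENNReal.ofReal (c₀ * (n * volume.real (poly ν fun _ => 1))) := by
  have : Fintype ι := Fintype.ofFinite ι
  set P := poly ν fun _ => 1 with hP
  have hPfin : volume P ≠ ⊤ := hb.measure_lt_top.ne
  have key : ∀ t : ℝ, 0 < t → ENNReal.ofReal t * μH[(n : ℝ) - 1] (frontier P) ≤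
      ENNReal.ofReal (c₀ * (((1 + t) ^ n - 1) * volume.real P)) := fun t ht => by
    have hdisj : Pairwise (Function.onFun Disjoint fun i =>
        prism (ν i) 1 (facet ν (fun _ => 1) i) (Ioo 0 t)) := by
      intro i j hij
      rw [Function.onFun, Set.disjoint_left]
      rintro x ⟨hx, hs⟩ ⟨hx', hs'⟩
      have h1 := (isNormal_facet hx hs.1.le).dist_le (isNormal_facet hx' hs'.1.le)
      rw [sub_add_cancel, sub_add_cancel, dist_self] at h1
      have h2 := dist_le_zero.1 h1
      have h3 : (⟪ν i, x⟫ - 1) • ν i = (⟪ν j, x⟫ - 1) • ν j := by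
        rw [sub_right_inj] at h2; exact h2
      have h4 := congrArg norm h3
      rw [norm_smul, norm_smul, hν, hν, Real.norm_of_nonneg hs.1.le,
        Real.norm_of_nonneg hs'.1.le, mul_one, mul_one] at h4
      rw [h4] at h3
      exact hij (hinj (smul_right_injective _ hs'.1.ne' h3))
    have hsub : (⋃ i, prism (ν i) 1 (facet ν (fun _ => 1) i) (Ioo 0 t)) ⊆ ((1 + t) • P) \ P := by
      refine iUnion_subset fun i => ?_
      rintro x ⟨hx, hs⟩
      refine ⟨?_, fun hxP => ?_⟩
      · rw [hP, ← poly_smul (by linarith)]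
        intro j
        have h1 := hx.1 j
        have hji : ⟪ν j, ν i⟫ ≤ 1 := by
          simpa [hν] using real_inner_le_norm (ν j) (ν i)
        rw [inner_sub_right, inner_smul_right] at h1
        simp only [Pi.smul_apply, smul_eq_mul, mul_one]
        nlinarith [hs.1, hs.2]
      · have h1 := hxP i
        have h2 := hs.1
        linarith
    have hPm : MeasurableSet P := (isClosed_poly ν _).measurableSet
    calc ENNReal.ofReal t * μH[(n : ℝ) - 1] (frontier P)
        ≤ ENNReal.ofReal t * ∑ i, μH[(n : ℝ) - 1] (facet ν (fun _ => 1) i) := by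
          gcongr
          exact (measure_mono (frontier_poly_subset _)).trans (measure_iUnion_fintype_le _ _)
      _ = ENNReal.ofReal c₀ * volume (⋃ i, prism (ν i) 1 (facet ν (fun _ => 1) i) (Ioo 0 t)) := by
          rw [measure_iUnion hdisj fun i =>
            measurableSet_prism _ _ (isClosed_facet _ i).measurableSet measurableSet_Ioo,
            tsum_fintype, Finset.mul_sum, Finset.mul_sum]
          refine Finset.sum_congr rfl fun i _ => ?_
          rw [hc.2 (ν i) (hν i) 1 (facet ν (fun _ => 1) i) (isClosed_facet _ i).measurableSet
            (fun x hx => hx.2) _ measurableSet_Ioo, Real.volume_Ioo, sub_zero]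
      _ ≤ ENNReal.ofReal c₀ * volume (((1 + t) • P) \ P) := by gcongr
      _ = ENNReal.ofReal (c₀ * (((1 + t) ^ n - 1) * volume.real P)) := by
          have h1 : P ⊆ (1 + t) • P := by
            conv_rhs => rw [hP, ← poly_smul (by linarith)]
            exact poly_mono fun i => by simp [ht.le]
          rw [measure_sdiff h1 hPm.nullMeasurableSet hPfin, ENNReal.ofReal_mul hc.1.le]
          congr 1
          rw [Measure.addHaar_smul, finrank_euclideanSpace_fin, abs_of_nonneg (by positivity),
            ← ENNReal.ofReal_toReal hPfin, ← ENNReal.ofReal_mul (by positivity),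
            ← ENNReal.ofReal_sub _ ENNReal.toReal_nonneg, Measure.real]
          congr 1
          ring
  have hfin : μH[(n : ℝ) - 1] (frontier P) ≠ ⊤ := fun h => by
    have := key 1 one_pos
    rw [h, ENNReal.mul_top (by simp)] at this
    exact absurd this (by simp)
  have key' : ∀ t : ℝ, 0 < t → (μH[(n : ℝ) - 1] (frontier P)).toReal ≤
      c₀ * ((((1 + t) ^ n - 1) / t) * volume.real P) := fun t ht => by
    have h1 := key t ht
    have h2 : 0 ≤ (1 + t) ^ n - 1 := by
      have := one_le_pow₀ (n := n) (show 1 ≤ 1 + t by linarith)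
      linarith
    rw [← ENNReal.ofReal_toReal hfin, ← ENNReal.ofReal_mul ht.le, ENNReal.ofReal_le_ofReal_iff
      (mul_nonneg hc.1.le (mul_nonneg h2 measureReal_nonneg))] at h1
    rw [div_mul_eq_mul_div, mul_div_assoc', le_div_iff₀ ht]
    linarith
  have hd : HasDerivAt (fun t : ℝ => (1 + t) ^ n) (n : ℝ) 0 := by
    have h1 : HasDerivAt (fun t : ℝ => 1 + t) 1 0 := (hasDerivAt_id (0 : ℝ)).const_add 1
    simpa using h1.fun_pow n
  have ht : Filter.Tendsto (fun t : ℝ => ((1 + t) ^ n - 1) / t) (nhdsWithin 0 (Ioi 0))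
      (nhds n) := by
    have := hd.tendsto_slope_zero_right
    refine this.congr fun t => ?_
    simp [div_eq_inv_mul]
  have h3 : (μH[(n : ℝ) - 1] (frontier P)).toReal ≤ c₀ * (n * volume.real P) :=
    ge_of_tendsto ((ht.mul_const _).const_mul c₀)
      (eventually_nhdsWithin_of_forall fun t ht => key' t ht)
  rw [← ENNReal.ofReal_toReal hfin]
  exact ENNReal.ofReal_le_ofReal h3

end Tube

section Sphere
variable {n : ℕ}

local notation "𝔼" => EuclideanSpace ℝ (Fin n)
local notation "⟪" left "," right "⟫" => inner ℝ left right

theorem volume_real_ball (hn : 1 ≤ n) (x : 𝔼) {r : ℝ} (hr : 0 ≤ r) :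
    volume.real (ball x r) = r ^ n * unitBallVol n := by
  have : Nontrivial 𝔼 := by
    have : Nonempty (Fin n) := ⟨⟨0, hn⟩⟩
    infer_instance
  rw [Measure.real, Measure.addHaar_ball _ _ hr, ENNReal.toReal_mul, finrank_euclideanSpace_fin,
    ENNReal.toReal_ofReal (by positivity), unitBallVol]

theorem volume_real_closedBall (hn : 1 ≤ n) (x : 𝔼) {r : ℝ} (hr : 0 ≤ r) :
    volume.real (closedBall x r) = r ^ n * unitBallVol n := by
  have : Nontrivial 𝔼 := by
    have : Nonempty (Fin n) := ⟨⟨0, hn⟩⟩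
    infer_instance
  rw [← volume_real_ball hn x hr, Measure.real, Measure.addHaar_closedBall_eq_addHaar_ball,
    Measure.real]

theorem unitBallVol_pos : 0 < unitBallVol n :=
  ENNReal.toReal_pos (measure_ball_pos _ _ one_pos).ne' measure_ball_lt_top.ne

theorem IsPrismConst.sphere_one_le (hn : 1 ≤ n) {c₀ : ℝ} (hc : IsPrismConst n c₀) :
    μH[(n : ℝ) - 1] (sphere (0 : 𝔼) 1) ≤ ENNReal.ofReal (c₀ * (n * unitBallVol n)) := by
  have hn' : (1 : ℝ) ≤ n := by exact_mod_cast hn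
  have key : ∀ δ : ℝ, 0 < δ → δ < 1 → μH[(n : ℝ) - 1] (sphere (0 : 𝔼) 1) ≤
      ENNReal.ofReal (c₀ * (n * ((1 - δ)⁻¹ ^ n * unitBallVol n))) := fun δ hδ hδ1 => by
    obtain ⟨U, hUs, hUf, hU⟩ := (isCompact_sphere (0 : 𝔼) 1).finite_cover_balls hδ
    have : Finite U := hUf.to_subtype
    set ν : U → 𝔼 := fun u => u with hν_def
    have hν : ∀ i, ‖ν i‖ = 1 := fun i => by simpa using hUs i.2
    have hδ0 : 0 < 1 - δ := by linarith
    have hsub : poly ν (fun _ => 1) ⊆ closedBall 0 (1 - δ)⁻¹ := fun x hx => by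
      rw [mem_closedBall_zero_iff]
      rcases eq_or_ne x 0 with rfl | hx0
      · rw [norm_zero]; positivity
      have hxn : 0 < ‖x‖ := norm_pos_iff.2 hx0
      have h1 : ‖x‖⁻¹ • x ∈ sphere (0 : 𝔼) 1 := by
        rw [mem_sphere_zero_iff_norm, norm_smul, norm_inv, norm_norm, inv_mul_cancel₀ hxn.ne']
      have h2 := hU h1
      simp only [mem_iUnion] at h2
      obtain ⟨u, hu, h3⟩ := h2
      rw [mem_ball, dist_eq_norm] at h3
      have h4 := (real_inner_le_norm (‖x‖⁻¹ • x - u) x).trans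
        (mul_le_mul_of_nonneg_right h3.le hxn.le)
      rw [inner_sub_left, real_inner_smul_left, real_inner_self_eq_norm_sq] at h4
      have h5 : ⟪u, x⟫ ≤ 1 := hx ⟨u, hu⟩
      have h6 : ‖x‖⁻¹ * ‖x‖ ^ 2 = ‖x‖ := by field_simp
      rw [h6] at h4
      rw [← one_div, le_div_iff₀ hδ0]
      linarith
    have hb : IsBounded (poly ν fun _ => 1) := isBounded_closedBall.subset hsub
    have h1 := hc.frontier_le hν Subtype.val_injective hb
    have h2 : closedBall (0 : 𝔼) 1 ⊆ poly ν fun _ => 1 := fun x hx i => by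
      rw [mem_closedBall_zero_iff] at hx
      have := real_inner_le_norm (ν i) x
      rw [hν] at this
      linarith
    have h3 := hausdorffMeasure_frontier_mono (d := (n : ℝ) - 1) (by linarith)
      (convex_closedBall (0 : 𝔼) 1) isClosed_closedBall
      ⟨0, ball_subset_interior_closedBall (mem_ball_self one_pos)⟩ hb
      (h2.trans subset_closure)
    rw [frontier_closedBall _ one_ne_zero] at h3
    refine (h3.trans h1).trans (ENNReal.ofReal_le_ofReal ?_)
    rw [← volume_real_closedBall hn 0 (inv_nonneg.2 hδ0.le)]
    have := hc.1
    gcongr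
    exact isBounded_closedBall.measure_lt_top.ne
  have hcont : ContinuousAt (fun δ : ℝ =>
      ENNReal.ofReal (c₀ * (n * ((1 - δ)⁻¹ ^ n * unitBallVol n)))) 0 := by
    refine ENNReal.continuous_ofReal.continuousAt.comp ?_
    have : ContinuousAt (fun δ : ℝ => (1 - δ)⁻¹) 0 :=
      ContinuousAt.inv₀ (by fun_prop) (by norm_num)
    fun_prop
  have ht := hcont.tendsto.mono_left (nhdsWithin_le_nhds (s := Ioi 0))
  simp only [sub_zero, inv_one, one_pow, one_mul] at ht
  refine ge_of_tendsto ht ?_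
  filter_upwards [Ioo_mem_nhdsGT (zero_lt_one' ℝ)] with δ hδ using key δ hδ.1 hδ.2

theorem IsPrismConst.sphere_le (hn : 1 ≤ n) {c₀ : ℝ} (hc : IsPrismConst n c₀) {R : ℝ}
    (hR : 0 < R) (x : 𝔼) : μH[(n : ℝ) - 1] (sphere x R) ≤
      ENNReal.ofReal (c₀ * (n * unitBallVol n * R ^ (n - 1))) := by
  have hn' : (1 : ℝ) ≤ n := by exact_mod_cast hn
  have h1 : sphere x R = (fun y => x + y) '' (R • sphere (0 : 𝔼) 1) := by
    rw [smul_sphere' hR.ne', Real.norm_of_nonneg hR.le, smul_zero, mul_one, image_add_left]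
    ext y
    simp [dist_eq_norm, ← sub_eq_neg_add]
  rw [h1, (isometry_add_left x).hausdorffMeasure_image (Or.inl (by linarith)),
    Measure.hausdorffMeasure_smul₀ (by linarith) hR.ne']
  have h2 : (‖R‖₊ ^ ((n : ℝ) - 1) : ℝ≥0) = (R ^ (n - 1)).toNNReal := by
    rw [← NNReal.coe_inj, NNReal.coe_rpow, coe_nnnorm, Real.norm_of_nonneg hR.le,
      Real.coe_toNNReal _ (by positivity), ← Real.rpow_natCast, Nat.cast_sub hn, Nat.cast_one]
  rw [h2, ENNReal.smul_def, smul_eq_mul]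
  calc _ ≤ ENNReal.ofReal (R ^ (n - 1)) * ENNReal.ofReal (c₀ * (n * unitBallVol n)) := by
        exact mul_le_mul_right (hc.sphere_one_le hn) _
    _ = _ := by
        rw [← ENNReal.ofReal_mul (by positivity)]
        congr 1; ring

theorem IsPrismConst.frontier_lt_top (hn : 1 ≤ n) {c₀ : ℝ} (hc : IsPrismConst n c₀) {K : Set 𝔼}
    (hK : Convex ℝ K) (hcl : IsClosed K) (hi : (interior K).Nonempty) (hb : IsBounded K) :
    μH[(n : ℝ) - 1] (frontier K) < ⊤ := by
  have hn' : (1 : ℝ) ≤ n := by exact_mod_cast hn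
  obtain ⟨r, hr, hKr⟩ := hb.subset_closedBall_lt 0 0
  refine (hausdorffMeasure_frontier_mono (by linarith) hK hcl hi isBounded_closedBall
    (hKr.trans subset_closure)).trans_lt ?_
  rw [frontier_closedBall _ hr.ne']
  exact (hc.sphere_le hn hr 0).trans_lt ENNReal.ofReal_lt_top

end Sphere

section OuterTube
variable {n : ℕ}

local notation "𝔼" => EuclideanSpace ℝ (Fin n)
local notation "⟪" left "," right "⟫" => inner ℝ left right

theorem exists_finite_convexHull_approx {A : Set 𝔼} (hA : Convex ℝ A) (hc : IsCompact A)
    (h0 : (0 : 𝔼) ∈ interior A) {η : ℝ} (hη : 0 < η) :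
    ∃ V : Set 𝔼, V ⊆ A ∧ V.Finite ∧ (0 : 𝔼) ∈ interior (convexHull ℝ V) ∧
      A ⊆ (1 + η) • convexHull ℝ V := by
  obtain ⟨ρ, hρ, hb⟩ := Metric.nhds_basis_closedBall.mem_iff.1 (mem_interior_iff_mem_nhds.1 h0)
  set κ := η / (1 + η) with hκ
  have hκ0 : 0 < κ := by positivity
  have hκ1 : 1 - κ = (1 + η)⁻¹ := by rw [hκ]; field_simp; ring
  have hκ2 : 0 < 1 - κ := by rw [hκ1]; positivity
  obtain ⟨V, hVA, hVf, hV⟩ := hc.finite_cover_balls (mul_pos hκ0 hρ)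
  have hsub : (1 - κ) • A ⊆ convexHull ℝ V := by
    refine subset_of_add_subset_add (convex_convexHull ℝ V) (hVf.isCompact_convexHull ℝ).isClosed
      (hVf.isCompact_convexHull ℝ).isBounded (C := κ • A) (hc.isBounded.smul₀ κ)
      ⟨κ • (0 : 𝔼), smul_mem_smul_set (interior_subset h0)⟩ ?_
    rw [← hA.add_smul hκ2.le hκ0.le, sub_add_cancel, one_smul]
    intro x hx
    have := hV hx
    simp only [mem_iUnion] at this
    obtain ⟨v, hv, hxv⟩ := this
    refine ⟨v, subset_convexHull ℝ V hv, x - v, ?_, by simp⟩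
    rw [mem_smul_set_iff_inv_smul_mem₀ hκ0.ne']
    apply hb
    rw [mem_ball, dist_eq_norm] at hxv
    rw [mem_closedBall_zero_iff, norm_smul, norm_inv, Real.norm_of_nonneg hκ0.le,
      inv_mul_le_iff₀ hκ0]
    exact hxv.le
  refine ⟨V, hVA, hVf, ?_, ?_⟩
  · refine interior_mono hsub ?_
    rw [← smul_zero (1 - κ), interior_smul₀ hκ2.ne']
    exact smul_mem_smul_set h0
  · have := smul_set_mono (a := 1 + η) hsub
    rwa [smul_smul, hκ1, mul_inv_cancel₀ (by positivity), one_smul] at this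

theorem IsPrismConst.outer_tube_aux (hn : 2 ≤ n) {c₀ : ℝ} (hc : IsPrismConst n c₀) {A K : Set 𝔼}
    (hA : Convex ℝ A) (hAc : IsCompact A) (h0 : (0 : 𝔼) ∈ interior A) (hK : IsBounded K)
    {τ R : ℝ} (hτ : 0 < τ) (hR : 0 < R) (hAK : A + closedBall 0 τ ⊆ K)
    (hper : μH[(n : ℝ) - 1] (frontier K) ≤
      ENNReal.ofReal (c₀ * (n * unitBallVol n * R ^ (n - 1)))) {η : ℝ} (hη : 0 < η) :
    ((1 + η) ^ n)⁻¹ ^ (1 / ((n : ℝ) - 1)) * τ ≤ R ∧ ∀ ε ∈ Ioc 0 τ,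
      volume.real (A + closedBall 0 ε) ≤ (1 + η) ^ n * (volume.real A +
        ε * (n * unitBallVol n *
          (R - ((1 + η) ^ n)⁻¹ ^ (1 / ((n : ℝ) - 1)) * (τ - ε)) ^ (n - 1))) := by
  set a := 1 / ((n : ℝ) - 1) with ha
  set θ := ((1 + η) ^ n)⁻¹ ^ a with hθ
  set ω := unitBallVol n with hω
  have hω0 : 0 < ω := unitBallVol_pos
  have hn' : (2 : ℝ) ≤ n := by exact_mod_cast hn
  have ha0 : 0 < a := one_div_pos.2 (by linarith)
  have hcast : ((n - 1 : ℕ) : ℝ) = (n : ℝ) - 1 := by rw [Nat.cast_sub (by omega), Nat.cast_one]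
  have hroot : ∀ x : ℝ, 0 ≤ x → (x ^ (n - 1)) ^ a = x := fun x hx => by
    rw [ha, ← hcast, one_div]
    exact Real.pow_rpow_inv_natCast hx (by omega)
  have hroot' : ∀ x : ℝ, 0 ≤ x → (x ^ a) ^ (n - 1) = x := fun x hx => by
    rw [ha, ← hcast, one_div]
    exact Real.rpow_inv_natCast_pow hx (by omega)
  obtain ⟨V, hVA, hVf, hV0, hV⟩ := exists_finite_convexHull_approx hA hAc h0 hη
  obtain ⟨W, hWB, hWf, hW0, hW⟩ := exists_finite_convexHull_approx (convex_closedBall (0 : 𝔼) τ)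
    (isCompact_closedBall _ _) (ball_subset_interior_closedBall (mem_ball_self hτ)) hη
  obtain ⟨N, f, g, hN, hpoly, hf, hfg, hg⟩ := exists_polytope_gbm hn hVf hWf hV0 hW0
  set K' := convexHull ℝ V with hK'
  set Q' := convexHull ℝ W with hQ'
  have hK'c : IsCompact K' := hVf.isCompact_convexHull ℝ
  have hQ'c : IsCompact Q' := hWf.isCompact_convexHull ℝ
  have hK'A : K' ⊆ A := convexHull_min hVA hA
  have hQ'B : Q' ⊆ closedBall 0 τ := convexHull_min hWB (convex_closedBall _ _)
  have hK'n : K'.Nonempty := ⟨0, interior_subset hV0⟩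
  have hQ'n : Q'.Nonempty := ⟨0, interior_subset hW0⟩
  have hsuppQ : ∀ u ∈ N, supp Q' u ≤ τ := fun u hu => supp_le hQ'n fun x hx => by
    have h1 := hQ'B hx
    rw [mem_closedBall_zero_iff] at h1
    have h2 := real_inner_le_norm u x
    rw [hN u hu] at h2
    linarith
  have hsK : ∀ u ∈ N, 0 < supp K' u := fun u hu =>
    supp_pos hK'c.isBounded hV0 (by rintro rfl; simpa using hN _ hu)
  have hsQ : ∀ u ∈ N, 0 < supp Q' u := fun u hu =>
    supp_pos hQ'c.isBounded hW0 (by rintro rfl; simpa using hN _ hu)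
  set ν : N → 𝔼 := fun u => u with hν
  set P : ℝ → Set 𝔼 := fun s => poly ν fun u => supp K' u + s * supp Q' u with hP
  have hfP : ∀ s ∈ Icc (0 : ℝ) 1, f s = volume.real (P s) := fun s hs => by
    rw [← hf s hs, ← hpoly s hs]
  have hone : (1 : ℝ) ∈ Icc (0 : ℝ) 1 := ⟨zero_le_one, le_rfl⟩
  have hzero : (0 : ℝ) ∈ Icc (0 : ℝ) 1 := ⟨le_rfl, zero_le_one⟩
  have hP1 : P 1 = K' + Q' := by rw [hP]; simpa using hpoly 1 hone
  have hP1K : P 1 ⊆ K := by rw [hP1]; exact (add_subset_add hK'A hQ'B).trans hAK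
  have hperP : μH[(n : ℝ) - 1] (frontier (P 1)) ≤
      ENNReal.ofReal (c₀ * (n * ω * R ^ (n - 1))) := by
    refine (hausdorffMeasure_frontier_mono (by linarith) (convex_poly ν _) (isClosed_poly ν _)
      ?_ hK (hP1K.trans subset_closure)).trans hper
    refine ⟨0, interior_mono (t := P 1) ?_ hV0⟩
    rw [hP1]
    intro x hx
    exact ⟨x, hx, 0, interior_subset hW0, add_zero x⟩
  -- the derivative at the outer end
  have hslope : ∀ t ∈ Ioo (0 : ℝ) 1, f 1 - f (1 - t) ≤ t * (τ * (n * ω * R ^ (n - 1))) := by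
    intro t ht
    have ht' : 1 - t ∈ Icc (0 : ℝ) 1 := ⟨by linarith [ht.2], by linarith [ht.1]⟩
    rw [hfP 1 hone, hfP _ ht']
    have hpos : ∀ u : N, 0 < supp K' u + 1 * supp Q' u := fun u => by
      have := hsK u u.2; have := hsQ u u.2; linarith
    have htube := hc.volume_diff_le (ν := ν) (fun u => hN u u.2) Subtype.val_injective hpos (t * τ)
    set X := poly ν fun u : N => supp K' u + 1 * supp Q' u - t * τ with hX
    have hXP : X ⊆ P (1 - t) := poly_mono fun u => by
      have h1 := hsuppQ u u.2
      nlinarith [ht.1]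
    have hPb : ∀ s ∈ Icc (0 : ℝ) 1, volume (P s) ≠ ⊤ := fun s hs => by
      have : IsBounded (P s) := by
        rw [hP]; change IsBounded (poly _ _)
        rw [hpoly s hs]
        exact (hK'c.isBounded).add (hQ'c.isBounded.smul₀ s)
      exact this.measure_lt_top.ne
    have h1 : volume.real (P 1) ≤ volume.real (P 1 \ X) + volume.real (P (1 - t)) := by
      refine (measureReal_mono (s₂ := (P 1 \ X) ∪ P (1 - t)) (fun x hx => ?_) ?_).trans
        (measureReal_union_le _ _)
      · by_cases hxX : x ∈ X
        · exact Or.inr (hXP hxX)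
        · exact Or.inl ⟨hx, hxX⟩
      · exact (measure_union_lt_top ((measure_mono sdiff_subset).trans_lt (hPb 1 hone).lt_top)
          (hPb _ ht').lt_top).ne
    have h2 : ENNReal.ofReal c₀ * volume (P 1 \ X) ≤
        ENNReal.ofReal (t * τ * (c₀ * (n * ω * R ^ (n - 1)))) := by
      refine htube.trans ?_
      rw [ENNReal.ofReal_mul (mul_nonneg ht.1.le hτ.le)]
      gcongr
    have h3 : c₀ * volume.real (P 1 \ X) ≤ t * τ * (c₀ * (n * ω * R ^ (n - 1))) := by
      have h4 := ENNReal.toReal_mono ENNReal.ofReal_ne_top h2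
      have := ht.1
      have := hc.1
      rwa [ENNReal.toReal_mul, ENNReal.toReal_ofReal hc.1.le,
        ENNReal.toReal_ofReal (by positivity)] at h4
    have h4 : volume.real (P 1 \ X) ≤ t * (τ * (n * ω * R ^ (n - 1))) := by
      refine le_of_mul_le_mul_left (h3.trans (le_of_eq ?_)) hc.1
      ring
    linarith
  have hg1 : g 1 ≤ τ * (n * ω * R ^ (n - 1)) := by
    have ht := (hfg 1).tendsto_slope_zero_left
    refine le_of_tendsto ht ?_
    filter_upwards [Ioo_mem_nhdsLT (show (-1 : ℝ) < 0 by norm_num)] with t ht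
    have h1 := hslope (-t) ⟨by linarith [ht.2], by linarith [ht.1]⟩
    rw [sub_neg_eq_add] at h1
    rw [smul_eq_mul, inv_mul_eq_div, div_le_iff_of_neg ht.2]
    linarith
  -- the lower bound for the volume of `Q'`
  have hQvol : ((1 + η) ^ n)⁻¹ * (τ ^ n * ω) ≤ volume.real Q' := by
    rw [inv_mul_le_iff₀ (by positivity), ← volume_real_closedBall (by omega) (0 : 𝔼) hτ.le,
      ← volume_real_smul (by positivity)]
    exact measureReal_mono hW (hQ'c.isBounded.smul₀ _).measure_lt_top.ne
  have hQroot : (n * ω * τ) ^ a * (θ * τ) ≤ (n * volume.real Q') ^ a := by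
    have h1 : n * (((1 + η) ^ n)⁻¹ * (τ ^ n * ω)) ≤ n * volume.real Q' := by gcongr
    refine le_trans (le_of_eq ?_) (Real.rpow_le_rpow (by positivity) h1 ha0.le)
    have hτn : τ ^ n = τ * τ ^ (n - 1) := by rw [← pow_succ']; congr 1; omega
    rw [hτn, show (n : ℝ) * (((1 + η) ^ n)⁻¹ * (τ * τ ^ (n - 1) * ω)) =
      (n * ω * τ) * (((1 + η) ^ n)⁻¹ * τ ^ (n - 1)) by ring,
      Real.mul_rpow (x := (n * ω * τ)) (by positivity) (by positivity),
      Real.mul_rpow (x := ((1 + η) ^ n)⁻¹) (by positivity) (by positivity), hroot τ hτ.le]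
  have hgroot : ∀ s ∈ Icc (0 : ℝ) 1, g s ^ a ≤ (n * ω * τ) ^ a * (R - (1 - s) * (θ * τ)) := by
    intro s hs
    have h1 := (hg s hs).2
    have h2 : g 1 ^ a ≤ (n * ω * τ) ^ a * R := by
      refine (Real.rpow_le_rpow (hg 1 hone).1 hg1 ha0.le).trans (le_of_eq ?_)
      rw [show τ * (n * ω * R ^ (n - 1)) = (n * ω * τ) * R ^ (n - 1) by ring,
        Real.mul_rpow (by positivity) (by positivity), hroot R hR.le]
    have h3 := mul_le_mul_of_nonneg_left hQroot (sub_nonneg.2 hs.2)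
    linarith
  have hbase : ∀ s ∈ Icc (0 : ℝ) 1, 0 ≤ R - (1 - s) * (θ * τ) := fun s hs => by
    have h1 := (Real.rpow_nonneg (hg s hs).1 a).trans (hgroot s hs)
    exact nonneg_of_mul_nonneg_right h1 (by positivity)
  have hgs : ∀ s ∈ Icc (0 : ℝ) 1, g s ≤ n * ω * τ * (R - (1 - s) * (θ * τ)) ^ (n - 1) := by
    intro s hs
    have h1 := pow_le_pow_left₀ (Real.rpow_nonneg (hg s hs).1 a) (hgroot s hs) (n - 1)
    rwa [hroot' _ (hg s hs).1, mul_pow, hroot' _ (by positivity)] at h1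
  refine ⟨?_, fun ε hε => ?_⟩
  · have := hbase 0 hzero
    linarith
  set s := ε / τ with hs_def
  have hs : s ∈ Icc (0 : ℝ) 1 := ⟨div_nonneg hε.1.le hτ.le, div_le_one_of_le₀ hε.2 hτ.le⟩
  have hs0 : 0 < s := div_pos hε.1 hτ
  have hθ0 : 0 ≤ θ := by positivity
  have hmvt : f s - f 0 ≤ ε * (n * ω * (R - θ * (τ - ε)) ^ (n - 1)) := by
    obtain ⟨c, hcs, hc'⟩ := exists_hasDerivAt_eq_slope f g hs0
      (fun x _ => (hfg x).continuousAt.continuousWithinAt) (fun x _ => hfg x)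
    have hcI : c ∈ Icc (0 : ℝ) 1 := ⟨hcs.1.le, hcs.2.le.trans hs.2⟩
    have h1 : f s - f 0 = s * g c := by
      rw [hc', sub_zero]; field_simp
    have h2 : R - (1 - c) * (θ * τ) ≤ R - θ * (τ - ε) := by
      have : c * τ ≤ ε := by
        have := hcs.2.le
        rwa [hs_def, le_div_iff₀ hτ] at this
      nlinarith
    rw [h1]
    calc s * g c ≤ s * (n * ω * τ * (R - (1 - c) * (θ * τ)) ^ (n - 1)) := by
          gcongr; exact hgs c hcI
      _ ≤ s * (n * ω * τ * (R - θ * (τ - ε)) ^ (n - 1)) := by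
          gcongr; exact hbase c hcI
      _ = _ := by rw [hs_def]; field_simp
  have hf0 : f 0 ≤ volume.real A := by
    rw [← hf 0 hzero, zero_smul_set hQ'n, add_zero]
    exact measureReal_mono hK'A hAc.isBounded.measure_lt_top.ne
  have hball : closedBall (0 : 𝔼) ε ⊆ (1 + η) • (s • Q') := by
    have h1 : closedBall (0 : 𝔼) ε = s • closedBall (0 : 𝔼) τ := by
      rw [smul_closedBall _ _ hτ.le, smul_zero, Real.norm_of_nonneg hs.1, hs_def,
        div_mul_cancel₀ _ hτ.ne']
    rw [h1, smul_comm]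
    exact smul_set_mono hW
  have hAε : volume.real (A + closedBall 0 ε) ≤ (1 + η) ^ n * f s := by
    rw [← hf s hs, ← volume_real_smul (by positivity)]
    refine measureReal_mono ?_ (((hK'c.isBounded).add
      (hQ'c.isBounded.smul₀ s)).smul₀ (1 + η)).measure_lt_top.ne
    rw [smul_add]
    exact add_subset_add hV hball
  refine hAε.trans ?_
  gcongr
  linarith

/-- The key upper bound for the growth of an inner convex body. -/
theorem IsPrismConst.outer_tube (hn : 2 ≤ n) {c₀ : ℝ} (hc : IsPrismConst n c₀) {A K : Set 𝔼}
    (hA : Convex ℝ A) (hAc : IsCompact A) (hi : (interior A).Nonempty) (hK : IsBounded K)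
    {τ R : ℝ} (hτ : 0 < τ) (hR : 0 < R) (hAK : A + closedBall 0 τ ⊆ K)
    (hper : μH[(n : ℝ) - 1] (frontier K) ≤
      ENNReal.ofReal (c₀ * (n * unitBallVol n * R ^ (n - 1)))) :
    τ ≤ R ∧ ∀ ε ∈ Ioc 0 τ, volume.real (A + closedBall 0 ε) ≤ volume.real A +
        ε * (n * unitBallVol n * (R - (τ - ε)) ^ (n - 1)) := by
  obtain ⟨z, hz⟩ := hi
  have key : ∀ η : ℝ, 0 < η → ((1 + η) ^ n)⁻¹ ^ (1 / ((n : ℝ) - 1)) * τ ≤ R ∧ ∀ ε ∈ Ioc 0 τ,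
      volume.real (A + closedBall 0 ε) ≤ (1 + η) ^ n * (volume.real A +
        ε * (n * unitBallVol n *
          (R - ((1 + η) ^ n)⁻¹ ^ (1 / ((n : ℝ) - 1)) * (τ - ε)) ^ (n - 1))) := fun η hη => by
    have h1 := hc.outer_tube_aux (A := (-z) +ᵥ A) (K := (-z) +ᵥ K) hn (hA.vadd _)
      (hAc.vadd _) (by rw [interior_vadd]; exact ⟨z, hz, by simp⟩) (hK.vadd _) hτ hR
      (by rw [vadd_add_assoc]; exact vadd_set_mono hAK) (by
        have : frontier (-z +ᵥ K) = -z +ᵥ frontier K :=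
          ((Homeomorph.vadd (-z)).image_frontier K).symm
        rw [this, hausdorffMeasure_vadd]
        · exact hper
        · left
          have : (2 : ℝ) ≤ n := by exact_mod_cast hn
          linarith) hη
    simpa only [vadd_add_assoc, Measure.real, measure_vadd] using h1
  have hθ : Filter.Tendsto (fun η : ℝ => ((1 + η) ^ n)⁻¹ ^ (1 / ((n : ℝ) - 1)))
      (nhdsWithin 0 (Ioi 0)) (nhds 1) := by
    have : ContinuousAt (fun η : ℝ => ((1 + η) ^ n)⁻¹ ^ (1 / ((n : ℝ) - 1))) 0 :=
      ContinuousAt.rpow_const (ContinuousAt.inv₀ (by fun_prop) (by simp)) (by simp)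
    have h1 := this.tendsto.mono_left (nhdsWithin_le_nhds (s := Ioi 0))
    simpa using h1
  have hone : Filter.Tendsto (fun η : ℝ => (1 + η) ^ n) (nhdsWithin 0 (Ioi 0)) (nhds 1) := by
    have : ContinuousAt (fun η : ℝ => (1 + η) ^ n) 0 := by fun_prop
    have h1 := this.tendsto.mono_left (nhdsWithin_le_nhds (s := Ioi 0))
    simpa using h1
  refine ⟨?_, fun ε hε => ?_⟩
  · have := le_of_tendsto (hθ.mul_const τ)
      (eventually_nhdsWithin_of_forall fun η hη => (key η hη).1)
    simpa using this
  · have h1 := ((((hθ.mul_const (τ - ε)).const_sub R).pow (n - 1)).const_mul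
      (n * unitBallVol n)).const_mul ε
    have h2 := ge_of_tendsto (hone.mul (h1.const_add (volume.real A)))
      (eventually_nhdsWithin_of_forall fun η hη => (key η hη).2 ε hε)
    simpa using h2

end OuterTube

section InnerParallel
variable {n : ℕ}

local notation "𝔼" => EuclideanSpace ℝ (Fin n)

theorem isClosed_innerPar {K : Set 𝔼} (hc : IsClosed K) (t : ℝ) : IsClosed (innerPar K t) := by
  have : innerPar K t = ⋂ z ∈ closedBall (0 : 𝔼) t, (fun x => x + z) ⁻¹' K := by
    ext x
    simp only [innerPar, mem_ofPred_eq, mem_iInter, mem_preimage]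
    constructor
    · intro h z hz
      exact h (by simpa [dist_eq_norm] using hz)
    · intro h z hz
      simpa using h (z - x) (by simpa [dist_eq_norm] using hz)
  rw [this]
  exact isClosed_biInter fun z _ => hc.preimage (by fun_prop)

theorem convex_innerPar {K : Set 𝔼} (hK : Convex ℝ K) (t : ℝ) : Convex ℝ (innerPar K t) := by
  intro x hx y hy a b ha hb hab z hz
  have h1 : x + (z - (a • x + b • y)) ∈ K := hx (by simpa [dist_eq_norm] using hz)
  have h2 : y + (z - (a • x + b • y)) ∈ K := hy (by simpa [dist_eq_norm] using hz)
  have h3 := hK h1 h2 ha hb hab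
  convert h3 using 1
  have hb' : b = 1 - a := by linarith
  subst hb'
  module

theorem innerPar_zero (K : Set 𝔼) : innerPar K 0 = K := by
  ext x; simp [innerPar]

theorem innerPar_anti (K : Set 𝔼) {s t : ℝ} (hst : s ≤ t) : innerPar K t ⊆ innerPar K s :=
  fun _ hx => (closedBall_subset_closedBall hst).trans hx

theorem innerPar_innerPar_subset (K : Set 𝔼) {s t : ℝ} (hs : 0 < s) (ht : 0 < t) :
    innerPar (innerPar K s) t ⊆ innerPar K (s + t) := by
  intro x hx z hz
  have hst : 0 < s + t := by linarith
  rw [mem_closedBall, dist_eq_norm] at hz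
  have h1 : x + (t / (s + t)) • (z - x) ∈ closedBall x t := by
    rw [mem_closedBall, dist_eq_norm, add_sub_cancel_left, norm_smul,
      Real.norm_of_nonneg (by positivity), div_mul_eq_mul_div, div_le_iff₀ hst]
    gcongr
  refine hx h1 ?_
  rw [mem_closedBall, dist_eq_norm,
    show z - (x + (t / (s + t)) • (z - x)) = (s / (s + t)) • (z - x) by
      have : s / (s + t) = 1 - t / (s + t) := by field_simp; ring
      rw [this]; module,
    norm_smul, Real.norm_of_nonneg (by positivity), div_mul_eq_mul_div, div_le_iff₀ hst]
  gcongr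

theorem innerPar_add_closedBall_subset (K : Set 𝔼) (t : ℝ) :
    innerPar K t + closedBall 0 t ⊆ K := by
  rintro _ ⟨x, hx, z, hz, rfl⟩
  exact hx (by simpa [dist_eq_norm] using hz)

theorem volume_real_eq_zero_of_interior_eq_empty {K : Set 𝔼} (hK : Convex ℝ K) (hc : IsClosed K)
    (hi : ¬ (interior K).Nonempty) : volume.real K = 0 := by
  have h1 : frontier K = K := by
    rw [hc.frontier_eq, not_nonempty_iff_eq_empty.1 hi, sdiff_empty]
  rw [← h1, Measure.real, hK.addHaar_frontier volume, ENNReal.toReal_zero]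

variable {K : Set (EuclideanSpace ℝ (Fin n))} {c₀ R : ℝ}

theorem IsPrismConst.innerPar_step (hn : 2 ≤ n) (hc : IsPrismConst n c₀) (hK : Convex ℝ K)
    (hcl : IsClosed K) (hb : IsBounded K) (hR : 0 < R)
    (hper : μH[(n : ℝ) - 1] (frontier K) ≤
      ENNReal.ofReal (c₀ * (n * unitBallVol n * R ^ (n - 1)))) {τ ε : ℝ} (hε : 0 < ε)
    (hετ : ε ≤ τ) (hi : (interior (innerPar K τ)).Nonempty) :
    volume.real (innerPar K τ) - volume.real (innerPar K (τ + ε)) ≤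
      ε * (n * unitBallVol n * (R - (τ - ε)) ^ (n - 1)) := by
  have hτ : 0 < τ := hε.trans_le hετ
  set A := innerPar K τ with hA
  have hAb : IsBounded A := hb.subset (innerPar_subset K hτ.le)
  have hAcl : IsClosed A := isClosed_innerPar hcl τ
  have hAconv : Convex ℝ A := convex_innerPar hK τ
  have h1 := (hc.outer_tube hn hAconv (isCompact_of_isClosed_isBounded hAcl hAb) hi hb hτ hR
    (innerPar_add_closedBall_subset K τ) hper).2 ε ⟨hε, hετ⟩
  have h2 := volume_diff_innerPar_le hAconv hAcl hi (ε := ε)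
  have hfin : ∀ S : Set 𝔼, IsBounded S → volume S ≠ ⊤ := fun S hS => hS.measure_lt_top.ne
  have hAε : IsBounded (A + closedBall 0 ε) := hAb.add isBounded_closedBall
  have h3 : volume.real (A \ innerPar A ε) ≤ volume.real ((A + closedBall 0 ε) \ A) :=
    ENNReal.toReal_mono (hfin _ (hAε.subset sdiff_subset)) h2
  have h4 : A ⊆ A + closedBall 0 ε := fun x hx =>
    ⟨x, hx, 0, mem_closedBall_self hε.le, add_zero x⟩
  rw [measureReal_sdiff h4 hAcl.measurableSet (hfin _ hAε)] at h3
  have h5 : volume.real A ≤ volume.real (A \ innerPar A ε) + volume.real (innerPar K (τ + ε)) := by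
    have hKb : IsBounded (innerPar K (τ + ε)) := hb.subset (innerPar_subset K (by linarith))
    refine (measureReal_mono (s₂ := (A \ innerPar A ε) ∪ innerPar K (τ + ε)) (fun x hx => ?_)
      (hfin _ ((hAb.subset sdiff_subset).union hKb))).trans (measureReal_union_le _ _)
    by_cases hxA : x ∈ innerPar A ε
    · exact Or.inr (innerPar_innerPar_subset K hτ hε hxA)
    · exact Or.inl ⟨hx, hxA⟩
  linarith

theorem IsPrismConst.innerPar_volume_eq_zero (hn : 2 ≤ n) (hc : IsPrismConst n c₀)
    (hK : Convex ℝ K) (hcl : IsClosed K) (hb : IsBounded K) (hR : 0 < R)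
    (hper : μH[(n : ℝ) - 1] (frontier K) ≤
      ENNReal.ofReal (c₀ * (n * unitBallVol n * R ^ (n - 1)))) {t : ℝ} (ht : R ≤ t) :
    volume.real (innerPar K t) = 0 := by
  have ht0 : 0 < t := hR.trans_le ht
  refine volume_real_eq_zero_of_interior_eq_empty (convex_innerPar hK t) (isClosed_innerPar hcl t)
    fun hi => ?_
  obtain ⟨x, hx⟩ := hi
  obtain ⟨δ, hδ, hball⟩ := Metric.nhds_basis_closedBall.mem_iff.1 (mem_interior_iff_mem_nhds.1 hx)
  have hsub : ball x (δ / 2) ⊆ innerPar K (t + δ / 2) := fun y hy => by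
    refine innerPar_innerPar_subset K ht0 (half_pos hδ) fun z hz => hball ?_
    rw [mem_closedBall] at hz ⊢
    rw [mem_ball] at hy
    linarith [dist_triangle z y x]
  have hi' : (interior (innerPar K (t + δ / 2))).Nonempty :=
    ⟨x, interior_maximal hsub isOpen_ball (mem_ball_self (half_pos hδ))⟩
  have hAb : IsBounded (innerPar K (t + δ / 2)) :=
    hb.subset (innerPar_subset K (by linarith))
  have := (hc.outer_tube hn (convex_innerPar hK _) (isCompact_of_isClosed_isBounded
    (isClosed_innerPar hcl _) hAb) hi' hb (by linarith) hR
    (innerPar_add_closedBall_subset K _) hper).1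
  linarith

theorem sub_mul_pow_le {a b : ℝ} (hb : 0 ≤ b) (hab : b ≤ a) (n : ℕ) :
    (a - b) * (n * b ^ (n - 1)) ≤ a ^ n - b ^ n := by
  rcases n with _ | m
  · simp
  rw [← (Commute.all a b).mul_geom_sum₂, add_tsub_cancel_right]
  have h : ((m + 1 : ℕ) : ℝ) * b ^ m ≤ ∑ i ∈ Finset.range (m + 1), a ^ i * b ^ (m + 1 - 1 - i) := by
    have h1 : ∀ i ∈ Finset.range (m + 1), b ^ m ≤ a ^ i * b ^ (m + 1 - 1 - i) := fun i hi => by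
      have him : i ≤ m := Nat.lt_succ_iff.1 (Finset.mem_range.1 hi)
      calc b ^ m = b ^ i * b ^ (m - i) := by rw [← pow_add]; congr 1; omega
        _ ≤ a ^ i * b ^ (m + 1 - 1 - i) := by
          rw [add_tsub_cancel_right]; gcongr
    simpa using Finset.card_nsmul_le_sum _ _ _ h1
  exact mul_le_mul_of_nonneg_left h (by linarith)

/-- Comparison of inner parallel sets with those of the ball of the same perimeter. -/
theorem IsPrismConst.innerPar_sub_le_of_pos (hn : 2 ≤ n) (hc : IsPrismConst n c₀)
    (hK : Convex ℝ K) (hcl : IsClosed K) (hb : IsBounded K) (hR : 0 < R)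
    (hper : μH[(n : ℝ) - 1] (frontier K) ≤
      ENNReal.ofReal (c₀ * (n * unitBallVol n * R ^ (n - 1)))) {s t : ℝ} (hs : 0 < s)
    (hst : s < t) (ht : t ≤ R) :
    volume.real (innerPar K s) - volume.real (innerPar K t) ≤
      unitBallVol n * ((R - s) ^ n - (R - t) ^ n) := by
  set ω := unitBallVol n
  have hω : 0 < ω := unitBallVol_pos
  have hstep : ∀ τ ε : ℝ, 0 < ε → ε ≤ τ → τ ≤ R →
      volume.real (innerPar K τ) - volume.real (innerPar K (τ + ε)) ≤
        ω * ((R - (τ - 2 * ε)) ^ n - (R - (τ + ε - 2 * ε)) ^ n) := fun τ ε hε hετ hτ => by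
    have h1 := sub_mul_pow_le (a := R - (τ - 2 * ε)) (b := R - (τ - ε)) (by linarith)
      (by linarith) n
    rw [show R - (τ - 2 * ε) - (R - (τ - ε)) = ε by ring] at h1
    rw [show τ + ε - 2 * ε = τ - ε by ring]
    by_cases hi : (interior (innerPar K τ)).Nonempty
    · refine (hc.innerPar_step hn hK hcl hb hR hper hε hετ hi).trans ?_
      have := mul_le_mul_of_nonneg_left h1 hω.le
      change _ * (_ * ω * _) ≤ _
      linarith
    · rw [volume_real_eq_zero_of_interior_eq_empty (convex_innerPar hK τ)
        (isClosed_innerPar hcl τ) hi]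
      have h2 : 0 ≤ volume.real (innerPar K (τ + ε)) := measureReal_nonneg
      have h3 : 0 ≤ ε * (n * (R - (τ - ε)) ^ (n - 1)) := by
        have : 0 ≤ R - (τ - ε) := by linarith
        positivity
      have := mul_nonneg hω.le (h3.trans h1)
      linarith
  have key : ∀ N : ℕ, 0 < N → (t - s) / N ≤ s →
      volume.real (innerPar K s) - volume.real (innerPar K t) ≤
        ω * ((R - (s - 2 * ((t - s) / N))) ^ n - (R - (t - 2 * ((t - s) / N))) ^ n) := by
    intro N hN hNs
    have hN' : (0 : ℝ) < N := by exact_mod_cast hN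
    set ε := (t - s) / N with hε
    have hε0 : 0 < ε := div_pos (by linarith) hN'
    have hNε : N * ε = t - s := by rw [hε]; field_simp
    have h1 := Finset.sum_le_sum (s := Finset.range N)
      (f := fun k : ℕ => volume.real (innerPar K (s + k * ε)) -
        volume.real (innerPar K (s + (k + 1 : ℕ) * ε)))
      (g := fun k : ℕ => ω * ((R - (s + k * ε - 2 * ε)) ^ n) -
        ω * (R - (s + (k + 1 : ℕ) * ε - 2 * ε)) ^ n) fun k hk => by
        have hkN : (k : ℝ) + 1 ≤ N := by exact_mod_cast Finset.mem_range.1 hk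
        have hk0 : (0 : ℝ) ≤ k * ε := by positivity
        have h2 := hstep (s + k * ε) ε hε0 (by linarith) (by nlinarith)
        push_cast
        rw [show s + ((k : ℝ) + 1) * ε = s + k * ε + ε by ring]
        linarith
    rw [Finset.sum_range_sub' (fun k : ℕ => volume.real (innerPar K (s + k * ε))),
      Finset.sum_range_sub' (fun k : ℕ => ω * ((R - (s + k * ε - 2 * ε)) ^ n))] at h1
    rw [hNε] at h1
    simp only [Nat.cast_zero, zero_mul, add_zero, add_sub_cancel] at h1
    linarith
  have hlim : Filter.Tendsto (fun N : ℕ => (t - s) / (N : ℝ)) Filter.atTop (nhds 0) :=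
    tendsto_const_div_atTop_nhds_zero_nat _
  have hcont : Continuous fun ε : ℝ =>
      ω * ((R - (s - 2 * ε)) ^ n - (R - (t - 2 * ε)) ^ n) := by fun_prop
  have h2 := (hcont.tendsto 0).comp hlim
  simp only [mul_zero, sub_zero] at h2
  refine ge_of_tendsto h2 ?_
  filter_upwards [Filter.eventually_gt_atTop 0, hlim.eventually_le_const hs] with N h3 h4
  exact key N h3 h4

theorem tendsto_volume_innerPar (hK : Convex ℝ K) (hb : IsBounded K) :
    Filter.Tendsto (fun k : ℕ => volume.real (innerPar K (1 / ((k : ℝ) + 1)))) Filter.atTop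
      (nhds (volume.real K)) := by
  have hmono : Monotone fun k : ℕ => innerPar K (1 / ((k : ℝ) + 1)) := fun i j hij =>
    innerPar_anti K (one_div_le_one_div_of_le (by positivity) (by gcongr))
  have h1 := tendsto_measure_iUnion_atTop (μ := volume) hmono
  have h2 : volume (⋃ k : ℕ, innerPar K (1 / ((k : ℝ) + 1))) = volume K := by
    refine le_antisymm (measure_mono (iUnion_subset fun k => innerPar_subset K (by positivity))) ?_
    have h3 : interior K ⊆ ⋃ k : ℕ, innerPar K (1 / ((k : ℝ) + 1)) := fun x hx => by
      obtain ⟨δ, hδ, hball⟩ :=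
        Metric.nhds_basis_closedBall.mem_iff.1 (mem_interior_iff_mem_nhds.1 hx)
      obtain ⟨k, hk⟩ := exists_nat_one_div_lt hδ
      exact mem_iUnion.2 ⟨k, (closedBall_subset_closedBall hk.le).trans hball⟩
    calc volume K ≤ volume (interior K) + volume (frontier K) := by
          refine (measure_mono fun x hx => ?_).trans (measure_union_le _ _)
          by_cases hxi : x ∈ interior K
          · exact Or.inl hxi
          · exact Or.inr ⟨subset_closure hx, hxi⟩
      _ = volume (interior K) := by rw [hK.addHaar_frontier volume, add_zero]
      _ ≤ _ := measure_mono h3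
  rw [h2] at h1
  exact (ENNReal.tendsto_toReal hb.measure_lt_top.ne).comp h1

theorem IsPrismConst.innerPar_sub_le (hn : 2 ≤ n) (hc : IsPrismConst n c₀)
    (hK : Convex ℝ K) (hcl : IsClosed K) (hb : IsBounded K) (hR : 0 < R)
    (hper : μH[(n : ℝ) - 1] (frontier K) ≤
      ENNReal.ofReal (c₀ * (n * unitBallVol n * R ^ (n - 1)))) {s t : ℝ} (hs : 0 ≤ s)
    (hst : s ≤ t) (ht : t ≤ R) :
    volume.real (innerPar K s) - volume.real (innerPar K t) ≤
      unitBallVol n * ((R - s) ^ n - (R - t) ^ n) := by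
  rcases hst.eq_or_lt with rfl | hst
  · simp
  rcases hs.eq_or_lt with rfl | hs
  · have h1 := ((tendsto_volume_innerPar hK hb).sub_const (volume.real (innerPar K t)))
    have hlim : Filter.Tendsto (fun k : ℕ => 1 / ((k : ℝ) + 1)) Filter.atTop (nhds 0) :=
      tendsto_one_div_add_atTop_nhds_zero_nat
    have hcont : Continuous fun s : ℝ => unitBallVol n * ((R - s) ^ n - (R - t) ^ n) := by
      fun_prop
    have h2 := (hcont.tendsto 0).comp hlim
    rw [innerPar_zero]
    refine le_of_tendsto_of_tendsto h1 h2 ?_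
    filter_upwards [hlim.eventually_lt_const hst] with k hk
    exact hc.innerPar_sub_le_of_pos hn hK hcl hb hR hper (by positivity) hk ht
  · exact hc.innerPar_sub_le_of_pos hn hK hcl hb hR hper hs hst ht

end InnerParallel

section TraceMeasure
variable {n : ℕ}

local notation "𝔼" => EuclideanSpace ℝ (Fin n)

theorem measure_le_of_closedBall_le {X : Type*} [MetricSpace X] [SecondCountableTopology X]
    [MeasurableSpace X] [BorelSpace X] [HasBesicovitchCovering X] {ν μ : Measure X}
    [IsFiniteMeasure ν] [IsLocallyFiniteMeasure μ]
    (h : ∀ x : X, ∀ r : ℝ, 0 < r → ν (closedBall x r) ≤ μ (closedBall x r)) : ν ≤ μ := by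
  refine Measure.le_iff'.2 fun s => ?_
  refine (Besicovitch.vitaliFamily ν).measure_le_of_frequently_le μ
    Measure.AbsolutelyContinuous.rfl s fun x _ => ?_
  refine VitaliFamily.frequently_filterAt_iff _ |>.2 fun ε hε => ?_
  exact ⟨closedBall x ε, mem_image_of_mem _ hε, Subset.rfl, h x ε hε⟩

variable {Ω : Set (EuclideanSpace ℝ (Fin n))} {c₀ : ℝ}

theorem interior_closure_of_convex (ho : IsOpen Ω) (hK : Convex ℝ Ω) (hne : Ω.Nonempty) :
    interior (closure Ω) = Ω := by
  rw [hK.interior_closure_eq_interior_of_nonempty_interior (by rwa [ho.interior_eq]),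
    ho.interior_eq]

theorem frontier_closure_of_convex (ho : IsOpen Ω) (hK : Convex ℝ Ω) (hne : Ω.Nonempty) :
    frontier (closure Ω) = frontier Ω := by
  rw [frontier, closure_closure, interior_closure_of_convex ho hK hne, frontier, ho.interior_eq]

theorem IsPrismConst.frontier_inter_closedBall_le (hn : 2 ≤ n) (hc : IsPrismConst n c₀)
    (ho : IsOpen Ω) (hK : Convex ℝ Ω) {z : 𝔼} (hz : z ∈ frontier Ω) {r : ℝ} (hr : 0 < r) :
    μH[(n : ℝ) - 1] (frontier Ω ∩ closedBall z r) ≤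
      ENNReal.ofReal (c₀ * (n * unitBallVol n * r ^ (n - 1))) := by
  have hne : Ω.Nonempty := closure_nonempty_iff.1 ⟨z, hz.1⟩
  have hd : (0 : ℝ) ≤ (n : ℝ) - 1 := by
    have : (2 : ℝ) ≤ n := by exact_mod_cast hn
    linarith
  have h_interior : (interior (closure Ω ∩ closedBall z r)).Nonempty := by
    obtain ⟨x, hx, hxz⟩ := Metric.mem_closure_iff.1 hz.1 r hr
    refine ⟨x, interior_maximal (t := Ω ∩ ball z r)
      (inter_subset_inter subset_closure ball_subset_closedBall) (ho.inter isOpen_ball)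
      ⟨hx, by rwa [mem_ball, dist_comm]⟩⟩
  calc μH[(n : ℝ) - 1] (frontier Ω ∩ closedBall z r)
      ≤ μH[(n : ℝ) - 1] (frontier (closure Ω ∩ closedBall z r)) := by
        refine measure_mono fun y hy => ⟨subset_closure ⟨hy.1.1, hy.2⟩, fun hyi => ?_⟩
        have h1 := interior_mono inter_subset_left hyi
        rw [interior_closure_of_convex ho hK hne] at h1
        exact hy.1.2 (by rwa [ho.interior_eq])
    _ ≤ μH[(n : ℝ) - 1] (frontier (closedBall z r)) :=
        hausdorffMeasure_frontier_mono hd (hK.closure.inter (convex_closedBall z r))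
          (isClosed_closure.inter isClosed_closedBall) h_interior isBounded_closedBall
          (inter_subset_right.trans subset_closure)
    _ ≤ _ := by
        rw [frontier_closedBall _ hr.ne']
        exact hc.sphere_le (by omega) hr z

theorem IsPrismConst.frontier_open_lt_top (hn : 2 ≤ n) (hc : IsPrismConst n c₀)
    (ho : IsOpen Ω) (hb : IsBounded Ω) (hK : Convex ℝ Ω) :
    μH[(n : ℝ) - 1] (frontier Ω) < ⊤ := by
  rcases Ω.eq_empty_or_nonempty with rfl | hne
  · simp
  rw [← frontier_closure_of_convex ho hK hne]
  exact hc.frontier_lt_top (by omega) hK.closure isClosed_closure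
    (by rwa [interior_closure_of_convex ho hK hne]) hb.closure

/-- Averaging the boundary measure along the segments towards an interior point. -/
theorem IsPrismConst.exists_map_le (hn : 2 ≤ n) (hc : IsPrismConst n c₀)
    (ho : IsOpen Ω) (hb : IsBounded Ω) (hK : Convex ℝ Ω) {x₀ : 𝔼} (hx₀ : x₀ ∈ Ω) :
    ∃ C : ℝ≥0, ((μH[(n : ℝ) - 1].restrict (frontier Ω)).prod
      ((volume : Measure ℝ).restrict (Ico (1 / 2) 1))).map
        (fun q : 𝔼 × ℝ => x₀ + q.2 • (q.1 - x₀)) ≤ C • (volume : Measure 𝔼).restrict Ω := by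
  set Φ : 𝔼 × ℝ → 𝔼 := fun q => x₀ + q.2 • (q.1 - x₀) with hΦ
  have hΦm : Measurable Φ := by
    have : Continuous Φ := by fun_prop
    exact this.measurable
  set μ : Measure 𝔼 := μH[(n : ℝ) - 1].restrict (frontier Ω) with hμ
  set ℓ : Measure ℝ := (volume : Measure ℝ).restrict (Ico (1 / 2) 1) with hℓ
  have hfin := hc.frontier_open_lt_top hn ho hb hK
  have : IsFiniteMeasure μ := ⟨by rwa [hμ, Measure.restrict_apply_univ]⟩
  have : IsFiniteMeasure ℓ := ⟨by rw [hℓ, Measure.restrict_apply_univ]; simp⟩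
  obtain ⟨ρ, hρ, hball⟩ := Metric.isOpen_iff.1 ho x₀ hx₀
  obtain ⟨D, hD⟩ := (Metric.isBounded_iff_subset_closedBall x₀).1 hb.closure
  have hD0 : 0 ≤ D := by
    have := hD (subset_closure hx₀)
    rwa [mem_closedBall, dist_self] at this
  set G : Set 𝔼 := (Homeomorph.addLeft x₀) ⁻¹' Ω with hG
  have hGconv : Convex ℝ G := hK.translate_preimage_right x₀
  have hGball : ball 0 ρ ⊆ G := fun z hz => hball (by simpa [dist_eq_norm] using hz)
  have hG0 : G ∈ nhds (0 : 𝔼) := Filter.mem_of_superset (ball_mem_nhds 0 hρ) hGball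
  have hlip := hGconv.lipschitzWith_gauge (r := ⟨ρ, hρ.le⟩) (by exact_mod_cast hρ) hGball
  have hfr : ∀ y ∈ frontier Ω, gauge G (y - x₀) = 1 := fun y hy => by
    rw [gauge_eq_one_iff_mem_frontier hGconv hG0, hG, ← (Homeomorph.addLeft x₀).preimage_frontier]
    simpa using hy
  have hg : ∀ y ∈ frontier Ω, ∀ s : ℝ, 0 ≤ s → gauge G (Φ (y, s) - x₀) = s := fun y hy s hs => by
    rw [hΦ]
    simp only [add_sub_cancel_left]
    rw [gauge_smul_of_nonneg hs, hfr y hy, smul_eq_mul, mul_one]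
  have hs : ∀ y ∈ frontier Ω, ∀ y' ∈ frontier Ω, ∀ s s' : ℝ, 0 ≤ s → 0 ≤ s' →
      |s - s'| ≤ ρ⁻¹ * dist (Φ (y, s)) (Φ (y', s')) := fun y hy y' hy' s s' h h' => by
    have := hlip.dist_le_mul (Φ (y, s) - x₀) (Φ (y', s') - x₀)
    rw [hg y hy s h, hg y' hy' s' h', Real.dist_eq, dist_sub_right] at this
    exact this
  set L := 2 * (1 + D * ρ⁻¹) with hL
  have hL0 : 0 < L := by positivity
  have hy : ∀ y ∈ frontier Ω, ∀ y' ∈ frontier Ω, ∀ s s' : ℝ, 1 / 2 ≤ s → 1 / 2 ≤ s' →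
      dist y y' ≤ L * dist (Φ (y, s)) (Φ (y', s')) := fun y hy y' hy' s s' h h' => by
    have h1 := hs y hy y' hy' s s' (by linarith) (by linarith)
    have h2 : s • (y - y') = (Φ (y, s) - Φ (y', s')) + (s' - s) • (y' - x₀) := by
      rw [hΦ]; module
    have h3 : s * ‖y - y'‖ ≤ ‖Φ (y, s) - Φ (y', s')‖ + |s - s'| * ‖y' - x₀‖ := by
      have h30 : ‖s • (y - y')‖ = s * ‖y - y'‖ := by
        rw [norm_smul, Real.norm_of_nonneg (show 0 ≤ s by linarith)]
      rw [← h30, h2]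
      refine (norm_add_le _ _).trans ?_
      rw [norm_smul, Real.norm_eq_abs, abs_sub_comm s']
    have h4 : ‖y' - x₀‖ ≤ D := by
      have := hD (frontier_subset_closure hy')
      rwa [mem_closedBall, dist_eq_norm] at this
    rw [dist_eq_norm (Φ (y, s))] at h1 ⊢
    rw [dist_eq_norm]
    have h5 : |s - s'| * ‖y' - x₀‖ ≤ (ρ⁻¹ * ‖Φ (y, s) - Φ (y', s')‖) * D := by gcongr
    have h6 : 1 / 2 * ‖y - y'‖ ≤ s * ‖y - y'‖ := by gcongr
    rw [hL]; nlinarith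
  have hω := unitBallVol_pos (n := n)
  set C : ℝ := |c₀| * (n * unitBallVol n * (2 * L) ^ (n - 1)) * (4 * ρ⁻¹) / unitBallVol n with hC
  have hC0 : 0 ≤ C := by positivity
  refine ⟨C.toNNReal, ?_⟩
  have hmain : (μ.prod ℓ).map Φ ≤ C.toNNReal • (volume : Measure 𝔼) := by
    refine measure_le_of_closedBall_le fun x r hr => ?_
    rw [Measure.map_apply hΦm measurableSet_closedBall]
    set T : Set (𝔼 × ℝ) := {q | q.1 ∈ frontier Ω ∧ q.2 ∈ Ico (1 / 2 : ℝ) 1 ∧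
      Φ q ∈ closedBall x r} with hT
    have hTae : (μ.prod ℓ) (Φ ⁻¹' closedBall x r) ≤ (μ.prod ℓ) T := by
      refine measure_mono_ae ?_
      have h1 : ∀ᵐ y ∂μ, y ∈ frontier Ω := ae_restrict_mem isClosed_frontier.measurableSet
      have h2 : ∀ᵐ s ∂ℓ, s ∈ Ico (1 / 2 : ℝ) 1 := ae_restrict_mem measurableSet_Ico
      filter_upwards [Measure.quasiMeasurePreserving_fst.ae h1,
        Measure.quasiMeasurePreserving_snd.ae h2] with q hq1 hq2 hq3
      exact ⟨hq1, hq2, hq3⟩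
    refine hTae.trans ?_
    rcases T.eq_empty_or_nonempty with hT0 | ⟨⟨y₀, s₀⟩, hy₀, hs₀, hq₀⟩
    · rw [hT0, measure_empty]; exact zero_le
    have hdist : ∀ q ∈ T, dist (Φ q) (Φ (y₀, s₀)) ≤ 2 * r := fun q hq => by
      have h1 := hq.2.2
      rw [mem_closedBall] at h1 hq₀
      linarith [dist_triangle_right (Φ q) (Φ (y₀, s₀)) x]
    have hsub : T ⊆ closedBall y₀ (2 * L * r) ×ˢ closedBall s₀ (2 * ρ⁻¹ * r) := fun q hq => by
      have h1 := hdist q hq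
      have h2 := hs q.1 hq.1 y₀ hy₀ q.2 s₀ (by linarith [hq.2.1.1]) (by linarith [hs₀.1])
      have h3 := hy q.1 hq.1 y₀ hy₀ q.2 s₀ (by linarith [hq.2.1.1]) (by linarith [hs₀.1])
      constructor
      · rw [mem_closedBall]
        calc _ ≤ _ := h3
          _ ≤ L * (2 * r) := by gcongr
          _ = _ := by ring
      · rw [mem_closedBall, Real.dist_eq]
        calc _ ≤ _ := h2
          _ ≤ ρ⁻¹ * (2 * r) := by gcongr
          _ = _ := by ring
    have hLr : 0 < 2 * L * r := by positivity
    have hμ1 : μ (closedBall y₀ (2 * L * r)) ≤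
        ENNReal.ofReal (|c₀| * (n * unitBallVol n * (2 * L * r) ^ (n - 1))) := by
      rw [hμ, Measure.restrict_apply measurableSet_closedBall, inter_comm]
      refine (hc.frontier_inter_closedBall_le hn ho hK hy₀ hLr).trans (ENNReal.ofReal_le_ofReal ?_)
      gcongr
      exact le_abs_self c₀
    have hℓ1 : ℓ (closedBall s₀ (2 * ρ⁻¹ * r)) ≤ ENNReal.ofReal (2 * (2 * ρ⁻¹ * r)) := by
      rw [← Real.volume_closedBall]
      exact Measure.restrict_apply_le _ _
    calc (μ.prod ℓ) T ≤ μ (closedBall y₀ (2 * L * r)) * ℓ (closedBall s₀ (2 * ρ⁻¹ * r)) := by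
          rw [← Measure.prod_prod]; exact measure_mono hsub
      _ ≤ ENNReal.ofReal (|c₀| * (n * unitBallVol n * (2 * L * r) ^ (n - 1))) *
          ENNReal.ofReal (2 * (2 * ρ⁻¹ * r)) := by gcongr
      _ = ENNReal.ofReal (C * (r ^ n * unitBallVol n)) := by
          rw [← ENNReal.ofReal_mul (by positivity)]
          congr 1
          obtain ⟨m, rfl⟩ : ∃ m, n = m + 1 := ⟨n - 1, by omega⟩
          rw [hC, add_tsub_cancel_right, mul_pow _ r]
          field_simp
          ring
      _ = _ := by
          rw [ENNReal.ofReal_mul hC0, ← volume_real_closedBall (by omega) x hr.le,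
            Measure.smul_apply, Measure.real, ENNReal.ofReal_toReal
              (measure_closedBall_lt_top (x := x)).ne]
          rfl
  have hmem : ∀ᵐ x ∂((μ.prod ℓ).map Φ), x ∈ Ω := by
    refine (ae_map_iff (p := fun x => x ∈ Ω) hΦm.aemeasurable ho.measurableSet).2 ?_
    have h1 : ∀ᵐ y ∂μ, y ∈ frontier Ω := ae_restrict_mem isClosed_frontier.measurableSet
    have h2 : ∀ᵐ s ∂ℓ, s ∈ Ico (1 / 2 : ℝ) 1 := ae_restrict_mem measurableSet_Ico
    filter_upwards [Measure.quasiMeasurePreserving_fst.ae h1,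
      Measure.quasiMeasurePreserving_snd.ae h2] with q hq1 hq2
    have h3 := hK.openSegment_interior_closure_subset_interior (by rwa [ho.interior_eq])
      (frontier_subset_closure hq1)
    rw [ho.interior_eq] at h3
    refine h3 ⟨1 - q.2, q.2, by linarith [hq2.2], by linarith [hq2.1], by ring, ?_⟩
    rw [hΦ]; module
  have h := Measure.restrict_mono (Subset.refl Ω) hmain
  rw [Measure.restrict_eq_self_of_ae_mem hmem, Measure.restrict_smul] at h
  exact h

end TraceMeasure

section Trace
variable {n : ℕ}

local notation "𝔼" => EuclideanSpace ℝ (Fin n)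

theorem absolutelyContinuousOnInterval_le_integral {f : ℝ → ℝ}
    (hf : AbsolutelyContinuousOnInterval f (1 / 2) 1) :
    IntegrableOn (fun s => 2 * f s + |deriv f s|) (Ico (1 / 2) 1) ∧
      f 1 ≤ ∫ s in Ico (1 / 2) 1, (2 * f s + |deriv f s|) := by
  have h_interior := hf.intervalIntegrable_deriv
  have hfc : ContinuousOn f (Icc (1 / 2) 1) := by
    have := hf.continuousOn
    rwa [uIcc_of_le (by norm_num)] at this
  have hfi : IntegrableOn f (Icc (1 / 2) 1) := hfc.integrableOn_Icc
  have hdi : IntegrableOn (deriv f) (Icc (1 / 2) 1) :=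
    (intervalIntegrable_iff_integrableOn_Icc_of_le (by norm_num)).1 h_interior
  have hadi : IntegrableOn (fun s => |deriv f s|) (Icc (1 / 2) 1) := hdi.abs
  set A := ∫ s in Icc (1 / 2) 1, |deriv f s| with hA
  have h1 : ∀ s ∈ Icc (1 / 2 : ℝ) 1, f 1 ≤ f s + A := fun s hs => by
    have h2 := (hf.mono (c := s) (d := 1) (by
      rw [uIcc_of_le hs.2, uIcc_of_le (by norm_num)]
      exact Icc_subset_Icc_left hs.1)).integral_deriv_eq_sub
    have h3 : ∫ t in s..1, deriv f t ≤ A := by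
      calc ∫ t in s..1, deriv f t ≤ ∫ t in s..1, |deriv f t| :=
            (le_abs_self _).trans (intervalIntegral.abs_integral_le_integral_abs hs.2)
        _ = ∫ t in Ioc s 1, |deriv f t| := intervalIntegral.integral_of_le hs.2
        _ ≤ A := setIntegral_mono_set hadi (Filter.Eventually.of_forall fun t => abs_nonneg _)
            (LE.le.eventuallyLE fun t ht => ⟨hs.1.trans ht.1.le, ht.2⟩)
    linarith
  have hAi : IntegrableOn (fun _ : ℝ => A) (Icc (1 / 2 : ℝ) 1) := by simp
  have h4 : ∫ _ in Icc (1 / 2 : ℝ) 1, f 1 ≤ ∫ s in Icc (1 / 2) 1, (f s + A) :=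
    setIntegral_mono_on (by simp) (hfi.add hAi) measurableSet_Icc h1
  rw [integral_add hfi hAi] at h4
  simp only [setIntegral_const, Real.volume_real_Icc, smul_eq_mul] at h4
  norm_num at h4
  constructor
  · have h5 : IntegrableOn (fun s => 2 * f s + |deriv f s|) (Icc (1 / 2) 1) :=
      (hfi.const_mul 2).add hadi
    exact h5.mono_set Ico_subset_Icc_self
  · rw [← integral_Icc_eq_integral_Ico, integral_add (hfi.const_mul 2) hadi, integral_const_mul]
    linarith

theorem mul_rpow_mul_le {p ε D : ℝ} (hp : 1 < p) (hε : 0 < ε) (hD : 0 ≤ D) :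
    ∃ C : ℝ, 0 ≤ C ∧ ∀ a b : ℝ, 0 ≤ a → 0 ≤ b →
      p * a ^ (p - 1) * b * D ≤ ε * b ^ p + C * a ^ p := by
  set M : ℝ := (p * D / ε) ^ (1 / (p - 1)) with hM
  have hM0 : 0 ≤ M := by positivity
  have hMp : M ^ (p - 1) = p * D / ε := by
    rw [hM, ← Real.rpow_mul (by positivity), one_div_mul_cancel (by linarith), Real.rpow_one]
  have hpow : ∀ a : ℝ, 0 ≤ a → a ^ (p - 1) * a = a ^ p := fun a ha => by
    rcases ha.eq_or_lt with rfl | ha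
    · rw [mul_zero, Real.zero_rpow (by linarith)]
    · rw [← Real.rpow_add_one ha.ne', sub_add_cancel]
  refine ⟨p * D * M, by positivity, fun a b ha hb => ?_⟩
  have ha' : 0 ≤ a ^ (p - 1) := Real.rpow_nonneg ha _
  rcases le_total b (M * a) with h | h
  · calc p * a ^ (p - 1) * b * D ≤ p * a ^ (p - 1) * (M * a) * D := by gcongr
      _ = p * D * M * (a ^ (p - 1) * a) := by ring
      _ = p * D * M * a ^ p := by rw [hpow a ha]
      _ ≤ _ := le_add_of_nonneg_left (by positivity)
  · have h1 : (M * a) ^ (p - 1) ≤ b ^ (p - 1) :=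
      Real.rpow_le_rpow (by positivity) h (by linarith)
    rw [Real.mul_rpow hM0 ha, hMp] at h1
    have h2 : p * D * a ^ (p - 1) ≤ ε * b ^ (p - 1) := by
      rw [div_mul_eq_mul_div, div_le_iff₀ hε] at h1
      linarith
    calc p * a ^ (p - 1) * b * D = p * D * a ^ (p - 1) * b := by ring
      _ ≤ ε * b ^ (p - 1) * b := by gcongr
      _ = ε * b ^ p := by rw [mul_assoc, hpow b hb]
      _ ≤ _ := le_add_of_nonneg_right (by positivity)

variable {Ω : Set (EuclideanSpace ℝ (Fin n))} {c₀ : ℝ}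

theorem integrableOn_abs_rpow {p : ℝ} (hp : 0 ≤ p) {g : 𝔼 → ℝ} (hg : Continuous g)
    {μ : Measure 𝔼} {S : Set 𝔼} (hS : IsCompact S) (hμ : μ S < ⊤) :
    IntegrableOn (fun x => |g x| ^ p) S μ := by
  have hcont : Continuous fun x => |g x| ^ p := hg.abs.rpow_const fun _ => Or.inr hp
  obtain ⟨M, hM⟩ := hS.exists_bound_of_continuousOn hcont.continuousOn
  exact Measure.integrableOn_of_bounded (M := M) hμ.ne hcont.aestronglyMeasurable
    ((ae_restrict_iff' hS.measurableSet).2 (Filter.Eventually.of_forall hM))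

theorem integrableOn_norm_fderiv_rpow {p : ℝ} (hp : 0 ≤ p) {g : 𝔼 → ℝ} {K : ℝ≥0}
    (hg : LipschitzWith K g) {S : Set 𝔼} (hS : volume S < ⊤) :
    IntegrableOn (fun x => ‖fderiv ℝ g x‖ ^ p) S := by
  refine Measure.integrableOn_of_bounded (M := (K : ℝ) ^ p) hS.ne
    ((measurable_fderiv ℝ g).norm.pow_const p).aestronglyMeasurable
    (Filter.Eventually.of_forall fun x => ?_)
  rw [Real.norm_of_nonneg (by positivity)]
  exact Real.rpow_le_rpow (norm_nonneg _) (norm_fderiv_le_of_lipschitz ℝ hg) hp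

theorem IsPrismConst.trace_le (hn : 2 ≤ n) (hc : IsPrismConst n c₀)
    (ho : IsOpen Ω) (hb : IsBounded Ω) (hK : Convex ℝ Ω) (hne : Ω.Nonempty) {p ε : ℝ} (hp : 1 < p)
    (hε : 0 < ε) : ∃ C : ℝ, 0 ≤ C ∧ ∀ (g : 𝔼 → ℝ) (K : ℝ≥0), LipschitzWith K g →
      ∫ x in frontier Ω, |g x| ^ p ∂(μH[(n : ℝ) - 1]) ≤
        ε * (∫ x in Ω, ‖fderiv ℝ g x‖ ^ p) + C * ∫ x in Ω, |g x| ^ p := by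
  obtain ⟨x₀, hx₀⟩ := hne
  obtain ⟨Cν, hCν⟩ := hc.exists_map_le hn ho hb hK hx₀
  obtain ⟨D, hD⟩ := (Metric.isBounded_iff_subset_closedBall x₀).1 hb.closure
  have hD0 : 0 ≤ D := by
    have := hD (subset_closure hx₀)
    rwa [mem_closedBall, dist_self] at this
  set ε' : ℝ := ε / (Cν + 1) with hε'
  have hε'0 : 0 < ε' := by positivity
  obtain ⟨C, hC0, hC⟩ := mul_rpow_mul_le hp hε'0 hD0
  refine ⟨Cν * (2 + C), by positivity, fun g K hg => ?_⟩
  set Φ : 𝔼 × ℝ → 𝔼 := fun q => x₀ + q.2 • (q.1 - x₀) with hΦ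
  have hΦc : Continuous Φ := by fun_prop
  set μ : Measure 𝔼 := μH[(n : ℝ) - 1].restrict (frontier Ω) with hμ
  set ℓ : Measure ℝ := (volume : Measure ℝ).restrict (Ico (1 / 2) 1) with hℓ
  have hfin := hc.frontier_open_lt_top hn ho hb hK
  have : IsFiniteMeasure μ := ⟨by rwa [hμ, Measure.restrict_apply_univ]⟩
  have : IsFiniteMeasure ℓ := ⟨by rw [hℓ, Measure.restrict_apply_univ]; simp⟩
  set H : 𝔼 → ℝ := fun x => ε' * ‖fderiv ℝ g x‖ ^ p + (2 + C) * |g x| ^ p with hH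
  have hgm : Measurable fun x => |g x| ^ p := by
    have := hg.continuous
    exact (this.measurable.abs).pow_const p
  have hHm : Measurable H :=
    (((measurable_fderiv ℝ g).norm.pow_const p).const_mul _).add (hgm.const_mul _)
  have hH0 : ∀ x, 0 ≤ H x := fun x => by rw [hH]; positivity
  have hdiff : ∀ᵐ q ∂(μ.prod ℓ), DifferentiableAt ℝ g (Φ q) := by
    refine ae_of_ae_map hΦc.measurable.aemeasurable ?_
    refine (Measure.absolutelyContinuous_of_le hCν) ?_
    exact Measure.smul_absolutelyContinuous (ae_restrict_of_ae hg.ae_differentiableAt)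
  have hpt : ∀ᵐ y ∂μ, ENNReal.ofReal (|g y| ^ p) ≤ ∫⁻ s, ENNReal.ofReal (H (Φ (y, s))) ∂ℓ := by
    filter_upwards [Measure.ae_ae_of_ae_prod hdiff,
      ae_restrict_mem isClosed_frontier.measurableSet] with y hy hyΩ
    have hyD : ‖y - x₀‖ ≤ D := by
      have := hD (frontier_subset_closure hyΩ)
      rwa [mem_closedBall, dist_eq_norm] at this
    set f : ℝ → ℝ := fun s => |g (Φ (y, s))| ^ p with hf
    have hφlip : LocallyLipschitz fun t : ℝ => |t| ^ p :=
      (contDiff_norm_rpow (E := ℝ) hp).locallyLipschitz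
    have hΦlip : LocallyLipschitz fun s : ℝ => Φ (y, s) := by
      have : ContDiff ℝ 1 fun s : ℝ => Φ (y, s) := by
        rw [hΦ]; fun_prop
      exact this.locallyLipschitz
    have hflip : LocallyLipschitz f := hφlip.comp (hg.locallyLipschitz.comp hΦlip)
    obtain ⟨L, hL⟩ := LocallyLipschitzOn.exists_lipschitzOnWith_of_compact
      (isCompact_uIcc (a := (1 / 2 : ℝ)) (b := 1)) hflip.locallyLipschitzOn
    obtain ⟨hi, hle⟩ := absolutelyContinuousOnInterval_le_integral
      hL.absolutelyContinuousOnInterval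
    have hf1 : f 1 = |g y| ^ p := by simp [hf, hΦ]
    rw [← hf1]
    refine (ENNReal.ofReal_le_ofReal hle).trans ?_
    have hf0 : ∀ s, 0 ≤ f s := fun s => by positivity
    rw [ofReal_integral_eq_lintegral_ofReal hi
      (Filter.Eventually.of_forall fun s => by have := hf0 s; positivity)]
    refine lintegral_mono_ae ?_
    filter_upwards [hy] with s hs
    refine ENNReal.ofReal_le_ofReal ?_
    have hd1 : HasDerivAt (fun s : ℝ => Φ (y, s)) (y - x₀) s := by
      have := ((hasDerivAt_id s).smul_const (y - x₀)).const_add x₀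
      simpa [hΦ] using this
    have hd2 : HasDerivAt f (p * |g (Φ (y, s))| ^ (p - 2) * g (Φ (y, s)) *
        fderiv ℝ g (Φ (y, s)) (y - x₀)) s := by
      have h6 : HasDerivAt (fun s : ℝ => g (Φ (y, s))) (fderiv ℝ g (Φ (y, s)) (y - x₀)) s :=
        hs.hasFDerivAt.comp_hasDerivAt s hd1
      exact HasDerivAt.comp (h₂ := fun t : ℝ => |t| ^ p) s
        (hasDerivAt_abs_rpow (g (Φ (y, s))) hp) h6
    have hpow : |g (Φ (y, s))| ^ (p - 2) * |g (Φ (y, s))| ≤ |g (Φ (y, s))| ^ (p - 1) := by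
      rcases (abs_nonneg (g (Φ (y, s)))).eq_or_lt with h | h
      · rw [← h, mul_zero]; exact Real.rpow_nonneg le_rfl _
      · rw [← Real.rpow_add_one h.ne']
        apply le_of_eq; congr 1; ring
    have h3 : |deriv f s| ≤ p * |g (Φ (y, s))| ^ (p - 1) * ‖fderiv ℝ g (Φ (y, s))‖ * D := by
      rw [hd2.deriv, abs_mul, abs_mul, abs_mul, abs_of_nonneg (show 0 ≤ p by linarith),
        abs_of_nonneg (Real.rpow_nonneg (abs_nonneg (g (Φ (y, s)))) (p - 2))]
      have h4 : |fderiv ℝ g (Φ (y, s)) (y - x₀)| ≤ ‖fderiv ℝ g (Φ (y, s))‖ * D :=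
        ((fderiv ℝ g (Φ (y, s))).le_opNorm _).trans (by gcongr)
      calc _ = p * (|g (Φ (y, s))| ^ (p - 2) * |g (Φ (y, s))|) *
            |fderiv ℝ g (Φ (y, s)) (y - x₀)| := by ring
        _ ≤ p * |g (Φ (y, s))| ^ (p - 1) * (‖fderiv ℝ g (Φ (y, s))‖ * D) := by gcongr
        _ = _ := by ring
    have h5 := hC _ _ (abs_nonneg (g (Φ (y, s)))) (norm_nonneg (fderiv ℝ g (Φ (y, s))))
    change 2 * |g (Φ (y, s))| ^ p + |deriv f s| ≤
      ε' * ‖fderiv ℝ g (Φ (y, s))‖ ^ p + (2 + C) * |g (Φ (y, s))| ^ p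
    linarith
  have hΩfin : volume Ω < ⊤ := hb.measure_lt_top
  have hi1 : IntegrableOn (fun x => ‖fderiv ℝ g x‖ ^ p) Ω :=
    integrableOn_norm_fderiv_rpow (by linarith) hg hΩfin
  have hcpt : IsCompact (closure Ω) := hb.isCompact_closure
  have hi2 : IntegrableOn (fun x => |g x| ^ p) Ω :=
    (integrableOn_abs_rpow (by linarith) hg.continuous hcpt hb.closure.measure_lt_top).mono_set
      subset_closure
  have hHi : IntegrableOn H Ω := (hi1.const_mul _).add (hi2.const_mul _)
  have hbd : IntegrableOn (fun x => |g x| ^ p) (frontier Ω) μH[(n : ℝ) - 1] :=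
    integrableOn_abs_rpow (by linarith) hg.continuous
      (isCompact_of_isClosed_isBounded isClosed_frontier
        (hb.closure.subset frontier_subset_closure)) hfin
  have hchain : ENNReal.ofReal (∫ x in frontier Ω, |g x| ^ p ∂(μH[(n : ℝ) - 1])) ≤
      ENNReal.ofReal (Cν * ∫ x in Ω, H x) := by
    rw [ofReal_integral_eq_lintegral_ofReal hbd
      (Filter.Eventually.of_forall fun s => by positivity), ENNReal.ofReal_mul (by positivity),
      ofReal_integral_eq_lintegral_ofReal hHi (Filter.Eventually.of_forall hH0)]
    calc _ ≤ ∫⁻ y, ∫⁻ s, ENNReal.ofReal (H (Φ (y, s))) ∂ℓ ∂μ := lintegral_mono_ae hpt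
      _ = ∫⁻ q, ENNReal.ofReal (H (Φ q)) ∂(μ.prod ℓ) :=
          (lintegral_prod _ (hHm.comp hΦc.measurable).ennreal_ofReal.aemeasurable).symm
      _ = ∫⁻ x, ENNReal.ofReal (H x) ∂((μ.prod ℓ).map Φ) :=
          (lintegral_map hHm.ennreal_ofReal hΦc.measurable).symm
      _ ≤ ∫⁻ x, ENNReal.ofReal (H x) ∂(Cν • (volume : Measure 𝔼).restrict Ω) :=
          lintegral_mono' hCν le_rfl
      _ = _ := by
          rw [lintegral_smul_measure, ENNReal.ofReal_coe_nnreal]; rfl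
  have hHint : 0 ≤ ∫ x in Ω, H x := integral_nonneg hH0
  rw [ENNReal.ofReal_le_ofReal_iff (by positivity)] at hchain
  rw [hH, integral_add (hi1.const_mul _) (hi2.const_mul _), integral_const_mul,
    integral_const_mul] at hchain
  have h6 : Cν * ε' ≤ ε := by
    rw [hε', mul_div_assoc', div_le_iff₀ (by positivity)]
    nlinarith [Cν.coe_nonneg]
  have h7 : 0 ≤ ∫ x in Ω, ‖fderiv ℝ g x‖ ^ p := integral_nonneg fun x => by positivity
  nlinarith

/-- The Rayleigh quotients of a bounded convex domain are bounded below. -/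
theorem IsPrismConst.exists_le_rayleigh (hn : 2 ≤ n) (hc : IsPrismConst n c₀)
    (ho : IsOpen Ω) (hb : IsBounded Ω) (hK : Convex ℝ Ω) (hne : Ω.Nonempty) {p β : ℝ} (hp : 1 < p)
    (hβ : β < 0) : ∃ C : ℝ, ∀ u : 𝔼 → ℝ, (∃ K : ℝ≥0, LipschitzOnWith K u (closure Ω)) →
      (0 < ∫ x in Ω, |u x| ^ p) → C ≤ rayleigh n p β Ω u := by
  obtain ⟨C, hC0, hC⟩ := hc.trace_le hn ho hb hK hne hp (ε := 1 / |β|)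
    (one_div_pos.2 (abs_pos.2 hβ.ne))
  refine ⟨β * C, fun u ⟨K, hu⟩ hpos => ?_⟩
  obtain ⟨g, hg, hgu⟩ := hu.extend_real
  have h1 := hC g K hg
  have e1 : ∫ x in Ω, |u x| ^ p = ∫ x in Ω, |g x| ^ p :=
    setIntegral_congr_fun ho.measurableSet fun x hx => by
      simp only [hgu (subset_closure hx)]
  have e2 : ∫ x in Ω, ‖fderiv ℝ u x‖ ^ p = ∫ x in Ω, ‖fderiv ℝ g x‖ ^ p :=
    setIntegral_congr_fun ho.measurableSet fun x hx => by
      have : u =ᶠ[nhds x] g := by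
        filter_upwards [ho.mem_nhds hx] with z hz using hgu (subset_closure hz)
      simp only [this.fderiv_eq]
  have e3 : ∫ x in frontier Ω, |u x| ^ p ∂(μH[(n : ℝ) - 1]) =
      ∫ x in frontier Ω, |g x| ^ p ∂(μH[(n : ℝ) - 1]) :=
    setIntegral_congr_fun isClosed_frontier.measurableSet fun x hx => by
      simp only [hgu (frontier_subset_closure hx)]
  rw [e1] at hpos
  rw [rayleigh, e1, e2, e3, le_div_iff₀ hpos]
  have h2 := mul_le_mul_of_nonpos_left h1 hβ.le
  have h3 : β * (1 / |β| * ∫ x in Ω, ‖fderiv ℝ g x‖ ^ p) = -∫ x in Ω, ‖fderiv ℝ g x‖ ^ p := by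
    have hβ0 : β * (1 / |β|) = -1 := by
      rw [abs_of_neg hβ, mul_one_div, div_neg, div_self hβ.ne]
    rw [← mul_assoc, hβ0, neg_one_mul]
  rw [mul_add, h3] at h2
  linarith

end Trace

section Distribution
variable {n : ℕ}

local notation "𝔼" => EuclideanSpace ℝ (Fin n)

theorem measure_real_line_le_of_Ioc {ν μ : Measure ℝ} [IsFiniteMeasure ν] [IsFiniteMeasure μ]
    (h : ∀ a b : ℝ, a < b → ν (Ioc a b) ≤ μ (Ioc a b)) : ν ≤ μ := by
  refine measure_le_of_closedBall_le fun x r hr => ?_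
  rw [Real.closedBall_eq_Icc]
  set a := x - r
  set b := x + r
  have hab : a < b := by simp only [a, b]; linarith
  have hIcc : Icc a b = ⋂ k : ℕ, Ioc (a - 1 / ((k : ℝ) + 1)) b := by
    ext t
    simp only [mem_iInter, mem_Ioc, mem_Icc]
    constructor
    · rintro ⟨h1, h2⟩ k
      have : (0 : ℝ) < 1 / ((k : ℝ) + 1) := by positivity
      exact ⟨by linarith, h2⟩
    · intro hk
      refine ⟨le_of_forall_pos_lt_add fun ε hε => ?_, (hk 0).2⟩
      obtain ⟨k, hkε⟩ := exists_nat_one_div_lt hε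
      linarith [(hk k).1]
  have hanti : Antitone fun k : ℕ => Ioc (a - 1 / ((k : ℝ) + 1)) b := fun i j hij =>
    Ioc_subset_Ioc_left (sub_le_sub_left
      (one_div_le_one_div_of_le (by positivity) (by gcongr)) a)
  have hlim : ∀ (ξ : Measure ℝ) [IsFiniteMeasure ξ], Filter.Tendsto
      (fun k : ℕ => ξ (Ioc (a - 1 / ((k : ℝ) + 1)) b)) Filter.atTop (nhds (ξ (Icc a b))) :=
    fun ξ _ => by
      rw [hIcc]
      exact tendsto_measure_iInter_atTop (fun k => measurableSet_Ioc.nullMeasurableSet) hanti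
        ⟨0, measure_ne_top _ _⟩
  refine le_of_tendsto_of_tendsto' (hlim ν) (hlim μ) fun k => h _ _ ?_
  have : (0 : ℝ) < 1 / ((k : ℝ) + 1) := by positivity
  linarith

variable {Ω : Set (EuclideanSpace ℝ (Fin n))} {c₀ R : ℝ}

theorem mem_innerPar_closure_of_le_infDist {x : 𝔼} {t : ℝ} (ht : 0 < t)
    (h : t ≤ infDist x Ωᶜ) : x ∈ innerPar (closure Ω) t := by
  have h1 : ball x t ⊆ Ω := fun z hz => by
    by_contra hzΩ
    have := infDist_le_dist_of_mem (x := x) (show z ∈ Ωᶜ from hzΩ)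
    rw [mem_ball, dist_comm] at hz
    linarith
  change closedBall x t ⊆ closure Ω
  rw [← closure_ball x ht.ne']
  exact closure_mono h1

theorem le_infDist_of_mem_innerPar_closure (ho : IsOpen Ω) (hK : Convex ℝ Ω) (hne : Ω.Nonempty)
    (hcompl : (Ωᶜ).Nonempty) {x : 𝔼} {t : ℝ} (h : x ∈ innerPar (closure Ω) t) :
    t ≤ infDist x Ωᶜ := by
  refine (le_infDist hcompl).2 fun z hz => ?_
  by_contra! hlt
  have h1 : ball x t ⊆ Ω := by
    rw [← interior_closure_of_convex ho hK hne]
    exact interior_maximal (ball_subset_closedBall.trans h) isOpen_ball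
  exact hz (h1 (by rwa [mem_ball, dist_comm]))

theorem nonempty_compl_of_isBounded (hn : 1 ≤ n) (hb : IsBounded Ω) : (Ωᶜ).Nonempty := by
  have : Nonempty (Fin n) := ⟨⟨0, hn⟩⟩
  rw [nonempty_compl]
  rintro rfl
  exact NormedSpace.unbounded_univ ℝ 𝔼 hb

theorem volume_closure_of_convex (hK : Convex ℝ Ω) : volume (closure Ω) = volume Ω := by
  refine le_antisymm ?_ (measure_mono subset_closure)
  calc volume (closure Ω) ≤ volume (Ω ∪ frontier Ω) :=
        measure_mono fun x hx => by
          by_cases h : x ∈ Ω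
          · exact Or.inl h
          · exact Or.inr ⟨hx, fun hi => h (interior_subset hi)⟩
    _ ≤ volume Ω + volume (frontier Ω) := measure_union_le _ _
    _ = volume Ω := by rw [hK.addHaar_frontier volume, add_zero]

/-- The ball of radius `R` has at least the perimeter of `Ω`, measured with the prism
constant. -/
def IsPerimBound (n : ℕ) (c₀ R : ℝ) (Ω : Set (EuclideanSpace ℝ (Fin n))) : Prop :=
  μH[(n : ℝ) - 1] (frontier Ω) ≤ ENNReal.ofReal (c₀ * (n * unitBallVol n * R ^ (n - 1)))

theorem IsPrismConst.closure_innerPar_sub_le (hn : 2 ≤ n) (hc : IsPrismConst n c₀)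
    (ho : IsOpen Ω) (hb : IsBounded Ω) (hK : Convex ℝ Ω) (hne : Ω.Nonempty) (hR : 0 < R)
    (hper : IsPerimBound n c₀ R Ω) {s t : ℝ} (hs : 0 ≤ s) (hst : s ≤ t) (ht : t ≤ R) :
    volume.real (innerPar (closure Ω) s) - volume.real (innerPar (closure Ω) t) ≤
      unitBallVol n * ((R - s) ^ n - (R - t) ^ n) :=
  hc.innerPar_sub_le hn hK.closure isClosed_closure hb.closure hR
    (by rw [frontier_closure_of_convex ho hK hne]; exact hper) hs hst ht

theorem IsPrismConst.closure_innerPar_eq_zero (hn : 2 ≤ n) (hc : IsPrismConst n c₀)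
    (ho : IsOpen Ω) (hb : IsBounded Ω) (hK : Convex ℝ Ω) (hne : Ω.Nonempty) (hR : 0 < R)
    (hper : IsPerimBound n c₀ R Ω) {t : ℝ} (ht : R ≤ t) :
    volume.real (innerPar (closure Ω) t) = 0 :=
  hc.innerPar_volume_eq_zero hn hK.closure isClosed_closure hb.closure hR
    (by rw [frontier_closure_of_convex ho hK hne]; exact hper) ht

theorem IsPrismConst.volume_le (hn : 2 ≤ n) (hc : IsPrismConst n c₀)
    (ho : IsOpen Ω) (hb : IsBounded Ω) (hK : Convex ℝ Ω) (hne : Ω.Nonempty) (hR : 0 < R)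
    (hper : IsPerimBound n c₀ R Ω) : volume.real Ω ≤ unitBallVol n * R ^ n := by
  have h1 := hc.closure_innerPar_sub_le hn ho hb hK hne hR hper le_rfl hR.le le_rfl
  rw [hc.closure_innerPar_eq_zero hn ho hb hK hne hR hper le_rfl, innerPar_zero, Measure.real,
    volume_closure_of_convex hK] at h1
  rw [sub_self, zero_pow (by omega), sub_zero, sub_zero, sub_zero] at h1
  exact h1

theorem IsPrismConst.infDist_le (hn : 2 ≤ n) (hc : IsPrismConst n c₀)
    (ho : IsOpen Ω) (hb : IsBounded Ω) (hK : Convex ℝ Ω) (hne : Ω.Nonempty) (hR : 0 < R)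
    (hper : IsPerimBound n c₀ R Ω) (x : 𝔼) : infDist x Ωᶜ ≤ R := by
  by_contra! h
  set δ := infDist x Ωᶜ - R with hδ
  have hδ0 : 0 < δ := by linarith
  have h1 : ball x δ ⊆ innerPar (closure Ω) R := fun y hy => by
    refine mem_innerPar_closure_of_le_infDist hR ?_
    rw [mem_ball, dist_comm] at hy
    linarith [infDist_le_infDist_add_dist (s := Ωᶜ) (x := x) (y := y)]
  have h2 := measureReal_mono (μ := volume) h1
    ((hb.closure.subset (innerPar_subset _ hR.le)).measure_lt_top.ne)
  rw [hc.closure_innerPar_eq_zero hn ho hb hK hne hR hper le_rfl,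
    volume_real_ball (by omega) x hδ0.le] at h2
  have := unitBallVol_pos (n := n)
  have : 0 < δ ^ n * unitBallVol n := by positivity
  linarith

theorem volume_real_annulus (hn : 1 ≤ n) {a b : ℝ} (ha : 0 ≤ a) (hab : a < b) :
    volume.real (ball (0 : 𝔼) b \ closedBall 0 a) = unitBallVol n * (b ^ n - a ^ n) := by
  rw [measureReal_sdiff (closedBall_subset_ball hab) isClosed_closedBall.measurableSet
    measure_ball_lt_top.ne, volume_real_ball hn 0 (ha.trans hab.le), volume_real_closedBall hn 0 ha]
  ring

/-- The distribution of the distance to the boundary is dominated by that of the ball of the same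
perimeter. -/
theorem IsPrismConst.map_infDist_le (hn : 2 ≤ n) (hc : IsPrismConst n c₀)
    (ho : IsOpen Ω) (hb : IsBounded Ω) (hK : Convex ℝ Ω) (hne : Ω.Nonempty) (hR : 0 < R)
    (hper : IsPerimBound n c₀ R Ω) :
    (volume.restrict Ω).map (fun x => R - infDist x Ωᶜ) ≤
      (volume.restrict (ball (0 : 𝔼) R)).map (fun x => ‖x‖) := by
  have hcompl := nonempty_compl_of_isBounded (by omega) hb
  have hm : Measurable fun x : 𝔼 => R - infDist x Ωᶜ :=
    measurable_const.sub (continuous_infDist_pt _).measurable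
  have : IsFiniteMeasure (volume.restrict Ω) :=
    ⟨by rw [Measure.restrict_apply_univ]; exact hb.measure_lt_top⟩
  have : IsFiniteMeasure (volume.restrict (ball (0 : 𝔼) R)) :=
    ⟨by rw [Measure.restrict_apply_univ]; exact measure_ball_lt_top⟩
  refine measure_real_line_le_of_Ioc fun a b hab => ?_
  rw [Measure.map_apply hm measurableSet_Ioc, Measure.map_apply measurable_norm measurableSet_Ioc,
    Measure.restrict_apply (hm measurableSet_Ioc),
    Measure.restrict_apply (measurable_norm measurableSet_Ioc)]
  set K := closure Ω with hKdef
  have hfin : ∀ t : ℝ, 0 ≤ t → volume (innerPar K t) ≠ ⊤ := fun t ht =>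
    (hb.closure.subset (innerPar_subset _ ht)).measure_lt_top.ne
  have hzero : volume (innerPar K R) = 0 := by
    have := hc.closure_innerPar_eq_zero hn ho hb hK hne hR hper le_rfl
    rwa [Measure.real, ENNReal.toReal_eq_zero_iff, or_iff_left (hfin R hR.le)] at this
  have hpos : ∀ x ∈ Ω, 0 < infDist x Ωᶜ := fun x hx =>
    (ho.isClosed_compl.notMem_iff_infDist_pos hcompl).1 (by simpa using hx)
  set a' := max a 0 with ha'
  set b' := min b R with hb'
  have hbR : b' ≤ R := min_le_right _ _
  have ha0 : 0 ≤ a' := le_max_right _ _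
  have hsub : (fun x => R - infDist x Ωᶜ) ⁻¹' Ioc a b ∩ Ω ⊆
      {x | x ∈ Ω ∧ R - b' ≤ infDist x Ωᶜ ∧ R - infDist x Ωᶜ > a} := by
    rintro x ⟨⟨h1, h2⟩, hx⟩
    refine ⟨hx, ?_, h1⟩
    have := hpos x hx
    rcases min_choice b R with h | h <;> rw [hb', h] <;> linarith
  rcases le_or_gt b' a' with hle | hlt
  · -- the preimage is negligible
    have h0 : volume ((fun x => R - infDist x Ωᶜ) ⁻¹' Ioc a b ∩ Ω) = 0 := by
      refine measure_mono_null (fun x hx => ?_) hzero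
      obtain ⟨hxΩ, h1, h2⟩ := hsub hx
      have h3 := hpos x hxΩ
      refine mem_innerPar_closure_of_le_infDist hR ?_
      rcases max_choice a 0 with h | h
      · rw [ha', h] at hle
        rcases min_choice b R with h' | h' <;> rw [hb', h'] at hle <;> linarith
      · rw [ha', h] at hle; linarith
    rw [h0]; exact zero_le
  · have hRb : 0 ≤ R - b' := by linarith
    have h1 : (fun x => R - infDist x Ωᶜ) ⁻¹' Ioc a b ∩ Ω ⊆
        (innerPar K (R - b') \ innerPar K (R - a')) ∪ innerPar K R := fun x hx => by
      obtain ⟨hxΩ, h1, h2⟩ := hsub hx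
      have h3 : x ∈ innerPar K (R - b') := by
        rcases hRb.eq_or_lt with h | h
        · rw [← h, innerPar_zero]; exact subset_closure hxΩ
        · exact mem_innerPar_closure_of_le_infDist h h1
      by_cases h4 : x ∈ innerPar K (R - a')
      · right
        have h5 := le_infDist_of_mem_innerPar_closure ho hK hne hcompl h4
        rcases max_choice a 0 with h | h
        · rw [ha', h] at h5; linarith
        · rw [ha', h, sub_zero] at h4; exact h4
      · exact Or.inl ⟨h3, h4⟩
    have haR : a' < R := hlt.trans_le hbR
    have h2 : innerPar K (R - a') ⊆ innerPar K (R - b') := innerPar_anti K (by linarith)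
    calc volume ((fun x => R - infDist x Ωᶜ) ⁻¹' Ioc a b ∩ Ω)
        ≤ volume (innerPar K (R - b') \ innerPar K (R - a')) + volume (innerPar K R) :=
          (measure_mono h1).trans (measure_union_le _ _)
      _ = ENNReal.ofReal (volume.real (innerPar K (R - b') \ innerPar K (R - a'))) := by
          rw [hzero, add_zero, Measure.real,
            ENNReal.ofReal_toReal (measure_ne_top_of_subset sdiff_subset (hfin _ hRb))]
      _ ≤ ENNReal.ofReal (volume.real (ball (0 : 𝔼) b' \ closedBall 0 a')) := by
          refine ENNReal.ofReal_le_ofReal ?_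
          rw [measureReal_sdiff h2 (isClosed_innerPar isClosed_closure _).measurableSet (hfin _ hRb),
            volume_real_annulus (by omega) ha0 hlt]
          have := hc.closure_innerPar_sub_le hn ho hb hK hne hR hper hRb
            (show R - b' ≤ R - a' by linarith) (by linarith)
          simpa using this
      _ ≤ volume (ball (0 : 𝔼) b' \ closedBall 0 a') := ENNReal.ofReal_toReal_le
      _ ≤ _ := by
          refine measure_mono ?_
          rintro x ⟨hx1, hx2⟩
          rw [mem_ball_zero_iff] at hx1
          rw [mem_closedBall_zero_iff, not_le] at hx2
          refine ⟨⟨(le_max_left _ _).trans_lt hx2, (hx1.le).trans (min_le_left _ _)⟩, ?_⟩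
          rw [mem_ball_zero_iff]
          exact hx1.trans_le hbR

/-- The distribution of the norm on a ball is absolutely continuous. -/
theorem map_norm_absolutelyContinuous (hn : 1 ≤ n) (R : ℝ) :
    (volume.restrict (ball (0 : 𝔼) R)).map (fun x => ‖x‖) ≪ (volume : Measure ℝ) := by
  have : Nontrivial 𝔼 := by
    have : Nonempty (Fin n) := ⟨⟨0, hn⟩⟩
    infer_instance
  refine Measure.AbsolutelyContinuous.mk fun s hs h0 => ?_
  rw [Measure.map_apply measurable_norm hs, Measure.restrict_apply (measurable_norm hs)]
  have h1 := integral_fun_norm_addHaar (volume : Measure 𝔼) ((s ∩ Iio R).indicator fun _ => (1 : ℝ))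
  have h2 : ∫ y in Ioi (0 : ℝ), y ^ (Module.finrank ℝ 𝔼 - 1) •
      (s ∩ Iio R).indicator (fun _ => (1 : ℝ)) y = 0 := by
    refine integral_eq_zero_of_ae ?_
    refine ae_restrict_of_ae ?_
    have h3 : ∀ᵐ y : ℝ, y ∉ s := by rwa [← measure_eq_zero_iff_ae_notMem]
    filter_upwards [h3] with y hy
    simp [hy]
  have h4 : (fun x : 𝔼 => (s ∩ Iio R).indicator (fun _ => (1 : ℝ)) ‖x‖) =
      ((fun x : 𝔼 => ‖x‖) ⁻¹' s ∩ ball 0 R).indicator fun _ => (1 : ℝ) := by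
    funext x
    by_cases hx : ‖x‖ ∈ s <;> by_cases hx' : ‖x‖ < R <;> simp [hx, hx', Set.indicator]
  rw [h2, h4, integral_indicator ((measurable_norm hs).inter measurableSet_ball)] at h1
  simp only [integral_const, smul_eq_mul, mul_one, mul_zero, smul_zero,
    measureReal_restrict_apply_univ] at h1
  exact (measureReal_eq_zero_iff
    (measure_ne_top_of_subset inter_subset_right measure_ball_lt_top.ne)).1 h1

end Distribution

section Comparison
variable {n : ℕ}

local notation "𝔼" => EuclideanSpace ℝ (Fin n)

theorem norm_fderiv_comp_le_abs_deriv {E : Type*} [NormedAddCommGroup E] [NormedSpace ℝ E]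
    {H : ℝ → ℝ} {d : E → ℝ} (hd : LipschitzWith 1 d) {x : E} (hH : DifferentiableAt ℝ H (d x)) :
    ‖fderiv ℝ (fun y => H (d y)) x‖ ≤ |deriv H (d x)| := by
  by_cases hdiff : DifferentiableAt ℝ (fun y => H (d y)) x
  swap
  · rw [fderiv_zero_of_not_differentiableAt hdiff, norm_zero]; exact abs_nonneg _
  refine le_of_forall_pos_le_add fun ε hε => ?_
  refine hdiff.hasFDerivAt.le_of_lip' (by positivity) ?_
  have h1 := hH.hasDerivAt.isLittleO.def hε
  have h2 : Filter.Tendsto d (nhds x) (nhds (d x)) := hd.continuous.continuousAt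
  filter_upwards [h2.eventually h1] with y hy
  have h3 : ‖d y - d x‖ ≤ ‖y - x‖ := by
    have := hd.dist_le_mul y x
    rwa [NNReal.coe_one, one_mul, dist_eq_norm, dist_eq_norm] at this
  calc ‖H (d y) - H (d x)‖
      = ‖(H (d y) - H (d x) - (d y - d x) • deriv H (d x)) + (d y - d x) • deriv H (d x)‖ := by
        rw [sub_add_cancel]
    _ ≤ ε * ‖d y - d x‖ + ‖d y - d x‖ * |deriv H (d x)| := by
        refine (norm_add_le _ _).trans (add_le_add hy ?_)
        rw [norm_smul, Real.norm_eq_abs (deriv H (d x))]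
    _ = (|deriv H (d x)| + ε) * ‖d y - d x‖ := by ring
    _ ≤ _ := by gcongr

theorem abs_deriv_le_norm_fderiv_comp_norm [Nontrivial 𝔼] {H : ℝ → ℝ} {x : 𝔼} (hx : x ≠ 0) :
    |deriv H ‖x‖| ≤ ‖fderiv ℝ (fun y : 𝔼 => H ‖y‖) x‖ := by
  by_cases hH : DifferentiableAt ℝ H ‖x‖
  · have h1 : DifferentiableAt ℝ (fun y : 𝔼 => ‖y‖) x := differentiableAt_id.norm ℝ hx
    have h2 : HasFDerivAt (fun y : 𝔼 => H ‖y‖) (deriv H ‖x‖ • fderiv ℝ (fun y : 𝔼 => ‖y‖) x) x :=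
      hH.hasDerivAt.comp_hasFDerivAt x h1.hasFDerivAt
    rw [h2.fderiv, norm_smul, norm_fderiv_norm h1, mul_one, Real.norm_eq_abs]
  · rw [deriv_zero_of_not_differentiableAt hH, abs_zero]; exact norm_nonneg _

/-- The radial profile of a first eigenfunction extends to a Lipschitz function on the line. -/
theorem exists_lipschitz_profile (hn : 1 ≤ n) {p β R : ℝ} (hR : 0 < R) {v : 𝔼 → ℝ}
    (hv : IsFirstEigenfunction n p β (ball (0 : 𝔼) R) v) :
    ∃ (H : ℝ → ℝ) (K : ℝ≥0), LipschitzWith K H ∧ ∀ x ∈ closedBall (0 : 𝔼) R, v x = H ‖x‖ := by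
  obtain ⟨⟨K, hK⟩, -, ⟨h, hh⟩, -⟩ := hv
  rw [closure_ball _ hR.ne'] at hK hh
  set e : 𝔼 := EuclideanSpace.single ⟨0, hn⟩ 1 with he
  have he1 : ‖e‖ = 1 := by simp [he]
  have hmem : ∀ s ∈ Icc (0 : ℝ) R, s • e ∈ closedBall (0 : 𝔼) R := fun s hs => by
    rw [mem_closedBall_zero_iff, norm_smul, he1, mul_one, Real.norm_of_nonneg hs.1]; exact hs.2
  have hL : LipschitzOnWith K (fun s : ℝ => v (s • e)) (Icc 0 R) := by
    refine LipschitzOnWith.of_dist_le_mul fun s hs t ht => ?_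
    refine (hK.dist_le_mul _ (hmem s hs) _ (hmem t ht)).trans_eq ?_
    rw [dist_eq_norm, ← sub_smul, norm_smul, he1, mul_one, dist_eq_norm]
  obtain ⟨H, hH, hHe⟩ := hL.extend_real
  refine ⟨H, K, hH, fun x hx => ?_⟩
  have hx' : ‖x‖ ∈ Icc (0 : ℝ) R := ⟨norm_nonneg _, mem_closedBall_zero_iff.1 hx⟩
  rw [← hHe hx', hh x hx]
  simp only
  rw [hh _ (hmem _ hx'), norm_smul, he1, mul_one, norm_norm]

variable {Ω : Set (EuclideanSpace ℝ (Fin n))} {c₀ R : ℝ}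

/-- Integrals of functions of the distance to the boundary are dominated by radial integrals over
the ball. -/
theorem IsPrismConst.integral_infDist_le (hn : 2 ≤ n) (hc : IsPrismConst n c₀)
    (ho : IsOpen Ω) (hb : IsBounded Ω) (hK : Convex ℝ Ω) (hne : Ω.Nonempty) (hR : 0 < R)
    (hper : IsPerimBound n c₀ R Ω) {f : ℝ → ℝ} (hf : Measurable f)
    (hf0 : ∀ t ∈ Icc 0 R, 0 ≤ f t) (hfi : IntegrableOn (fun x : 𝔼 => f ‖x‖) (ball 0 R)) :
    IntegrableOn (fun x => f (R - infDist x Ωᶜ)) Ω ∧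
      ∫ x in Ω, f (R - infDist x Ωᶜ) ≤ ∫ x in ball (0 : 𝔼) R, f ‖x‖ := by
  have hle := hc.map_infDist_le hn ho hb hK hne hR hper
  have hm : Measurable fun x : 𝔼 => R - infDist x Ωᶜ :=
    (continuous_const.sub (continuous_infDist_pt _)).measurable
  have hfi' : Integrable f ((volume.restrict (ball (0 : 𝔼) R)).map (fun x => ‖x‖)) :=
    (integrable_map_measure hf.aestronglyMeasurable measurable_norm.aemeasurable).2 hfi
  constructor
  · exact (integrable_map_measure hf.aestronglyMeasurable hm.aemeasurable).1
      (hfi'.mono_measure hle)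
  rw [← integral_map hm.aemeasurable hf.aestronglyMeasurable,
    ← integral_map (φ := fun x : 𝔼 => ‖x‖) measurable_norm.aemeasurable hf.aestronglyMeasurable]
  refine integral_mono_measure hle ?_ hfi'
  have h1 : ∀ᵐ t ∂(volume.restrict (ball (0 : 𝔼) R)).map (fun x => ‖x‖), t ∈ Icc 0 R := by
    rw [ae_map_iff (p := fun t => t ∈ Icc 0 R) measurable_norm.aemeasurable measurableSet_Icc]
    filter_upwards [ae_restrict_mem measurableSet_ball] with x hx
    exact ⟨norm_nonneg _, (mem_ball_zero_iff.1 hx).le⟩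
  filter_upwards [h1] with t ht using hf0 t ht

theorem IsPrismConst.integral_norm_fderiv_le (hn : 2 ≤ n) (hc : IsPrismConst n c₀)
    (ho : IsOpen Ω) (hb : IsBounded Ω) (hK : Convex ℝ Ω) (hne : Ω.Nonempty) (hR : 0 < R)
    (hper : IsPerimBound n c₀ R Ω) {H : ℝ → ℝ} {K : ℝ≥0} (hH : LipschitzWith K H) {p : ℝ}
    (hp : 1 < p) :
    ∫ x in Ω, ‖fderiv ℝ (fun y => H (R - infDist y Ωᶜ)) x‖ ^ p ≤
      ∫ x in ball (0 : 𝔼) R, ‖fderiv ℝ (fun y : 𝔼 => H ‖y‖) x‖ ^ p := by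
  have : Nontrivial 𝔼 := by
    have : Nonempty (Fin n) := ⟨⟨0, by omega⟩⟩
    infer_instance
  have hp0 : 0 ≤ p := by linarith
  have hd : LipschitzWith 1 fun y : 𝔼 => R - infDist y Ωᶜ := by
    refine LipschitzWith.of_dist_le_mul fun x y => ?_
    rw [dist_sub_left]
    exact (lipschitz_infDist_pt Ωᶜ).dist_le_mul x y
  have hHn : LipschitzWith (K * 1) fun y : 𝔼 => H ‖y‖ := hH.comp lipschitzWith_one_norm
  have hrad : ∀ x : 𝔼, x ≠ 0 →
      |deriv H ‖x‖| ^ p ≤ ‖fderiv ℝ (fun y : 𝔼 => H ‖y‖) x‖ ^ p := fun x hx =>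
    Real.rpow_le_rpow (abs_nonneg _) (abs_deriv_le_norm_fderiv_comp_norm hx) hp0
  have hae0 : ∀ᵐ x : 𝔼 ∂volume.restrict (ball (0 : 𝔼) R), x ≠ 0 :=
    ae_restrict_of_ae (by simp [ae_iff])
  have hiB : IntegrableOn (fun x => ‖fderiv ℝ (fun y : 𝔼 => H ‖y‖) x‖ ^ p) (ball 0 R) :=
    integrableOn_norm_fderiv_rpow hp0 hHn measure_ball_lt_top
  have hmf : Measurable fun t : ℝ => |deriv H t| ^ p :=
    ((continuous_abs.measurable.comp (measurable_deriv H)).pow_const p)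
  have hfi : IntegrableOn (fun x : 𝔼 => |deriv H ‖x‖| ^ p) (ball 0 R) := by
    refine Integrable.mono' hiB (hmf.comp measurable_norm).aestronglyMeasurable ?_
    filter_upwards [hae0] with x hx
    rw [Real.norm_of_nonneg (by positivity)]
    exact hrad x hx
  obtain ⟨hi, hle⟩ := hc.integral_infDist_le hn ho hb hK hne hR hper hmf
    (fun t _ => by positivity) hfi
  have hdiff : ∀ᵐ x ∂volume.restrict Ω, DifferentiableAt ℝ H (R - infDist x Ωᶜ) := by
    refine ae_of_ae_map (p := fun t => DifferentiableAt ℝ H t) hd.continuous.measurable.aemeasurable ?_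
    have hac := (Measure.absolutelyContinuous_of_le
      (hc.map_infDist_le hn ho hb hK hne hR hper)).trans
      (map_norm_absolutelyContinuous (by omega) R)
    exact hac.ae_le hH.ae_differentiableAt_real
  calc ∫ x in Ω, ‖fderiv ℝ (fun y => H (R - infDist y Ωᶜ)) x‖ ^ p
      ≤ ∫ x in Ω, |deriv H (R - infDist x Ωᶜ)| ^ p := by
        refine integral_mono_of_nonneg (Filter.Eventually.of_forall fun x => by positivity) hi ?_
        filter_upwards [hdiff] with x hx
        exact Real.rpow_le_rpow (norm_nonneg _) (norm_fderiv_comp_le_abs_deriv hd hx) hp0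
    _ ≤ ∫ x in ball (0 : 𝔼) R, |deriv H ‖x‖| ^ p := hle
    _ ≤ _ := by
        refine integral_mono_ae hfi hiB ?_
        filter_upwards [hae0] with x hx using hrad x hx

end Comparison

section Eigenvalues
variable {n : ℕ} {Ω : Set (EuclideanSpace ℝ (Fin n))} {c₀ R : ℝ}

local notation "𝔼" => EuclideanSpace ℝ (Fin n)

theorem IsPrismConst.robinEig_le (hn : 2 ≤ n) (hc : IsPrismConst n c₀)
    (ho : IsOpen Ω) (hb : IsBounded Ω) (hK : Convex ℝ Ω) (hne : Ω.Nonempty) {p β : ℝ} (hp : 1 < p)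
    (hβ : β < 0) {u : 𝔼 → ℝ} (hu : ∃ K : ℝ≥0, LipschitzOnWith K u (closure Ω))
    (hpos : 0 < ∫ x in Ω, |u x| ^ p) : robinEig n p β Ω ≤ rayleigh n p β Ω u := by
  obtain ⟨C, hC⟩ := hc.exists_le_rayleigh hn ho hb hK hne hp hβ
  refine csInf_le ⟨C, ?_⟩ ⟨u, hu, hpos, rfl⟩
  rintro r ⟨w, hw, hwpos, rfl⟩
  exact hC w hw hwpos

theorem volume_real_pos (ho : IsOpen Ω) (hb : IsBounded Ω) (hne : Ω.Nonempty) :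
    0 < volume.real Ω :=
  ENNReal.toReal_pos (ho.measure_pos volume hne).ne' hb.measure_lt_top.ne

theorem IsPrismConst.robinEig_nonpos (hn : 2 ≤ n) (hc : IsPrismConst n c₀)
    (ho : IsOpen Ω) (hb : IsBounded Ω) (hK : Convex ℝ Ω) (hne : Ω.Nonempty) {p β : ℝ} (hp : 1 < p)
    (hβ : β < 0) : robinEig n p β Ω ≤ 0 := by
  have hvol := volume_real_pos ho hb hne
  have h1 : ∫ x in Ω, |(1 : ℝ)| ^ p = volume.real Ω := by simp
  refine (hc.robinEig_le hn ho hb hK hne hp hβ (u := fun _ => 1)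
    ⟨0, (LipschitzWith.const 1).lipschitzOnWith⟩ (by rw [h1]; exact hvol)).trans ?_
  rw [rayleigh, h1]
  refine div_nonpos_of_nonpos_of_nonneg ?_ hvol.le
  have h2 : ∀ x : 𝔼, ‖fderiv ℝ (fun _ : 𝔼 => (1 : ℝ)) x‖ ^ p = 0 := fun x => by
    rw [fderiv_fun_const]; simp [Real.zero_rpow (show p ≠ 0 by linarith)]
  simp only [h2, integral_zero, zero_add]
  exact mul_nonpos_of_nonpos_of_nonneg hβ.le (integral_nonneg fun x => by positivity)

theorem setIntegral_frontier_eq {u : 𝔼 → ℝ} {p a : ℝ} (h : ∀ x ∈ frontier Ω, u x = a) :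
    ∫ x in frontier Ω, |u x| ^ p ∂(μH[(n : ℝ) - 1]) = |a| ^ p * perim n Ω := by
  rw [setIntegral_congr_fun (g := fun _ => |a| ^ p) isClosed_frontier.measurableSet
    (fun x hx => by simp only [h x hx]), setIntegral_const, smul_eq_mul, mul_comm]
  rfl

theorem IsPrismConst.isPerimBound (hn : 2 ≤ n) (hc : IsPrismConst n c₀)
    (ho : IsOpen Ω) (hb : IsBounded Ω) (hK : Convex ℝ Ω) (hR : 0 < R)
    (hper : perim n (ball (0 : 𝔼) R) = perim n Ω) : IsPerimBound n c₀ R Ω := by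
  have h1 := hc.frontier_open_lt_top hn ho hb hK
  have h2 := hc.frontier_open_lt_top hn isOpen_ball isBounded_ball (convex_ball (0 : 𝔼) R)
  have h3 := (ENNReal.toReal_eq_toReal_iff' h2.ne h1.ne).1 hper
  rw [IsPerimBound, ← h3, frontier_ball _ hR.ne']
  exact hc.sphere_le (by omega) hR 0

/-- Quantitative comparison of the first Robin eigenvalues in terms of the volume deficit. -/
theorem IsPrismConst.robinEig_comparison (hn : 2 ≤ n) (hc : IsPrismConst n c₀)
    (ho : IsOpen Ω) (hb : IsBounded Ω) (hK : Convex ℝ Ω) (hne : Ω.Nonempty) {p β : ℝ} (hp : 1 < p)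
    (hβ : β < 0) (hR : 0 < R) (hper : perim n (ball (0 : 𝔼) R) = perim n Ω) {v : 𝔼 → ℝ}
    (hv : IsFirstEigenfunction n p β (ball (0 : 𝔼) R) v) {m : ℝ} (hm0 : 0 < m)
    (hm : ∀ x ∈ closedBall (0 : 𝔼) R, m ≤ v x) :
    |robinEig n p β Ω| * (m ^ p * (unitBallVol n * R ^ n - volume.real Ω)) /
        (∫ x in ball (0 : 𝔼) R, |v x| ^ p) ≤
      robinEig n p β (ball (0 : 𝔼) R) - robinEig n p β Ω := by
  have hpb := hc.isPerimBound hn ho hb hK hR hper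
  obtain ⟨H, K, hH, hvH⟩ := exists_lipschitz_profile (by omega) hR hv
  obtain ⟨-, -, -, hDB, hray⟩ := hv
  have hp0 : 0 ≤ p := by linarith
  have hcompl := nonempty_compl_of_isBounded (by omega) hb
  have hd : LipschitzWith 1 fun y : 𝔼 => R - infDist y Ωᶜ := by
    refine LipschitzWith.of_dist_le_mul fun x y => ?_
    rw [dist_sub_left]
    exact (lipschitz_infDist_pt Ωᶜ).dist_le_mul x y
  have hu : LipschitzWith (K * 1) fun y : 𝔼 => H (R - infDist y Ωᶜ) := hH.comp hd
  have hvol := volume_real_pos ho hb hne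
  have hmH : ∀ t ∈ Icc 0 R, m ≤ H t := fun t ht => by
    set e : 𝔼 := EuclideanSpace.single ⟨0, by omega⟩ 1 with he
    have he1 : ‖t • e‖ = t := by
      rw [norm_smul, he, PiLp.norm_single, norm_one, mul_one, Real.norm_of_nonneg ht.1]
    have hmem : t • e ∈ closedBall (0 : 𝔼) R := by rw [mem_closedBall_zero_iff, he1]; exact ht.2
    have := hm _ hmem
    rwa [hvH _ hmem, he1] at this
  have hBeq : ∀ x ∈ ball (0 : 𝔼) R, v x = H ‖x‖ := fun x hx => hvH x (ball_subset_closedBall hx)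
  -- the denominators
  have hDeq : ∫ x in ball (0 : 𝔼) R, |v x| ^ p = ∫ x in ball (0 : 𝔼) R, |H ‖x‖| ^ p :=
    setIntegral_congr_fun measurableSet_ball fun x hx => by simp only [hBeq x hx]
  have hHc : Continuous fun x : 𝔼 => H ‖x‖ := hH.continuous.comp continuous_norm
  have hiB : IntegrableOn (fun x : 𝔼 => |H ‖x‖| ^ p) (ball 0 R) :=
    (integrableOn_abs_rpow hp0 hHc (isCompact_closedBall (0 : 𝔼) R)
      measure_closedBall_lt_top).mono_set ball_subset_closedBall
  have hiΩ : IntegrableOn (fun x : 𝔼 => |H (R - infDist x Ωᶜ)| ^ p) Ω :=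
    (integrableOn_abs_rpow hp0 hu.continuous hb.isCompact_closure
      hb.closure.measure_lt_top).mono_set subset_closure
  have hcB : IntegrableOn (fun _ : 𝔼 => m ^ p) (ball 0 R) :=
    integrableOn_const measure_ball_lt_top.ne
  have hcΩ : IntegrableOn (fun _ : 𝔼 => m ^ p) Ω := integrableOn_const hb.measure_lt_top.ne
  have hf0 : ∀ t ∈ Icc 0 R, 0 ≤ |H t| ^ p - m ^ p := fun t ht => by
    have := hmH t ht
    rw [abs_of_nonneg (by linarith)]
    exact sub_nonneg.2 (Real.rpow_le_rpow hm0.le this hp0)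
  have hden := (hc.integral_infDist_le hn ho hb hK hne hR hpb (f := fun t => |H t| ^ p - m ^ p)
    (((hH.continuous.abs.rpow_const fun _ => Or.inr hp0).sub continuous_const).measurable)
    hf0 (hiB.sub hcB)).2
  rw [integral_sub hiΩ hcΩ, integral_sub hiB hcB, setIntegral_const, setIntegral_const,
    smul_eq_mul, smul_eq_mul, volume_real_ball (by omega) 0 hR.le, ← hDeq] at hden
  have hposden : 0 ≤ ∫ x in Ω, (|H (R - infDist x Ωᶜ)| ^ p - m ^ p) :=
    setIntegral_nonneg ho.measurableSet fun x _ => hf0 _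
      ⟨by linarith [hc.infDist_le hn ho hb hK hne hR hpb x], by linarith [infDist_nonneg (x := x) (s := Ωᶜ)]⟩
  rw [integral_sub hiΩ hcΩ, setIntegral_const, smul_eq_mul] at hposden
  have hmp : 0 < m ^ p := Real.rpow_pos_of_pos hm0 p
  set DΩ := ∫ x in Ω, |H (R - infDist x Ωᶜ)| ^ p with hDΩ
  set DB := ∫ x in ball (0 : 𝔼) R, |v x| ^ p with hDBdef
  have hDΩ0 : 0 < DΩ := by nlinarith [mul_pos hvol hmp]
  -- the numerators
  have hgrad := hc.integral_norm_fderiv_le hn ho hb hK hne hR hpb hH hp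
  have hgeq : ∫ x in ball (0 : 𝔼) R, ‖fderiv ℝ v x‖ ^ p =
      ∫ x in ball (0 : 𝔼) R, ‖fderiv ℝ (fun y : 𝔼 => H ‖y‖) x‖ ^ p :=
    setIntegral_congr_fun measurableSet_ball fun x hx => by
      have : v =ᶠ[nhds x] fun y : 𝔼 => H ‖y‖ := by
        filter_upwards [isOpen_ball.mem_nhds hx] with y hy using hBeq y hy
      simp only [this.fderiv_eq]
  have hbΩ : ∫ x in frontier Ω, |H (R - infDist x Ωᶜ)| ^ p ∂(μH[(n : ℝ) - 1]) =
      |H R| ^ p * perim n Ω := setIntegral_frontier_eq fun x hx => by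
    rw [frontier_eq_closure_inter_closure] at hx
    rw [(mem_closure_iff_infDist_zero hcompl).1 hx.2, sub_zero]
  have hbB : ∫ x in frontier (ball (0 : 𝔼) R), |v x| ^ p ∂(μH[(n : ℝ) - 1]) =
      |H R| ^ p * perim n (ball (0 : 𝔼) R) := setIntegral_frontier_eq fun x hx => by
    rw [frontier_ball _ hR.ne'] at hx
    rw [hvH x (sphere_subset_closedBall hx), mem_sphere_zero_iff_norm.1 hx]
  have h1 := hc.robinEig_le hn ho hb hK hne hp hβ (u := fun y : 𝔼 => H (R - infDist y Ωᶜ))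
    ⟨_, hu.lipschitzOnWith⟩ hDΩ0
  have h0 := hc.robinEig_nonpos hn ho hb hK hne hp hβ
  rw [rayleigh, hbΩ, ← hDΩ, le_div_iff₀ hDΩ0] at h1
  rw [rayleigh, hbB, hper, ← hDBdef, div_eq_iff hDB.ne', hgeq] at hray
  rw [abs_of_nonpos h0, div_le_iff₀ hDB]
  set l := robinEig n p β Ω
  have h2 : l * (DB - m ^ p * (unitBallVol n * R ^ n - volume.real Ω)) ≤ l * DΩ :=
    mul_le_mul_of_nonpos_left (by linarith) h0
  linarith
end Eigenvalues

section BallDifference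
variable {n : ℕ}

local notation "𝔼" => EuclideanSpace ℝ (Fin n)
local notation "⟪" left "," right "⟫" => inner ℝ left right

theorem volume_real_sector_ge (hn : 1 ≤ n) {e : 𝔼} (he : ‖e‖ = 1) {a b : ℝ} (ha : 0 < a)
    (hab : a ≤ b) : unitBallVol n / 16 ^ n * (b ^ n - a ^ n) ≤
      volume.real {y : 𝔼 | a ≤ ‖y‖ ∧ ‖y‖ < b ∧ 3 / 4 * ‖y‖ < ⟪y, e⟫} := by
  set T : Set 𝔼 := {y | 3 / 4 * ‖y‖ < ⟪y, e⟫} with hT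
  have hTo : IsOpen T := isOpen_lt (by fun_prop) (by fun_prop)
  have hV : unitBallVol n / 16 ^ n ≤ volume.real (T ∩ ball 0 1) := by
    have h1 : ball ((1 / 2 : ℝ) • e) (1 / 16) ⊆ T ∩ ball 0 1 := fun y hy => by
      rw [mem_ball, dist_eq_norm] at hy
      set u := y - (1 / 2 : ℝ) • e with hu
      have hyu : y = (1 / 2 : ℝ) • e + u := by rw [hu]; abel
      have h2 : ‖(1 / 2 : ℝ) • e‖ = 1 / 2 := by rw [norm_smul, he]; norm_num
      have h3 : ‖y‖ < 9 / 16 := by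
        rw [hyu]; have := norm_add_le ((1 / 2 : ℝ) • e) u; linarith
      have h4 : 7 / 16 < ⟪y, e⟫ := by
        rw [hyu, inner_add_left, real_inner_smul_left, real_inner_self_eq_norm_sq, he]
        have := abs_le.1 ((abs_real_inner_le_norm u e).trans_eq (by rw [he, mul_one]))
        linarith [this.1]
      refine ⟨?_, ?_⟩
      · show 3 / 4 * ‖y‖ < ⟪y, e⟫
        linarith
      · rw [mem_ball_zero_iff]; linarith
    have h2 := measureReal_mono (μ := volume) h1
      (measure_ne_top_of_subset inter_subset_right measure_ball_lt_top.ne)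
    rw [volume_real_ball hn _ (by norm_num)] at h2
    calc unitBallVol n / 16 ^ n = (1 / 16) ^ n * unitBallVol n := by
          rw [div_pow, one_pow]; ring
      _ ≤ _ := h2
  have hscale : ∀ r : ℝ, 0 < r → volume.real (T ∩ ball 0 r) = r ^ n * volume.real (T ∩ ball 0 1) := by
    intro r hr
    rw [← volume_real_smul hr.le]
    congr 1
    ext y
    rw [mem_smul_set_iff_inv_smul_mem₀ hr.ne']
    have hr' : 0 < r⁻¹ := inv_pos.2 hr
    simp only [hT, mem_inter_iff, mem_ofPred_eq, mem_ball_zero_iff, norm_smul, real_inner_smul_left,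
      Real.norm_of_nonneg hr'.le]
    rw [show 3 / 4 * (r⁻¹ * ‖y‖) = r⁻¹ * (3 / 4 * ‖y‖) by ring, mul_lt_mul_iff_right₀ hr',
      inv_mul_lt_one₀ hr]
  have hb : 0 < b := ha.trans_le hab
  have hset : {y : 𝔼 | a ≤ ‖y‖ ∧ ‖y‖ < b ∧ 3 / 4 * ‖y‖ < ⟪y, e⟫} =
      (T ∩ ball 0 b) \ (T ∩ ball 0 a) := by
    ext y
    simp only [hT, mem_ofPred_eq, mem_sdiff, mem_inter_iff, mem_ball_zero_iff, not_and, not_lt]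
    tauto
  rw [hset, measureReal_sdiff (inter_subset_inter_right _ (ball_subset_ball hab))
    (hTo.inter isOpen_ball).measurableSet
    (measure_ne_top_of_subset inter_subset_right measure_ball_lt_top.ne), hscale b hb, hscale a ha,
    ← sub_mul, mul_comm]
  exact mul_le_mul_of_nonneg_left hV (sub_nonneg.2 (pow_le_pow_left₀ ha.le hab n))

/-- Quantitative lower bound for the difference of two balls with the same radius. -/
theorem le_volume_real_ball_diff (hn : 1 ≤ n) {ρ : ℝ} (hρ : 0 < ρ) (z z' : 𝔼) :
    n * unitBallVol n / (4 * 16 ^ n) * ρ ^ (n - 1) * min ‖z' - z‖ (ρ / 2) ≤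
      volume.real (ball z' ρ \ ball z ρ) := by
  have hω := unitBallVol_pos (n := n)
  rcases eq_or_ne z' z with rfl | hne
  · rw [sub_self, norm_zero, min_eq_left (by positivity), mul_zero]; exact measureReal_nonneg
  set w := z' - z with hw
  have hw0 : 0 < ‖w‖ := norm_pos_iff.2 (sub_ne_zero.2 hne)
  set q := min ‖w‖ (ρ / 2) with hq
  have hq0 : 0 < q := lt_min hw0 (by positivity)
  have hqρ : q ≤ ρ / 2 := min_le_right _ _
  set e : 𝔼 := ‖w‖⁻¹ • w with he
  have he1 : ‖e‖ = 1 := by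
    rw [he, norm_smul, norm_inv, norm_norm, inv_mul_cancel₀ hw0.ne']
  have hwe : w = ‖w‖ • e := by rw [he, smul_inv_smul₀ hw0.ne']
  -- the nearby ball
  have hsector : (fun y => y - z) ⁻¹' {y : 𝔼 | ρ ≤ ‖y‖ ∧ ‖y‖ < ρ + q / 4 ∧ 3 / 4 * ‖y‖ < ⟪y, e⟫} ⊆
      ball (z + q • e) ρ \ ball z ρ := by
    rintro y' ⟨h1, h2, h3⟩
    set y := y' - z with hy
    refine ⟨?_, ?_⟩
    · have h4 : ‖y - q • e‖ ^ 2 = ‖y‖ ^ 2 - 2 * q * ⟪y, e⟫ + q ^ 2 := by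
        rw [norm_sub_sq_real, norm_smul, he1, real_inner_smul_right, mul_one, Real.norm_eq_abs, sq_abs]
        ring
      rw [mem_ball, dist_eq_norm, show y' - (z + q • e) = y - q • e by rw [hy]; abel]
      refine lt_of_pow_lt_pow_left₀ 2 hρ.le ?_
      rw [h4]
      have h5 : 0 < q * (⟪y, e⟫ - 3 / 4 * ‖y‖) := mul_pos hq0 (by linarith)
      have h6 : ‖y‖ ^ 2 ≤ (ρ + q / 4) ^ 2 := by gcongr
      have h7 : q * ρ ≤ q * ‖y‖ := by gcongr
      nlinarith
    · rw [mem_ball, dist_eq_norm, not_lt]; exact h1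
  have h1 : unitBallVol n / 16 ^ n * ((ρ + q / 4) ^ n - ρ ^ n) ≤
      volume.real (ball (z + q • e) ρ \ ball z ρ) := by
    refine (volume_real_sector_ge hn he1 hρ (by linarith)).trans ?_
    refine le_trans (le_of_eq ?_) (measureReal_mono (μ := volume) hsector
      (measure_ne_top_of_subset sdiff_subset measure_ball_lt_top.ne))
    simp only [Measure.real, sub_eq_add_neg]
    rw [measure_preimage_add_right]
  have h2 : (q / 4) * (n * ρ ^ (n - 1)) ≤ (ρ + q / 4) ^ n - ρ ^ n := by
    have := sub_mul_pow_le hρ.le (show ρ ≤ ρ + q / 4 by linarith) n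
    rwa [add_sub_cancel_left] at this
  -- convexity of the intersections in the centre
  have h3 : ball z' ρ ∩ ball z ρ ⊆ ball (z + q • e) ρ ∩ ball z ρ := by
    rintro y ⟨hy', hy⟩
    refine ⟨?_, hy⟩
    have h4 : z + q • e ∈ segment ℝ z z' := by
      rw [segment_eq_image']
      refine ⟨q / ‖w‖, ⟨by positivity, (div_le_one hw0).2 (min_le_left _ _)⟩, ?_⟩
      simp only [← hw, he, smul_smul, div_eq_mul_inv]
    have h5 := (convex_ball y ρ).segment_subset (mem_ball'.2 hy) (mem_ball'.2 hy') h4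
    rw [mem_ball'] at h5
    exact h5
  have h4 := measureReal_mono (μ := volume) h3
    (measure_ne_top_of_subset inter_subset_right measure_ball_lt_top.ne)
  have h5 := measureReal_sdiff_add_inter (μ := volume) (s := ball z' ρ) (t := ball z ρ)
    measurableSet_ball measure_ball_lt_top.ne
  have h6 := measureReal_sdiff_add_inter (μ := volume) (s := ball (z + q • e) ρ) (t := ball z ρ)
    measurableSet_ball measure_ball_lt_top.ne
  rw [volume_real_ball hn _ hρ.le] at h5 h6
  have h7 := mul_le_mul_of_nonneg_left h2 (show 0 ≤ unitBallVol n / 16 ^ n by positivity)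
  have h8 : n * unitBallVol n / (4 * 16 ^ n) * ρ ^ (n - 1) * q =
      unitBallVol n / 16 ^ n * (q / 4 * (n * ρ ^ (n - 1))) := by
    field_simp
  rw [h8]
  linarith

end BallDifference

section Sandwich
variable {n : ℕ} {Ω : Set (EuclideanSpace ℝ (Fin n))} {c₀ R : ℝ}

local notation "𝔼" => EuclideanSpace ℝ (Fin n)
local notation "⟪" left "," right "⟫" => inner ℝ left right

theorem norm_sub_le_of_volume_ball_diff_le (hn : 1 ≤ n) {ρ t : ℝ} {z z' : 𝔼} (hR : 0 < R)
    (hρ : R / 2 ≤ ρ) (ht : 4 * 32 ^ n * t < 1 / 4)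
    (h : volume.real (ball z' ρ \ ball z ρ) ≤ n * t * (unitBallVol n * R ^ n)) :
    ‖z' - z‖ ≤ 4 * 32 ^ n * t * R := by
  have hω := unitBallVol_pos (n := n)
  have hρ0 : 0 < ρ := by linarith
  have hn0 : (0 : ℝ) < n := by exact_mod_cast hn
  have h1 := (le_volume_real_ball_diff hn hρ0 z z').trans h
  have h2 : R ^ (n - 1) / 2 ^ n ≤ ρ ^ (n - 1) := by
    calc R ^ (n - 1) / 2 ^ n ≤ R ^ (n - 1) / 2 ^ (n - 1) := by
          gcongr
          · norm_num
          · omega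
      _ = (R / 2) ^ (n - 1) := by rw [div_pow]
      _ ≤ ρ ^ (n - 1) := by gcongr
  set q := min ‖z' - z‖ (ρ / 2) with hq
  have hq0 : 0 ≤ q := le_min (norm_nonneg _) (by linarith)
  have h3 : n * unitBallVol n / (4 * 16 ^ n) * (R ^ (n - 1) / 2 ^ n) * q ≤
      n * t * (unitBallVol n * R ^ n) := le_trans (by gcongr) h1
  have hRn : R ^ n = R ^ (n - 1) * R := by rw [← pow_succ, Nat.sub_add_cancel hn]
  have h32 : (32 : ℝ) ^ n = 16 ^ n * 2 ^ n := by rw [← mul_pow]; norm_num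
  have h4 : q ≤ 4 * 32 ^ n * t * R := by
    have h5 : 0 < n * unitBallVol n / (4 * 16 ^ n) * (R ^ (n - 1) / 2 ^ n) := by positivity
    refine le_of_mul_le_mul_left (h3.trans_eq ?_) h5
    rw [hRn, h32]
    field_simp
  rcases min_choice ‖z' - z‖ (ρ / 2) with h5 | h5
  · rwa [hq, h5] at h4
  · rw [hq, h5] at h4
    nlinarith

set_option maxHeartbeats 800000 in
/-- A convex set with small volume deficit lies between two balls with close radii. -/
theorem IsPrismConst.exists_closedBall_subset (hn : 2 ≤ n) (hc : IsPrismConst n c₀)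
    (ho : IsOpen Ω) (hb : IsBounded Ω) (hK : Convex ℝ Ω) (hne : Ω.Nonempty) (hR : 0 < R)
    (hper : IsPerimBound n c₀ R Ω) {σ : ℝ} (hσ0 : 0 < σ) (hσ : 4 * 32 ^ n * σ ≤ 1 / 32)
    (hΔ : unitBallVol n * R ^ n - volume.real Ω ≤
      σ ^ n / (n * 16 ^ n) * (unitBallVol n * (σ * R) ^ n)) :
    ∃ z, closedBall z ((1 - σ) * R) ⊆ closure Ω ∧
      closure Ω ⊆ closedBall z ((1 + 4 * 32 ^ n * σ) * R) := by
  have hω := unitBallVol_pos (n := n)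
  have hn1 : 1 ≤ n := by omega
  have hn0 : (1 : ℝ) ≤ n := by exact_mod_cast hn1
  have h32 : (1 : ℝ) ≤ 32 ^ n := one_le_pow₀ (by norm_num)
  have hσ1 : σ ≤ 1 / 32 := by nlinarith
  set K := closure Ω with hKdef
  have hKc : Convex ℝ K := hK.closure
  have hKcomp : IsCompact K := hb.isCompact_closure
  have hKvol : volume.real K = volume.real Ω := by
    rw [Measure.real, volume_closure_of_convex hK]; rfl
  have hKle := hc.volume_le hn ho hb hK hne hR hper
  set τ := σ ^ n / (n * 16 ^ n) with hτ
  have hτ0 : 0 < τ := by positivity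
  have hτ1 : τ < 1 := by
    have h1 : σ ^ n ≤ 1 := pow_le_one₀ hσ0.le (by linarith)
    have h2 : (1 : ℝ) < 16 ^ n := one_lt_pow₀ (by norm_num) (by omega)
    rw [hτ, div_lt_one (by positivity)]
    nlinarith
  set ρ := (1 - σ) * R with hρ
  have hρ0 : 0 < ρ := mul_pos (by linarith) hR
  have hρR : R / 2 ≤ ρ := by rw [hρ]; nlinarith
  set G := innerPar K ρ with hG
  have hGK : G ⊆ K := innerPar_subset K hρ0.le
  have hGfin : volume G ≠ ⊤ := measure_ne_top_of_subset hGK hKcomp.measure_lt_top.ne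
  -- the volume of the inner parallel set
  have hGvol : unitBallVol n * (σ * R) ^ n * (1 - τ) ≤ volume.real G := by
    have h1 := hc.closure_innerPar_sub_le hn ho hb hK hne hR hper le_rfl hρ0.le
      (show ρ ≤ R by rw [hρ]; nlinarith)
    rw [innerPar_zero, ← hKdef, hKvol, sub_zero, show R - ρ = σ * R by rw [hρ]; ring] at h1
    linarith
  have hGpos : 0 < volume.real G := lt_of_lt_of_le (by
    have : 0 < 1 - τ := by linarith
    positivity) hGvol
  obtain ⟨z, hz⟩ : G.Nonempty := by
    by_contra h
    rw [not_nonempty_iff_eq_empty.1 h, measureReal_empty] at hGpos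
    exact hGpos.false
  have hBern : ∀ t : ℝ, t ≤ 1 → 1 - n * t ≤ (1 - t) ^ n := fun t ht => by
    have := one_add_mul_le_pow (show (-2 : ℝ) ≤ -t by linarith) n
    rw [← sub_eq_add_neg] at this
    linarith
  -- its diameter
  have hGdiam : ∀ z' ∈ G, ‖z' - z‖ ≤ 4 * 32 ^ n * σ * R := fun z' hz' => by
    refine norm_sub_le_of_volume_ball_diff_le hn1 hR hρR (by linarith) ?_
    have h1 : ball z ρ ∪ (ball z' ρ \ ball z ρ) ⊆ K :=
      union_subset (ball_subset_closedBall.trans hz)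
        (sdiff_subset.trans (ball_subset_closedBall.trans hz'))
    have h2 := measureReal_mono (μ := volume) h1 hKcomp.measure_lt_top.ne
    rw [measureReal_union disjoint_sdiff_right (measurableSet_ball.diff measurableSet_ball)
      measure_ball_lt_top.ne (measure_ne_top_of_subset sdiff_subset measure_ball_lt_top.ne),
      volume_real_ball hn1 z hρ0.le] at h2
    have h3 : (1 - n * σ) * R ^ n ≤ ρ ^ n := by
      rw [hρ, mul_pow]
      exact mul_le_mul_of_nonneg_right (hBern σ (by linarith)) (by positivity)
    nlinarith
  -- the volume of the regularized set
  set M := G + closedBall (0 : 𝔼) ρ with hM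
  have hMK : M ⊆ K := innerPar_add_closedBall_subset K ρ
  have hGcl : IsClosed G := isClosed_innerPar isClosed_closure ρ
  have hGcomp : IsCompact G := hKcomp.of_isClosed_subset hGcl hGK
  have hMcomp : IsCompact M := hGcomp.add (isCompact_closedBall 0 ρ)
  have hMc : Convex ℝ M := (convex_innerPar hKc ρ).add (convex_closedBall 0 ρ)
  have hMvol : unitBallVol n * R ^ n * (1 - n * (σ * τ)) ≤ volume.real M := by
    set k : ℝ := unitBallVol n ^ (1 / (n : ℝ)) with hk
    have hk0 : 0 < k := Real.rpow_pos_of_pos hω _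
    have hkn : k ^ n = unitBallVol n := by
      rw [hk, one_div, Real.rpow_inv_natCast_pow hω.le (by omega)]
    have hx : 0 < k * (σ * R * (1 - τ)) := by
      have : 0 < 1 - τ := by linarith
      positivity
    have hA : ENNReal.ofReal ((k * (σ * R * (1 - τ))) ^ n) ≤ volume G := by
      rw [← ENNReal.ofReal_toReal hGfin]
      refine ENNReal.ofReal_le_ofReal (le_trans ?_ hGvol)
      rw [mul_pow, hkn, mul_pow, mul_assoc]
      have h1 : (1 - τ) ^ n ≤ (1 - τ) ^ 1 :=
        pow_le_pow_of_le_one (by linarith) (by linarith) hn1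
      rw [pow_one] at h1
      gcongr
    have hB : ENNReal.ofReal ((k * ρ) ^ n) ≤ volume (closedBall (0 : 𝔼) ρ) := by
      rw [← ENNReal.ofReal_toReal (measure_closedBall_lt_top (x := (0 : 𝔼)) (r := ρ)).ne]
      refine ENNReal.ofReal_le_ofReal (le_of_eq ?_)
      have := volume_real_closedBall hn1 (0 : 𝔼) hρ0.le
      rw [Measure.real] at this
      rw [this, mul_pow, hkn, mul_comm]
    have hBM := brunn_minkowski hGcl.measurableSet isClosed_closedBall.measurableSet
      hMcomp.measurableSet subset_rfl hx (mul_pos hk0 hρ0) hA hB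
    have h1 := (ENNReal.ofReal_le_iff_le_toReal hMcomp.measure_lt_top.ne).1 hBM
    refine le_trans ?_ h1
    rw [show k * (σ * R * (1 - τ)) + k * ρ = k * R * (1 - σ * τ) by rw [hρ]; ring, mul_pow, mul_pow,
      hkn]
    exact mul_le_mul_of_nonneg_left (hBern _ (by nlinarith)) (by positivity)
  have hKM : volume.real (K \ M) ≤ σ * (unitBallVol n * (σ * R / 16) ^ n) := by
    rw [measureReal_sdiff hMK hMcomp.measurableSet
      hKcomp.measure_lt_top.ne]
    have h1 : unitBallVol n * R ^ n * (n * (σ * τ)) = σ * (unitBallVol n * (σ * R / 16) ^ n) := by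
      rw [hτ, div_pow, mul_pow]
      field_simp
    rw [hKvol, ← h1]
    linarith
  have hMz : ∀ m ∈ M, ‖m - z‖ ≤ 4 * 32 ^ n * σ * R + ρ := by
    rintro _ ⟨g, hg, b, hb', rfl⟩
    rw [mem_closedBall_zero_iff] at hb'
    calc ‖g + b - z‖ = ‖(g - z) + b‖ := by congr 1; abel
      _ ≤ _ := (norm_add_le _ _).trans (add_le_add (hGdiam g hg) hb')
  refine ⟨z, hz, fun y hy => ?_⟩
  have hMne : M.Nonempty := ⟨z + 0, add_mem_add hz (mem_closedBall_self hρ0.le)⟩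
  obtain ⟨m, hm, hmin⟩ := exists_norm_eq_iInf_of_complete_convex hMne hMcomp.isComplete hMc y
  have hsep := (norm_eq_iInf_iff_real_inner_le_zero hMc hm).1 hmin
  have hym : ‖y - m‖ ≤ σ * R := by
    by_contra! hlt
    have hd0 : 0 < ‖y - m‖ := (by positivity : 0 < σ * R).trans hlt
    set θ := σ / 8 with hθ
    have hθ0 : 0 < θ := by positivity
    have hsub : ball (y + θ • (z - y)) (θ * ρ) ⊆ K \ M := fun x hx => by
      set x₀ := y + θ⁻¹ • (x - y) with hx₀
      have hxx : x = (1 - θ) • y + θ • x₀ := by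
        rw [hx₀, smul_add, smul_inv_smul₀ hθ0.ne', sub_smul, one_smul]; abel
      have hx₀z : ‖x₀ - z‖ < ρ := by
        have h1 : θ • (x₀ - z) = x - (y + θ • (z - y)) := by
          rw [hxx, sub_smul, one_smul, smul_sub, smul_sub]; abel
        rw [mem_ball, dist_eq_norm, ← h1, norm_smul, Real.norm_of_nonneg hθ0.le] at hx
        exact lt_of_mul_lt_mul_left hx hθ0.le
      refine ⟨?_, fun hxM => ?_⟩
      · rw [hxx]
        exact hKc hy (hz (by rw [mem_closedBall, dist_eq_norm]; exact hx₀z.le)) (by linarith)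
          hθ0.le (by ring)
      · have h1 := hsep x hxM
        have h2 : x - m = (1 - θ) • (y - m) + θ • (x₀ - m) := by
          rw [hxx, smul_sub, smul_sub, sub_smul, sub_smul, one_smul, one_smul]; abel
        have h3 : ‖x₀ - m‖ ≤ 3 * R := by
          calc ‖x₀ - m‖ = ‖(x₀ - z) - (m - z)‖ := by congr 1; abel
            _ ≤ ρ + (4 * 32 ^ n * σ * R + ρ) :=
              (norm_sub_le _ _).trans (add_le_add hx₀z.le (hMz m hm))
            _ ≤ 3 * R := by rw [hρ]; nlinarith
        rw [h2, inner_add_right, real_inner_smul_right, real_inner_smul_right,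
          real_inner_self_eq_norm_sq] at h1
        have h4 := (abs_le.1 (abs_real_inner_le_norm (y - m) (x₀ - m))).1
        have h5 : ‖y - m‖ * ‖x₀ - m‖ ≤ ‖y - m‖ * (3 * R) := by gcongr
        have h6 : (1 - θ) * ‖y - m‖ ^ 2 ≤ θ * (‖y - m‖ * (3 * R)) := by
          have := mul_le_mul_of_nonneg_left (show -(‖y - m‖ * (3 * R)) ≤ ⟪y - m, x₀ - m⟫ by linarith)
            hθ0.le
          linarith
        have h7 : (1 - θ) * ‖y - m‖ ≤ θ * (3 * R) := by
          refine le_of_mul_le_mul_left ?_ hd0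
          linarith
        have h8 : 7 / 8 * ‖y - m‖ ≤ (1 - θ) * ‖y - m‖ :=
          mul_le_mul_of_nonneg_right (by linarith) hd0.le
        have h9 : θ * (3 * R) = 3 / 8 * (σ * R) := by rw [hθ]; ring
        have : 0 < σ * R := mul_pos hσ0 hR
        linarith
    have h1 := (measureReal_mono (μ := volume) hsub
      (measure_ne_top_of_subset sdiff_subset hKcomp.measure_lt_top.ne)).trans hKM
    rw [volume_real_ball hn1 _ (by positivity)] at h1
    have h2 : (σ * R / 16) ^ n ≤ (θ * ρ) ^ n := by
      refine pow_le_pow_left₀ (by positivity) ?_ n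
      rw [hθ]; nlinarith
    have h3 : 0 < unitBallVol n * (σ * R / 16) ^ n := by positivity
    have h4 := mul_le_mul_of_nonneg_left h2 hω.le
    have h5 := mul_le_mul_of_nonneg_right hσ1 h3.le
    linarith
  rw [mem_closedBall, dist_eq_norm]
  calc ‖y - z‖ = ‖(y - m) + (m - z)‖ := by congr 1; abel
    _ ≤ σ * R + (4 * 32 ^ n * σ * R + ρ) := (norm_add_le _ _).trans (add_le_add hym (hMz m hm))
    _ = _ := by rw [hρ]; ring

end Sandwich

section Stability
variable {n : ℕ} {Ω : Set (EuclideanSpace ℝ (Fin n))} {c₀ R : ℝ}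

local notation "𝔼" => EuclideanSpace ℝ (Fin n)

/-- The volume deficit controls the position of an optimal ball of the same volume. -/
theorem IsPrismConst.norm_sub_le_of_optimal (hn : 2 ≤ n) (hc : IsPrismConst n c₀)
    (ho : IsOpen Ω) (hb : IsBounded Ω) (hK : Convex ℝ Ω) (hne : Ω.Nonempty) (hR : 0 < R)
    (hper : IsPerimBound n c₀ R Ω) {σ r : ℝ} (hσ : 4 * 32 ^ n * σ ≤ 1 / 32) {z c : 𝔼}
    (hz : closedBall z ((1 - σ) * R) ⊆ closure Ω) (hr : R / 2 ≤ r) (hρr : (1 - σ) * R ≤ r)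
    (hσ1 : σ ≤ 1)
    (hvol : volume (ball c r) = volume Ω)
    (hopt : volume (Ω ∆ ball c r) ≤ volume (Ω ∆ ball z r)) :
    ‖c - z‖ ≤ 4 * 32 ^ n * (4 * σ) * R := by
  have hω := unitBallVol_pos (n := n)
  have hn1 : 1 ≤ n := by omega
  have hρ0 : 0 ≤ (1 - σ) * R := mul_nonneg (by linarith) hR.le
  have hΩfin : volume Ω ≠ ⊤ := hb.measure_lt_top.ne
  have hvolz : volume.real (ball z r) = volume.real Ω := by
    simp only [Measure.real]
    rw [← hvol, Measure.addHaar_ball_center, Measure.addHaar_ball_center volume c]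
  have hKle := hc.volume_le hn ho hb hK hne hR hper
  have h1 : volume.real (Ω \ ball z r) ≤ n * σ * (unitBallVol n * R ^ n) := by
    have hsub : Ω \ ball z r ⊆ closure Ω \ ball z ((1 - σ) * R) :=
      sdiff_subset_sdiff subset_closure (ball_subset_ball hρr)
    have h2 := measureReal_mono (μ := volume) hsub
      (measure_ne_top_of_subset sdiff_subset hb.closure.measure_lt_top.ne)
    rw [measureReal_sdiff (ball_subset_closedBall.trans hz) measurableSet_ball
      hb.closure.measure_lt_top.ne, volume_real_ball hn1 z hρ0] at h2
    have h3 : volume.real (closure Ω) = volume.real Ω := by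
      rw [Measure.real, volume_closure_of_convex hK]; rfl
    have h4 : (1 - n * σ) * R ^ n ≤ ((1 - σ) * R) ^ n := by
      rw [mul_pow]
      refine mul_le_mul_of_nonneg_right ?_ (by positivity)
      have := one_add_mul_le_pow (show (-2 : ℝ) ≤ -σ by linarith) n
      rw [← sub_eq_add_neg] at this
      linarith
    nlinarith
  have h2 : volume.real (ball z r \ Ω) = volume.real (Ω \ ball z r) := by
    have h3 := measureReal_sdiff_add_inter (μ := volume) (s := Ω) (t := ball z r)
      measurableSet_ball hΩfin
    have h4 := measureReal_sdiff_add_inter (μ := volume) (s := ball z r) (t := Ω)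
      ho.measurableSet measure_ball_lt_top.ne
    rw [inter_comm] at h4
    linarith
  have h3 : volume.real (Ω ∆ ball c r) ≤ 2 * (n * σ * (unitBallVol n * R ^ n)) := by
    have hfin : volume (Ω ∆ ball z r) ≠ ⊤ :=
      measure_ne_top_of_subset symmDiff_subset_union
        ((measure_union_lt_top hb.measure_lt_top measure_ball_lt_top).ne)
    calc volume.real (Ω ∆ ball c r) ≤ volume.real (Ω ∆ ball z r) :=
          ENNReal.toReal_mono hfin hopt
      _ ≤ volume.real (Ω \ ball z r) + volume.real (ball z r \ Ω) := measureReal_union_le _ _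
      _ ≤ _ := by linarith
  refine norm_sub_le_of_volume_ball_diff_le hn1 hR hr (by linarith) ?_
  have hsub : ball c r \ ball z r ⊆ (Ω ∆ ball c r) ∪ (Ω \ ball z r) := by
    rintro x ⟨hx, hx'⟩
    by_cases hxΩ : x ∈ Ω
    · exact Or.inr ⟨hxΩ, hx'⟩
    · exact Or.inl (Or.inr ⟨hx, hxΩ⟩)
  have h4 := measureReal_mono (μ := volume) hsub
    (measure_union_lt_top ((measure_mono symmDiff_subset_union).trans_lt
      (measure_union_lt_top hb.measure_lt_top measure_ball_lt_top))
      ((measure_mono sdiff_subset).trans_lt hb.measure_lt_top)).ne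
  have h5 := measureReal_union_le (μ := volume) (Ω ∆ ball c r) (Ω \ ball z r)
  have h6 : 0 ≤ n * σ * (unitBallVol n * R ^ n) := measureReal_nonneg.trans h1
  linarith

theorem hausdorffDist_le_of_sandwich {s : Set 𝔼} {c z : 𝔼} {r ρ₁ ρ₂ δ : ℝ} (hδ : 0 ≤ δ)
    (hr : 0 < r) (hρ : 0 ≤ ρ₁) (h1 : closedBall z ρ₁ ⊆ closure s) (h2 : closure s ⊆ closedBall z ρ₂)
    (h3 : ρ₂ + ‖c - z‖ ≤ r + δ) (h4 : r + ‖c - z‖ ≤ ρ₁ + δ) :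
    hausdorffDist s (ball c r) ≤ δ := by
  rw [← hausdorffDist_closure, closure_ball _ hr.ne']
  rw [← dist_eq_norm] at h3 h4
  refine hausdorffDist_le_of_mem_dist hδ (fun x hx => ?_) fun x hx => ?_
  · have h5 : dist x c ≤ r + δ := by
      have := mem_closedBall.1 (h2 hx)
      have := dist_triangle_right x c z
      linarith
    obtain ⟨y, hy1, hy2⟩ := exists_dist_le_le hδ hr.le h5
    exact ⟨y, hy2, hy1⟩
  · have h5 : dist x z ≤ ρ₁ + δ := by
      have := mem_closedBall.1 hx
      have := dist_triangle x c z
      linarith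
    obtain ⟨y, hy1, hy2⟩ := exists_dist_le_le hδ hρ h5
    exact ⟨y, h1 hy2, hy1⟩

/-- Quantitative isodiametric-type stability: the volume deficit at given perimeter controls the
Hausdorff distance to an optimal ball. -/
theorem IsPrismConst.pow_hausdorffDist_le (hn : 2 ≤ n) (hc : IsPrismConst n c₀)
    (ho : IsOpen Ω) (hb : IsBounded Ω) (hK : Convex ℝ Ω) (hne : Ω.Nonempty) (hR : 0 < R)
    (hper : IsPerimBound n c₀ R Ω) {r : ℝ} {c : 𝔼} (hr : 0 < r)
    (hvol : volume (ball c r) = volume Ω)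
    (hopt : ∀ (c' : 𝔼) (r' : ℝ), 0 < r' → volume (ball c' r') = volume Ω →
      volume (Ω ∆ ball c r) ≤ volume (Ω ∆ ball c' r'))
    (hasym : volume (Ω ∆ ball c r) < volume Ω / 2) :
    (1 / (128 * 32 ^ n)) ^ (2 * n) / (n * 16 ^ n) *
        (hausdorffDist Ω (ball c r) / (diam Ω + diam (ball c r))) ^ (2 * n) *
        (unitBallVol n * R ^ n) ≤ unitBallVol n * R ^ n - volume.real Ω := by
  have hω := unitBallVol_pos (n := n)
  have hn1 : 1 ≤ n := by omega
  have hn0 : (1 : ℝ) ≤ n := by exact_mod_cast hn1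
  have h32 : (1 : ℝ) ≤ 32 ^ n := one_le_pow₀ (by norm_num)
  have hnt : Nontrivial 𝔼 := by
    have : Nonempty (Fin n) := ⟨⟨0, by omega⟩⟩
    infer_instance
  have hdiam : diam (ball c r) = 2 * r := diam_ball_eq c hr.le
  have hKle := hc.volume_le hn ho hb hK hne hR hper
  have hD : 0 < diam Ω + diam (ball c r) := by
    rw [hdiam]; linarith [diam_nonneg (s := Ω)]
  set D := diam Ω + diam (ball c r) with hDdef
  set d := hausdorffDist Ω (ball c r) with hd
  have hinter : (Ω ∩ ball c r).Nonempty := by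
    by_contra h
    rw [not_nonempty_iff_eq_empty, ← disjoint_iff_inter_eq_empty] at h
    have h1 : volume Ω ≤ volume (Ω ∆ ball c r) := measure_mono fun x hx =>
      Or.inl ⟨hx, fun hx' => h.notMem_of_mem_left hx hx'⟩
    exact absurd (h1.trans_lt hasym) (not_lt.2 ENNReal.half_le_self)
  have hdD : d ≤ D := (hausdorffDist_le_diam hne hb (nonempty_ball.2 hr) isBounded_ball).trans
    (diam_union' hinter)
  have hd0 : 0 ≤ d := hausdorffDist_nonneg
  set x := d / D with hx
  have hx0 : 0 ≤ x := by positivity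
  have hx1 : x ≤ 1 := (div_le_one hD).2 hdD
  by_contra! hlt
  rcases hx0.eq_or_lt with h0 | hxpos
  · rw [← h0, zero_pow (by omega)] at hlt
    linarith
  set σ := 1 / (128 * 32 ^ n) * x with hσ
  have hσ0 : 0 < σ := by positivity
  have hAσ : 4 * 32 ^ n * σ = x / 32 := by rw [hσ]; field_simp; norm_num
  have hσ1 : σ ≤ 1 / 32 := by nlinarith
  obtain ⟨z, hz1, hz2⟩ := hc.exists_closedBall_subset hn ho hb hK hne hR hper hσ0 (by linarith) (by
    refine hlt.le.trans (le_of_eq ?_)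
    rw [hσ]
    generalize 1 / (128 * (32 : ℝ) ^ n) = κ
    ring)
  have hρ0 : 0 < (1 - σ) * R := mul_pos (by linarith) hR
  have hrvol : volume.real Ω = r ^ n * unitBallVol n := by
    rw [← volume_real_ball hn1 c hr.le, Measure.real, Measure.real, hvol]
  have hrR : r ≤ R := by
    refine le_of_pow_le_pow_left₀ (show n ≠ 0 by omega) hR.le ?_
    refine le_of_mul_le_mul_left ?_ hω
    linarith
  have hρr : (1 - σ) * R ≤ r := by
    refine le_of_pow_le_pow_left₀ (show n ≠ 0 by omega) hr.le ?_
    refine le_of_mul_le_mul_right ?_ hω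
    have := measureReal_mono (μ := volume) hz1 hb.closure.measure_lt_top.ne
    rw [volume_real_closedBall hn1 z hρ0.le, Measure.real, volume_closure_of_convex hK] at this
    exact this.trans_eq hrvol
  have hrR2 : R / 2 ≤ r := by nlinarith
  have hcz := hc.norm_sub_le_of_optimal hn ho hb hK hne hR hper (σ := σ) (by linarith) hz1 hrR2 hρr
    (by linarith) hvol (hopt z r hr (by
      rw [← hvol, Measure.addHaar_ball_center, Measure.addHaar_ball_center volume c]))
  rw [show 4 * 32 ^ n * (4 * σ) * R = 4 * (4 * 32 ^ n * σ) * R by ring, hAσ] at hcz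
  rw [hAσ] at hz2
  have hσx : σ ≤ x / 32 := by nlinarith
  have hσR := mul_le_mul_of_nonneg_right hσx hR.le
  have hfin := hausdorffDist_le_of_sandwich (c := c) (δ := 6 * (x / 32 * R)) (by positivity) hr hρ0.le hz1 hz2
    (by nlinarith) (by nlinarith)
  have hdx : d = x * D := by rw [hx, div_mul_cancel₀ _ hD.ne']
  have hDR : R ≤ D := by rw [hDdef, hdiam]; linarith [diam_nonneg (s := Ω)]
  have h1 : x * R ≤ x * D := by gcongr
  have h2 : 0 < x * R := by positivity
  linarith

end Stability

end RobinStab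

/-- **Final remark:** unconstrained quantitative reverse Faber–Krahn inequality, with
Hausdorff distance to an optimal ball of the same volume. -/
theorem stmt14 {n : ℕ} (hn : 2 ≤ n) :
    ∃ C : ℝ, 0 < C ∧
      ∀ (p β : ℝ), 1 < p → β < 0 →
        ∀ (Ω Ωstar Ωsharp : Set (EuclideanSpace ℝ (Fin n))) (R r : ℝ)
          (c : EuclideanSpace ℝ (Fin n)) (v : EuclideanSpace ℝ (Fin n) → ℝ) (vm : ℝ),
          IsOpen Ω → IsBounded Ω → Convex ℝ Ω → Ω.Nonempty →
          0 < R → Ωstar = ball (0 : EuclideanSpace ℝ (Fin n)) R →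
          perim n Ωstar = perim n Ω →
          IsFirstEigenfunction n p β Ωstar v →
          vm = sInf (v '' closure Ωstar) →
          0 < r → Ωsharp = ball c r → volume Ωsharp = volume Ω →
          (∀ (c' : EuclideanSpace ℝ (Fin n)) (r' : ℝ), 0 < r' →
            volume (ball c' r') = volume Ω →
            volume (Ω ∆ Ωsharp) ≤ volume (Ω ∆ ball c' r')) →
          volume (Ω ∆ Ωsharp) < volume Ω / 2 →
          robinEig n p β Ωstar - robinEig n p β Ω ≥
            |robinEig n p β Ω| * C *
              (vm ^ p * (volume Ωstar).toReal / ∫ x in Ωstar, |v x| ^ p) *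
              (Metric.hausdorffDist Ω Ωsharp) ^ (2 * n) /
              (Metric.diam Ω + Metric.diam Ωsharp) ^ (2 * n) := by
  obtain ⟨c₀, hc⟩ : ∃ c₀, RobinStab.IsPrismConst n c₀ := RobinStab.exists_prism_const (by omega)
  have hω := RobinStab.unitBallVol_pos (n := n)
  have hn0 : (0 : ℝ) < n := by exact_mod_cast (by omega : 0 < n)
  refine ⟨(1 / (128 * 32 ^ n)) ^ (2 * n) / (n * 16 ^ n), by positivity, ?_⟩
  intro p β hp hβ Ω Ωstar Ωsharp R r c v vm ho hb hK hne hR hstar hper hv hvm hr hsharp hvol hopt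
    hasym
  subst hstar hsharp
  rw [closure_ball _ hR.ne'] at hvm
  have hvL := hv.1
  have hvpos := hv.2.1
  have hDB := hv.2.2.2.1
  rw [closure_ball _ hR.ne'] at hvL hvpos
  obtain ⟨K, hKv⟩ := hvL
  have hcomp := isCompact_closedBall (0 : EuclideanSpace ℝ (Fin n)) R
  obtain ⟨x₀, hx₀, hmin⟩ := hcomp.exists_isMinOn
    ⟨0, mem_closedBall_self hR.le⟩ hKv.continuousOn
  have hvm' : vm = v x₀ := by
    rw [hvm]
    exact IsLeast.csInf_eq ⟨mem_image_of_mem v hx₀, forall_mem_image.2 fun x hx => hmin hx⟩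
  have hvm0 : 0 < vm := by rw [hvm']; exact hvpos x₀ hx₀
  have hpb := hc.isPerimBound hn ho hb hK hR hper
  have hcmp := hc.robinEig_comparison hn ho hb hK hne hp hβ hR hper hv hvm0
    fun x hx => by rw [hvm']; exact hmin hx
  have hstab := hc.pow_hausdorffDist_le hn ho hb hK hne hR hpb hr hvol hopt hasym
  have hballvol : (volume (ball (0 : EuclideanSpace ℝ (Fin n)) R)).toReal =
      unitBallVol n * R ^ n := by
    rw [mul_comm]; exact RobinStab.volume_real_ball (by omega) 0 hR.le
  rw [hballvol, ge_iff_le]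
  refine le_trans (le_of_eq ?_) (le_trans (div_le_div_of_nonneg_right
    (mul_le_mul_of_nonneg_left (mul_le_mul_of_nonneg_left hstab
      (Real.rpow_nonneg hvm0.le p)) (abs_nonneg (robinEig n p β Ω))) hDB.le) hcmp)
  rw [div_pow]
  ring
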